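/- Suppose the coefficients are state dependent, i.e. b(t, x, a) = b(t, x_t, a), σ(t, x) = σ(t, x_t), g(x) = g(x_T), and suppose (i) σ = σ(t, x) does not depend on the control and is uniformly Lipschitz continuous in x; and (ii) b = σλ where λ : [0,T] × ℝⁿ × A → ℝ^d is bounded, continuous in a, uniformly Lipschitz continuous in x, and the set {λ(t,x,a) : a ∈ A} ⊂ ℝ^d is convex for each (t,x). Then the open-loop and closed-loop values coincide: V^o_0 = V^c_0. (Here g may be discontinuous and σ may be degenerate.) -/

import Mathlib

open MeasureTheory ProbabilityTheory Filter Set Matrix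
open scoped Classical

noncomputable section

/-- The σ-algebra generated by the `P`-null sets. -/
def nullSets {Ω : Type*} [MeasurableSpace Ω] (P : Measure Ω) : MeasurableSpace Ω :=
  MeasurableSpace.generateFrom {s : Set Ω | P s = 0}

/-- The natural filtration of a process `u`. -/
def natFilt {Ω E : Type*} [MeasurableSpace E] (u : ℝ → Ω → E) (s : ℝ) :
    MeasurableSpace Ω :=
  ⨆ r ∈ Set.Icc (0 : ℝ) s, MeasurableSpace.comap (u r) inferInstance

/-- The `P`-augmented natural filtration of a process `u`. -/
def augFilt {Ω E : Type*} [MeasurableSpace Ω] [MeasurableSpace E] (P : Measure Ω)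
    (u : ℝ → Ω → E) (s : ℝ) : MeasurableSpace Ω :=
  natFilt u s ⊔ nullSets P

/-- Progressive measurability of a process `u` with respect to a family of σ-algebras `F`. -/
def ProgMeas {Ω E : Type*} [MeasurableSpace E] (F : ℝ → MeasurableSpace Ω)
    (u : ℝ → Ω → E) : Prop :=
  ∀ s : ℝ, 0 ≤ s →
    @Measurable (Set.Icc (0 : ℝ) s × Ω) E
      (MeasurableSpace.prod inferInstance (F s)) _ (fun p => u p.1 p.2)

/-- `B` is a `d`-dimensional `F`-Brownian motion under `P`: continuous paths started at `0`,
adapted, with increments that are centered Gaussian (with iid coordinates) and independent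
of the past. -/
def IsBMd {Ω : Type*} [MeasurableSpace Ω] {d : ℕ} (P : Measure Ω)
    (F : ℝ → MeasurableSpace Ω) (B : ℝ → Ω → Fin d → ℝ) : Prop :=
  (∀ ω, B 0 ω = 0) ∧ (∀ ω, Continuous fun s => B s ω) ∧
  (∀ s : ℝ, 0 ≤ s → Measurable[F s] (B s)) ∧
  (∀ s u : ℝ, 0 ≤ s → s < u →
    Measure.map (fun ω => B u ω - B s ω) P
      = Measure.pi (fun _ : Fin d => gaussianReal 0 ((u - s).toNNReal)) ∧
    Indep (MeasurableSpace.comap (fun ω => B u ω - B s ω) inferInstance) (F s) P)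

/-- Left-endpoint Riemann sum of a matrix-valued integrand against a vector-valued
integrator, along the uniform partition of `[0, s]` with `N` steps. -/
def itoRiemannSum {Ω : Type*} {n d : ℕ} (H : ℝ → Ω → Matrix (Fin n) (Fin d) ℝ)
    (B : ℝ → Ω → Fin d → ℝ) (s : ℝ) (N : ℕ) (ω : Ω) : Fin n → ℝ :=
  ∑ i ∈ Finset.range N,
    (H (s * i / N) ω).mulVec (B (s * (i + 1) / N) ω - B (s * i / N) ω)

/-- `I` is (a version of) the Itô integral `∫ H dB` on `[0, T]`: at each time in `[0, T]`
the left-endpoint Riemann sums converge in probability. -/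
def IsItoIntegralOn {Ω : Type*} [MeasurableSpace Ω] {n d : ℕ} (P : Measure Ω) (T : ℝ)
    (H : ℝ → Ω → Matrix (Fin n) (Fin d) ℝ) (B : ℝ → Ω → Fin d → ℝ)
    (I : ℝ → Ω → Fin n → ℝ) : Prop :=
  ∀ s ∈ Set.Icc (0 : ℝ) T,
    TendstoInMeasure P (fun N ω => itoRiemannSum H B s N ω) atTop (fun ω => I s ω)

/-- A weak solution of the controlled path-dependent SDE
`X_s = x₀ + ∫_0^s b(r, X, α_r) dr + ∫_0^s σ(r, X, α_r) dB_r` on `[0, T]`,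
with controls valued in `A`. -/
structure SDEWeakSol {n d m : ℕ} (T : ℝ) (x₀ : Fin n → ℝ) (A : Set (Fin m → ℝ))
    (b : ℝ → (ℝ → Fin n → ℝ) → (Fin m → ℝ) → Fin n → ℝ)
    (σ : ℝ → (ℝ → Fin n → ℝ) → (Fin m → ℝ) → Matrix (Fin n) (Fin d) ℝ) where
  Ω : Type
  mΩ : MeasurableSpace Ω
  P : @Measure Ω mΩ
  hP : IsProbabilityMeasure P
  F : ℝ → MeasurableSpace Ω
  F_mono : ∀ s u : ℝ, s ≤ u → F s ≤ F u
  F_le : ∀ s : ℝ, F s ≤ mΩ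
  B : ℝ → Ω → Fin d → ℝ
  X : ℝ → Ω → Fin n → ℝ
  α : ℝ → Ω → Fin m → ℝ
  hB : @IsBMd Ω mΩ d P F B
  X_cont : ∀ ω, Continuous fun s => X s ω
  X_prog : ProgMeas F X
  α_prog : ProgMeas F α
  α_mem : ∀ s ω, α s ω ∈ A
  sde : @IsItoIntegralOn Ω mΩ n d P T (fun s ω => σ s (fun u => X u ω) (α s ω)) B
    (fun s ω => X s ω - x₀ - ∫ r in Set.Icc (0 : ℝ) s, b r (fun u => X u ω) (α r ω))

attribute [instance] SDEWeakSol.mΩ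

/-- Open-loop: the control is prog. measurable w.r.t. the `P`-augmented natural filtration
of `B`. -/
def SDEWeakSol.OpenLoop {n d m : ℕ} {T : ℝ} {x₀ : Fin n → ℝ} {A : Set (Fin m → ℝ)} {b}
    {σ : ℝ → (ℝ → Fin n → ℝ) → (Fin m → ℝ) → Matrix (Fin n) (Fin d) ℝ}
    (S : SDEWeakSol T x₀ A b σ) : Prop :=
  ProgMeas (augFilt S.P S.B) S.α

/-- Closed-loop: the control is prog. measurable w.r.t. the `P`-augmented natural filtration
of `X`. -/
def SDEWeakSol.ClosedLoop {n d m : ℕ} {T : ℝ} {x₀ : Fin n → ℝ} {A : Set (Fin m → ℝ)} {b}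
    {σ : ℝ → (ℝ → Fin n → ℝ) → (Fin m → ℝ) → Matrix (Fin n) (Fin d) ℝ}
    (S : SDEWeakSol T x₀ A b σ) : Prop :=
  ProgMeas (augFilt S.P S.X) S.α

/-- The open-loop value `V^o_0`. -/
def Vopen {n d m : ℕ} (T : ℝ) (x₀ : Fin n → ℝ) (A : Set (Fin m → ℝ))
    (b : ℝ → (ℝ → Fin n → ℝ) → (Fin m → ℝ) → Fin n → ℝ)
    (σ : ℝ → (ℝ → Fin n → ℝ) → (Fin m → ℝ) → Matrix (Fin n) (Fin d) ℝ)
    (g : (ℝ → Fin n → ℝ) → ℝ) : ℝ :=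
  sSup {r | ∃ S : SDEWeakSol T x₀ A b σ, S.OpenLoop ∧
    r = ∫ ω, g (fun s => S.X s ω) ∂S.P}

/-- The closed-loop value `V^c_0`. -/
def Vclosed {n d m : ℕ} (T : ℝ) (x₀ : Fin n → ℝ) (A : Set (Fin m → ℝ))
    (b : ℝ → (ℝ → Fin n → ℝ) → (Fin m → ℝ) → Fin n → ℝ)
    (σ : ℝ → (ℝ → Fin n → ℝ) → (Fin m → ℝ) → Matrix (Fin n) (Fin d) ℝ)
    (g : (ℝ → Fin n → ℝ) → ℝ) : ℝ :=
  sSup {r | ∃ S : SDEWeakSol T x₀ A b σ, S.ClosedLoop ∧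
    r = ∫ ω, g (fun s => S.X s ω) ∂S.P}

set_option linter.unusedSectionVars false

/-! ### Brownian increments -/

section

/-- The law of a `d`-dimensional Brownian increment over a time step of length `t`. -/
def gaussPi (d : ℕ) (t : ℝ) : Measure (Fin d → ℝ) :=
  Measure.pi (fun _ : Fin d => gaussianReal 0 t.toNNReal)

instance (d : ℕ) (t : ℝ) : IsProbabilityMeasure (gaussPi d t) := by
  unfold gaussPi; infer_instance

lemma gaussPi_map_eval {d : ℕ} (t : ℝ) (j : Fin d) :
    (gaussPi d t).map (fun w => w j) = gaussianReal 0 t.toNNReal :=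
  (measurePreserving_eval (fun _ : Fin d => gaussianReal 0 t.toNNReal) j).map_eq

lemma gaussPi_memLp {d : ℕ} (t : ℝ) (j : Fin d) {p : ENNReal} (hp : p ≠ ⊤) :
    MemLp (fun w : Fin d → ℝ => w j) p (gaussPi d t) := by
  have h := memLp_id_gaussianReal' (μ := 0) (v := t.toNNReal) p hp
  rw [← gaussPi_map_eval t j] at h
  exact (memLp_map_measure_iff measurable_id.aestronglyMeasurable
    (measurable_pi_apply j).aemeasurable).1 h

lemma gaussPi_integral_eval {d : ℕ} (t : ℝ) (j : Fin d) : ∫ w, w j ∂(gaussPi d t) = 0 := by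
  have h := integral_id_gaussianReal (μ := 0) (v := t.toNNReal)
  rw [← gaussPi_map_eval t j, integral_map (measurable_pi_apply j).aemeasurable
    (by fun_prop)] at h
  exact h

lemma gaussPi_integral_mul {d : ℕ} {t : ℝ} (ht : 0 ≤ t) (j k : Fin d) :
    ∫ w, w j * w k ∂(gaussPi d t) = if j = k then t else 0 := by
  split_ifs with h
  · subst h
    have h := variance_id_gaussianReal (μ := 0) (v := t.toNNReal)
    rw [variance_of_integral_eq_zero (by fun_prop) (by simp [integral_id_gaussianReal]),
      ← gaussPi_map_eval t j, integral_map (measurable_pi_apply j).aemeasurable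
        (by fun_prop)] at h
    simpa [pow_two, Real.coe_toNNReal t ht] using h
  · have hi : iIndepFun (fun (i : Fin d) (w : Fin d → ℝ) => w i) (gaussPi d t) :=
      iIndepFun_pi (X := fun (_ : Fin d) (x : ℝ) => x) (fun i => by fun_prop)
    rw [(hi.indepFun h).integral_fun_mul_eq_mul_integral
      (measurable_pi_apply j).aestronglyMeasurable (measurable_pi_apply k).aestronglyMeasurable,
      gaussPi_integral_eval]
    simp

lemma gaussPi_lintegral_exp {d : ℕ} {t : ℝ} (ht : 0 ≤ t) (x : Fin d → ℝ) :
    ∫⁻ w, ENNReal.ofReal (Real.exp (∑ j, x j * w j - t / 2 * ∑ j, x j ^ 2)) ∂(gaussPi d t) = 1 := by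
  have h0 : ∀ w : Fin d → ℝ, Real.exp (∑ j, x j * w j - t / 2 * ∑ j, x j ^ 2)
      = ∏ j, Real.exp (x j * w j - t / 2 * x j ^ 2) := by
    intro w
    rw [← Real.exp_sum, Finset.sum_sub_distrib, Finset.mul_sum]
  have h1 : ∀ j, Integrable (fun y : ℝ => Real.exp (x j * y - t / 2 * x j ^ 2))
      (gaussianReal 0 t.toNNReal) := fun j => by
    simp_rw [Real.exp_sub]
    exact (integrable_exp_mul_gaussianReal (x j)).div_const _
  have h2 : ∀ j, ∫ y : ℝ, Real.exp (x j * y - t / 2 * x j ^ 2) ∂(gaussianReal 0 t.toNNReal) = 1 := by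
    intro j
    simp_rw [Real.exp_sub]
    rw [integral_div]
    have := mgf_gaussianReal (p := gaussianReal 0 t.toNNReal) (X := id) (μ := 0)
      (v := t.toNNReal) (by simp) (x j)
    rw [mgf] at this
    simp only [id] at this
    rw [this, Real.coe_toNNReal t ht, ← Real.exp_sub]
    rw [show (0 * x j + t * x j ^ 2 / 2 - t / 2 * x j ^ 2 : ℝ) = 0 by ring, Real.exp_zero]
  simp_rw [h0]
  rw [← ofReal_integral_eq_lintegral_ofReal]
  · unfold gaussPi
    rw [integral_fintype_prod_eq_prod (fun j (y : ℝ) => Real.exp (x j * y - t / 2 * x j ^ 2))]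
    simp [h2]
  · exact Integrable.fintype_prod (f := fun j (y : ℝ) => Real.exp (x j * y - t / 2 * x j ^ 2)) h1
  · exact Eventually.of_forall fun w => Finset.prod_nonneg fun j _ => (Real.exp_pos _).le

variable {Ω : Type*} [mΩ : MeasurableSpace Ω] {d : ℕ}

/-- A filtered probability space carrying a Brownian motion. -/
structure BMSetup (P : Measure Ω) (F : ℝ → MeasurableSpace Ω) (B : ℝ → Ω → Fin d → ℝ) :
    Prop where
  mono : ∀ s u : ℝ, s ≤ u → F s ≤ F u
  le : ∀ s : ℝ, F s ≤ mΩ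
  bm : IsBMd P F B

namespace BMSetup

variable {P : Measure Ω} {F : ℝ → MeasurableSpace Ω} {B : ℝ → Ω → Fin d → ℝ}

lemma measurable_B (S : BMSetup P F B) {s : ℝ} (hs : 0 ≤ s) : Measurable[F s] (B s) :=
  S.bm.2.2.1 s hs

lemma measurable_B_of_le (S : BMSetup P F B) {s u : ℝ} (hs : 0 ≤ s) (hu : s ≤ u) :
    Measurable[F u] (B s) :=
  (S.measurable_B hs).mono (S.mono _ _ hu) le_rfl

lemma measurable_incr (S : BMSetup P F B) {s u v : ℝ} (hs : 0 ≤ s) (hu : s ≤ u) (hv : u ≤ v) :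
    Measurable[F v] (fun ω => B u ω - B s ω) :=
  Measurable.sub (m := F v) (S.measurable_B_of_le (hs.trans hu) hv)
    (S.measurable_B_of_le hs (hu.trans hv))

lemma measurable_incr_coord (S : BMSetup P F B) {s u v : ℝ} (hs : 0 ≤ s) (hu : s ≤ u)
    (hv : u ≤ v) (j : Fin d) : Measurable[F v] (fun ω => B u ω j - B s ω j) :=
  (measurable_pi_apply j).comp (S.measurable_incr hs hu hv)

variable [IsProbabilityMeasure P]

lemma map_incr (S : BMSetup P F B) {s u : ℝ} (hs : 0 ≤ s) (hu : s ≤ u) :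
    Measure.map (fun ω => B u ω - B s ω) P = gaussPi d (u - s) := by
  rcases hu.eq_or_lt with rfl | h
  · simp only [sub_self, gaussPi, Real.toNNReal_zero, gaussianReal_zero_var]
    rw [Measure.map_const, measure_univ, one_smul]
    refine (Measure.pi_eq fun t ht => ?_).symm
    rw [Measure.dirac_apply' _ (MeasurableSet.univ_pi ht)]
    simp_rw [fun i => Measure.dirac_apply' (0 : ℝ) (ht i)]
    by_cases h : ∀ i, (0 : ℝ) ∈ t i
    · simp [Set.indicator, h]
    · push Not at h
      obtain ⟨i, hi⟩ := h
      rw [Finset.prod_eq_zero (Finset.mem_univ i) (by simp [hi])]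
      simp only [Set.indicator_apply_eq_zero]
      intro hh
      exact absurd (hh i (Set.mem_univ i)) hi
  · exact (S.bm.2.2.2 s u hs h).1

lemma indepFun_incr (S : BMSetup P F B) {γ : Type*} [MeasurableSpace γ] {Y : Ω → γ} {s u : ℝ}
    (hs : 0 ≤ s) (hu : s ≤ u) (hY : Measurable[F s] Y) :
    IndepFun Y (fun ω => B u ω - B s ω) P := by
  rcases hu.eq_or_lt with rfl | h
  · simp only [sub_self]
    exact indepFun_const_right Y _
  · exact (indep_of_indep_of_le_right (S.bm.2.2.2 s u hs h).2 hY.comap_le).symm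

/-- Disintegration of a functional of the past and of a Brownian increment. -/
lemma lintegral_incr (S : BMSetup P F B) {γ : Type*} [MeasurableSpace γ] {Y : Ω → γ} {s u : ℝ}
    (hs : 0 ≤ s) (hu : s ≤ u) (hY : Measurable[F s] Y) {Φ : γ × (Fin d → ℝ) → ENNReal}
    (hΦ : Measurable Φ) :
    ∫⁻ ω, Φ (Y ω, B u ω - B s ω) ∂P = ∫⁻ ω, ∫⁻ w, Φ (Y ω, w) ∂(gaussPi d (u - s)) ∂P := by
  have hY' : Measurable Y := hY.mono (S.le _) le_rfl
  have hD : Measurable (fun ω => B u ω - B s ω) :=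
    (S.measurable_incr hs hu le_rfl).mono (S.le _) le_rfl
  have h := (S.indepFun_incr hs hu hY).map_prod_eq_prod_map_map hY'.aemeasurable hD.aemeasurable
  have e : ∫⁻ ω, Φ (Y ω, B u ω - B s ω) ∂P
      = ∫⁻ z, Φ z ∂(P.map (fun ω => (Y ω, B u ω - B s ω))) := by
    rw [lintegral_map hΦ (hY'.prodMk hD)]
  have : IsProbabilityMeasure (P.map Y) := Measure.isProbabilityMeasure_map hY'.aemeasurable
  rw [e, h, S.map_incr hs hu, lintegral_prod _ hΦ.aemeasurable,
    lintegral_map hΦ.lintegral_prod_right' hY']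

lemma memLp_incr (S : BMSetup P F B) {s u : ℝ} (hs : 0 ≤ s) (hu : s ≤ u) (j : Fin d)
    {p : ENNReal} (hp : p ≠ ⊤) : MemLp (fun ω => B u ω j - B s ω j) p P := by
  have h := gaussPi_memLp (u - s) j hp
  rw [← S.map_incr hs hu] at h
  exact (memLp_map_measure_iff (measurable_pi_apply j).aestronglyMeasurable
    ((S.measurable_incr hs hu le_rfl).mono (S.le _) le_rfl).aemeasurable).1 h

lemma integral_mul_incr (S : BMSetup P F B) {Y : Ω → ℝ} {s u : ℝ} (hs : 0 ≤ s) (hu : s ≤ u)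
    (hY : Measurable[F s] Y) (j : Fin d) : ∫ ω, Y ω * (B u ω j - B s ω j) ∂P = 0 := by
  have hD : Measurable (fun ω => B u ω - B s ω) :=
    (S.measurable_incr hs hu le_rfl).mono (S.le _) le_rfl
  have hi := (S.indepFun_incr hs hu hY).comp measurable_id (measurable_pi_apply j)
  have := hi.integral_fun_mul_eq_mul_integral
    (hY.mono (S.le _) le_rfl).aestronglyMeasurable
    ((measurable_pi_apply j).comp hD).aestronglyMeasurable
  have h2 : ∫ ω, (B u ω - B s ω) j ∂P = 0 := by
    rw [← gaussPi_integral_eval (u - s) j, ← S.map_incr hs hu,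
      integral_map hD.aemeasurable (measurable_pi_apply j).aestronglyMeasurable]
  simp only [Function.comp_def, id] at this
  rw [h2, mul_zero] at this
  exact this

lemma integral_mul_incr_mul_incr (S : BMSetup P F B) {Y : Ω → ℝ} {s u : ℝ} (hs : 0 ≤ s)
    (hu : s ≤ u) (hY : Measurable[F s] Y) (j k : Fin d) :
    ∫ ω, Y ω * ((B u ω j - B s ω j) * (B u ω k - B s ω k)) ∂P
      = if j = k then (∫ ω, Y ω ∂P) * (u - s) else 0 := by
  have hD : Measurable (fun ω => B u ω - B s ω) :=
    (S.measurable_incr hs hu le_rfl).mono (S.le _) le_rfl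
  have hm : Measurable (fun w : Fin d → ℝ => w j * w k) := by fun_prop
  have hi := (S.indepFun_incr hs hu hY).comp measurable_id hm
  have := hi.integral_fun_mul_eq_mul_integral
    (hY.mono (S.le _) le_rfl).aestronglyMeasurable (hm.comp hD).aestronglyMeasurable
  have h2 : ∫ ω, (B u ω - B s ω) j * (B u ω - B s ω) k ∂P = if j = k then (u - s) else 0 := by
    rw [← gaussPi_integral_mul (sub_nonneg.2 hu) j k, ← S.map_incr hs hu,
      integral_map hD.aemeasurable hm.aestronglyMeasurable]
  simp only [Function.comp_def, id] at this
  rw [h2] at this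
  refine this.trans ?_
  split_ifs <;> simp

end BMSetup

end

/-! ### Square functionals -/

section

variable {Ω : Type*} [mΩ : MeasurableSpace Ω] {d : ℕ}

namespace BMSetup

variable {P : Measure Ω} {F : ℝ → MeasurableSpace Ω} {B : ℝ → Ω → Fin d → ℝ}
  [IsProbabilityMeasure P]

lemma integrable_bdd_mul_incr_mul_incr (S : BMSetup P F B) {Y : Ω → ℝ} {C : ℝ} {a b c e : ℝ}
    (ha : 0 ≤ a) (hab : a ≤ b) (hc : 0 ≤ c) (hce : c ≤ e) (hY : Measurable Y)
    (hYC : ∀ ω, |Y ω| ≤ C) (j k : Fin d) :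
    Integrable (fun ω => Y ω * ((B b ω j - B a ω j) * (B e ω k - B c ω k))) P :=
  Integrable.bdd_mul (c := C) ((S.memLp_incr ha hab j (p := 2) (by simp)).integrable_mul
    (S.memLp_incr hc hce k (p := 2) (by simp))) hY.aestronglyMeasurable
    (Eventually.of_forall fun ω => by simpa using hYC ω)

lemma gram_of_le (S : BMSetup P F B) {a b c e : ℝ} (ha : 0 ≤ a) (hab : a ≤ b) (hac : a ≤ c)
    (hce : c ≤ e) {ξ η : Ω → ℝ} {C D : ℝ} (hξ : Measurable[F a] ξ) (hη : Measurable[F c] η)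
    (hξC : ∀ ω, |ξ ω| ≤ C) (hηD : ∀ ω, |η ω| ≤ D) (j k : Fin d) :
    ∫ ω, (ξ ω * (B b ω j - B a ω j)) * (η ω * (B e ω k - B c ω k)) ∂P
      = if j = k then (∫ ω, ξ ω * η ω ∂P) * volume.real (Ioc a b ∩ Ioc c e) else 0 := by
  have hc : 0 ≤ c := ha.trans hac
  set m := min (max b c) e with hm
  have hcm : c ≤ m := le_min (le_max_right _ _) hce
  have hme : m ≤ e := min_le_right _ _
  have hmb : m ≤ max b c := min_le_left _ _
  have hY : Measurable[F c] (fun ω => ξ ω * η ω) :=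
    Measurable.mul (m := F c) (hξ.mono (S.mono _ _ hac) le_rfl) hη
  have hYC : ∀ ω, |ξ ω * η ω| ≤ C * D := fun ω => by
    rw [abs_mul]
    exact mul_le_mul (hξC ω) (hηD ω) (abs_nonneg _) ((abs_nonneg _).trans (hξC ω))
  have hY' : Measurable (fun ω => ξ ω * η ω) := hY.mono (S.le _) le_rfl
  have hmin : min b c ≤ c := min_le_right _ _
  have hamin : a ≤ min b c := le_min hab hac
  have e0 : ∀ ω, (ξ ω * (B b ω j - B a ω j)) * (η ω * (B e ω k - B c ω k))
      = ξ ω * η ω * ((B (min b c) ω j - B a ω j) * (B e ω k - B c ω k))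
        + (ξ ω * η ω * ((B m ω j - B c ω j) * (B m ω k - B c ω k))
        + (ξ ω * η ω * ((B m ω j - B c ω j) * (B e ω k - B m ω k))
        + ξ ω * η ω * ((B (max b c) ω j - B m ω j) * (B m ω k - B c ω k)))) := by
    intro ω
    have h1 : B b ω j = B (min b c) ω j + B (max b c) ω j - B c ω j := by
      rcases le_total b c with h | h <;> simp [h]
    have h2 : (B (max b c) ω j - B m ω j) * (B e ω k - B m ω k) = 0 := by
      rcases le_total (max b c) e with h | h <;> simp [hm, h]
    rw [h1]
    linear_combination (ξ ω * η ω) * h2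
  have i1 := S.integrable_bdd_mul_incr_mul_incr ha hamin hc hce hY' hYC j k
  have i2 := S.integrable_bdd_mul_incr_mul_incr hc hcm hc hcm hY' hYC j k
  have i3 := S.integrable_bdd_mul_incr_mul_incr hc hcm (hc.trans hcm) hme hY' hYC j k
  have i4 := S.integrable_bdd_mul_incr_mul_incr (hc.trans hcm) hmb hc hcm hY' hYC j k
  have v1 : ∫ ω, ξ ω * η ω * ((B (min b c) ω j - B a ω j) * (B e ω k - B c ω k)) ∂P = 0 := by
    rw [← S.integral_mul_incr hc hce (Measurable.mul (m := F c) hY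
      (S.measurable_incr_coord ha hamin hmin j)) k]
    exact integral_congr_ae (Eventually.of_forall fun ω => by simp only [Pi.mul_apply]; ring)
  have hYm : Measurable[F m] (fun ω => ξ ω * η ω) := hY.mono (S.mono _ _ hcm) le_rfl
  have v3 : ∫ ω, ξ ω * η ω * ((B m ω j - B c ω j) * (B e ω k - B m ω k)) ∂P = 0 := by
    rw [← S.integral_mul_incr (hc.trans hcm) hme (Measurable.mul (m := F m) hYm
      (S.measurable_incr_coord hc hcm le_rfl j)) k]
    exact integral_congr_ae (Eventually.of_forall fun ω => by simp only [Pi.mul_apply]; ring)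
  have v4 : ∫ ω, ξ ω * η ω * ((B (max b c) ω j - B m ω j) * (B m ω k - B c ω k)) ∂P = 0 := by
    rw [← S.integral_mul_incr (hc.trans hcm) hmb (Measurable.mul (m := F m) hYm
      (S.measurable_incr_coord hc hcm le_rfl k)) j]
    exact integral_congr_ae (Eventually.of_forall fun ω => by simp only [Pi.mul_apply]; ring)
  have i34 := i3.add i4
  have i234 := i2.add i34
  simp_rw [e0]
  erw [integral_add i1 i234, integral_add i2 i34, integral_add i3 i4]
  rw [v1, v3, v4, S.integral_mul_incr_mul_incr hc hcm hY]
  have hvol : volume.real (Ioc a b ∩ Ioc c e) = m - c := by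
    rw [Ioc_inter_Ioc, Measure.real, Real.volume_Ioc, ENNReal.toReal_ofReal']
    have hbe : 0 ≤ e - c := sub_nonneg.2 hce
    rw [max_eq_right hac, hm]
    rcases le_total b c with h | h
    · rw [max_eq_right h, min_eq_left hce, min_eq_left (h.trans hce), sub_self,
        max_eq_right (sub_nonpos.2 h)]
    · rw [max_eq_left h, max_eq_left (sub_nonneg.2 (le_min h hce))]
  rw [hvol]
  simp

lemma gram (S : BMSetup P F B) {a b c e : ℝ} (ha : 0 ≤ a) (hab : a ≤ b) (hc : 0 ≤ c)
    (hce : c ≤ e) {ξ η : Ω → ℝ} {C D : ℝ} (hξ : Measurable[F a] ξ) (hη : Measurable[F c] η)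
    (hξC : ∀ ω, |ξ ω| ≤ C) (hηD : ∀ ω, |η ω| ≤ D) (j k : Fin d) :
    ∫ ω, (ξ ω * (B b ω j - B a ω j)) * (η ω * (B e ω k - B c ω k)) ∂P
      = if j = k then (∫ ω, ξ ω * η ω ∂P) * volume.real (Ioc a b ∩ Ioc c e) else 0 := by
  rcases le_total a c with h | h
  · exact S.gram_of_le ha hab h hce hξ hη hξC hηD j k
  · have := S.gram_of_le hc hce h hab hη hξ hηD hξC k j
    rw [integral_congr_ae (Eventually.of_forall fun ω => mul_comm _ _), this, inter_comm]
    simp only [eq_comm (a := k), mul_comm (η _)]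

end BMSetup

/-- The integral of the square of a real function, as an extended nonnegative number. -/
def sqn {α : Type*} [MeasurableSpace α] (μ : Measure α) (f : α → ℝ) : ENNReal :=
  ∫⁻ x, ENNReal.ofReal (f x ^ 2) ∂μ

section sqn

variable {α : Type*} [MeasurableSpace α] {μ : Measure α} {f g : α → ℝ}

lemma sqn_congr (h : f =ᵐ[μ] g) : sqn μ f = sqn μ g :=
  lintegral_congr_ae (h.mono fun x hx => by simp only [hx])

lemma sqn_eq_eLpNorm : sqn μ f = eLpNorm f 2 μ ^ (2 : ℕ) := by
  have := eLpNorm_nnreal_pow_eq_lintegral (f := f) (μ := μ) (p := 2) (by norm_num)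
  simp only [NNReal.coe_ofNat, ENNReal.rpow_ofNat, ENNReal.coe_ofNat] at this
  rw [this, sqn]
  refine lintegral_congr fun x => ?_
  rw [← sq_abs, ENNReal.ofReal_pow (abs_nonneg _), Real.enorm_eq_ofReal_abs]

lemma sqn_zero : sqn μ (fun _ => 0) = 0 := by simp [sqn]

lemma sqn_add_le (hf : AEMeasurable f μ) :
    sqn μ (fun x => f x + g x) ≤ 2 * sqn μ f + 2 * sqn μ g := by
  unfold sqn
  rw [← lintegral_const_mul' _ _ (by simp), ← lintegral_const_mul' _ _ (by simp),
    ← lintegral_add_left' (by fun_prop)]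
  refine lintegral_mono fun x => ?_
  have h2 : (2 : ENNReal) = ENNReal.ofReal 2 := by simp
  rw [h2, ← ENNReal.ofReal_mul (by norm_num), ← ENNReal.ofReal_mul (by norm_num),
    ← ENNReal.ofReal_add (by positivity) (by positivity)]
  exact ENNReal.ofReal_le_ofReal (by nlinarith [sq_nonneg (f x - g x)])

lemma sqn_sub_le (hf : AEMeasurable f μ) :
    sqn μ (fun x => f x - g x) ≤ 2 * sqn μ f + 2 * sqn μ g := by
  have := sqn_add_le (g := fun x => - g x) hf
  simpa [sub_eq_add_neg, sqn] using this

lemma sqn_neg : sqn μ (fun x => - f x) = sqn μ f := by simp [sqn]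

lemma sqn_sub_comm : sqn μ (fun x => f x - g x) = sqn μ (fun x => g x - f x) := by
  rw [← sqn_neg]; simp

/-- Triangle inequality through an intermediate function. -/
lemma sqn_sub_le_add {h : α → ℝ} (hf : AEMeasurable f μ) (hg : AEMeasurable g μ) :
    sqn μ (fun x => f x - h x) ≤ 2 * sqn μ (fun x => f x - g x) + 2 * sqn μ (fun x => g x - h x) := by
  have := sqn_add_le (μ := μ) (f := fun x => f x - g x) (g := fun x => g x - h x) (hf.sub hg)
  simpa using this

lemma sqn_le_sub_add (hf : AEMeasurable f μ) (hg : AEMeasurable g μ) :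
    sqn μ f ≤ 2 * sqn μ (fun x => f x - g x) + 2 * sqn μ g := by
  have := sqn_add_le (μ := μ) (f := fun x => f x - g x) (g := g) (hf.sub hg)
  simpa using this

lemma sqn_const_mul (c : ℝ) : sqn μ (fun x => c * f x) = ENNReal.ofReal (c ^ 2) * sqn μ f := by
  unfold sqn
  rw [← lintegral_const_mul' _ _ (by simp)]
  simp only [mul_pow, ENNReal.ofReal_mul (sq_nonneg c)]

lemma sqn_mul_le {C : ℝ} (hC : ∀ x, |g x| ≤ C) :
    sqn μ (fun x => g x * f x) ≤ ENNReal.ofReal (C ^ 2) * sqn μ f := by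
  rw [← sqn_const_mul]
  refine lintegral_mono fun x => ENNReal.ofReal_le_ofReal ?_
  rw [mul_pow, mul_pow]
  exact mul_le_mul_of_nonneg_right (sq_le_sq' (by linarith [neg_abs_le (g x), hC x])
    ((le_abs_self _).trans (hC x))) (sq_nonneg _)

lemma sqn_eq_zero (hf : AEMeasurable f μ) (h : sqn μ f = 0) : f =ᵐ[μ] fun _ => 0 := by
  rw [sqn, lintegral_eq_zero_iff' (by fun_prop)] at h
  filter_upwards [h] with x hx
  simpa using le_antisymm (by simpa using hx) (sq_nonneg (f x))

lemma memLp_two_of_sqn (hf : AEMeasurable f μ) (h : sqn μ f ≠ ⊤) : MemLp f 2 μ := by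
  refine ⟨hf.aestronglyMeasurable, lt_top_iff_ne_top.2 fun h' => h ?_⟩
  rw [sqn_eq_eLpNorm, h']; simp

lemma sqn_ne_top (hf : MemLp f 2 μ) : sqn μ f ≠ ⊤ := by
  rw [sqn_eq_eLpNorm]; exact ENNReal.pow_ne_top hf.eLpNorm_ne_top

lemma sqn_eq_ofReal_integral (hf : MemLp f 2 μ) :
    sqn μ f = ENNReal.ofReal (∫ x, f x * f x ∂μ) := by
  have : Integrable (fun x => f x * f x) μ := hf.integrable_mul hf
  rw [ofReal_integral_eq_lintegral_ofReal this
    (Eventually.of_forall fun x => mul_self_nonneg (f x))]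
  simp only [sqn, sq]

lemma tendsto_sqn_iff {u : ℕ → α → ℝ} :
    Tendsto (fun n => sqn μ (fun x => u n x - f x)) atTop (nhds 0) ↔
      Tendsto (fun n => eLpNorm (u n - f) 2 μ) atTop (nhds 0) := by
  simp only [sqn_eq_eLpNorm]
  constructor
  · intro h
    have := (ENNReal.continuous_rpow_const (y := (2 : ℝ)⁻¹)).tendsto 0 |>.comp h
    simp only [Function.comp_def] at this
    refine (this.congr fun n => ?_).trans (by simp)
    rw [← ENNReal.rpow_natCast, ← ENNReal.rpow_mul]
    norm_num; rfl
  · intro h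
    have := (ENNReal.continuous_pow 2).tendsto 0 |>.comp h
    simp only [Function.comp_def, ne_eq, OfNat.ofNat_ne_zero, not_false_eq_true, zero_pow] at this
    exact this

lemma tendstoInMeasure_of_sqn {u : ℕ → α → ℝ} (hu : ∀ n, AEMeasurable (u n) μ)
    (hf : AEMeasurable f μ)
    (h : Tendsto (fun n => sqn μ (fun x => u n x - f x)) atTop (nhds 0)) :
    TendstoInMeasure μ u atTop f :=
  tendstoInMeasure_of_tendsto_eLpNorm (by norm_num) (fun n => (hu n).aestronglyMeasurable)
    hf.aestronglyMeasurable (tendsto_sqn_iff.1 h)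

/-- Completeness of `L²` phrased with `sqn`. -/
lemma exists_limit_of_sqn_cauchy {u : ℕ → α → ℝ} (hu : ∀ n, MemLp (u n) 2 μ)
    (h : ∀ ε : ENNReal, 0 < ε → ∃ N, ∀ n ≥ N, ∀ m ≥ N, sqn μ (fun x => u n x - u m x) ≤ ε) :
    ∃ v, MemLp v 2 μ ∧ Tendsto (fun n => sqn μ (fun x => u n x - v x)) atTop (nhds 0) := by
  have hc : CauchySeq (fun n => (hu n).toLp (u n)) := by
    refine EMetric.cauchySeq_iff.2 fun ε hε => ?_
    obtain ⟨δ, hδ, hδε⟩ := exists_between hε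
    obtain ⟨N, hN⟩ := h (δ ^ 2) (by positivity)
    refine ⟨N, fun m hm n hn => ?_⟩
    rw [Lp.edist_toLp_toLp]
    refine lt_of_le_of_lt ?_ hδε
    have := hN m hm n hn
    rw [sqn_eq_eLpNorm] at this
    exact (ENNReal.pow_le_pow_left_iff two_ne_zero).1 this
  obtain ⟨v, hv⟩ := cauchySeq_tendsto_of_complete hc
  refine ⟨v, Lp.memLp v, tendsto_sqn_iff.2 ?_⟩
  have := (Lp.tendsto_Lp_iff_tendsto_eLpNorm' _ _).1 hv
  refine this.congr fun n => eLpNorm_congr_ae ?_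
  exact (hu n).coeFn_toLp.sub (ae_eq_refl _)

end sqn

end

/-! ### Itô integrals as limits of elementary integrals -/

section

variable {Ω : Type*} [mΩ : MeasurableSpace Ω] {d : ℕ}

/-- Elementary integrands on `(a, b]` together with their stochastic integrals. -/
def elemPairs (F : ℝ → MeasurableSpace Ω) (B : ℝ → Ω → Fin d → ℝ) (a b : ℝ) :
    Set ((Fin d → ℝ → Ω → ℝ) × (Ω → ℝ)) :=
  {p | ∃ (j : Fin d) (u v C : ℝ) (ξ : Ω → ℝ), a ≤ u ∧ u ≤ v ∧ v ≤ b ∧ Measurable[F u] ξ ∧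
    (∀ ω, |ξ ω| ≤ C) ∧
    p = (fun k r ω => if k = j then (Ioc u v).indicator (fun _ => ξ ω) r else 0,
      fun ω => ξ ω * (B v ω j - B u ω j))}

/-- The span of the elementary integrands, together with their stochastic integrals. -/
def elemSpan (F : ℝ → MeasurableSpace Ω) (B : ℝ → Ω → Fin d → ℝ) (a b : ℝ) :
    Submodule ℝ ((Fin d → ℝ → Ω → ℝ) × (Ω → ℝ)) := Submodule.span ℝ (elemPairs F B a b)

/-- `J` is the `L²` stochastic integral of `h`, an `L²` limit of elementary integrands on
`(a, b]`. -/
structure IsIto (P : Measure Ω) (F : ℝ → MeasurableSpace Ω) (B : ℝ → Ω → Fin d → ℝ) (a b : ℝ)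
    (h : Fin d → ℝ → Ω → ℝ) (J : Ω → ℝ) : Prop where
  aem : ∀ k, AEMeasurable (Function.uncurry (h k)) (volume.prod P)
  aemJ : AEMeasurable J P
  exists_seq : ∃ p : ℕ → (Fin d → ℝ → Ω → ℝ) × (Ω → ℝ), (∀ i, p i ∈ elemSpan F B a b) ∧
    (∀ k, Tendsto (fun i => sqn (volume.prod P)
      (fun x => (p i).1 k x.1 x.2 - h k x.1 x.2)) atTop (nhds 0)) ∧
    Tendsto (fun i => sqn P (fun ω => (p i).2 ω - J ω)) atTop (nhds 0)

namespace BMSetup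

variable {P : Measure Ω} {F : ℝ → MeasurableSpace Ω} {B : ℝ → Ω → Fin d → ℝ}
  [IsProbabilityMeasure P] {a b : ℝ} {p q : (Fin d → ℝ → Ω → ℝ) × (Ω → ℝ)}
  {h h' : Fin d → ℝ → Ω → ℝ} {J J' : Ω → ℝ}

lemma measurable_indicator_uncurry {u v : ℝ} {ξ : Ω → ℝ} (hξ : Measurable ξ) :
    Measurable (fun x : ℝ × Ω => (Ioc u v).indicator (fun _ => ξ x.2) x.1) := by
  have : (fun x : ℝ × Ω => (Ioc u v).indicator (fun _ => ξ x.2) x.1)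
      = (Prod.fst ⁻¹' Ioc u v).indicator (fun x => ξ x.2) := by
    ext x; simp only [indicator, mem_preimage]
  rw [this]
  exact (hξ.comp measurable_snd).indicator (measurable_fst measurableSet_Ioc)

lemma memLp_indicator_uncurry {u v C : ℝ} {ξ : Ω → ℝ} (hξ : Measurable ξ) (hC : ∀ ω, |ξ ω| ≤ C) :
    MemLp (fun x : ℝ × Ω => (Ioc u v).indicator (fun _ => ξ x.2) x.1) 2 (volume.prod P) := by
  have : (fun x : ℝ × Ω => (Ioc u v).indicator (fun _ => ξ x.2) x.1)
      = (Ioc u v ×ˢ univ).indicator (fun x => ξ x.2) := by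
    ext x; simp only [indicator, mem_prod, mem_univ, and_true]
  rw [this, memLp_indicator_iff_restrict (measurableSet_Ioc.prod MeasurableSet.univ)]
  have hfin : IsFiniteMeasure ((volume.prod P).restrict (Ioc u v ×ˢ (univ : Set Ω))) :=
    ⟨by rw [Measure.restrict_apply_univ, Measure.prod_prod]; simp⟩
  exact MemLp.of_bound (hξ.comp measurable_snd).aestronglyMeasurable C
    (Eventually.of_forall fun x => by simpa using hC x.2)

lemma elemSpan_facts (S : BMSetup P F B) (ha : 0 ≤ a) (hp : p ∈ elemSpan F B a b) :
    (∀ k, Measurable (Function.uncurry (p.1 k))) ∧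
    (∀ k, MemLp (Function.uncurry (p.1 k)) 2 (volume.prod P)) ∧
    Measurable[F b] p.2 ∧ MemLp p.2 2 P := by
  induction hp using Submodule.span_induction with
  | mem p hp =>
    obtain ⟨j, u, v, C, ξ, hau, huv, hvb, hξ, hC, rfl⟩ := hp
    have hξ' : Measurable ξ := hξ.mono (S.le _) le_rfl
    refine ⟨fun k => ?_, fun k => ?_, ?_, ?_⟩
    · by_cases hk : k = j
      · simpa [Function.uncurry_def, hk] using measurable_indicator_uncurry hξ'
      · simp [Function.uncurry_def, hk]
    · by_cases hk : k = j
      · simpa [Function.uncurry_def, hk] using memLp_indicator_uncurry hξ' hC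
      · simp [Function.uncurry_def, hk]
    · exact Measurable.mul (m := F b) (hξ.mono (S.mono _ _ (huv.trans hvb)) le_rfl)
        (S.measurable_incr_coord (ha.trans hau) huv hvb j)
    · have hB := S.memLp_incr (ha.trans hau) huv j (p := 2) (by simp)
      exact memLp_two_of_sqn (hξ'.aemeasurable.mul hB.1.aemeasurable)
        (ne_top_of_le_ne_top (ENNReal.mul_ne_top ENNReal.ofReal_ne_top (sqn_ne_top hB))
          (sqn_mul_le hC))
  | zero =>
    exact ⟨fun k => measurable_const, fun k => MemLp.zero', measurable_const, MemLp.zero'⟩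
  | add p q _ _ hp hq =>
    exact ⟨fun k => (hp.1 k).add (hq.1 k), fun k => (hp.2.1 k).add (hq.2.1 k),
      Measurable.add (m := F b) hp.2.2.1 hq.2.2.1, hp.2.2.2.add hq.2.2.2⟩
  | smul c p _ hp =>
    exact ⟨fun k => (hp.1 k).const_smul c, fun k => (hp.2.1 k).const_smul c,
      Measurable.const_smul (m := F b) hp.2.2.1 c, hp.2.2.2.const_smul c⟩

lemma integral_indicator_mul {u v u' v' : ℝ} {ξ η : Ω → ℝ} :
    ∫ x, (Ioc u v).indicator (fun _ => ξ x.2) x.1 * (Ioc u' v').indicator (fun _ => η x.2) x.1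
      ∂(volume.prod P) = (∫ ω, ξ ω * η ω ∂P) * volume.real (Ioc u v ∩ Ioc u' v') := by
  have : ∀ x : ℝ × Ω, (Ioc u v).indicator (fun _ => ξ x.2) x.1 *
      (Ioc u' v').indicator (fun _ => η x.2) x.1
      = (Ioc u v ∩ Ioc u' v').indicator (fun _ => (1 : ℝ)) x.1 * (ξ x.2 * η x.2) := by
    intro x
    by_cases h1 : x.1 ∈ Ioc u v <;> by_cases h2 : x.1 ∈ Ioc u' v' <;> simp [h1, h2, indicator]
  simp_rw [this]
  rw [integral_prod_mul (μ := volume) (ν := P)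
    (fun r => (Ioc u v ∩ Ioc u' v').indicator (fun _ => (1 : ℝ)) r) (fun ω => ξ ω * η ω),
    integral_indicator (measurableSet_Ioc.inter measurableSet_Ioc)]
  simp [mul_comm]

lemma elemSpan_inner (S : BMSetup P F B) (ha : 0 ≤ a) (hp : p ∈ elemSpan F B a b)
    (hq : q ∈ elemSpan F B a b) :
    ∫ ω, p.2 ω * q.2 ω ∂P
      = ∑ k, ∫ x, p.1 k x.1 x.2 * q.1 k x.1 x.2 ∂(volume.prod P) := by
  induction hp using Submodule.span_induction with
  | mem p hp =>
    induction hq using Submodule.span_induction with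
    | mem q hq =>
      obtain ⟨j, u, v, C, ξ, hau, huv, hvb, hξ, hC, rfl⟩ := hp
      obtain ⟨j', u', v', C', ξ', hau', huv', hvb', hξ', hC', rfl⟩ := hq
      simp only
      rw [S.gram (ha.trans hau) huv (ha.trans hau') huv' hξ hξ' hC hC',
        Finset.sum_eq_single j]
      · simp only [if_true]
        split_ifs with hjj
        · exact integral_indicator_mul.symm
        · simp
      · intro k _ hk; simp [hk]
      · simp
    | zero => simp
    | add q q' hq hq' h1 h2 =>
      have fp := S.elemSpan_facts ha (Submodule.subset_span hp)
      have fq := S.elemSpan_facts ha hq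
      have fq' := S.elemSpan_facts ha hq'
      simp only [Prod.fst_add, Prod.snd_add, Pi.add_apply, mul_add]
      erw [integral_add (fp.2.2.2.integrable_mul fq.2.2.2) (fp.2.2.2.integrable_mul fq'.2.2.2)]
      simp only [Pi.mul_apply]
      rw [h1, h2, ← Finset.sum_add_distrib]
      refine Finset.sum_congr rfl fun k _ => ?_
      exact (integral_add ((fp.2.1 k).integrable_mul (fq.2.1 k))
        ((fp.2.1 k).integrable_mul (fq'.2.1 k))).symm
    | smul c q hq h1 =>
      simp only [Prod.smul_fst, Prod.smul_snd, Pi.smul_apply, smul_eq_mul, mul_left_comm _ c,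
        integral_const_mul, h1, Finset.mul_sum]
  | zero => simp
  | add p p' hp hp' h1 h2 =>
    have fq := S.elemSpan_facts ha hq
    have fp := S.elemSpan_facts ha hp
    have fp' := S.elemSpan_facts ha hp'
    simp only [Prod.fst_add, Prod.snd_add, Pi.add_apply, add_mul]
    erw [integral_add (fp.2.2.2.integrable_mul fq.2.2.2) (fp'.2.2.2.integrable_mul fq.2.2.2)]
    simp only [Pi.mul_apply]
    rw [h1, h2, ← Finset.sum_add_distrib]
    refine Finset.sum_congr rfl fun k _ => ?_
    exact (integral_add ((fp.2.1 k).integrable_mul (fq.2.1 k))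
      ((fp'.2.1 k).integrable_mul (fq.2.1 k))).symm
  | smul c p hp h1 =>
    simp only [Prod.smul_fst, Prod.smul_snd, Pi.smul_apply, smul_eq_mul, mul_assoc,
      integral_const_mul, h1, Finset.mul_sum]

lemma elemSpan_isometry (S : BMSetup P F B) (ha : 0 ≤ a) (hp : p ∈ elemSpan F B a b) :
    sqn P p.2 = ∑ k, sqn (volume.prod P) (fun x => p.1 k x.1 x.2) := by
  have fp := S.elemSpan_facts ha hp
  rw [sqn_eq_ofReal_integral fp.2.2.2, S.elemSpan_inner ha hp hp,
    ENNReal.ofReal_sum_of_nonneg fun k _ => integral_nonneg fun x => mul_self_nonneg _]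
  exact Finset.sum_congr rfl fun k _ => (sqn_eq_ofReal_integral (fp.2.1 k)).symm


lemma _root_.elemSpan_mono {a' b' : ℝ} (ha : a' ≤ a) (hb : b ≤ b') :
    elemSpan F B a b ≤ elemSpan F B a' b' := by
  refine Submodule.span_mono ?_
  rintro p ⟨j, u, v, C, ξ, hau, huv, hvb, h⟩
  exact ⟨j, u, v, C, ξ, ha.trans hau, huv, hvb.trans hb, h⟩

end BMSetup

namespace IsIto

variable {P : Measure Ω} {F : ℝ → MeasurableSpace Ω} {B : ℝ → Ω → Fin d → ℝ}
  [IsProbabilityMeasure P] {a b : ℝ} {p q : (Fin d → ℝ → Ω → ℝ) × (Ω → ℝ)}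
  {h h' : Fin d → ℝ → Ω → ℝ} {J J' : Ω → ℝ}

lemma mono {a' b' : ℝ} (H : IsIto P F B a b h J) (ha : a' ≤ a) (hb : b ≤ b') :
    IsIto P F B a' b' h J := by
  obtain ⟨p, hp, h1, h2⟩ := H.exists_seq
  exact ⟨H.aem, H.aemJ, p, fun i => elemSpan_mono ha hb (hp i), h1, h2⟩

lemma of_mem (S : BMSetup P F B) (ha : 0 ≤ a) (hp : p ∈ elemSpan F B a b) :
    IsIto P F B a b p.1 p.2 := by
  have fp := S.elemSpan_facts ha hp
  refine ⟨fun k => (fp.1 k).aemeasurable, (fp.2.2.1.mono (S.le _) le_rfl).aemeasurable,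
    fun _ => p, fun _ => hp, ?_, ?_⟩ <;> simp [sqn]

lemma add (S : BMSetup P F B) (ha : 0 ≤ a) (H : IsIto P F B a b h J)
    (H' : IsIto P F B a b h' J') :
    IsIto P F B a b (fun k r ω => h k r ω + h' k r ω) (fun ω => J ω + J' ω) := by
  obtain ⟨p, hp, h1, h2⟩ := H.exists_seq
  obtain ⟨q, hq, h1', h2'⟩ := H'.exists_seq
  have fp := fun i => S.elemSpan_facts ha (hp i)
  have fq := fun i => S.elemSpan_facts ha (hq i)
  refine ⟨fun k => (H.aem k).add (H'.aem k), H.aemJ.add H'.aemJ, fun i => p i + q i,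
    fun i => add_mem (hp i) (hq i), fun k => ?_, ?_⟩
  · have := ((ENNReal.Tendsto.const_mul (a := 2) (h1 k) (by simp)).add
      (ENNReal.Tendsto.const_mul (a := 2) (h1' k) (by simp)))
    simp only [mul_zero, add_zero] at this
    refine tendsto_of_tendsto_of_tendsto_of_le_of_le tendsto_const_nhds this
      (fun _ => zero_le) fun i => ?_
    refine le_trans (le_of_eq ?_) (sqn_add_le (((fp i).1 k).aemeasurable.sub (H.aem k)))
    simp [sqn, add_sub_add_comm]
  · have := ((ENNReal.Tendsto.const_mul (a := 2) h2 (by simp)).add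
      (ENNReal.Tendsto.const_mul (a := 2) h2' (by simp)))
    simp only [mul_zero, add_zero] at this
    refine tendsto_of_tendsto_of_tendsto_of_le_of_le tendsto_const_nhds this
      (fun _ => zero_le) fun i => ?_
    refine le_trans (le_of_eq ?_)
      (sqn_add_le (((fp i).2.2.1.mono (S.le _) le_rfl).aemeasurable.sub H.aemJ))
    simp [sqn, add_sub_add_comm]

lemma const_mul (c : ℝ) (H : IsIto P F B a b h J) :
    IsIto P F B a b (fun k r ω => c * h k r ω) (fun ω => c * J ω) := by
  obtain ⟨p, hp, h1, h2⟩ := H.exists_seq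
  refine ⟨fun k => (H.aem k).const_mul c, H.aemJ.const_mul c, fun i => c • p i,
    fun i => Submodule.smul_mem _ c (hp i), fun k => ?_, ?_⟩
  · have := ENNReal.Tendsto.const_mul (a := ENNReal.ofReal (c ^ 2)) (h1 k) (by simp)
    rw [mul_zero] at this
    refine this.congr fun i => ?_
    rw [← sqn_const_mul]
    simp [mul_sub]
  · have := ENNReal.Tendsto.const_mul (a := ENNReal.ofReal (c ^ 2)) h2 (by simp)
    rw [mul_zero] at this
    refine this.congr fun i => ?_
    rw [← sqn_const_mul]
    simp [mul_sub]

lemma sub (S : BMSetup P F B) (ha : 0 ≤ a) (H : IsIto P F B a b h J)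
    (H' : IsIto P F B a b h' J') :
    IsIto P F B a b (fun k r ω => h k r ω - h' k r ω) (fun ω => J ω - J' ω) := by
  have := H.add S ha (H'.const_mul (-1))
  simpa [sub_eq_add_neg] using this

lemma zero : IsIto P F B a b (fun _ _ _ => 0) (fun _ => 0) :=
  ⟨fun _ => aemeasurable_const, aemeasurable_const, fun _ => 0, fun _ => zero_mem _,
    fun k => by simp [sqn], by simp [sqn]⟩

lemma sum (S : BMSetup P F B) (ha : 0 ≤ a) {ι : Type*} (s : Finset ι)
    {h : ι → Fin d → ℝ → Ω → ℝ} {J : ι → Ω → ℝ} (H : ∀ i ∈ s, IsIto P F B a b (h i) (J i)) :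
    IsIto P F B a b (fun k r ω => ∑ i ∈ s, h i k r ω) (fun ω => ∑ i ∈ s, J i ω) := by
  induction s using Finset.induction_on with
  | empty => simpa using zero
  | insert i s hi ih =>
    simp only [Finset.sum_insert hi]
    exact (H i (Finset.mem_insert_self _ _)).add S ha
      (ih fun j hj => H j (Finset.mem_insert_of_mem hj))

lemma congr (H : IsIto P F B a b h J)
    (hh : ∀ k, (fun x : ℝ × Ω => h k x.1 x.2) =ᵐ[volume.prod P] fun x => h' k x.1 x.2)
    (hJ : J =ᵐ[P] J') : IsIto P F B a b h' J' := by
  obtain ⟨p, hp, h1, h2⟩ := H.exists_seq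
  refine ⟨fun k => (H.aem k).congr (hh k), H.aemJ.congr hJ, p, hp, fun k => ?_, ?_⟩
  · refine (h1 k).congr fun i => sqn_congr ?_
    filter_upwards [hh k] with x hx
    rw [hx]
  · refine h2.congr fun i => sqn_congr ?_
    filter_upwards [hJ] with x hx
    rw [hx]

lemma bounds (S : BMSetup P F B) (ha : 0 ≤ a) (H : IsIto P F B a b h J) :
    sqn P J ≤ 4 * ∑ k, sqn (volume.prod P) (fun x => h k x.1 x.2) ∧
    ∑ k, sqn (volume.prod P) (fun x => h k x.1 x.2) ≤ 4 * sqn P J := by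
  obtain ⟨p, hp, h1, h2⟩ := H.exists_seq
  have fp := fun i => S.elemSpan_facts ha (hp i)
  have iso := fun i => S.elemSpan_isometry ha (hp i)
  have h1s := tendsto_finsetSum Finset.univ fun k _ => h1 k
  simp only [Finset.sum_const_zero] at h1s
  have mp := fun i => ((fp i).2.2.1.mono (S.le _) le_rfl).aemeasurable (μ := P)
  have four : (2 : ENNReal) * 2 = 4 := by norm_num
  have t : Tendsto (fun i => 2 * sqn P (fun ω => (p i).2 ω - J ω)
      + 4 * ∑ k, sqn (volume.prod P) (fun x => (p i).1 k x.1 x.2 - h k x.1 x.2))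
      atTop (nhds 0) := by
    have := (ENNReal.Tendsto.const_mul (a := 2) h2 (by simp)).add
      (ENNReal.Tendsto.const_mul (a := 4) h1s (by simp))
    simpa using this
  have t' : Tendsto (fun i => 2 * ∑ k, sqn (volume.prod P)
      (fun x => (p i).1 k x.1 x.2 - h k x.1 x.2) + 4 * sqn P (fun ω => (p i).2 ω - J ω))
      atTop (nhds 0) := by
    have := (ENNReal.Tendsto.const_mul (a := 2) h1s (by simp)).add
      (ENNReal.Tendsto.const_mul (a := 4) h2 (by simp))
    simpa using this
  constructor
  · have := t.add_const (4 * ∑ k, sqn (volume.prod P) (fun x => h k x.1 x.2))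
    rw [zero_add] at this
    refine ge_of_tendsto' this fun i => ?_
    refine (sqn_le_sub_add H.aemJ (mp i)).trans ?_
    have h3 : ∑ k, sqn (volume.prod P) (fun x => (p i).1 k x.1 x.2)
        ≤ ∑ k, (2 * sqn (volume.prod P) (fun x => (p i).1 k x.1 x.2 - h k x.1 x.2)
          + 2 * sqn (volume.prod P) (fun x => h k x.1 x.2)) :=
      Finset.sum_le_sum fun k _ => sqn_le_sub_add ((fp i).1 k).aemeasurable (H.aem k)
    rw [Finset.sum_add_distrib, ← Finset.mul_sum, ← Finset.mul_sum] at h3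
    rw [sqn_sub_comm, iso i, add_assoc, ← four, mul_assoc, mul_assoc, ← mul_add 2 (2 * _)]
    gcongr
  · have := t'.add_const (4 * sqn P J)
    rw [zero_add] at this
    refine ge_of_tendsto' this fun i => ?_
    have : ∑ k, sqn (volume.prod P) (fun x => h k x.1 x.2) ≤ ∑ k, (2 * sqn (volume.prod P)
      (fun x => (p i).1 k x.1 x.2 - h k x.1 x.2) + 2 * sqn (volume.prod P)
        (fun x => (p i).1 k x.1 x.2)) := by
      refine Finset.sum_le_sum fun k _ => ?_
      rw [sqn_sub_comm]
      exact sqn_le_sub_add (H.aem k) ((fp i).1 k).aemeasurable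
    refine this.trans ?_
    rw [Finset.sum_add_distrib, ← Finset.mul_sum, ← Finset.mul_sum, ← iso i, add_assoc,
      ← four, mul_assoc, mul_assoc, ← mul_add 2 (2 * _)]
    gcongr
    exact sqn_le_sub_add (mp i) H.aemJ

lemma ae_unique (S : BMSetup P F B) (ha : 0 ≤ a) (H : IsIto P F B a b h J)
    (H' : IsIto P F B a b h' J')
    (hh : ∀ k, (fun x : ℝ × Ω => h k x.1 x.2) =ᵐ[volume.prod P] fun x => h' k x.1 x.2) :
    J =ᵐ[P] J' := by
  have hs := H.sub S ha H'
  have h0 : sqn P (fun ω => J ω - J' ω) = 0 := by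
    refine le_antisymm ((hs.bounds S ha).1.trans (le_of_eq ?_)) zero_le
    rw [Finset.sum_eq_zero fun k _ => ?_, mul_zero]
    rw [sqn_congr ((hh k).mono fun x hx => by
      show _ = (fun _ => (0 : ℝ)) x
      simp only [hx, sub_self]), sqn_zero]
  filter_upwards [sqn_eq_zero hs.aemJ h0] with ω hω
  linarith

/-- An `L²` limit of elementary integrands is integrable. -/
lemma exists_of_tendsto_elem (S : BMSetup P F B) (ha : 0 ≤ a)
    {p : ℕ → (Fin d → ℝ → Ω → ℝ) × (Ω → ℝ)} (hp : ∀ i, p i ∈ elemSpan F B a b)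
    (hh : ∀ k, AEMeasurable (fun x : ℝ × Ω => h k x.1 x.2) (volume.prod P))
    (h1 : ∀ k, Tendsto (fun i => sqn (volume.prod P)
      (fun x => (p i).1 k x.1 x.2 - h k x.1 x.2)) atTop (nhds 0)) :
    ∃ J, IsIto P F B a b h J ∧
      Tendsto (fun i => sqn P (fun ω => (p i).2 ω - J ω)) atTop (nhds 0) := by
  have fp := fun i => S.elemSpan_facts ha (hp i)
  have h1s := tendsto_finsetSum Finset.univ fun k _ => h1 k
  simp only [Finset.sum_const_zero] at h1s
  obtain ⟨J, hJ, hlim⟩ := exists_limit_of_sqn_cauchy (fun i => (fp i).2.2.2) (by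
    intro ε hε
    obtain ⟨N, hN⟩ := (ENNReal.tendsto_atTop_zero.1 h1s) (ε / 4)
      (ENNReal.div_pos hε.ne' (by simp))
    refine ⟨N, fun n hn m hm => ?_⟩
    have := S.elemSpan_isometry ha (sub_mem (hp n) (hp m))
    calc sqn P (fun x => (p n).2 x - (p m).2 x)
        = ∑ k, sqn (volume.prod P) (fun x => (p n).1 k x.1 x.2 - (p m).1 k x.1 x.2) := this
      _ ≤ ∑ k, (2 * sqn (volume.prod P) (fun x => (p n).1 k x.1 x.2 - h k x.1 x.2)
          + 2 * sqn (volume.prod P) (fun x => (p m).1 k x.1 x.2 - h k x.1 x.2)) := by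
        refine Finset.sum_le_sum fun k _ => ?_
        rw [sqn_sub_comm (f := fun x : ℝ × Ω => (p m).1 k x.1 x.2)]
        exact sqn_sub_le_add ((fp n).1 k).aemeasurable (hh k)
      _ = 2 * ∑ k, sqn (volume.prod P) (fun x => (p n).1 k x.1 x.2 - h k x.1 x.2)
          + 2 * ∑ k, sqn (volume.prod P) (fun x => (p m).1 k x.1 x.2 - h k x.1 x.2) := by
        rw [Finset.sum_add_distrib, Finset.mul_sum, Finset.mul_sum]
      _ ≤ 2 * (ε / 4) + 2 * (ε / 4) := by gcongr <;> [exact hN n hn; exact hN m hm]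
      _ = ε := by
        rw [← mul_add, ← two_mul, ← mul_assoc, show (2 : ENNReal) * 2 = 4 by norm_num,
          ENNReal.mul_div_cancel (by simp) (by simp)])
  exact ⟨J, ⟨hh, hJ.1.aemeasurable, p, hp, h1, hlim⟩, hlim⟩

/-- Closedness of the stochastic integral. -/
lemma exists_of_tendsto (S : BMSetup P F B) (ha : 0 ≤ a)
    {hn : ℕ → Fin d → ℝ → Ω → ℝ} {Jn : ℕ → Ω → ℝ} (Hn : ∀ i, IsIto P F B a b (hn i) (Jn i))
    (hh : ∀ k, AEMeasurable (fun x : ℝ × Ω => h k x.1 x.2) (volume.prod P))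
    (h1 : ∀ k, Tendsto (fun i => sqn (volume.prod P)
      (fun x => hn i k x.1 x.2 - h k x.1 x.2)) atTop (nhds 0)) :
    ∃ J, IsIto P F B a b h J ∧
      Tendsto (fun i => sqn P (fun ω => Jn i ω - J ω)) atTop (nhds 0) := by
  have : ∀ i : ℕ, ∃ p ∈ elemSpan F B a b, ∀ k, sqn (volume.prod P)
      (fun x => p.1 k x.1 x.2 - hn i k x.1 x.2) ≤ (i : ENNReal)⁻¹ := by
    intro i
    obtain ⟨p, hp, hp1, -⟩ := (Hn i).exists_seq
    have : ∀ᶠ m in atTop, ∀ k, sqn (volume.prod P)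
        (fun x => (p m).1 k x.1 x.2 - hn i k x.1 x.2) ≤ (i : ENNReal)⁻¹ := by
      rw [eventually_all]
      exact fun k => (hp1 k).eventually_le_const (by simp)
    obtain ⟨m, hm⟩ := this.exists
    exact ⟨p m, hp m, hm⟩
  choose p hp hpi using this
  have fp := fun i => S.elemSpan_facts ha (hp i)
  have h1' : ∀ k, Tendsto (fun i => sqn (volume.prod P)
      (fun x => (p i).1 k x.1 x.2 - h k x.1 x.2)) atTop (nhds 0) := by
    intro k
    have := (ENNReal.Tendsto.const_mul (a := 2) ENNReal.tendsto_inv_nat_nhds_zero (by simp)).add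
      (ENNReal.Tendsto.const_mul (a := 2) (h1 k) (by simp))
    simp only [mul_zero, add_zero] at this
    refine tendsto_of_tendsto_of_tendsto_of_le_of_le tendsto_const_nhds this
      (fun _ => zero_le) fun i => ?_
    refine (sqn_sub_le_add ((fp i).1 k).aemeasurable ((Hn i).aem k)).trans ?_
    have := hpi i k
    gcongr
    · exact this
    · exact le_rfl
  obtain ⟨J, HJ, -⟩ := exists_of_tendsto_elem S ha hp hh h1'
  refine ⟨J, HJ, ?_⟩
  have h1s := tendsto_finsetSum Finset.univ fun k _ => h1 k
  simp only [Finset.sum_const_zero] at h1s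
  have := ENNReal.Tendsto.const_mul (a := 4) h1s (by simp)
  rw [mul_zero] at this
  exact tendsto_of_tendsto_of_tendsto_of_le_of_le tendsto_const_nhds this
      (fun _ => zero_le) fun i => (((Hn i).sub S ha HJ).bounds S ha).1

/-- Multiplication by a bounded variable known at the initial time. -/
lemma bdd_mul (S : BMSetup P F B) {ζ : Ω → ℝ} {C : ℝ}
    (hζ : Measurable[F a] ζ) (hC : ∀ ω, |ζ ω| ≤ C) (H : IsIto P F B a b h J) :
    IsIto P F B a b (fun k r ω => ζ ω * h k r ω) (fun ω => ζ ω * J ω) := by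
  have hζ' : Measurable ζ := hζ.mono (S.le _) le_rfl
  obtain ⟨p, hp, h1, h2⟩ := H.exists_seq
  have key : ∀ q ∈ elemSpan F B a b,
      ((fun k r ω => ζ ω * q.1 k r ω, fun ω => ζ ω * q.2 ω) :
        (Fin d → ℝ → Ω → ℝ) × (Ω → ℝ)) ∈ elemSpan F B a b := by
    intro q hq
    induction hq using Submodule.span_induction with
    | mem q hq =>
      obtain ⟨j, u, v, D, ξ, hau, huv, hvb, hξ, hD, rfl⟩ := hq
      refine Submodule.subset_span ⟨j, u, v, C * D, fun ω => ζ ω * ξ ω, hau, huv, hvb,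
        Measurable.mul (m := F u) (hζ.mono (S.mono _ _ hau) le_rfl) hξ, fun ω => ?_, ?_⟩
      · rw [abs_mul]
        exact mul_le_mul (hC ω) (hD ω) (abs_nonneg _) ((abs_nonneg _).trans (hC ω))
      · refine Prod.ext ?_ ?_
        · ext k r ω
          simp only [indicator]
          split_ifs <;> simp
        · ext ω; simp only; ring
    | zero =>
      convert zero_mem (elemSpan F B a b) using 1
      simp only [mul_zero, Prod.fst_zero, Prod.snd_zero, Pi.zero_apply]; rfl
    | add q q' _ _ h1 h2 =>
      convert add_mem h1 h2 using 1
      refine Prod.ext ?_ ?_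
      · ext k r ω; simp [mul_add]
      · ext ω; simp [mul_add]
    | smul c q _ h1 =>
      convert Submodule.smul_mem _ c h1 using 1
      refine Prod.ext ?_ ?_
      · ext k r ω; simp [mul_left_comm]
      · ext ω; simp [mul_left_comm]
  refine ⟨fun k => (hζ'.comp measurable_snd).aemeasurable.mul (H.aem k),
    hζ'.aemeasurable.mul H.aemJ, fun i => _, fun i => key _ (hp i), fun k => ?_, ?_⟩
  · have := ENNReal.Tendsto.const_mul (a := ENNReal.ofReal (C ^ 2)) (h1 k) (by simp)
    rw [mul_zero] at this
    refine tendsto_of_tendsto_of_tendsto_of_le_of_le tendsto_const_nhds this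
      (fun _ => zero_le) fun i => ?_
    simp only [← mul_sub]
    exact sqn_mul_le fun x => hC x.2
  · have := ENNReal.Tendsto.const_mul (a := ENNReal.ofReal (C ^ 2)) h2 (by simp)
    rw [mul_zero] at this
    refine tendsto_of_tendsto_of_tendsto_of_le_of_le tendsto_const_nhds this
      (fun _ => zero_le) fun i => ?_
    simp only [← mul_sub]
    exact sqn_mul_le hC

end IsIto

end

/-! ### Almost sure measurability and step processes -/

section

/-- `f` agrees almost surely with an `m`-measurable function. -/
def AEM {Ω E : Type*} [MeasurableSpace E] (m : MeasurableSpace Ω) [MeasurableSpace Ω]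
    (P : Measure Ω) (f : Ω → E) : Prop := ∃ g, Measurable[m] g ∧ f =ᵐ[P] g

namespace AEM

variable {Ω E E' : Type*} {m m' : MeasurableSpace Ω} [mΩ : MeasurableSpace Ω]
  [MeasurableSpace E] [MeasurableSpace E']
  {P : Measure Ω} {f : Ω → E} {f' : Ω → E'}

lemma of_measurable (h : Measurable[m] f) : AEM m P f := ⟨f, h, ae_eq_refl _⟩

lemma mono (h : AEM m P f) (hm : m ≤ m') : AEM m' P f := by
  obtain ⟨g, hg, hfg⟩ := h
  exact ⟨g, hg.mono hm le_rfl, hfg⟩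

lemma congr {g : Ω → E} (h : AEM m P f) (hfg : f =ᵐ[P] g) : AEM m P g := by
  obtain ⟨g', hg, hfg'⟩ := h
  exact ⟨g', hg, hfg.symm.trans hfg'⟩

lemma comp (h : AEM m P f) {φ : E → E'} (hφ : Measurable φ) : AEM m P (fun ω => φ (f ω)) := by
  obtain ⟨g, hg, hfg⟩ := h
  exact ⟨fun ω => φ (g ω), hφ.comp hg, hfg.mono fun ω hω => by simp only [hω]⟩

lemma prodMk (h : AEM m P f) (h' : AEM m P f') : AEM m P (fun ω => (f ω, f' ω)) := by
  obtain ⟨g, hg, hfg⟩ := h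
  obtain ⟨g', hg', hfg'⟩ := h'
  refine ⟨fun ω => (g ω, g' ω), Measurable.prodMk hg hg', ?_⟩
  filter_upwards [hfg, hfg'] with ω h1 h2
  rw [h1, h2]

lemma pi {ι : Type*} [Countable ι] {f : Ω → ι → E} (h : ∀ i, AEM m P (fun ω => f ω i)) :
    AEM m P f := by
  choose g hg hfg using h
  refine ⟨fun ω i => g i ω, @measurable_pi_lambda _ _ _ m _ _ hg, ?_⟩
  filter_upwards [ae_all_iff.2 hfg] with ω h1
  ext i; exact h1 i

lemma add {f g : Ω → ℝ} (hf : AEM m P f) (hg : AEM m P g) : AEM m P (fun ω => f ω + g ω) :=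
  (hf.prodMk hg).comp (φ := fun x : ℝ × ℝ => x.1 + x.2) (by fun_prop)

lemma mul {f g : Ω → ℝ} (hf : AEM m P f) (hg : AEM m P g) : AEM m P (fun ω => f ω * g ω) :=
  (hf.prodMk hg).comp (φ := fun x : ℝ × ℝ => x.1 * x.2) (by fun_prop)

lemma sum {ι : Type*} (s : Finset ι) {f : ι → Ω → ℝ} (hf : ∀ i ∈ s, AEM m P (f i)) :
    AEM m P (fun ω => ∑ i ∈ s, f i ω) := by
  induction s using Finset.induction_on with
  | empty => simpa using of_measurable (m := m) (P := P) (measurable_const (a := (0 : ℝ)))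
  | insert i s hi ih =>
    simp only [Finset.sum_insert hi]
    exact (hf i (Finset.mem_insert_self _ _)).add
      (ih fun j hj => hf j (Finset.mem_insert_of_mem hj))

/-- Limits in measure preserve almost sure measurability. -/
lemma of_tendstoInMeasure {u : ℕ → Ω → ℝ} {v : Ω → ℝ} (hu : ∀ i, AEM m P (u i))
    (h : TendstoInMeasure P u atTop v) : AEM m P v := by
  obtain ⟨ns, -, hns⟩ := h.exists_seq_tendsto_ae
  choose g hg hfg using hu
  refine ⟨fun ω => limsup (fun i => g (ns i) ω) atTop,
    Measurable.limsup (δ := Ω) (fun i => hg (ns i)), ?_⟩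
  filter_upwards [hns, ae_all_iff.2 hfg] with ω h1 h2
  simp only [h2] at h1
  exact h1.limsup_eq.symm

lemma of_sqn {u : ℕ → Ω → ℝ} {v : Ω → ℝ} (hu : ∀ i, AEM m P (u i))
    (hu' : ∀ i, AEMeasurable (u i) P) (hv : AEMeasurable v P)
    (h : Tendsto (fun i => sqn P (fun ω => u i ω - v ω)) atTop (nhds 0)) : AEM m P v :=
  of_tendstoInMeasure hu (tendstoInMeasure_of_sqn hu' hv h)

end AEM

variable {Ω : Type*} [mΩ : MeasurableSpace Ω] {d : ℕ}

/-- Left-continuous step process with values `ξ i` on `(t i, t (i + 1)]`. -/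
def stepProc (t : ℕ → ℝ) (N : ℕ) (ξ : ℕ → Ω → Fin d → ℝ) (k : Fin d) (r : ℝ) (ω : Ω) : ℝ :=
  ∑ i ∈ Finset.range N, (Ioc (t i) (t (i + 1))).indicator (fun _ => ξ i ω k) r

/-- The stochastic integral of a step process. -/
def stepInt (B : ℝ → Ω → Fin d → ℝ) (t : ℕ → ℝ) (N : ℕ) (ξ : ℕ → Ω → Fin d → ℝ) (ω : Ω) : ℝ :=
  ∑ i ∈ Finset.range N, ∑ k, ξ i ω k * (B (t (i + 1)) ω k - B (t i) ω k)

/-- Adaptedness and boundedness of the values of a step process. -/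
structure StepAdapted (F : ℝ → MeasurableSpace Ω) (t : ℕ → ℝ) (N : ℕ)
    (ξ : ℕ → Ω → Fin d → ℝ) (C : ℝ) : Prop where
  mono : Monotone t
  nonneg : 0 ≤ t 0
  meas : ∀ i < N, Measurable[F (t i)] (ξ i)
  bdd : ∀ i < N, ∀ ω k, |ξ i ω k| ≤ C

namespace StepAdapted

variable {P : Measure Ω} {F : ℝ → MeasurableSpace Ω} {B : ℝ → Ω → Fin d → ℝ}
  {t : ℕ → ℝ} {N : ℕ} {ξ : ℕ → Ω → Fin d → ℝ} {C : ℝ}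

lemma stepProc_eq (ht : Monotone t) {i : ℕ} (hi : i < N) {r : ℝ} (hr : r ∈ Ioc (t i) (t (i + 1)))
    (k : Fin d) (ω : Ω) : stepProc t N ξ k r ω = ξ i ω k := by
  unfold stepProc
  rw [Finset.sum_eq_single i]
  · simp [hr]
  · intro j _ hj
    refine indicator_of_notMem ?_ _
    rintro ⟨h1, h2⟩
    rcases lt_or_gt_of_ne hj with h | h
    · exact absurd (h2.trans (ht h)) (not_le.2 hr.1)
    · exact absurd (hr.2.trans (ht h)) (not_le.2 h1)
  · simp [hi]

lemma exists_cell {r : ℝ} (hr : r ∈ Ioc (t 0) (t N)) :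
    ∃ i < N, r ∈ Ioc (t i) (t (i + 1)) := by
  induction N with
  | zero => simp at hr
  | succ N ih =>
    by_cases h : r ≤ t N
    · obtain ⟨i, hi, hi'⟩ := ih ⟨hr.1, h⟩
      exact ⟨i, hi.trans (Nat.lt_succ_self _), hi'⟩
    · exact ⟨N, Nat.lt_succ_self _, not_le.1 h, hr.2⟩

lemma stepProc_eq_zero (ht : Monotone t) {r : ℝ} (hr : r ∉ Ioc (t 0) (t N)) (k : Fin d) (ω : Ω) :
    stepProc t N ξ k r ω = 0 := by
  refine Finset.sum_eq_zero fun i hi => indicator_of_notMem (fun h => hr ?_) _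
  exact ⟨(ht (Nat.zero_le i)).trans_lt h.1, h.2.trans (ht (Finset.mem_range.1 hi))⟩

lemma abs_stepProc_le (A : StepAdapted F t N ξ C) (hC : 0 ≤ C) (k : Fin d) (r : ℝ) (ω : Ω) :
    |stepProc t N ξ k r ω| ≤ C := by
  by_cases hr : r ∈ Ioc (t 0) (t N)
  · obtain ⟨i, hi, hi'⟩ := exists_cell hr
    rw [stepProc_eq A.mono hi hi']
    exact A.bdd i hi ω k
  · rw [stepProc_eq_zero A.mono hr]; simpa using hC

lemma mem_elemSpan (A : StepAdapted F t N ξ C) :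
    ((stepProc t N ξ, stepInt B t N ξ) : (Fin d → ℝ → Ω → ℝ) × (Ω → ℝ))
      ∈ elemSpan F B (t 0) (t N) := by
  have : ((stepProc t N ξ, stepInt B t N ξ) : (Fin d → ℝ → Ω → ℝ) × (Ω → ℝ))
      = ∑ i ∈ Finset.range N, ∑ j, (fun k r ω => if k = j then
        (Ioc (t i) (t (i + 1))).indicator (fun _ => ξ i ω j) r else 0,
        fun ω => ξ i ω j * (B (t (i + 1)) ω j - B (t i) ω j)) := by
    refine Prod.ext ?_ ?_
    · ext k r ω
      simp [stepProc, Prod.fst_sum, Finset.sum_apply]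
    · ext ω
      simp [stepInt, Prod.snd_sum, Finset.sum_apply]
  rw [this]
  refine Submodule.sum_mem _ fun i hi => Submodule.sum_mem _ fun j _ => Submodule.subset_span ?_
  have hi := Finset.mem_range.1 hi
  exact ⟨j, t i, t (i + 1), C, fun ω => ξ i ω j, A.mono (Nat.zero_le i), A.mono (Nat.le_succ i),
    A.mono hi, (measurable_pi_apply j).comp (A.meas i hi), fun ω => A.bdd i hi ω j, rfl⟩

lemma of_le (A : StepAdapted F t N ξ C) {M : ℕ} (h : M ≤ N) : StepAdapted F t M ξ C :=
  ⟨A.mono, A.nonneg, fun i hi => A.meas i (hi.trans_le h), fun i hi => A.bdd i (hi.trans_le h)⟩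

lemma const_mul (A : StepAdapted F t N ξ C) (c : ℝ) :
    StepAdapted F t N (fun i ω k => c * ξ i ω k) (|c| * C) := by
  refine ⟨A.mono, A.nonneg, fun i hi => ?_, fun i hi ω k => ?_⟩
  · exact @measurable_pi_lambda _ _ _ (F (t i)) _ _ fun k =>
      ((measurable_pi_apply k).comp (A.meas i hi)).const_mul c
  · rw [abs_mul]
    exact mul_le_mul_of_nonneg_left (A.bdd i hi ω k) (abs_nonneg _)

lemma measurable_stepInt (S : BMSetup P F B) (A : StepAdapted F t N ξ C) :
    Measurable[F (t N)] (stepInt B t N ξ) := by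
  unfold stepInt
  refine Finset.measurable_fun_sum _ fun i hi => Finset.measurable_fun_sum _ fun k _ => ?_
  have hi := Finset.mem_range.1 hi
  exact Measurable.mul (m := F (t N)) (((measurable_pi_apply k).comp (A.meas i hi)).mono
    (S.mono _ _ (A.mono hi.le)) le_rfl)
    (S.measurable_incr_coord (A.nonneg.trans (A.mono (Nat.zero_le i))) (A.mono (Nat.le_succ i))
      (A.mono hi) k)

lemma measurable_quad (hmono : ∀ s u : ℝ, s ≤ u → F s ≤ F u) (A : StepAdapted F t N ξ C) :
    Measurable[F (t N)]
      (fun ω => ∑ i ∈ Finset.range N, (t (i + 1) - t i) * ∑ k, ξ i ω k ^ 2) := by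
  refine Finset.measurable_fun_sum _ fun i hi => ?_
  have hi := Finset.mem_range.1 hi
  refine Measurable.const_mul ?_ _
  refine Finset.measurable_fun_sum _ fun k _ => ?_
  exact (((measurable_pi_apply k).comp (A.meas i hi)).mono
    (hmono _ _ (A.mono hi.le)) le_rfl).pow_const 2

lemma quad_le (A : StepAdapted F t N ξ C) (ω : Ω) :
    ∑ i ∈ Finset.range N, (t (i + 1) - t i) * ∑ k, ξ i ω k ^ 2 ≤ (t N - t 0) * (d * C ^ 2) := by
  rw [← Finset.sum_range_sub t N, Finset.sum_mul]
  refine Finset.sum_le_sum fun i hi => ?_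
  have hi := Finset.mem_range.1 hi
  refine mul_le_mul_of_nonneg_left ?_ (sub_nonneg.2 (A.mono (Nat.le_succ i)))
  calc ∑ k, ξ i ω k ^ 2 ≤ ∑ k : Fin d, C ^ 2 := Finset.sum_le_sum fun k _ =>
        sq_le_sq' (by linarith [neg_abs_le (ξ i ω k), A.bdd i hi ω k])
          ((le_abs_self _).trans (A.bdd i hi ω k))
    _ = d * C ^ 2 := by simp

/-- The stochastic exponential of a step process has conditional mean one. -/
lemma lintegral_exp [IsProbabilityMeasure P] (S : BMSetup P F B) (A : StepAdapted F t N ξ C)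
    {Y : Ω → ENNReal} (hY : Measurable[F (t 0)] Y) :
    ∫⁻ ω, Y ω * ENNReal.ofReal (Real.exp (stepInt B t N ξ ω
      - 1 / 2 * ∑ i ∈ Finset.range N, (t (i + 1) - t i) * ∑ k, ξ i ω k ^ 2)) ∂P
      = ∫⁻ ω, Y ω ∂P := by
  induction N with
  | zero => simp [stepInt]
  | succ N ih =>
    have A' := A.of_le (Nat.le_succ N)
    rw [← ih A']
    set E : Ω → ENNReal := fun ω => Y ω * ENNReal.ofReal (Real.exp (stepInt B t N ξ ω
      - 1 / 2 * ∑ i ∈ Finset.range N, (t (i + 1) - t i) * ∑ k, ξ i ω k ^ 2)) with hE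
    have hEm : Measurable[F (t N)] E :=
      Measurable.mul (m := F (t N)) (hY.mono (S.mono _ _ (A.mono (Nat.zero_le N))) le_rfl)
        (Measurable.ennreal_ofReal (Real.measurable_exp.comp
          (Measurable.sub (m := F (t N)) (measurable_stepInt S A')
            ((measurable_quad S.mono A').const_mul _))))
    have ht0 : 0 ≤ t N := A.nonneg.trans (A.mono (Nat.zero_le N))
    have htN : t N ≤ t (N + 1) := A.mono (Nat.le_succ N)
    have key := S.lintegral_incr ht0 htN
      (Y := fun ω => (E ω, ξ N ω)) (Measurable.prodMk hEm (A.meas N (Nat.lt_succ_self N)))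
      (Φ := fun x => x.1.1 * ENNReal.ofReal (Real.exp (∑ j, x.1.2 j * x.2 j
        - (t (N + 1) - t N) / 2 * ∑ j, x.1.2 j ^ 2))) (by fun_prop)
    simp only at key
    have h1 : ∀ ω, Y ω * ENNReal.ofReal (Real.exp (stepInt B t (N + 1) ξ ω
      - 1 / 2 * ∑ i ∈ Finset.range (N + 1), (t (i + 1) - t i) * ∑ k, ξ i ω k ^ 2))
      = E ω * ENNReal.ofReal (Real.exp (∑ j, ξ N ω j * (B (t (N + 1)) ω - B (t N) ω) j
        - (t (N + 1) - t N) / 2 * ∑ j, ξ N ω j ^ 2)) := by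
      intro ω
      rw [hE]
      simp only
      rw [mul_assoc, ← ENNReal.ofReal_mul (Real.exp_nonneg _), ← Real.exp_add]
      congr 3
      simp only [stepInt, Finset.sum_range_succ, Pi.sub_apply]
      ring
    simp_rw [h1]
    rw [key]
    refine lintegral_congr fun ω => ?_
    rw [lintegral_const_mul _ (by fun_prop), gaussPi_lintegral_exp (sub_nonneg.2 htN), mul_one]

lemma lintegral_exp_mul_le [IsProbabilityMeasure P] (S : BMSetup P F B)
    (A : StepAdapted F t N ξ C) (c : ℝ) :
    ∫⁻ ω, ENNReal.ofReal (Real.exp (c * stepInt B t N ξ ω)) ∂P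
      ≤ ENNReal.ofReal (Real.exp (c ^ 2 / 2 * ((t N - t 0) * (d * C ^ 2)))) := by
  have h := lintegral_exp S (A.const_mul c) (Y := fun _ => 1) measurable_const
  simp only [one_mul, lintegral_const, measure_univ] at h
  calc ∫⁻ ω, ENNReal.ofReal (Real.exp (c * stepInt B t N ξ ω)) ∂P
      ≤ ∫⁻ ω, ENNReal.ofReal (Real.exp (c ^ 2 / 2 * ((t N - t 0) * (d * C ^ 2)))) *
        ENNReal.ofReal (Real.exp (stepInt B t N (fun i ω k => c * ξ i ω k) ω
      - 1 / 2 * ∑ i ∈ Finset.range N, (t (i + 1) - t i) * ∑ k, (c * ξ i ω k) ^ 2)) ∂P := by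
        refine lintegral_mono fun ω => ?_
        rw [← ENNReal.ofReal_mul (Real.exp_nonneg _), ← Real.exp_add]
        refine ENNReal.ofReal_le_ofReal (Real.exp_le_exp.2 ?_)
        have e1 : stepInt B t N (fun i ω k => c * ξ i ω k) ω = c * stepInt B t N ξ ω := by
          simp only [stepInt, Finset.mul_sum, mul_assoc]
        have e2 : ∑ i ∈ Finset.range N, (t (i + 1) - t i) * ∑ k, (c * ξ i ω k) ^ 2
            = c ^ 2 * ∑ i ∈ Finset.range N, (t (i + 1) - t i) * ∑ k, ξ i ω k ^ 2 := by
          simp only [Finset.mul_sum, mul_pow, mul_left_comm]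
        rw [e1, e2]
        nlinarith [A.quad_le ω, sq_nonneg c]
    _ = _ := by rw [lintegral_const_mul' _ _ ENNReal.ofReal_ne_top, h, mul_one]

end StepAdapted

end

/-! ### Averages over grids -/

section

variable {Ω : Type*} [mΩ : MeasurableSpace Ω] {d : ℕ}

/-- Averages over small intervals comparable to their distance to `r` converge to the value at
`r`, for almost every `r`. -/
lemma ae_tendsto_interval_average {f : ℝ → ℝ} (hf : LocallyIntegrable f volume) :
    ∀ᵐ r, ∀ u v : ℕ → ℝ, (∀ i, u i < v i) → Tendsto (fun i => v i - u i) atTop (nhds 0) →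
      (∀ᶠ i in atTop, u i ≤ r ∧ r - u i ≤ 2 * (v i - u i)) →
      Tendsto (fun i => (v i - u i)⁻¹ * ∫ x in Ioc (u i) (v i), f x) atTop (nhds (f r)) := by
  filter_upwards [IsUnifLocDoublingMeasure.ae_tendsto_average volume hf 3] with r hr u v huv h0 hu
  have := hr (fun i => (u i + v i) / 2) (fun i => (v i - u i) / 2) (l := atTop) (by
    refine tendsto_nhdsWithin_iff.2 ⟨?_, Eventually.of_forall fun i => ?_⟩
    · simpa using h0.div_const 2
    · simp [huv i]) (by
    filter_upwards [hu] with i hi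
    rw [Real.closedBall_eq_Icc]
    constructor <;> linarith [huv i])
  refine this.congr fun i => ?_
  rw [Real.closedBall_eq_Icc, setAverage_eq, show (u i + v i) / 2 - (v i - u i) / 2 = u i by ring,
    show (u i + v i) / 2 + (v i - u i) / 2 = v i by ring, integral_Icc_eq_integral_Ioc,
    Measure.real, Real.volume_Icc, ENNReal.toReal_ofReal (sub_nonneg.2 (huv i).le), smul_eq_mul]

/-- Uniform grid with `N + 1` cells on `[a, b]`. -/
def grid (a b : ℝ) (N i : ℕ) : ℝ := a + i * ((b - a) / (N + 1))

section grid

variable {a b : ℝ} {N : ℕ}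

lemma grid_zero : grid a b N 0 = a := by simp [grid]

lemma grid_last : grid a b N (N + 1) = b := by
  have : (N : ℝ) + 1 ≠ 0 := by positivity
  simp only [grid]; push_cast; field_simp; ring

lemma grid_succ_sub (i : ℕ) : grid a b N (i + 1) - grid a b N i = (b - a) / (N + 1) := by
  simp only [grid]; push_cast; ring

lemma grid_mono (hab : a ≤ b) : Monotone (grid a b N) := by
  refine monotone_nat_of_le_succ fun i => ?_
  have : 0 ≤ (b - a) / (N + 1) := div_nonneg (sub_nonneg.2 hab) (by positivity)
  linarith [grid_succ_sub (a := a) (b := b) (N := N) i]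

lemma grid_lt (hab : a < b) (i : ℕ) : grid a b N i < grid a b N (i + 1) := by
  have : 0 < (b - a) / (N + 1) := div_pos (sub_pos.2 hab) (by positivity)
  linarith [grid_succ_sub (a := a) (b := b) (N := N) i]

lemma tendsto_mesh (a b : ℝ) : Tendsto (fun N : ℕ => (b - a) / (N + 1)) atTop (nhds 0) := by
  have := (tendsto_one_div_add_atTop_nhds_zero_nat (𝕜 := ℝ)).const_mul (b - a)
  simpa [div_eq_mul_inv] using this

end grid

/-- Previous-cell averages of `f` along the uniform grid. -/
def prevAvg (a b : ℝ) (f : ℝ → ℝ) (N i : ℕ) : ℝ :=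
  if i = 0 then 0 else ((b - a) / (N + 1))⁻¹ *
    ∫ x in Ioc (grid a b N (i - 1)) (grid a b N i), f x

lemma abs_avg_le {f : ℝ → ℝ} {C : ℝ} (hC : ∀ x, |f x| ≤ C) {u v : ℝ} (huv : u ≤ v) :
    |(v - u)⁻¹ * ∫ x in Ioc u v, f x| ≤ C := by
  have hC0 : 0 ≤ C := (abs_nonneg _).trans (hC 0)
  rcases huv.eq_or_lt with rfl | h
  · simpa using hC0
  · rw [abs_mul, abs_of_pos (inv_pos.2 (sub_pos.2 h)), inv_mul_le_iff₀ (sub_pos.2 h)]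
    have := norm_setIntegral_le_of_norm_le_const (μ := volume) (s := Ioc u v) (f := f) (C := C)
      (by simp) (fun x _ => hC x)
    rw [Measure.real, Real.volume_Ioc, ENNReal.toReal_ofReal (sub_nonneg.2 huv)] at this
    rw [mul_comm]
    simpa using this

lemma abs_prevAvg_le {a b : ℝ} (hab : a ≤ b) {f : ℝ → ℝ} {C : ℝ} (hC : ∀ x, |f x| ≤ C) (N i : ℕ) :
    |prevAvg a b f N i| ≤ C := by
  unfold prevAvg
  split_ifs with h
  · simpa using (abs_nonneg _).trans (hC 0)
  · obtain ⟨j, rfl⟩ := Nat.exists_eq_succ_of_ne_zero h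
    have := abs_avg_le hC (grid_mono (N := N) hab (Nat.le_succ j))
    rwa [Nat.succ_eq_add_one, grid_succ_sub] at this

lemma ae_tendsto_prevAvg {a b : ℝ} (hab : a < b) {f : ℝ → ℝ} (hf : LocallyIntegrable f volume) :
    ∀ᵐ r, r ∈ Ioc a b → ∀ i : ℕ → ℕ, (∀ N, r ∈ Ioc (grid a b N (i N)) (grid a b N (i N + 1))) →
      Tendsto (fun N => prevAvg a b f N (i N)) atTop (nhds (f r)) := by
  filter_upwards [ae_tendsto_interval_average hf] with r hr hrab i hi
  have hpos : ∀ N : ℕ, 0 < (b - a) / ((N : ℝ) + 1) := fun N => div_pos (sub_pos.2 hab) (by positivity)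
  have := hr (fun N => grid a b N (i N) - (b - a) / (N + 1)) (fun N => grid a b N (i N))
    (fun N => by linarith [hpos N]) (by simpa using tendsto_mesh a b)
    (Eventually.of_forall fun N => by
      have h1 := hi N
      have h2 := grid_succ_sub (a := a) (b := b) (N := N) (i N)
      constructor <;> linarith [h1.1, h1.2, hpos N])
  refine this.congr' ?_
  have ev : ∀ᶠ N : ℕ in atTop, (b - a) / ((N : ℝ) + 1) < r - a :=
    (tendsto_mesh a b).eventually_lt_const (sub_pos.2 hrab.1)
  filter_upwards [ev] with N hN
  have hi0 : i N ≠ 0 := by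
    intro h0
    have := (hi N).2
    rw [h0, zero_add] at this
    simp only [grid] at this
    push_cast at this
    linarith
  obtain ⟨j, hj⟩ := Nat.exists_eq_succ_of_ne_zero hi0
  have h2 := grid_succ_sub (a := a) (b := b) (N := N) j
  rw [prevAvg, if_neg hi0, hj, Nat.succ_eq_add_one, Nat.add_sub_cancel,
    show grid a b N (j + 1) - (b - a) / (N + 1) = grid a b N j by linarith, h2]

/-- Current-cell averages of a coefficient frozen at the left endpoint value of a path. -/
def curAvg {E : Type*} (a b : ℝ) (f : ℝ → E → ℝ) (N i : ℕ) (x : E) : ℝ :=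
  ((b - a) / (N + 1))⁻¹ * ∫ r in Ioc (grid a b N i) (grid a b N (i + 1)), f r x

lemma abs_curAvg_le {E : Type*} {a b : ℝ} (hab : a ≤ b) {f : ℝ → E → ℝ} {C : ℝ}
    (hC : ∀ r x, |f r x| ≤ C) (N i : ℕ) (x : E) : |curAvg a b f N i x| ≤ C := by
  have := abs_avg_le (fun r => hC r x) (grid_mono (N := N) hab (Nat.le_succ i))
  rwa [grid_succ_sub] at this

lemma locallyIntegrable_of_bdd {f : ℝ → ℝ} {C : ℝ} (hf : Measurable f) (hC : ∀ x, |f x| ≤ C) :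
    LocallyIntegrable f volume :=
  (locallyIntegrable_const C).mono hf.aestronglyMeasurable
    (Eventually.of_forall fun x => by
      simpa using (hC x).trans (le_abs_self C))

lemma integrableOn_Ioc_of_bdd {f : ℝ → ℝ} {C : ℝ} (hf : Measurable f) (hC : ∀ x, |f x| ≤ C)
    (u v : ℝ) : IntegrableOn f (Ioc u v) volume :=
  ((locallyIntegrable_of_bdd hf hC).integrableOn_isCompact isCompact_Icc).mono_set Ioc_subset_Icc_self

lemma ae_tendsto_curAvg {E : Type*} [PseudoMetricSpace E] [MeasurableSpace E] [BorelSpace E]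
    {a b : ℝ} (hab : a < b) {f : ℝ → E → ℝ} (hf : Measurable (Function.uncurry f)) {C L : ℝ}
    (hC : ∀ r x, |f r x| ≤ C) (hL : ∀ r x y, |f r x - f r y| ≤ L * dist x y) {x : ℝ → E}
    (hx : Continuous x) :
    ∀ᵐ r, r ∈ Ioc a b → ∀ i : ℕ → ℕ, (∀ N, r ∈ Ioc (grid a b N (i N)) (grid a b N (i N + 1))) →
      Tendsto (fun N => curAvg a b f N (i N) (x (grid a b N (i N)))) atTop (nhds (f r (x r))) := by
  have hfx : Measurable (fun r => f r (x r)) := hf.comp (measurable_id.prodMk hx.measurable)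
  filter_upwards [ae_tendsto_interval_average (locallyIntegrable_of_bdd hfx fun r => hC r (x r))]
    with r hr hrab i hi
  have hpos : ∀ N : ℕ, 0 < (b - a) / ((N : ℝ) + 1) := fun N => div_pos (sub_pos.2 hab) (by positivity)
  have h1 := hr (fun N => grid a b N (i N)) (fun N => grid a b N (i N + 1))
    (fun N => grid_lt hab _) (by simpa only [grid_succ_sub] using tendsto_mesh a b)
    (Eventually.of_forall fun N => by
      have h1 := hi N
      have h2 := grid_succ_sub (a := a) (b := b) (N := N) (i N)
      constructor <;> linarith [h1.1, h1.2, hpos N])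
  simp only [grid_succ_sub] at h1
  refine tendsto_of_tendsto_of_dist h1 ?_
  rw [Metric.tendsto_atTop]
  intro ε hε
  obtain ⟨η, hη, hηx⟩ := Metric.uniformContinuousOn_iff.1
    (isCompact_Icc.uniformContinuousOn_of_continuous (hx.continuousOn (s := Icc a b)))
    (ε / (2 * (|L| + 1))) (by positivity)
  obtain ⟨N₀, hN₀⟩ := (Metric.tendsto_atTop.1 (tendsto_mesh a b)) η hη
  refine ⟨N₀, fun N hN => ?_⟩
  have hmesh := hN₀ N hN
  rw [Real.dist_eq, sub_zero, abs_of_pos (hpos N)] at hmesh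
  have hsub := grid_succ_sub (a := a) (b := b) (N := N) (i N)
  have hga : a ≤ grid a b N (i N) := by
    have := grid_mono (N := N) hab.le (Nat.zero_le (i N)); rwa [grid_zero] at this
  have hgb : grid a b N (i N + 1) ≤ b := by
    have hlt : grid a b N (i N) < grid a b N (N + 1) := by
      rw [grid_last]; exact (hi N).1.trans_le hrab.2
    have : i N < N + 1 := by
      by_contra hcon
      exact absurd (grid_mono (N := N) hab.le (not_lt.1 hcon)) (not_le.2 hlt)
    have := grid_mono (N := N) hab.le (Nat.succ_le_of_lt this); rwa [grid_last] at this
  have hcalc : |((b - a) / ((N : ℝ) + 1))⁻¹ * ∫ y in Ioc (grid a b N (i N)) (grid a b N (i N + 1)),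
      (f y (x y) - f y (x (grid a b N (i N))))| ≤ ε / 2 := by
    rw [abs_mul, abs_of_pos (inv_pos.2 (hpos N)), inv_mul_le_iff₀ (hpos N)]
    have := norm_setIntegral_le_of_norm_le_const (μ := volume)
      (s := Ioc (grid a b N (i N)) (grid a b N (i N + 1)))
      (f := fun y => f y (x y) - f y (x (grid a b N (i N)))) (C := ε / 2) (by simp) (fun y hy => by
        rw [Real.norm_eq_abs]
        refine (hL _ _ _).trans ?_
        have hd := hηx y ⟨hga.trans hy.1.le, hy.2.trans hgb⟩ (grid a b N (i N))
          ⟨hga, (grid_lt hab _).le.trans hgb⟩ (by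
            rw [Real.dist_eq, abs_of_pos (sub_pos.2 hy.1)]; linarith [hy.2])
        have : L * dist (x y) (x (grid a b N (i N))) ≤ (|L| + 1) * (ε / (2 * (|L| + 1))) :=
          mul_le_mul ((le_abs_self L).trans (by linarith)) hd.le dist_nonneg (by positivity)
        refine this.trans (le_of_eq ?_)
        field_simp)
    rw [Measure.real, Real.volume_Ioc, hsub, ENNReal.toReal_ofReal (hpos N).le, mul_comm] at this
    exact this
  have hi1 : IntegrableOn (fun y => f y (x y))
      (Ioc (grid a b N (i N)) (grid a b N (i N + 1))) volume :=
    integrableOn_Ioc_of_bdd hfx (fun r => hC r (x r)) _ _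
  have hi2 : IntegrableOn (fun y => f y (x (grid a b N (i N))))
      (Ioc (grid a b N (i N)) (grid a b N (i N + 1))) volume :=
    integrableOn_Ioc_of_bdd (hf.comp (measurable_id.prodMk measurable_const)) (fun r => hC r _) _ _
  rw [Real.dist_eq, sub_zero, abs_of_nonneg dist_nonneg, Real.dist_eq, curAvg, ← mul_sub,
    ← integral_sub hi1 hi2]
  linarith

end

/-! ### Bounded progressive processes -/

section

/-- Restriction of a process to the time interval `(a, b]`. -/
def cut {Ω : Type*} {d : ℕ} (a b : ℝ) (θ : Fin d → ℝ → Ω → ℝ) (k : Fin d) (r : ℝ) (ω : Ω) : ℝ :=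
  (Ioc a b).indicator (fun r => θ k r ω) r

/-- Progressive measurability yields joint measurability after restriction to `(a, b]`. -/
lemma ProgMeas.measurable_indicator {Ω E : Type*} [MeasurableSpace E] [Zero E]
    {F : ℝ → MeasurableSpace Ω} {u : ℝ → Ω → E} (hu : ProgMeas F u) {a b : ℝ} (ha : 0 ≤ a) :
    Measurable[MeasurableSpace.prod inferInstance (F b)]
      (fun x : ℝ × Ω => (Ioc a b).indicator (fun r => u r x.2) x.1) := by
  let _ := F b
  by_cases hb : 0 ≤ b
  · have h1 : Measurable (fun x : ℝ × Ω => u (projIcc 0 b hb x.1) x.2) :=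
      (hu b hb).comp (((continuous_projIcc (h := hb)).measurable.comp measurable_fst).prodMk
        measurable_snd)
    have h2 := h1.indicator (s := Prod.fst ⁻¹' (Ioc a b)) (measurable_fst measurableSet_Ioc)
    refine (congrArg _ (funext fun x => ?_)).mp h2
    symm
    by_cases hx : x.1 ∈ Ioc a b
    · rw [indicator_of_mem hx, indicator_of_mem (by exact hx), projIcc_of_mem hb ⟨ha.trans hx.1.le, hx.2⟩]
    · rw [indicator_of_notMem hx, indicator_of_notMem (by exact hx)]
  · have : Ioc a b = ∅ := Ioc_eq_empty (by linarith)
    simp only [this, indicator_empty]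
    exact measurable_const

/-- Integrals over the first variable are measurable in the second one. -/
lemma measurable_setIntegral_left {Ω : Type*} {m : MeasurableSpace Ω} {f : ℝ × Ω → ℝ}
    (hf : Measurable[MeasurableSpace.prod inferInstance m] f) (s : Set ℝ) :
    Measurable[m] (fun ω => ∫ r in s, f (r, ω)) :=
  (StronglyMeasurable.integral_prod_left' (μ := volume.restrict s)
    (f := f) (hf.stronglyMeasurable)).measurable

/-- A bounded vector of progressively measurable processes. -/
structure BddProg {Ω : Type*} {d : ℕ} (F : ℝ → MeasurableSpace Ω) (θ : Fin d → ℝ → Ω → ℝ)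
    (C : ℝ) : Prop where
  prog : ∀ k, ProgMeas F (θ k)
  bdd : ∀ k r ω, |θ k r ω| ≤ C

namespace BddProg

variable {Ω : Type*} [mΩ : MeasurableSpace Ω] {d : ℕ} {F : ℝ → MeasurableSpace Ω}
  {θ η : Fin d → ℝ → Ω → ℝ} {C D a b : ℝ}

lemma cut_abs_le (A : BddProg F θ C) (a b : ℝ) (k : Fin d) (r : ℝ) (ω : Ω) :
    |cut a b θ k r ω| ≤ C := by
  unfold cut
  by_cases hr : r ∈ Ioc a b
  · simpa [hr] using A.bdd k r ω
  · simpa [hr] using (abs_nonneg _).trans (A.bdd k r ω)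

lemma measurable_cut (A : BddProg F θ C) (ha : 0 ≤ a) (k : Fin d) :
    Measurable[MeasurableSpace.prod inferInstance (F b)] (fun x : ℝ × Ω => cut a b θ k x.1 x.2) :=
  (A.prog k).measurable_indicator ha

lemma measurable_cut_top (A : BddProg F θ C) (hF : ∀ s, F s ≤ mΩ) (ha : 0 ≤ a) (k : Fin d) :
    Measurable (fun x : ℝ × Ω => cut a b θ k x.1 x.2) :=
  (A.measurable_cut ha k).mono (sup_le_sup le_rfl (MeasurableSpace.comap_mono (hF b))) le_rfl

lemma measurable_cut_path (A : BddProg F θ C) (ha : 0 ≤ a) (k : Fin d) (ω : Ω) :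
    Measurable (fun r => cut a b θ k r ω) := by
  let _ := F b
  exact (A.measurable_cut ha k).comp (measurable_id.prodMk measurable_const)

lemma measurable_integral (A : BddProg F θ C) (ha : 0 ≤ a) (k : Fin d) :
    Measurable[F b] (fun ω => ∫ r in Ioc a b, θ k r ω) := by
  have h := measurable_setIntegral_left (A.measurable_cut (b := b) ha k) (Ioc a b)
  convert h using 2 with ω
  exact setIntegral_congr_fun measurableSet_Ioc fun r hr => by simp [cut, hr]

lemma add (A : BddProg F θ C) (A' : BddProg F η D) :
    BddProg F (fun k r ω => θ k r ω + η k r ω) (C + D) :=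
  ⟨fun k s hs => by let _ := F s; exact (A.prog k s hs).add (A'.prog k s hs),
    fun k r ω => (abs_add_le _ _).trans (add_le_add (A.bdd k r ω) (A'.bdd k r ω))⟩

lemma sub (A : BddProg F θ C) (A' : BddProg F η D) :
    BddProg F (fun k r ω => θ k r ω - η k r ω) (C + D) :=
  ⟨fun k s hs => by let _ := F s; exact (A.prog k s hs).sub (A'.prog k s hs),
    fun k r ω => (abs_sub _ _).trans (add_le_add (A.bdd k r ω) (A'.bdd k r ω))⟩

lemma mul (A : BddProg F θ C) (A' : BddProg F η D) :
    BddProg F (fun k r ω => θ k r ω * η k r ω) (C * D) :=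
  ⟨fun k s hs => by let _ := F s; exact (A.prog k s hs).mul (A'.prog k s hs),
    fun k r ω => by
      rw [abs_mul]
      exact mul_le_mul (A.bdd k r ω) (A'.bdd k r ω) (abs_nonneg _)
        ((abs_nonneg _).trans (A.bdd k r ω))⟩

lemma neg (A : BddProg F θ C) : BddProg F (fun k r ω => - θ k r ω) C :=
  ⟨fun k s hs => by let _ := F s; exact (A.prog k s hs).neg, fun k r ω => by
    rw [abs_neg]; exact A.bdd k r ω⟩

lemma cut (A : BddProg F θ C) (a b : ℝ) : BddProg F (cut a b θ) C :=
  ⟨fun k s hs => by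
    let _ := F s
    have h2 := (A.prog k s hs).indicator (s := (fun p : Icc (0:ℝ) s × Ω => (p.1 : ℝ)) ⁻¹' (Ioc a b))
      ((measurable_subtype_coe.comp measurable_fst) measurableSet_Ioc)
    refine (congrArg _ (funext fun x => ?_)).mp h2
    by_cases hx : (x.1 : ℝ) ∈ Ioc a b <;> simp [_root_.cut, hx], A.cut_abs_le a b⟩

end BddProg

lemma cut_cut {Ω : Type*} {d : ℕ} {a b a' b' : ℝ} (ha : a' ≤ a) (hb : b ≤ b')
    (θ : Fin d → ℝ → Ω → ℝ) : cut a b (cut a' b' θ) = cut a b θ := by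
  ext k r ω
  by_cases hr : r ∈ Ioc a b
  · have : r ∈ Ioc a' b' := ⟨ha.trans_lt hr.1, hr.2.trans hb⟩
    simp [cut, hr, this]
  · simp [cut, hr]

lemma cut_cut' {Ω : Type*} {d : ℕ} {a b a' b' : ℝ} (ha : a' ≤ a) (hb : b ≤ b')
    (θ : Fin d → ℝ → Ω → ℝ) : cut a' b' (cut a b θ) = cut a b θ := by
  ext k r ω
  by_cases hr : r ∈ Ioc a b
  · have : r ∈ Ioc a' b' := ⟨ha.trans_lt hr.1, hr.2.trans hb⟩
    simp [cut, hr, this]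
  · by_cases hr' : r ∈ Ioc a' b' <;> simp [cut, hr, hr']

end

/-! ### Existence of Itô integrals -/

section

variable {Ω : Type*} [mΩ : MeasurableSpace Ω] {d : ℕ}

/-- Dominated convergence on `(a, b] × Ω`, with pointwise convergence for every `ω`. -/
lemma tendsto_sqn_of_forall_ae {P : Measure Ω} [IsFiniteMeasure P] {a b C : ℝ}
    {u : ℕ → ℝ → Ω → ℝ} {v : ℝ → Ω → ℝ}
    (hu : ∀ N, Measurable (fun x : ℝ × Ω => u N x.1 x.2))
    (hv : Measurable (fun x : ℝ × Ω => v x.1 x.2))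
    (huC : ∀ N r ω, |u N r ω| ≤ C) (hvC : ∀ r ω, |v r ω| ≤ C)
    (hu0 : ∀ N r ω, r ∉ Ioc a b → u N r ω = 0) (hv0 : ∀ r ω, r ∉ Ioc a b → v r ω = 0)
    (h : ∀ᵐ ω ∂P, ∀ᵐ r, Tendsto (fun N => u N r ω) atTop (nhds (v r ω))) :
    Tendsto (fun N => sqn (volume.prod P) (fun x : ℝ × Ω => u N x.1 x.2 - v x.1 x.2))
      atTop (nhds 0) := by
  have hm : ∀ N, Measurable (fun x : ℝ × Ω => ENNReal.ofReal ((u N x.1 x.2 - v x.1 x.2) ^ 2)) :=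
    fun N => (((hu N).sub hv).pow_const 2).ennreal_ofReal
  have e : ∀ N, sqn (volume.prod P) (fun x : ℝ × Ω => u N x.1 x.2 - v x.1 x.2)
      = ∫⁻ ω, (∫⁻ r, ENNReal.ofReal ((u N r ω - v r ω) ^ 2)) ∂P := fun N => by
    rw [sqn, lintegral_prod_symm _ (hm N).aemeasurable]
  simp_rw [e]
  have hb : ∀ N r ω, ENNReal.ofReal ((u N r ω - v r ω) ^ 2)
      ≤ (Ioc a b).indicator (fun _ => ENNReal.ofReal ((C + C) ^ 2)) r := by
    intro N r ω
    by_cases hr : r ∈ Ioc a b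
    · rw [indicator_of_mem hr]
      refine ENNReal.ofReal_le_ofReal ?_
      rw [← sq_abs]
      exact pow_le_pow_left₀ (abs_nonneg _)
        ((abs_sub _ _).trans (add_le_add (huC N r ω) (hvC r ω))) 2
    · simp [hu0 N r ω hr, hv0 r ω hr]
  have hfin : ∫⁻ r, (Ioc a b).indicator (fun _ => ENNReal.ofReal ((C + C) ^ 2)) r ≠ ⊤ := by
    rw [lintegral_indicator_const measurableSet_Ioc, Real.volume_Ioc]
    exact ENNReal.mul_ne_top ENNReal.ofReal_ne_top ENNReal.ofReal_ne_top
  have h0 : (0 : ENNReal) = ∫⁻ _, (0 : ENNReal) ∂P := by simp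
  rw [h0]
  refine tendsto_lintegral_of_dominated_convergence
    (fun _ => ∫⁻ r, (Ioc a b).indicator (fun _ => ENNReal.ofReal ((C + C) ^ 2)) r)
    (fun N => (hm N).lintegral_prod_left') (fun N => Eventually.of_forall fun ω => ?_) ?_ ?_
  · exact lintegral_mono fun r => hb N r ω
  · rw [lintegral_const]; exact ENNReal.mul_ne_top hfin (measure_ne_top _ _)
  · filter_upwards [h] with ω hω
    have h0 : (0 : ENNReal) = ∫⁻ _ : ℝ, (0 : ENNReal) := by simp
    rw [h0]
    refine tendsto_lintegral_of_dominated_convergence _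
      (fun N => (hm N).comp (measurable_id.prodMk measurable_const))
      (fun N => Eventually.of_forall fun r => hb N r ω) hfin ?_
    filter_upwards [hω] with r hr
    have := ((hr.sub_const (v r ω)).pow 2)
    rw [sub_self, zero_pow two_ne_zero] at this
    simpa using ENNReal.tendsto_ofReal this

/-- Convergence of step processes along uniform grids from convergence of the cell values. -/
lemma tendsto_stepProc_of_cell {a b : ℝ} (hab : a < b) {ξ : ℕ → ℕ → Ω → Fin d → ℝ} {k : Fin d}
    {ω : Ω} {f : ℝ → ℝ}
    (h : ∀ᵐ r, r ∈ Ioc a b →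
      ∀ i : ℕ → ℕ, (∀ N, r ∈ Ioc (grid a b N (i N)) (grid a b N (i N + 1))) →
      Tendsto (fun N => ξ N (i N) ω k) atTop (nhds (f r))) :
    ∀ᵐ r, Tendsto (fun N => stepProc (grid a b N) (N + 1) (ξ N) k r ω) atTop
      (nhds ((Ioc a b).indicator f r)) := by
  filter_upwards [h] with r hr
  by_cases hrab : r ∈ Ioc a b
  · have : ∀ N, ∃ i < N + 1, r ∈ Ioc (grid a b N i) (grid a b N (i + 1)) := fun N =>
      StepAdapted.exists_cell (by rwa [grid_zero, grid_last])
    choose i hi hir using this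
    rw [indicator_of_mem hrab]
    refine (hr hrab i hir).congr fun N => ?_
    rw [StepAdapted.stepProc_eq (grid_mono hab.le) (hi N) (hir N)]
  · rw [indicator_of_notMem hrab]
    refine tendsto_const_nhds.congr fun N => ?_
    rw [StepAdapted.stepProc_eq_zero (grid_mono hab.le) (by rwa [grid_zero, grid_last])]

lemma measurable_stepProc {t : ℕ → ℝ} {N : ℕ} {ξ : ℕ → Ω → Fin d → ℝ}
    (hξ : ∀ i < N, Measurable (ξ i)) (k : Fin d) :
    Measurable (fun x : ℝ × Ω => stepProc t N ξ k x.1 x.2) := by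
  unfold stepProc
  refine Finset.measurable_fun_sum _ fun i hi => ?_
  exact BMSetup.measurable_indicator_uncurry ((measurable_pi_apply k).comp (hξ i (Finset.mem_range.1 hi)))

/-- Integrals of products against a step process. -/
lemma sum_setIntegral_eq_stepProc {t : ℕ → ℝ} (ht : Monotone t) (N : ℕ) (ξ : ℕ → Ω → Fin d → ℝ)
    (k : Fin d) (ω : Ω) {f : ℝ → ℝ} (hf : IntegrableOn f (Ioc (t 0) (t N)))
    (φ : ℝ → ℝ) :
    ∫ r in Ioc (t 0) (t N), φ (stepProc t N ξ k r ω) * f r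
      = ∑ i ∈ Finset.range N, φ (ξ i ω k) * ∫ r in Ioc (t i) (t (i + 1)), f r := by
  have hi : ∀ i < N, EqOn (fun r => φ (stepProc t N ξ k r ω) * f r) (fun r => φ (ξ i ω k) * f r)
      (Ioc (t i) (t (i + 1))) := fun i hi r hr => by
    simp only [StepAdapted.stepProc_eq ht hi hr]
  have hfi : ∀ i < N, IntegrableOn f (Ioc (t i) (t (i + 1))) := fun i hi =>
    hf.mono_set (Ioc_subset_Ioc (ht (Nat.zero_le i)) (ht hi))
  have := intervalIntegral.sum_integral_adjacent_intervals (a := t) (n := N)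
    (f := fun r => φ (stepProc t N ξ k r ω) * f r) (μ := volume) (fun i hiN => by
      rw [intervalIntegrable_iff_integrableOn_Ioc_of_le (ht (Nat.le_succ i))]
      exact IntegrableOn.congr_fun (Integrable.const_mul (hfi i hiN) (φ (ξ i ω k)))
        (hi i hiN).symm measurableSet_Ioc)
  rw [intervalIntegral.integral_of_le (ht (Nat.zero_le N))] at this
  rw [← this]
  refine Finset.sum_congr rfl fun i hiN => ?_
  have hiN := Finset.mem_range.1 hiN
  rw [intervalIntegral.integral_of_le (ht (Nat.le_succ i)),
    setIntegral_congr_fun measurableSet_Ioc (hi i hiN), integral_const_mul]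

/-- Previous-cell averages of a process. -/
def progStep (a b : ℝ) (θ : Fin d → ℝ → Ω → ℝ) (N i : ℕ) (ω : Ω) (k : Fin d) : ℝ :=
  prevAvg a b (fun r => cut a b θ k r ω) N i

namespace BddProg

variable {F : ℝ → MeasurableSpace Ω} {θ : Fin d → ℝ → Ω → ℝ} {C a b : ℝ}

lemma stepAdapted (A : BddProg F θ C) (ha : 0 ≤ a) (hab : a ≤ b) (N : ℕ) :
    StepAdapted F (grid a b N) (N + 1) (progStep a b θ N) C where
  mono := grid_mono hab
  nonneg := by rwa [grid_zero]
  meas i _ := by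
    refine @measurable_pi_lambda _ _ _ (F _) _ _ fun k => ?_
    unfold progStep prevAvg
    split_ifs with h
    · exact measurable_const
    · refine Measurable.const_mul ?_ _
      refine (A.cut a b).measurable_integral ?_ k
      have := grid_mono (N := N) hab (Nat.zero_le (i - 1))
      rw [grid_zero] at this
      exact ha.trans this
  bdd i _ ω k := abs_prevAvg_le hab (fun r => A.cut_abs_le a b k r ω) N i

lemma ae_tendsto (A : BddProg F θ C) (ha : 0 ≤ a) (hab : a < b) (k : Fin d) (ω : Ω) :
    ∀ᵐ r, Tendsto (fun N => stepProc (grid a b N) (N + 1) (progStep a b θ N) k r ω) atTop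
      (nhds (_root_.cut a b θ k r ω)) := by
  have h := tendsto_stepProc_of_cell (Ω := Ω) hab (ξ := progStep a b θ) (k := k) (ω := ω)
    (ae_tendsto_prevAvg hab (locallyIntegrable_of_bdd (A.measurable_cut_path (b := b) ha k ω)
      (fun r => A.cut_abs_le a b k r ω)))
  filter_upwards [h] with r hr
  convert hr using 2
  by_cases hrab : r ∈ Ioc a b <;> simp [_root_.cut, hrab]

lemma nonneg_bound [Nonempty Ω] (A : BddProg F θ C) (k : Fin d) : 0 ≤ C :=
  (abs_nonneg _).trans (A.bdd k 0 (Classical.arbitrary Ω))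

lemma cut_eq_zero {r : ℝ} (hr : r ∉ Ioc a b) (k : Fin d) (ω : Ω) :
    _root_.cut a b θ k r ω = 0 := by simp [_root_.cut, hr]

lemma tendsto_sqn {P : Measure Ω} [IsFiniteMeasure P] (hF : ∀ s, F s ≤ mΩ) (A : BddProg F θ C)
    (ha : 0 ≤ a) (hab : a < b) (k : Fin d) :
    Tendsto (fun N => sqn (volume.prod P) (fun x : ℝ × Ω =>
      stepProc (grid a b N) (N + 1) (progStep a b θ N) k x.1 x.2 - _root_.cut a b θ k x.1 x.2))
      atTop (nhds 0) := by
  rcases isEmpty_or_nonempty Ω with hΩ | hΩ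
  · refine tendsto_const_nhds.congr fun N => ?_
    rw [sqn, lintegral_of_isEmpty]
  have hC := A.nonneg_bound k
  refine tendsto_sqn_of_forall_ae (a := a) (b := b) (C := C)
    (u := fun N r ω => stepProc (grid a b N) (N + 1) (progStep a b θ N) k r ω)
    (v := fun r ω => _root_.cut a b θ k r ω)
    (fun N => measurable_stepProc (fun i hi => ((A.stepAdapted ha hab.le N).meas i hi).mono
      (hF _) le_rfl) k) (A.measurable_cut_top hF ha k)
    (fun N r ω => (A.stepAdapted ha hab.le N).abs_stepProc_le hC k r ω)
    (fun r ω => A.cut_abs_le a b k r ω) (fun N r ω hr => ?_) (fun r ω hr => cut_eq_zero hr k ω)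
    (Eventually.of_forall fun ω => A.ae_tendsto ha hab k ω)
  rw [StepAdapted.stepProc_eq_zero (grid_mono hab.le) (by rwa [grid_zero, grid_last])]

/-- Bounded progressive processes have Itô integrals, which are limits of the integrals of the
canonical step approximations. -/
lemma exists_isIto {P : Measure Ω} [IsProbabilityMeasure P] {B : ℝ → Ω → Fin d → ℝ}
    (S : BMSetup P F B) (A : BddProg F θ C) (ha : 0 ≤ a) (hab : a < b) :
    ∃ J, IsIto P F B a b (_root_.cut a b θ) J ∧
      Tendsto (fun N => sqn P (fun ω => stepInt B (grid a b N) (N + 1) (progStep a b θ N) ω - J ω))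
        atTop (nhds 0) :=
  IsIto.exists_of_tendsto_elem S ha
    (p := fun N => (stepProc (grid a b N) (N + 1) (progStep a b θ N),
      stepInt B (grid a b N) (N + 1) (progStep a b θ N)))
    (fun N => by
      have := (A.stepAdapted ha hab.le N).mem_elemSpan (B := B)
      rwa [grid_zero, grid_last] at this)
    (fun k => (A.measurable_cut_top S.le ha k).aemeasurable)
    (fun k => A.tendsto_sqn S.le ha hab k)

end BddProg

lemma IsIto.tendsto_stepInt {P : Measure Ω} [IsProbabilityMeasure P] {F : ℝ → MeasurableSpace Ω}
    {B : ℝ → Ω → Fin d → ℝ} {θ : Fin d → ℝ → Ω → ℝ} {C a b : ℝ} {J : Ω → ℝ}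
    (S : BMSetup P F B) (A : BddProg F θ C) (ha : 0 ≤ a) (hab : a < b)
    (H : IsIto P F B a b (cut a b θ) J) :
    Tendsto (fun N => sqn P (fun ω => stepInt B (grid a b N) (N + 1) (progStep a b θ N) ω - J ω))
        atTop (nhds 0) := by
  obtain ⟨J', H', hJ'⟩ := A.exists_isIto S ha hab
  have h := H.ae_unique S ha H' (fun k => ae_eq_refl _)
  refine hJ'.congr fun N => sqn_congr ?_
  filter_upwards [h] with ω hω
  rw [hω]

lemma isIto_of_le {P : Measure Ω} [IsProbabilityMeasure P] {F : ℝ → MeasurableSpace Ω}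
    {B : ℝ → Ω → Fin d → ℝ} {θ : Fin d → ℝ → Ω → ℝ} {a b : ℝ} (hab : b ≤ a) :
    IsIto P F B a b (cut a b θ) (fun _ => 0) := by
  have : cut a b θ = fun _ _ _ => 0 := by ext k r ω; simp [cut, Ioc_eq_empty (not_lt.2 hab)]
  rw [this]; exact IsIto.zero

end

/-! ### Exponential functionals of step processes -/

section

section sqn

variable {α : Type*} [MeasurableSpace α] {μ : Measure α} {f g : α → ℝ}

lemma ofReal_sq_eq_enorm (x : ℝ) : ENNReal.ofReal (x ^ 2) = ‖x‖ₑ ^ 2 := by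
  rw [← sq_abs, ENNReal.ofReal_pow (abs_nonneg x), Real.enorm_eq_ofReal_abs]

lemma sqn_eq_lintegral_enorm : sqn μ f = ∫⁻ x, ‖f x‖ₑ ^ 2 ∂μ := by
  simp only [sqn, ofReal_sq_eq_enorm]

/-- Cauchy--Schwarz inequality. -/
lemma sq_lintegral_mul_le (hf : AEMeasurable f μ) (hg : AEMeasurable g μ) :
    (∫⁻ x, ‖f x * g x‖ₑ ∂μ) ^ 2 ≤ sqn μ f * sqn μ g := by
  have h := ENNReal.lintegral_mul_le_Lp_mul_Lq μ Real.HolderConjugate.two_two hf.enorm hg.enorm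
  have h2 := pow_le_pow_left₀ (zero_le) h 2
  rw [mul_pow, ← ENNReal.rpow_natCast, ← ENNReal.rpow_natCast (_ ^ _), ← ENNReal.rpow_natCast (_ ^ _),
    ← ENNReal.rpow_mul, ← ENNReal.rpow_mul] at h2
  norm_num at h2
  simp only [sqn_eq_lintegral_enorm, enorm_mul]
  exact h2

/-- The squared mean of an integral over an interval. -/
lemma sqn_setIntegral_le {Ω : Type*} [MeasurableSpace Ω] {P : Measure Ω} [SFinite P]
    {w : ℝ → Ω → ℝ} (hw : Measurable (fun x : ℝ × Ω => w x.1 x.2)) (a b : ℝ) :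
    sqn P (fun ω => ∫ r in Ioc a b, w r ω)
      ≤ ENNReal.ofReal (b - a) * sqn (volume.prod P) (fun x : ℝ × Ω => w x.1 x.2) := by
  have hm : Measurable (fun x : ℝ × Ω => ENNReal.ofReal (w x.1 x.2 ^ 2)) :=
    (hw.pow_const 2).ennreal_ofReal
  have e : sqn (volume.prod P) (fun x : ℝ × Ω => w x.1 x.2)
      = ∫⁻ ω, (∫⁻ r, ENNReal.ofReal (w r ω ^ 2)) ∂P := by
    rw [sqn, lintegral_prod_symm _ hm.aemeasurable]
  rw [e, ← lintegral_const_mul _ hm.lintegral_prod_left']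
  refine lintegral_mono fun ω => ?_
  have hwω : Measurable (fun r => w r ω) := hw.comp (measurable_id.prodMk measurable_const)
  calc ENNReal.ofReal ((∫ r in Ioc a b, w r ω) ^ 2) = ‖∫ r in Ioc a b, w r ω‖ₑ ^ 2 :=
        ofReal_sq_eq_enorm _
    _ ≤ (∫⁻ r in Ioc a b, ‖1 * w r ω‖ₑ) ^ 2 := by
        gcongr
        simpa using enorm_integral_le_lintegral_enorm (μ := volume.restrict (Ioc a b)) (fun r => w r ω)
    _ ≤ sqn (volume.restrict (Ioc a b)) (fun _ => (1 : ℝ))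
        * sqn (volume.restrict (Ioc a b)) (fun r => w r ω) :=
        sq_lintegral_mul_le (f := fun _ => (1 : ℝ)) aemeasurable_const hwω.aemeasurable
    _ ≤ ENNReal.ofReal (b - a) * ∫⁻ r, ENNReal.ofReal (w r ω ^ 2) := by
        gcongr
        · simp [sqn]
        · exact setLIntegral_le_lintegral _ _

lemma abs_exp_sub_exp_le (x y : ℝ) :
    |Real.exp x - Real.exp y| ≤ |x - y| * (Real.exp x + Real.exp y) := by
  wlog h : y ≤ x generalizing x y
  · rw [abs_sub_comm, abs_sub_comm x, add_comm]
    exact this y x (le_of_not_ge h)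
  have h1 := Real.exp_le_exp.2 h
  rw [abs_of_nonneg (sub_nonneg.2 h1), abs_of_nonneg (sub_nonneg.2 h)]
  have h2 : Real.exp y = Real.exp x * Real.exp (y - x) := by rw [← Real.exp_add]; ring_nf
  have h3 := Real.add_one_le_exp (y - x)
  have h4 := mul_le_mul_of_nonneg_left h3 (Real.exp_nonneg x)
  have h5 := mul_nonneg (sub_nonneg.2 h) (Real.exp_nonneg y)
  nlinarith

lemma sqn_exp : sqn μ (fun x => Real.exp (f x))
    = ∫⁻ x, ENNReal.ofReal (Real.exp (2 * f x)) ∂μ := by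
  simp only [sqn, ← Real.exp_nat_mul]; norm_num

lemma lintegral_le_of_sqn_tendsto {u : ℕ → α → ℝ} (hu : ∀ n, AEMeasurable (u n) μ)
    (hf : AEMeasurable f μ)
    (h : Tendsto (fun n => sqn μ (fun x => u n x - f x)) atTop (nhds 0))
    {φ : ℝ → ENNReal} (hφ : Continuous φ) {M : ENNReal}
    (hM : ∀ n, ∫⁻ x, φ (u n x) ∂μ ≤ M) : ∫⁻ x, φ (f x) ∂μ ≤ M := by
  obtain ⟨ns, -, hns⟩ := (tendstoInMeasure_of_sqn hu hf h).exists_seq_tendsto_ae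
  calc ∫⁻ x, φ (f x) ∂μ = ∫⁻ x, liminf (fun i => φ (u (ns i) x)) atTop ∂μ := by
        refine lintegral_congr_ae ?_
        filter_upwards [hns] with x hx
        exact ((hφ.tendsto _).comp hx).liminf_eq.symm
    _ ≤ liminf (fun i => ∫⁻ x, φ (u (ns i) x) ∂μ) atTop :=
        lintegral_liminf_le' fun i => hφ.measurable.comp_aemeasurable (hu (ns i))
    _ ≤ M := by
        refine liminf_le_of_le (by isBoundedDefault) fun b hb => ?_
        obtain ⟨i, hi⟩ := hb.exists
        exact hi.trans (hM _)

/-- Exponentials converge in mean under square-mean convergence of exponents and uniform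
exponential moments. -/
lemma tendsto_lintegral_exp_sub {u : ℕ → α → ℝ} (hu : ∀ n, AEMeasurable (u n) μ)
    (hf : AEMeasurable f μ)
    (h : Tendsto (fun n => sqn μ (fun x => u n x - f x)) atTop (nhds 0)) {M : ENNReal} (hM' : M ≠ ⊤)
    (hM : ∀ n, ∫⁻ x, ENNReal.ofReal (Real.exp (2 * u n x)) ∂μ ≤ M) :
    Tendsto (fun n => ∫⁻ x, ‖Real.exp (u n x) - Real.exp (f x)‖ₑ ∂μ) atTop (nhds 0) := by
  have hf2 : ∫⁻ x, ENNReal.ofReal (Real.exp (2 * f x)) ∂μ ≤ M :=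
    lintegral_le_of_sqn_tendsto hu hf h (φ := fun y => ENNReal.ofReal (Real.exp (2 * y)))
      (ENNReal.continuous_ofReal.comp (by fun_prop)) hM
  have h1 : ∀ n, (∫⁻ x, ‖Real.exp (u n x) - Real.exp (f x)‖ₑ ∂μ) ^ 2
      ≤ sqn μ (fun x => u n x - f x) * (4 * M) := by
    intro n
    have e1 : AEMeasurable (fun x => Real.exp (u n x)) μ := Real.measurable_exp.comp_aemeasurable (hu n)
    have e2 : AEMeasurable (fun x => Real.exp (f x)) μ := Real.measurable_exp.comp_aemeasurable hf
    calc (∫⁻ x, ‖Real.exp (u n x) - Real.exp (f x)‖ₑ ∂μ) ^ 2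
        ≤ (∫⁻ x, ‖(u n x - f x) * (Real.exp (u n x) + Real.exp (f x))‖ₑ ∂μ) ^ 2 := by
          gcongr with x
          rw [Real.enorm_eq_ofReal_abs, Real.enorm_eq_ofReal_abs, abs_mul,
            abs_of_nonneg (add_nonneg (Real.exp_nonneg _) (Real.exp_nonneg _))]
          exact ENNReal.ofReal_le_ofReal (abs_exp_sub_exp_le _ _)
      _ ≤ sqn μ (fun x => u n x - f x) * sqn μ (fun x => Real.exp (u n x) + Real.exp (f x)) :=
          sq_lintegral_mul_le ((hu n).sub hf) (e1.add e2)
      _ ≤ sqn μ (fun x => u n x - f x) * (4 * M) := by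
          gcongr
          calc _ ≤ 2 * sqn μ (fun x => Real.exp (u n x)) + 2 * sqn μ (fun x => Real.exp (f x)) :=
                sqn_add_le e1
            _ ≤ 2 * M + 2 * M := by
                rw [sqn_exp, sqn_exp]
                gcongr
                exact hM n
            _ = 4 * M := by ring
  have h2 : Tendsto (fun n => sqn μ (fun x => u n x - f x) * (4 * M)) atTop (nhds 0) := by
    have := ENNReal.Tendsto.mul_const h (b := 4 * M)
      (Or.inr (ENNReal.mul_ne_top (by norm_num) hM'))
    simpa using this
  have h3 := tendsto_of_tendsto_of_tendsto_of_le_of_le tendsto_const_nhds h2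
    (fun _ => zero_le) h1
  have h4 := ((ENNReal.continuous_rpow_const (y := 1 / 2)).tendsto 0).comp h3
  rw [ENNReal.zero_rpow_of_pos (by norm_num)] at h4
  refine h4.congr fun n => ?_
  simp only [Function.comp]
  rw [← ENNReal.rpow_natCast, ← ENNReal.rpow_mul]
  norm_num

end sqn

variable {Ω : Type*} [mΩ : MeasurableSpace Ω] {d : ℕ}

/-- The quadratic variation `∫_a^b |θ|² dr`. -/
def quad (a b : ℝ) (θ : Fin d → ℝ → Ω → ℝ) (ω : Ω) : ℝ :=
  ∑ k, ∫ r in Ioc a b, θ k r ω ^ 2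

lemma sqn_sum_le {α ι : Type*} [MeasurableSpace α] {μ : Measure α} [Fintype ι] {f : ι → α → ℝ}
    (hf : ∀ k, AEMeasurable (f k) μ) :
    sqn μ (fun x => ∑ k, f k x) ≤ (Fintype.card ι) * ∑ k, sqn μ (f k) := by
  simp only [sqn]
  rw [← lintegral_finsetSum' _ fun k _ => ((hf k).pow_const 2).ennreal_ofReal,
    ← lintegral_const_mul' _ _ (ENNReal.natCast_ne_top _)]
  refine lintegral_mono fun x => ?_
  rw [← ENNReal.ofReal_sum_of_nonneg fun k _ => sq_nonneg _, ← ENNReal.ofReal_natCast,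
    ← ENNReal.ofReal_mul (Nat.cast_nonneg _)]
  exact ENNReal.ofReal_le_ofReal sq_sum_le_card_mul_sum_sq

/-- Stability of weighted time integrals. -/
lemma sqn_integral_mul_sub_le {P : Measure Ω} [SFinite P] {u v η : Fin d → ℝ → Ω → ℝ} {C : ℝ}
    {a b : ℝ}
    (hu : ∀ k, Measurable (fun x : ℝ × Ω => u k x.1 x.2))
    (hv : ∀ k, Measurable (fun x : ℝ × Ω => v k x.1 x.2))
    (hη : ∀ k, Measurable (fun x : ℝ × Ω => η k x.1 x.2))
    (hηC : ∀ k r ω, |η k r ω| ≤ C) (hu' : ∀ k r ω, |u k r ω| ≤ C) (hv' : ∀ k r ω, |v k r ω| ≤ C) :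
    sqn P (fun ω => (∑ k, ∫ r in Ioc a b, u k r ω * η k r ω)
        - ∑ k, ∫ r in Ioc a b, v k r ω * η k r ω)
      ≤ d * (ENNReal.ofReal (b - a) * ENNReal.ofReal (C ^ 2)) *
        ∑ k, sqn (volume.prod P) (fun x : ℝ × Ω => u k x.1 x.2 - v k x.1 x.2) := by
  have hint : ∀ {w : Fin d → ℝ → Ω → ℝ}, (∀ k, Measurable (fun x : ℝ × Ω => w k x.1 x.2)) →
      (∀ k r ω, |w k r ω| ≤ C) → ∀ k ω, IntegrableOn (fun r => w k r ω * η k r ω) (Ioc a b) := by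
    intro w hw hwC k ω
    refine integrableOn_Ioc_of_bdd (C := C * C)
      (((hw k).mul (hη k)).comp (measurable_id.prodMk measurable_const)) (fun r => ?_) _ _
    change |w k r ω * η k r ω| ≤ C * C
    rw [abs_mul]
    exact mul_le_mul (hwC k r ω) (hηC k r ω) (abs_nonneg _) ((abs_nonneg _).trans (hwC k r ω))
  have e : ∀ ω, (∑ k, ∫ r in Ioc a b, u k r ω * η k r ω) - ∑ k, ∫ r in Ioc a b, v k r ω * η k r ω
      = ∑ k, ∫ r in Ioc a b, η k r ω * (u k r ω - v k r ω) := by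
    intro ω
    rw [← Finset.sum_sub_distrib]
    refine Finset.sum_congr rfl fun k _ => ?_
    rw [← integral_sub (hint hu hu' k ω) (hint hv hv' k ω)]
    refine integral_congr_ae (Eventually.of_forall fun r => ?_)
    simp only; ring
  simp_rw [e]
  have hm : ∀ k, Measurable (fun x : ℝ × Ω => η k x.1 x.2 * (u k x.1 x.2 - v k x.1 x.2)) :=
    fun k => (hη k).mul ((hu k).sub (hv k))
  refine (sqn_sum_le fun k => (measurable_setIntegral_left (hm k) (Ioc a b)).aemeasurable).trans ?_
  rw [Fintype.card_fin, mul_assoc]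
  refine mul_le_mul' le_rfl ?_
  rw [Finset.mul_sum]
  refine Finset.sum_le_sum fun k _ => ?_
  refine (sqn_setIntegral_le (hm k) a b).trans ?_
  rw [mul_assoc]
  gcongr
  exact sqn_mul_le (g := fun x : ℝ × Ω => η k x.1 x.2) (fun x => hηC k x.1 x.2)

lemma sqn_quad_sub_le {P : Measure Ω} [SFinite P] {u v : Fin d → ℝ → Ω → ℝ} {C : ℝ}
    {a b : ℝ}
    (hu : ∀ k, Measurable (fun x : ℝ × Ω => u k x.1 x.2))
    (hv : ∀ k, Measurable (fun x : ℝ × Ω => v k x.1 x.2))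
    (hu' : ∀ k r ω, |u k r ω| ≤ C) (hv' : ∀ k r ω, |v k r ω| ≤ C) :
    sqn P (fun ω => quad a b u ω - quad a b v ω)
      ≤ d * (ENNReal.ofReal (b - a) * ENNReal.ofReal ((C + C) ^ 2)) *
        ∑ k, sqn (volume.prod P) (fun x : ℝ × Ω => u k x.1 x.2 - v k x.1 x.2) := by
  have hC : ∀ k : Fin d, ∀ (r : ℝ) (ω : Ω), C ≤ C + C := fun k r ω => by
    linarith [(abs_nonneg _).trans (hu' k r ω)]
  have h := sqn_integral_mul_sub_le (P := P) (a := a) (b := b) hu hv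
    (η := fun k r ω => u k r ω + v k r ω)
    (fun k => (hu k).add (hv k)) (C := C + C)
    (fun k r ω => (abs_add_le _ _).trans (add_le_add (hu' k r ω) (hv' k r ω)))
    (fun k r ω => (hu' k r ω).trans (hC k r ω)) (fun k r ω => (hv' k r ω).trans (hC k r ω))
  refine le_trans (le_of_eq ?_) h
  congr 1
  ext ω
  have hint : ∀ {w w' : Fin d → ℝ → Ω → ℝ}, (∀ k, Measurable (fun x : ℝ × Ω => w k x.1 x.2)) →
      (∀ k r ω, |w k r ω| ≤ C) → (∀ k, Measurable (fun x : ℝ × Ω => w' k x.1 x.2)) →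
      (∀ k r ω, |w' k r ω| ≤ C) → ∀ k, IntegrableOn (fun r => w k r ω * w' k r ω) (Ioc a b) := by
    intro w w' hw hwC hw' hwC' k
    refine integrableOn_Ioc_of_bdd (C := C * C)
      (((hw k).mul (hw' k)).comp (measurable_id.prodMk measurable_const)) (fun r => ?_) _ _
    change |w k r ω * w' k r ω| ≤ C * C
    rw [abs_mul]
    exact mul_le_mul (hwC k r ω) (hwC' k r ω) (abs_nonneg _) ((abs_nonneg _).trans (hwC k r ω))
  simp only [quad]
  rw [← Finset.sum_sub_distrib, ← Finset.sum_sub_distrib]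
  refine Finset.sum_congr rfl fun k _ => ?_
  simp only [mul_add]
  rw [integral_add (hint hu hu' hu hu' k) (hint hu hu' hv hv' k),
    integral_add (hint hv hv' hu hu' k) (hint hv hv' hv hv' k)]
  simp only [sq]
  rw [show (fun r => v k r ω * u k r ω) = fun r => u k r ω * v k r ω from
    funext fun r => mul_comm _ _]
  ring

end

/-! ### Stochastic exponentials -/

section

variable {Ω : Type*} [mΩ : MeasurableSpace Ω] {d : ℕ}

/-- The stochastic exponential with stochastic integral `J`. -/
def expI (a b : ℝ) (θ : Fin d → ℝ → Ω → ℝ) (J : Ω → ℝ) (ω : Ω) : ℝ :=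
  Real.exp (J ω - 1 / 2 * quad a b θ ω)

lemma quad_nonneg (a b : ℝ) (θ : Fin d → ℝ → Ω → ℝ) (ω : Ω) : 0 ≤ quad a b θ ω :=
  Finset.sum_nonneg fun _ _ => integral_nonneg fun _ => sq_nonneg _

lemma quad_congr {a b : ℝ} {θ η : Fin d → ℝ → Ω → ℝ} {ω : Ω}
    (h : ∀ k, ∀ r ∈ Ioc a b, θ k r ω = η k r ω) : quad a b θ ω = quad a b η ω :=
  Finset.sum_congr rfl fun k _ => setIntegral_congr_fun measurableSet_Ioc fun r hr => by
    simp only [h k r hr]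

lemma quad_cut (a b : ℝ) (θ : Fin d → ℝ → Ω → ℝ) : quad a b (cut a b θ) = quad a b θ := by
  ext ω
  exact quad_congr fun k r hr => by simp [cut, hr]

lemma quad_stepProc {t : ℕ → ℝ} (ht : Monotone t) (N : ℕ) (ξ : ℕ → Ω → Fin d → ℝ) (ω : Ω) :
    quad (t 0) (t N) (stepProc t N ξ) ω
      = ∑ i ∈ Finset.range N, (t (i + 1) - t i) * ∑ k, ξ i ω k ^ 2 := by
  simp only [quad, Finset.mul_sum]
  rw [Finset.sum_comm]
  refine Finset.sum_congr rfl fun k _ => ?_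
  have := sum_setIntegral_eq_stepProc ht N ξ k ω (f := fun _ => 1)
    (integrableOn_Ioc_of_bdd measurable_const (C := 1) (by simp) _ _) (fun x => x ^ 2)
  simp only [mul_one] at this
  rw [this]
  refine Finset.sum_congr rfl fun i _ => ?_
  simp [ht (Nat.le_succ i), mul_comm]

lemma BddProg.measurable_quad {F : ℝ → MeasurableSpace Ω} {θ : Fin d → ℝ → Ω → ℝ} {C a b : ℝ}
    (A : BddProg F θ C) (ha : 0 ≤ a) : Measurable[F b] (quad a b θ) := by
  unfold quad
  refine Finset.measurable_fun_sum _ fun k _ => ?_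
  have := (A.mul A).measurable_integral (b := b) ha k
  simpa only [sq] using this

lemma measurable_quad_top {u : Fin d → ℝ → Ω → ℝ}
    (hu : ∀ k, Measurable (fun x : ℝ × Ω => u k x.1 x.2)) (a b : ℝ) : Measurable (quad a b u) := by
  unfold quad
  exact Finset.measurable_fun_sum _ fun k _ =>
    measurable_setIntegral_left ((hu k).pow_const 2) (Ioc a b)

lemma tendsto_expI {P : Measure Ω} [SFinite P] {u : ℕ → Fin d → ℝ → Ω → ℝ}
    {v : Fin d → ℝ → Ω → ℝ} {J : ℕ → Ω → ℝ} {J' : Ω → ℝ} {a b C : ℝ}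
    (hu : ∀ n k, Measurable (fun x : ℝ × Ω => u n k x.1 x.2))
    (hv : ∀ k, Measurable (fun x : ℝ × Ω => v k x.1 x.2))
    (huC : ∀ n k r ω, |u n k r ω| ≤ C) (hvC : ∀ k r ω, |v k r ω| ≤ C)
    (hJ : ∀ n, AEMeasurable (J n) P) (hJ' : AEMeasurable J' P)
    (h1 : Tendsto (fun n => sqn P (fun ω => J n ω - J' ω)) atTop (nhds 0))
    (h2 : ∀ k, Tendsto (fun n => sqn (volume.prod P)
      (fun x : ℝ × Ω => u n k x.1 x.2 - v k x.1 x.2)) atTop (nhds 0))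
    {M : ENNReal} (hM' : M ≠ ⊤) (hM : ∀ n, ∫⁻ ω, ENNReal.ofReal (Real.exp (2 * J n ω)) ∂P ≤ M) :
    Tendsto (fun n => ∫⁻ ω, ‖expI a b (u n) (J n) ω - expI a b v J' ω‖ₑ ∂P) atTop (nhds 0) := by
  have hq : Tendsto (fun n => sqn P (fun ω => quad a b (u n) ω - quad a b v ω)) atTop (nhds 0) := by
    have h3 : Tendsto (fun n => d * (ENNReal.ofReal (b - a) * ENNReal.ofReal ((C + C) ^ 2)) *
        ∑ k, sqn (volume.prod P) (fun x : ℝ × Ω => u n k x.1 x.2 - v k x.1 x.2)) atTop (nhds 0) := by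
      have h4 := tendsto_finsetSum (Finset.univ : Finset (Fin d)) fun k _ => h2 k
      have := ENNReal.Tendsto.const_mul h4
        (a := d * (ENNReal.ofReal (b - a) * ENNReal.ofReal ((C + C) ^ 2)))
        (Or.inr (ENNReal.mul_ne_top (ENNReal.natCast_ne_top _)
          (ENNReal.mul_ne_top ENNReal.ofReal_ne_top ENNReal.ofReal_ne_top)))
      simpa using this
    exact tendsto_of_tendsto_of_tendsto_of_le_of_le tendsto_const_nhds h3 (fun _ => zero_le)
      (fun n => sqn_quad_sub_le (hu n) hv (huC n) hvC)
  refine tendsto_lintegral_exp_sub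
    (fun n => (hJ n).sub ((measurable_quad_top (hu n) a b).aemeasurable.const_mul _))
    (hJ'.sub ((measurable_quad_top hv a b).aemeasurable.const_mul _)) ?_ hM' (fun n => ?_)
  · have h5 : ∀ n, sqn P (fun ω => (J n ω - 1 / 2 * quad a b (u n) ω) - (J' ω - 1 / 2 * quad a b v ω))
        ≤ 2 * sqn P (fun ω => J n ω - J' ω)
          + 2 * (ENNReal.ofReal ((1 / 2) ^ 2) * sqn P (fun ω => quad a b (u n) ω - quad a b v ω)) := by
      intro n
      have := sqn_sub_le (f := fun ω => J n ω - J' ω)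
        (g := fun ω => 1 / 2 * (quad a b (u n) ω - quad a b v ω)) ((hJ n).sub hJ')
      rw [sqn_const_mul] at this
      refine le_trans (le_of_eq ?_) this
      congr 1; ext ω; ring
    have h6 : Tendsto (fun n => 2 * sqn P (fun ω => J n ω - J' ω)
          + 2 * (ENNReal.ofReal ((1 / 2) ^ 2) * sqn P (fun ω => quad a b (u n) ω - quad a b v ω)))
        atTop (nhds 0) := by
      have e1 := ENNReal.Tendsto.const_mul h1 (a := 2) (Or.inr (by norm_num))
      have e2 := ENNReal.Tendsto.const_mul (ENNReal.Tendsto.const_mul hq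
        (a := ENNReal.ofReal ((1 / 2) ^ 2)) (Or.inr ENNReal.ofReal_ne_top)) (a := 2)
        (Or.inr (by norm_num))
      simpa using e1.add e2
    exact tendsto_of_tendsto_of_tendsto_of_le_of_le tendsto_const_nhds h6 (fun _ => zero_le) h5
  · refine (lintegral_mono fun ω => ENNReal.ofReal_le_ofReal (Real.exp_le_exp.2 ?_)).trans (hM n)
    have := quad_nonneg a b (u n) ω
    linarith

lemma expI_pos (a b : ℝ) (θ : Fin d → ℝ → Ω → ℝ) (J : Ω → ℝ) (ω : Ω) : 0 < expI a b θ J ω :=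
  Real.exp_pos _

section

variable {P : Measure Ω} [IsProbabilityMeasure P] {F : ℝ → MeasurableSpace Ω}
    {B : ℝ → Ω → Fin d → ℝ} {θ : Fin d → ℝ → Ω → ℝ} {C a b : ℝ} {J : Ω → ℝ}

lemma IsIto.lintegral_exp_mul_le (S : BMSetup P F B) (A : BddProg F θ C) (ha : 0 ≤ a)
    (hab : a < b) (H : IsIto P F B a b (cut a b θ) J) (c : ℝ) :
    ∫⁻ ω, ENNReal.ofReal (Real.exp (c * J ω)) ∂P
      ≤ ENNReal.ofReal (Real.exp (c ^ 2 / 2 * ((b - a) * (d * C ^ 2)))) := by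
  refine lintegral_le_of_sqn_tendsto
    (u := fun N => stepInt B (grid a b N) (N + 1) (progStep a b θ N))
    (fun N => (((A.stepAdapted ha hab.le N).measurable_stepInt S).mono (S.le _)
      le_rfl).aemeasurable) H.aemJ (H.tendsto_stepInt S A ha hab)
    (φ := fun y => ENNReal.ofReal (Real.exp (c * y)))
    (ENNReal.continuous_ofReal.comp (by fun_prop)) fun N => ?_
  have := (A.stepAdapted ha hab.le N).lintegral_exp_mul_le S c
  rwa [grid_zero, grid_last] at this

lemma aemeasurable_expI (hF : ∀ s, F s ≤ mΩ) (A : BddProg F θ C) (ha : 0 ≤ a)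
    (hJ : AEMeasurable J P) : AEMeasurable (expI a b θ J) P :=
  Real.measurable_exp.comp_aemeasurable
    (hJ.sub (((A.measurable_quad ha).mono (hF b) le_rfl).aemeasurable.const_mul _))

lemma IsIto.setLIntegral_expI (S : BMSetup P F B) (A : BddProg F θ C) (ha : 0 ≤ a)
    (hab : a < b) (H : IsIto P F B a b (cut a b θ) J) {D : Set Ω} (hD : MeasurableSet[F a] D) :
    ∫⁻ ω in D, ENNReal.ofReal (expI a b θ J ω) ∂P = P D := by
  rcases isEmpty_or_nonempty Ω with hΩ | hΩ
  · rw [Subsingleton.elim D ∅]; simp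
  set p : ℕ → Fin d → ℝ → Ω → ℝ := fun N => stepProc (grid a b N) (N + 1) (progStep a b θ N)
  set I : ℕ → Ω → ℝ := fun N => stepInt B (grid a b N) (N + 1) (progStep a b θ N)
  have hA := fun N => A.stepAdapted ha hab.le N
  have hI : ∀ N, AEMeasurable (I N) P := fun N =>
    (((hA N).measurable_stepInt S).mono (S.le _) le_rfl).aemeasurable
  have hp : ∀ N k, Measurable (fun x : ℝ × Ω => p N k x.1 x.2) := fun N k =>
    measurable_stepProc (fun i hi => ((hA N).meas i hi).mono (S.le _) le_rfl) k
  have hlim : Tendsto (fun N => ∫⁻ ω, ‖expI a b (p N) (I N) ω - expI a b (cut a b θ) J ω‖ₑ ∂P)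
      atTop (nhds 0) := by
    refine tendsto_expI (C := C) hp (fun k => A.measurable_cut_top S.le ha k)
      (fun N k r ω => (hA N).abs_stepProc_le (A.nonneg_bound k) k r ω)
      (fun k r ω => A.cut_abs_le a b k r ω) hI H.aemJ (H.tendsto_stepInt S A ha hab)
      (fun k => A.tendsto_sqn S.le ha hab k)
      (M := ENNReal.ofReal (Real.exp (2 ^ 2 / 2 * ((b - a) * (d * C ^ 2)))))
      ENNReal.ofReal_ne_top fun N => ?_
    have := (hA N).lintegral_exp_mul_le S 2
    rwa [grid_zero, grid_last] at this
  have hDm : MeasurableSet D := S.le a D hD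
  have hone : ∀ N, ∫⁻ ω in D, ENNReal.ofReal (expI a b (p N) (I N) ω) ∂P = P D := by
    intro N
    have h := (hA N).lintegral_exp S (Y := D.indicator 1) (by
      rw [grid_zero]; exact Measurable.indicator (m := F a) measurable_const hD)
    rw [lintegral_indicator_one hDm] at h
    rw [← h, ← lintegral_indicator hDm]
    refine lintegral_congr fun ω => ?_
    have := quad_stepProc (hA N).mono (N + 1) (progStep a b θ N) ω
    rw [grid_zero, grid_last] at this
    by_cases hω : ω ∈ D
    · simp only [hω, indicator_of_mem, Pi.one_apply, one_mul, expI, I, p, this]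
    · simp [hω]
  have hbd : ∀ (f g : Ω → ℝ), AEMeasurable f P → ∫⁻ ω in D, ENNReal.ofReal (g ω) ∂P
      ≤ ∫⁻ ω in D, ENNReal.ofReal (f ω) ∂P + ∫⁻ ω, ‖f ω - g ω‖ₑ ∂P := by
    intro f g hf
    refine (lintegral_mono (g := fun ω => ENNReal.ofReal (f ω) + ‖f ω - g ω‖ₑ) fun ω => ?_).trans ?_
    · change ENNReal.ofReal (g ω) ≤ ENNReal.ofReal (f ω) + ‖f ω - g ω‖ₑ
      rw [Real.enorm_eq_ofReal_abs]
      refine le_trans (ENNReal.ofReal_le_ofReal ?_) ENNReal.ofReal_add_le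
      linarith [neg_abs_le (f ω - g ω)]
    · rw [lintegral_add_left' hf.restrict.ennreal_ofReal]
      gcongr
      exact Measure.restrict_le_self
  have hZ : AEMeasurable (expI a b (cut a b θ) J) P := aemeasurable_expI S.le (A.cut a b) ha H.aemJ
  have hZn : ∀ N, AEMeasurable (expI a b (p N) (I N)) P := fun N =>
    Real.measurable_exp.comp_aemeasurable ((hI N).sub
      ((measurable_quad_top (hp N) a b).aemeasurable.const_mul _))
  have hcut : expI a b (cut a b θ) J = expI a b θ J := by ext ω; simp only [expI, quad_cut]
  rw [← hcut]
  refine le_antisymm ?_ ?_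
  · refine ge_of_tendsto (x := atTop) (f := fun N => P D
      + ∫⁻ ω, ‖expI a b (p N) (I N) ω - expI a b (cut a b θ) J ω‖ₑ ∂P)
      (by simpa using hlim.const_add (P D)) (Eventually.of_forall fun N => ?_)
    have := hbd _ (expI a b (cut a b θ) J) (hZn N)
    rwa [hone N] at this
  · refine ge_of_tendsto (x := atTop) (f := fun N => ∫⁻ ω in D, ENNReal.ofReal
      (expI a b (cut a b θ) J ω) ∂P
      + ∫⁻ ω, ‖expI a b (p N) (I N) ω - expI a b (cut a b θ) J ω‖ₑ ∂P)
      (by simpa using hlim.const_add _) (Eventually.of_forall fun N => ?_)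
    have := hbd _ (expI a b (p N) (I N)) hZ
    simp_rw [enorm_sub_rev (expI a b (cut a b θ) J _)] at this
    rwa [hone N] at this

lemma lintegral_mul_of_setLIntegral {m : MeasurableSpace Ω} (hm : m ≤ mΩ) {Z : Ω → ENNReal}
    (hZ : AEMeasurable Z P) (h : ∀ D, MeasurableSet[m] D → ∫⁻ ω in D, Z ω ∂P = P D)
    {Y : Ω → ENNReal} (hY : Measurable[m] Y) : ∫⁻ ω, Y ω * Z ω ∂P = ∫⁻ ω, Y ω ∂P := by
  have e : (P.withDensity Z).trim hm = P.trim hm := by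
    refine @Measure.ext _ m _ _ fun D hD => ?_
    rw [trim_measurableSet_eq hm hD, trim_measurableSet_eq hm hD, withDensity_apply _ (hm D hD), h D hD]
  have h1 : ∫⁻ ω, Y ω ∂(P.withDensity Z) = ∫⁻ ω, Y ω ∂P := by
    rw [← lintegral_trim hm hY, ← lintegral_trim hm hY, e]
  rw [← h1, lintegral_withDensity_eq_lintegral_mul₀ hZ (hY.mono hm le_rfl).aemeasurable]
  refine lintegral_congr fun ω => ?_
  simp [mul_comm]

/-- The stochastic exponential over `(a, b]` has conditional mean one given `F a`. -/
lemma IsIto.lintegral_mul_expI (S : BMSetup P F B) (A : BddProg F θ C) (ha : 0 ≤ a)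
    (hab : a ≤ b) (H : IsIto P F B a b (cut a b θ) J) {Y : Ω → ENNReal} (hY : AEM (F a) P Y) :
    ∫⁻ ω, Y ω * ENNReal.ofReal (expI a b θ J ω) ∂P = ∫⁻ ω, Y ω ∂P := by
  rcases hab.eq_or_lt with rfl | hab
  · have h := H.ae_unique S ha (isIto_of_le le_rfl) fun k => ae_eq_refl _
    refine lintegral_congr_ae ?_
    filter_upwards [h] with ω hω
    simp [expI, quad, hω]
  obtain ⟨g, hg, hYg⟩ := hY
  rw [lintegral_congr_ae (hYg.mono fun ω h => by rw [h]), lintegral_congr_ae hYg]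
  exact lintegral_mul_of_setLIntegral (S.le a)
    (aemeasurable_expI S.le A ha H.aemJ).ennreal_ofReal
    (fun D hD => H.setLIntegral_expI S A ha hab hD) hg

lemma IsIto.aemF (S : BMSetup P F B) (A : BddProg F θ C) (ha : 0 ≤ a)
    (hab : a ≤ b) (H : IsIto P F B a b (cut a b θ) J) : AEM (F b) P J := by
  rcases hab.eq_or_lt with rfl | hab
  · have h := H.ae_unique S ha (isIto_of_le le_rfl) fun k => ae_eq_refl _
    exact ⟨_, measurable_const, h⟩
  · refine AEM.of_sqn (fun N => AEM.of_measurable ?_)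
      (fun N => (((A.stepAdapted ha hab.le N).measurable_stepInt S).mono (S.le _)
      le_rfl).aemeasurable) H.aemJ (H.tendsto_stepInt S A ha hab)
    have := (A.stepAdapted ha hab.le N).measurable_stepInt S
    rwa [grid_last] at this

lemma IsIto.aem_expI (S : BMSetup P F B) (A : BddProg F θ C) (ha : 0 ≤ a)
    (hab : a ≤ b) (H : IsIto P F B a b (cut a b θ) J) : AEM (F b) P (expI a b θ J) :=
  ((H.aemF S A ha hab).prodMk (AEM.of_measurable (A.measurable_quad ha))).comp
    (φ := fun x : ℝ × ℝ => Real.exp (x.1 - 1 / 2 * x.2)) (by fun_prop)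

end

end

/-! ### Characterisation of Brownian increments by exponential moments -/

section

lemma measure_real_ext_of_lintegral_exp {μ ν : Measure ℝ} [IsFiniteMeasure μ] [IsFiniteMeasure ν]
    (h : ∀ t : ℝ, ∫⁻ x, ENNReal.ofReal (Real.exp (t * x)) ∂μ
      = ∫⁻ x, ENNReal.ofReal (Real.exp (t * x)) ∂ν)
    (hfin : ∀ t : ℝ, ∫⁻ x, ENNReal.ofReal (Real.exp (t * x)) ∂ν ≠ ⊤) : μ = ν := by
  have hint : ∀ t : ℝ, Integrable (fun x => Real.exp (t * id x)) μ := fun t =>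
    ⟨by fun_prop, by
      rw [hasFiniteIntegral_iff_ofReal (Eventually.of_forall fun x => (Real.exp_pos _).le)]
      exact lt_top_iff_ne_top.2 (by simpa only [id, h t] using hfin t)⟩
  have hm : mgf id μ = mgf id ν := by
    ext t
    unfold mgf
    rw [integral_eq_lintegral_of_nonneg_ae (Eventually.of_forall fun x => (Real.exp_pos _).le)
      (by fun_prop), integral_eq_lintegral_of_nonneg_ae
      (Eventually.of_forall fun x => (Real.exp_pos _).le) (by fun_prop)]
    simp only [id, h t]
  have h0 : μ univ = ν univ := by simpa using h 0
  have h1 := eqOn_complexMGF_of_mgf' hm (by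
    rw [← Measure.measure_univ_eq_zero, h0, Measure.measure_univ_eq_zero])
  have hset : integrableExpSet id μ = univ := eq_univ_of_forall fun t => hint t
  refine Measure.ext_of_complexMGF_id_eq (funext fun z => h1 ?_)
  simp [hset]

lemma measure_pi_ext_of_lintegral_exp {d : ℕ} {μ ν : Measure (Fin d → ℝ)} [IsFiniteMeasure μ]
    [IsFiniteMeasure ν]
    (h : ∀ u : Fin d → ℝ, ∫⁻ x, ENNReal.ofReal (Real.exp (∑ j, u j * x j)) ∂μ
      = ∫⁻ x, ENNReal.ofReal (Real.exp (∑ j, u j * x j)) ∂ν)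
    (hfin : ∀ u : Fin d → ℝ, ∫⁻ x, ENNReal.ofReal (Real.exp (∑ j, u j * x j)) ∂ν ≠ ⊤) :
    μ = ν := by
  refine Measure.ext_of_charFunDual (funext fun L => ?_)
  have hL : ∀ x : Fin d → ℝ, L x = ∑ j, L (Pi.single j 1) * x j := fun x => by
    conv_lhs => rw [pi_eq_sum_univ' x, map_sum]
    refine Finset.sum_congr rfl fun j _ => ?_
    rw [map_smul, smul_eq_mul, mul_comm]
  have hmap : ∀ (ρ : Measure (Fin d → ℝ)) (t : ℝ),
      ∫⁻ x, ENNReal.ofReal (Real.exp (t * x)) ∂(ρ.map L)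
        = ∫⁻ x, ENNReal.ofReal (Real.exp (∑ j, t * L (Pi.single j 1) * x j)) ∂ρ := fun ρ t => by
    rw [lintegral_map (by fun_prop) (by fun_prop)]
    refine lintegral_congr fun x => ?_
    rw [hL x, Finset.mul_sum]
    simp only [mul_assoc]
  rw [charFunDual_eq_charFun_map_one, charFunDual_eq_charFun_map_one]
  congr 1
  refine measure_real_ext_of_lintegral_exp (fun t => ?_) fun t => ?_
  · rw [hmap, hmap, h fun j => t * L (Pi.single j 1)]
  · rw [hmap]; exact hfin fun j => t * L (Pi.single j 1)

lemma gaussPi_lintegral_exp' {d : ℕ} {t : ℝ} (ht : 0 ≤ t) (x : Fin d → ℝ) :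
    ∫⁻ w, ENNReal.ofReal (Real.exp (∑ j, x j * w j)) ∂(gaussPi d t)
      = ENNReal.ofReal (Real.exp (t / 2 * ∑ j, x j ^ 2)) := by
  have h := gaussPi_lintegral_exp ht x
  simp_rw [sub_eq_add_neg, Real.exp_add] at h
  simp_rw [ENNReal.ofReal_mul (Real.exp_pos _).le] at h
  rw [lintegral_mul_const _ (by fun_prop)] at h
  rw [Real.exp_neg, ENNReal.ofReal_inv_of_pos (Real.exp_pos _)] at h
  rw [← div_eq_mul_inv, ENNReal.div_eq_one_iff (by simp [Real.exp_pos]) ENNReal.ofReal_ne_top] at h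
  exact h

/-- Exponential moments over all events of `m` determine a Gaussian law independent of `m`. -/
lemma map_eq_and_indep_of_lintegral_exp {Ω : Type*} {d : ℕ} {m : MeasurableSpace Ω}
    [mΩ : MeasurableSpace Ω] {P : Measure Ω}
    [IsProbabilityMeasure P] {D : Ω → Fin d → ℝ} (hD : Measurable D) {t : ℝ} (ht : 0 ≤ t)
    (h : ∀ E, MeasurableSet[m] E → ∀ u : Fin d → ℝ,
      ∫⁻ ω in E, ENNReal.ofReal (Real.exp (∑ j, u j * D ω j - t / 2 * ∑ j, u j ^ 2)) ∂P = P E) :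
    P.map D = gaussPi d t ∧ Indep (MeasurableSpace.comap D inferInstance) m P := by
  have key : ∀ E, MeasurableSet[m] E → (P.restrict E).map D = P E • gaussPi d t := fun E hE => by
    have hf : IsFiniteMeasure (P E • gaussPi d t) :=
      ⟨by simp⟩
    refine measure_pi_ext_of_lintegral_exp (fun u => ?_) fun u => ?_
    · rw [lintegral_map (by fun_prop) hD, lintegral_smul_measure, gaussPi_lintegral_exp' ht,
        ← h E hE u, smul_eq_mul, ← lintegral_mul_const _ (by fun_prop)]
      refine lintegral_congr fun ω => ?_
      rw [← ENNReal.ofReal_mul (Real.exp_pos _).le, ← Real.exp_add]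
      simp
    · rw [lintegral_smul_measure, gaussPi_lintegral_exp' ht]
      exact ENNReal.mul_ne_top (measure_ne_top _ _) ENNReal.ofReal_ne_top
  have hmap : P.map D = gaussPi d t := by simpa using key univ MeasurableSet.univ
  refine ⟨hmap, (Indep_iff _ _ _).2 ?_⟩
  rintro _ E ⟨G, hG, rfl⟩ hE
  have := congrArg (fun ρ => ρ G) (key E hE)
  simp only [Measure.smul_apply, smul_eq_mul] at this
  rw [Measure.map_apply hD hG, Measure.restrict_apply (hD hG), ← hmap, Measure.map_apply hD hG]
    at this
  rw [this, mul_comm]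

end

/-! ### Girsanov transform -/

section

variable {Ω : Type*} [mΩ : MeasurableSpace Ω] {d : ℕ}

lemma BddProg.integrableOn {F : ℝ → MeasurableSpace Ω} {θ : Fin d → ℝ → Ω → ℝ} {C a : ℝ}
    (A : BddProg F θ C) (ha : 0 ≤ a) (k : Fin d) (ω : Ω) (b : ℝ) :
    IntegrableOn (fun r => θ k r ω) (Ioc a b) := by
  have h := integrableOn_Ioc_of_bdd (A.measurable_cut_path (b := b) ha k ω)
    (fun r => A.cut_abs_le a b k r ω) a b
  exact IntegrableOn.congr_fun h (fun r hr => by simp [_root_.cut, hr]) measurableSet_Ioc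

lemma BddProg.const {F : ℝ → MeasurableSpace Ω} {v : Fin d → ℝ → ℝ} {C : ℝ}
    (hv : ∀ k, Measurable (v k)) (hC : ∀ k r, |v k r| ≤ C) :
    BddProg F (fun k r (_ : Ω) => v k r) C :=
  ⟨fun k s _ => by
    let _ := F s
    exact (hv k).comp (measurable_subtype_coe.comp measurable_fst), fun k r _ => hC k r⟩

lemma setIntegral_Ioc_split {f : ℝ → ℝ} {a s b : ℝ} (has : a ≤ s) (hsb : s ≤ b)
    (h1 : IntegrableOn f (Ioc a s)) (h2 : IntegrableOn f (Ioc s b)) :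
    ∫ r in Ioc a b, f r = (∫ r in Ioc a s, f r) + ∫ r in Ioc s b, f r := by
  rw [← Ioc_union_Ioc_eq_Ioc has hsb]
  exact setIntegral_union (Ioc_disjoint_Ioc_of_le le_rfl) measurableSet_Ioc h1 h2

section

variable {P : Measure Ω} {F : ℝ → MeasurableSpace Ω} {B : ℝ → Ω → Fin d → ℝ}
  {θ : Fin d → ℝ → Ω → ℝ} {C T : ℝ} {J : Ω → ℝ}

lemma BddProg.sq (A : BddProg F θ C) : BddProg F (fun k r ω => θ k r ω ^ 2) (C * C) := by
  simpa only [pow_two] using A.mul A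

lemma BddProg.quad_split (A : BddProg F θ C) {a s b : ℝ} (ha : 0 ≤ a) (has : a ≤ s) (hsb : s ≤ b)
    (ω : Ω) : quad a b θ ω = quad a s θ ω + quad s b θ ω := by
  unfold quad
  rw [← Finset.sum_add_distrib]
  exact Finset.sum_congr rfl fun k _ => setIntegral_Ioc_split has hsb
    (A.sq.integrableOn ha k ω s) (A.sq.integrableOn (ha.trans has) k ω b)

lemma cut_add_cut {a s b : ℝ} (has : a ≤ s) (hsb : s ≤ b) (k : Fin d) (r : ℝ) (ω : Ω) :
    cut a s θ k r ω + cut s b θ k r ω = cut a b θ k r ω := by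
  unfold cut
  rw [← Ioc_union_Ioc_eq_Ioc has hsb,
    indicator_union_of_disjoint (Ioc_disjoint_Ioc_of_le le_rfl)]

lemma BddProg.exists_isIto' [IsProbabilityMeasure P] (S : BMSetup P F B) (A : BddProg F θ C)
    {a b : ℝ} (ha : 0 ≤ a) (hab : a ≤ b) : ∃ J, IsIto P F B a b (_root_.cut a b θ) J := by
  rcases hab.eq_or_lt with rfl | h
  · exact ⟨_, isIto_of_le le_rfl⟩
  · exact (A.exists_isIto S ha h).imp fun _ h => h.1

lemma IsIto.append [IsProbabilityMeasure P] (S : BMSetup P F B) {a s b : ℝ} (ha : 0 ≤ a)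
    (has : a ≤ s) (hsb : s ≤ b) {J₁ J₂ : Ω → ℝ} (H₁ : IsIto P F B a s (cut a s θ) J₁)
    (H₂ : IsIto P F B s b (cut s b θ) J₂) :
    IsIto P F B a b (cut a b θ) (fun ω => J₁ ω + J₂ ω) := by
  have := (H₁.mono le_rfl hsb).add S ha (H₂.mono has le_rfl)
  simpa only [cut_add_cut has hsb] using this

lemma BMSetup.isIto_const [IsProbabilityMeasure P] (S : BMSetup P F B) {a s t b : ℝ} (ha : 0 ≤ a)
    (has : a ≤ s) (hst : s ≤ t) (htb : t ≤ b) (u : Fin d → ℝ) :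
    IsIto P F B a b (fun k r _ => (Ioc s t).indicator (fun _ => u k) r)
      (fun ω => ∑ k, u k * (B t ω k - B s ω k)) := by
  have := IsIto.sum S ha (a := a) (b := b) Finset.univ (h := fun j k r (_ : Ω) =>
    if k = j then (Ioc s t).indicator (fun _ => u j) r else 0)
    (J := fun j ω => u j * (B t ω j - B s ω j)) fun j _ =>
    IsIto.of_mem S ha (p := (_, _)) (Submodule.subset_span
      ⟨j, s, t, |u j|, fun _ => u j, has, hst, htb, measurable_const, fun _ => le_rfl, rfl⟩)
  simpa using this

/-- The measure with density the stochastic exponential of `θ`. -/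
def girP (P : Measure Ω) (T : ℝ) (θ : Fin d → ℝ → Ω → ℝ) (J : Ω → ℝ) : Measure Ω :=
  P.withDensity fun ω => ENNReal.ofReal (expI 0 T θ J ω)

/-- The Brownian motion shifted by the drift `θ`. -/
def girB (B : ℝ → Ω → Fin d → ℝ) (T : ℝ) (θ : Fin d → ℝ → Ω → ℝ) (t : ℝ) (ω : Ω) (k : Fin d) : ℝ :=
  B t ω k - ∫ r in Ioc 0 t, cut 0 T θ k r ω

lemma girP_absolutelyContinuous : girP P T θ J ≪ P := withDensity_absolutelyContinuous _ _

variable [IsProbabilityMeasure P]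

lemma isProbabilityMeasure_girP (S : BMSetup P F B) (A : BddProg F θ C) (hT : 0 ≤ T)
    (H : IsIto P F B 0 T (cut 0 T θ) J) : IsProbabilityMeasure (girP P T θ J) := by
  have := H.lintegral_mul_expI S A le_rfl hT (Y := fun _ => 1) (AEM.of_measurable measurable_const)
  exact ⟨by simpa [girP] using this⟩

lemma continuous_girB (S : BMSetup P F B) (A : BddProg F θ C) (ω : Ω) :
    Continuous fun t => girB B T θ t ω := by
  refine continuous_pi fun k => ?_
  have h1 : Continuous fun t => B t ω k := (continuous_apply k).comp (S.bm.2.1 ω)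
  have h2 : ∀ t, ∫ r in Ioc 0 t, cut 0 T θ k r ω = ∫ r in (0 : ℝ)..(max t 0), cut 0 T θ k r ω := by
    intro t
    rw [intervalIntegral.integral_of_le (le_max_right _ _)]
    rcases le_total t 0 with h | h
    · simp [h]
    · rw [max_eq_left h]
  simp only [girB, h2]
  refine h1.sub ((intervalIntegral.continuous_primitive (fun a b => ?_) 0).comp
    (continuous_id.max continuous_const))
  have hi := fun a b => integrableOn_Ioc_of_bdd (A.measurable_cut_path (b := T) le_rfl k ω)
    (fun r => A.cut_abs_le 0 T k r ω) a b
  exact ⟨hi a b, hi b a⟩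

lemma girB_sub (A : BddProg F θ C) {s t : ℝ} (hs : 0 ≤ s) (hst : s ≤ t) (ω : Ω) (k : Fin d) :
    girB B T θ t ω k - girB B T θ s ω k
      = B t ω k - B s ω k - ∫ r in Ioc s t, cut 0 T θ k r ω := by
  simp only [girB]
  rw [setIntegral_Ioc_split hs hst ((A.cut 0 T).integrableOn le_rfl k ω s)
    ((A.cut 0 T).integrableOn hs k ω t)]
  ring

lemma measurable_girB (S : BMSetup P F B) (A : BddProg F θ C) {s : ℝ} (hs : 0 ≤ s) :
    Measurable[F s] (girB B T θ s) := by
  refine @measurable_pi_lambda _ _ _ (F s) _ _ fun k => ?_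
  exact Measurable.sub (m := F s) ((measurable_pi_apply k).comp (S.measurable_B hs))
    ((A.cut 0 T).measurable_integral le_rfl k)

/-- The exponential moments of the shifted increments. -/
lemma lintegral_exp_girB (S : BMSetup P F B) (A : BddProg F θ C) (hT : 0 ≤ T)
    (H : IsIto P F B 0 T (cut 0 T θ) J) {s t : ℝ} (hs : 0 ≤ s) (hst : s < t) {D : Set Ω}
    (hD : MeasurableSet[F s] D) (u : Fin d → ℝ) :
    ∫⁻ ω in D, ENNReal.ofReal (Real.exp (∑ j, u j * (girB B T θ t ω - girB B T θ s ω) j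
      - (t - s) / 2 * ∑ j, u j ^ 2)) ∂(girP P T θ J) = girP P T θ J D := by
  set b := max T t with hb
  have hsb : s ≤ b := hst.le.trans (le_max_right _ _)
  set θc := cut 0 T θ with hθc
  have Ac : BddProg F θc C := A.cut 0 T
  obtain ⟨J₁, H₁⟩ := Ac.exists_isIto' S le_rfl hs
  obtain ⟨J₂, H₂⟩ := Ac.exists_isIto' S hs hsb
  have hJ : J =ᵐ[P] fun ω => J₁ ω + J₂ ω := by
    refine (H.mono le_rfl (le_max_left T t)).ae_unique S le_rfl (H₁.append S le_rfl hs hsb H₂)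
      fun k => Eventually.of_forall fun x => ?_
    rw [hθc, cut_cut' le_rfl (le_max_left T t)]
  have key : ∀ u : Fin d → ℝ, ∫⁻ ω in D, ENNReal.ofReal (Real.exp
      (∑ j, u j * (girB B T θ t ω - girB B T θ s ω) j
        - (t - s) / 2 * ∑ j, u j ^ 2)) ∂(girP P T θ J)
      = ∫⁻ ω, D.indicator (fun ω => ENNReal.ofReal (expI 0 s θc J₁ ω)) ω ∂P := by
    intro u
    set v : Fin d → ℝ → Ω → ℝ := fun k r _ => (Ioc s t).indicator (fun _ => u k) r with hv
    have Av : BddProg F v (∑ k, |u k|) := BddProg.const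
      (fun k => measurable_const.indicator measurableSet_Ioc) fun k r => by
        by_cases hr : r ∈ Ioc s t
        · simpa [hr] using Finset.single_le_sum (f := fun k => |u k|)
            (fun _ _ => abs_nonneg _) (Finset.mem_univ k)
        · simpa [hr] using Finset.sum_nonneg fun k (_ : k ∈ Finset.univ) => abs_nonneg (u k)
    have A' := Ac.add Av
    have H' : IsIto P F B s b (cut s b fun k r ω => θc k r ω + v k r ω)
        (fun ω => J₂ ω + ∑ k, u k * (B t ω k - B s ω k)) := by
      have := H₂.add S hs (S.isIto_const hs le_rfl hst.le (le_max_right T t) u)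
      refine this.congr (fun k => Eventually.of_forall fun x => ?_) (ae_eq_refl _)
      by_cases hx : x.1 ∈ Ioc s b
      · simp [cut, hx, v]
      · have : x.1 ∉ Ioc s t := fun h => hx ⟨h.1, h.2.trans (le_max_right _ _)⟩
        simp [cut, hx, this]
    have hY : AEM (F s) P (D.indicator (fun ω => ENNReal.ofReal (expI 0 s θc J₁ ω))) := by
      obtain ⟨f, hf, hfe⟩ := H₁.aem_expI S Ac le_rfl hs
      refine ⟨D.indicator fun ω => ENNReal.ofReal (f ω),
        Measurable.indicator (m := F s) (ENNReal.measurable_ofReal.comp hf) hD, ?_⟩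
      filter_upwards [hfe] with ω hω
      simp only [indicator, hω]
    rw [← H'.lintegral_mul_expI S A' hs hsb hY, girP, restrict_withDensity (S.le _ _ hD),
      lintegral_withDensity_eq_lintegral_mul₀
        (aemeasurable_expI S.le A le_rfl H.aemJ).ennreal_ofReal.restrict (by
          refine Measurable.aemeasurable ?_
          have h1 := ((measurable_girB (T := T) S A (hs.trans hst.le)).mono (S.le _) le_rfl).sub
            ((measurable_girB (T := T) S A hs).mono (S.le _) le_rfl)
          have : Measurable fun x : Fin d → ℝ => ENNReal.ofReal (Real.exp (∑ j, u j * x j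
            - (t - s) / 2 * ∑ j, u j ^ 2)) := by fun_prop
          exact this.comp h1), ← lintegral_indicator (S.le _ _ hD)]
    refine lintegral_congr_ae ?_
    filter_upwards [hJ] with ω hω
    by_cases hωD : ω ∈ D
    swap
    · simp [hωD]
    simp only [hωD, indicator_of_mem, Pi.mul_apply]
    rw [← ENNReal.ofReal_mul (expI_pos _ _ _ _ _).le, ← ENNReal.ofReal_mul (expI_pos _ _ _ _ _).le]
    congr 1
    unfold expI
    rw [← Real.exp_add, ← Real.exp_add]
    congr 1
    have q1 : quad 0 T θ ω = quad 0 s θc ω + quad s b θc ω := by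
      rw [← Ac.quad_split le_rfl hs hsb, Ac.quad_split le_rfl hT (le_max_left T t),
        hθc, quad_cut]
      have : quad T b (cut 0 T θ) ω = 0 := by
        refine (quad_congr (η := fun _ _ _ => 0) fun k r hr => ?_).trans (by simp [quad])
        have : r ∉ Ioc 0 T := fun h => absurd hr.1 (not_lt.2 h.2)
        simp [cut, this]
      rw [this, add_zero]
    have hstb : Ioc s t ⊆ Ioc s b := Ioc_subset_Ioc_right (le_max_right _ _)
    have q2 : quad s b (fun k r ω => θc k r ω + v k r ω) ω = quad s b θc ω
        + ∑ k, (2 * u k * ∫ r in Ioc s t, θc k r ω) + ∑ k, (t - s) * u k ^ 2 := by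
      unfold quad
      rw [← Finset.sum_add_distrib, ← Finset.sum_add_distrib]
      refine Finset.sum_congr rfl fun k _ => ?_
      have e : ∀ r, (θc k r ω + v k r ω) ^ 2 = θc k r ω ^ 2
          + ((Ioc s t).indicator (fun r => 2 * u k * θc k r ω) r
          + (Ioc s t).indicator (fun _ => u k ^ 2) r) := by
        intro r
        by_cases hr : r ∈ Ioc s t
        · simp only [v, hr, indicator_of_mem]; ring
        · simp [v, hr]
      have i1 := Ac.sq.integrableOn hs k ω b
      have i2 : IntegrableOn ((Ioc s t).indicator (fun r => 2 * u k * θc k r ω)) (Ioc s b) := by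
        have : IntegrableOn (fun r => 2 * u k * θc k r ω) (Ioc s t) :=
          (Ac.integrableOn hs k ω t).const_mul (2 * u k)
        exact (this.integrable_indicator measurableSet_Ioc).integrableOn
      have i3 : IntegrableOn ((Ioc s t).indicator (fun _ => u k ^ 2)) (Ioc s b) := by
        refine IntegrableOn.integrable_indicator ?_ measurableSet_Ioc |>.integrableOn
        simp
      simp_rw [e]
      rw [integral_add (f := fun r => θc k r ω ^ 2) (g := fun r => (Ioc s t).indicator
          (fun r => 2 * u k * θc k r ω) r + (Ioc s t).indicator (fun _ => u k ^ 2) r)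
          i1 (i2.add i3), integral_add i2 i3, setIntegral_indicator measurableSet_Ioc,
        setIntegral_indicator measurableSet_Ioc, inter_eq_self_of_subset_right hstb,
        integral_const_mul]
      simp [hst.le]
      ring
    rw [q1, q2, hω]
    simp only [Pi.sub_apply]
    simp_rw [girB_sub A hs hst.le]
    simp only [mul_sub, Finset.sum_sub_distrib, mul_assoc, ← Finset.mul_sum, hθc]
    ring
  rw [key u, ← key 0]
  simp

/-- **Girsanov's theorem** for bounded integrands. -/
theorem girsanov (S : BMSetup P F B) (A : BddProg F θ C) (hT : 0 ≤ T)
    (H : IsIto P F B 0 T (cut 0 T θ) J) : BMSetup (girP P T θ J) F (girB B T θ) := by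
  have := isProbabilityMeasure_girP S A hT H
  refine ⟨S.mono, S.le, fun ω => ?_, continuous_girB S A, fun s hs => measurable_girB S A hs,
    fun s t hs hst => ?_⟩
  · ext k
    simp [girB, S.bm.1 ω]
  · exact map_eq_and_indep_of_lintegral_exp (m := F s) (P := girP P T θ J)
      (D := fun ω => girB B T θ t ω - girB B T θ s ω)
      (((measurable_girB S A (hs.trans hst.le)).mono (S.le _) le_rfl).sub
        ((measurable_girB S A hs).mono (S.le _) le_rfl)) (sub_nonneg.2 hst.le)
      fun E hE u => lintegral_exp_girB S A hT H hs hst hE u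

end

end

/-! ### Itô integrals under a change of measure -/

section

variable {Ω : Type*} [mΩ : MeasurableSpace Ω] {d : ℕ}

/-- The time integral over `(a, b]` of the pointwise scalar product of two processes. -/
def dotI (a b : ℝ) (h θ : Fin d → ℝ → Ω → ℝ) (ω : Ω) : ℝ :=
  ∑ k, ∫ r in Ioc a b, h k r ω * θ k r ω

lemma dotI_congr {a b : ℝ} {h h' θ θ' : Fin d → ℝ → Ω → ℝ} {ω : Ω}
    (e : ∀ k, ∀ r ∈ Ioc a b, h k r ω = h' k r ω) (e' : ∀ k, ∀ r ∈ Ioc a b, θ k r ω = θ' k r ω) :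
    dotI a b h θ ω = dotI a b h' θ' ω :=
  Finset.sum_congr rfl fun k _ => setIntegral_congr_fun measurableSet_Ioc fun r hr => by
    simp only [e k r hr, e' k r hr]

lemma dotI_cut {a b : ℝ} {h θ : Fin d → ℝ → Ω → ℝ} {ω : Ω} :
    dotI a b (cut a b h) θ ω = dotI a b h θ ω :=
  dotI_congr (fun k r hr => by simp [cut, hr]) fun _ _ _ => rfl

lemma dotI_self {a b : ℝ} {h : Fin d → ℝ → Ω → ℝ} {ω : Ω} : dotI a b h h ω = quad a b h ω := by
  simp [dotI, quad, pow_two]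

lemma BddProg.mono {F : ℝ → MeasurableSpace Ω} {θ : Fin d → ℝ → Ω → ℝ} {C C' : ℝ}
    (A : BddProg F θ C) (h : C ≤ C') : BddProg F θ C' :=
  ⟨A.prog, fun k r ω => (A.bdd k r ω).trans h⟩

lemma tendstoInMeasure_of_absolutelyContinuous {E : Type*} [PseudoEMetricSpace E] {μ ν : Measure Ω}
    [IsFiniteMeasure μ] [IsFiniteMeasure ν] (hν : ν ≪ μ) {f : ℕ → Ω → E} {g : Ω → E}
    (hf : ∀ n, AEStronglyMeasurable (f n) μ) (h : TendstoInMeasure μ f atTop g) :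
    TendstoInMeasure ν f atTop g := by
  refine (exists_seq_tendstoInMeasure_atTop_iff fun n => (hf n).mono_ac hν).2 fun ns hns => ?_
  obtain ⟨ns', h1, h2⟩ := (exists_seq_tendstoInMeasure_atTop_iff hf).1 h ns hns
  exact ⟨ns', h1, hν.ae_le h2⟩

section

variable {P : Measure Ω} {F : ℝ → MeasurableSpace Ω} {B : ℝ → Ω → Fin d → ℝ}
  {θ h : Fin d → ℝ → Ω → ℝ} {C D T a b : ℝ} {J I : Ω → ℝ} [IsProbabilityMeasure P]

lemma stepInt_girB (A : BddProg F θ C) {t : ℕ → ℝ} {N : ℕ} {ξ : ℕ → Ω → Fin d → ℝ}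
    (ht : Monotone t) (h0 : 0 ≤ t 0) (ω : Ω) :
    stepInt (girB B T θ) t N ξ ω
      = stepInt B t N ξ ω - dotI (t 0) (t N) (stepProc t N ξ) (cut 0 T θ) ω := by
  have e : dotI (t 0) (t N) (stepProc t N ξ) (cut 0 T θ) ω = ∑ i ∈ Finset.range N, ∑ k,
      ξ i ω k * ∫ r in Ioc (t i) (t (i + 1)), cut 0 T θ k r ω := by
    rw [Finset.sum_comm]
    exact Finset.sum_congr rfl fun k _ => sum_setIntegral_eq_stepProc ht N ξ k ω
      ((A.cut 0 T).integrableOn h0 k ω (t N)) (fun x => x)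
  rw [e]
  unfold stepInt
  rw [← Finset.sum_sub_distrib]
  refine Finset.sum_congr rfl fun i _ => ?_
  rw [← Finset.sum_sub_distrib]
  refine Finset.sum_congr rfl fun k _ => ?_
  rw [girB_sub A (h0.trans (ht (Nat.zero_le i))) (ht (Nat.le_succ i))]
  ring

/-- Stochastic integrals under a change of measure. -/
theorem IsIto.girsanov (S : BMSetup P F B) (A : BddProg F θ C) (hT : 0 ≤ T)
    (H : IsIto P F B 0 T (cut 0 T θ) J) (Ah : BddProg F h D) (ha : 0 ≤ a) (hab : a ≤ b)
    (HI : IsIto P F B a b (cut a b h) I) :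
    IsIto (girP P T θ J) F (girB B T θ) a b (cut a b h)
      (fun ω => I ω - dotI a b h (cut 0 T θ) ω) := by
  have := isProbabilityMeasure_girP S A hT H
  have S' := _root_.girsanov S A hT H
  have hac : girP P T θ J ≪ P := girP_absolutelyContinuous
  rcases hab.eq_or_lt with rfl | hab
  · refine (isIto_of_le le_rfl).congr (fun k => ae_eq_refl _) ?_
    filter_upwards [hac.ae_le (HI.ae_unique S ha (isIto_of_le le_rfl) fun k => ae_eq_refl _)]
      with ω hω
    simp [hω, dotI]
  obtain ⟨I', H', hI'⟩ := Ah.exists_isIto S' ha hab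
  refine H'.congr (fun k => ae_eq_refl _) ?_
  have hst := fun N => Ah.stepAdapted ha hab.le N
  have hAm := Ah.mono (le_max_right C D)
  have Am := (A.mono (le_max_left C D)).cut 0 T
  have hAm' := (Ah.cut a b).mono (le_max_right C D)
  have m1 : ∀ N, Measurable (stepInt B (grid a b N) (N + 1) (progStep a b h N)) := fun N =>
    ((hst N).measurable_stepInt S).mono (S.le _) le_rfl
  have m1' : ∀ N, Measurable (stepInt (girB B T θ) (grid a b N) (N + 1) (progStep a b h N)) :=
    fun N => ((hst N).measurable_stepInt S').mono (S.le _) le_rfl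
  have m2 : ∀ N k, Measurable (fun x : ℝ × Ω =>
      stepProc (grid a b N) (N + 1) (progStep a b h N) k x.1 x.2) := fun N k =>
    measurable_stepProc (fun i hi => ((hst N).meas i hi).mono (S.le _) le_rfl) k
  have hθm : ∀ k, Measurable (fun x : ℝ × Ω => cut 0 T θ k x.1 x.2) :=
    A.measurable_cut_top S.le le_rfl
  have hhm : ∀ k, Measurable (fun x : ℝ × Ω => cut a b h k x.1 x.2) :=
    Ah.measurable_cut_top S.le ha
  have mdot : ∀ {u : Fin d → ℝ → Ω → ℝ}, (∀ k, Measurable (fun x : ℝ × Ω => u k x.1 x.2)) →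
      Measurable (dotI a b u (cut 0 T θ)) := fun hu =>
    Finset.measurable_fun_sum _ fun k _ =>
      measurable_setIntegral_left ((hu k).mul (hθm k)) (Ioc a b)
  rcases isEmpty_or_nonempty Ω with hΩ | ⟨⟨ω₀⟩⟩
  · exact Eventually.of_forall fun ω => hΩ.elim ω
  rcases Nat.eq_zero_or_pos d with rfl | hd
  · have h1 : IsIto P F B a b (cut a b h) (fun _ => 0) :=
      IsIto.zero.congr (fun k => k.elim0) (ae_eq_refl _)
    have h2 : IsIto (girP P T θ J) F (girB B T θ) a b (cut a b h) (fun _ => 0) :=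
      IsIto.zero.congr (fun k => k.elim0) (ae_eq_refl _)
    filter_upwards [hac.ae_le (HI.ae_unique S ha h1 fun k => ae_eq_refl _),
      H'.ae_unique S' ha h2 fun k => ae_eq_refl _] with ω h1 h2
    simp [h1, h2, dotI]
  have hD : 0 ≤ D := (abs_nonneg _).trans (Ah.bdd ⟨0, hd⟩ 0 ω₀)
  have lim1 : TendstoInMeasure P (fun N => dotI a b
      (stepProc (grid a b N) (N + 1) (progStep a b h N)) (cut 0 T θ)) atTop
      (dotI a b (cut a b h) (cut 0 T θ)) := by
    refine tendstoInMeasure_of_sqn (fun N => (mdot (m2 N)).aemeasurable) (mdot hhm).aemeasurable ?_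
    have h5 := fun N => sqn_integral_mul_sub_le (P := P) (a := a) (b := b) (m2 N) hhm hθm
      Am.bdd (fun k r ω => ((hst N).abs_stepProc_le hD k r ω).trans (le_max_right C D)) hAm'.bdd
    have h6 := tendsto_finsetSum Finset.univ fun k (_ : k ∈ Finset.univ) =>
      Ah.tendsto_sqn (P := P) S.le ha hab k
    rw [Finset.sum_const_zero] at h6
    have h7 := ENNReal.Tendsto.const_mul (a := d * (ENNReal.ofReal (b - a) *
      ENNReal.ofReal (max C D ^ 2))) h6 (Or.inr (ENNReal.mul_ne_top (by simp)
        (ENNReal.mul_ne_top ENNReal.ofReal_ne_top ENNReal.ofReal_ne_top)))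
    rw [mul_zero] at h7
    exact tendsto_of_tendsto_of_tendsto_of_le_of_le tendsto_const_nhds h7 (fun _ => zero_le) h5
  have lim2 := tendstoInMeasure_of_sqn (fun N => (m1 N).aemeasurable) HI.aemJ
    (HI.tendsto_stepInt S Ah ha hab)
  have lim3 := tendstoInMeasure_of_absolutelyContinuous hac
    (fun N => (mdot (m2 N)).aestronglyMeasurable) lim1
  have lim4 := tendstoInMeasure_of_absolutelyContinuous hac
    (fun N => (m1 N).aestronglyMeasurable) lim2
  have lim5 := tendstoInMeasure_of_sqn (fun N => (m1' N).aemeasurable) H'.aemJ hI'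
  obtain ⟨n₁, hn₁, e₁⟩ := lim3.exists_seq_tendsto_ae
  obtain ⟨n₂, hn₂, e₂⟩ := (lim4.comp hn₁.tendsto_atTop).exists_seq_tendsto_ae
  obtain ⟨n₃, hn₃, e₃⟩ :=
    ((lim5.comp hn₁.tendsto_atTop).comp hn₂.tendsto_atTop).exists_seq_tendsto_ae
  filter_upwards [e₁, e₂, e₃] with ω h1 h2 h3
  refine tendsto_nhds_unique h3 (((h2.comp hn₃.tendsto_atTop).sub
    ((h1.comp hn₂.tendsto_atTop).comp hn₃.tendsto_atTop)).congr' ?_ |>.trans (le_of_eq ?_))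
  · refine Eventually.of_forall fun N => ?_
    have := stepInt_girB (B := B) (T := T) A (hst (n₁ (n₂ (n₃ N)))).mono
      (hst (n₁ (n₂ (n₃ N)))).nonneg (N := n₁ (n₂ (n₃ N)) + 1)
      (ξ := progStep a b h (n₁ (n₂ (n₃ N)))) ω
    simp only [Function.comp_apply]
    rw [this, grid_zero, grid_last]
  · rw [dotI_cut]

end

end

/-! ### Weak solutions with bounded drift -/

section

variable {Ω : Type*} [mΩ : MeasurableSpace Ω] {n d : ℕ}

/-- The `i`-th row of the diffusion coefficient along the process `X`. -/
def rowProc (σ : ℝ → (Fin n → ℝ) → Matrix (Fin n) (Fin d) ℝ) (X : ℝ → Ω → Fin n → ℝ) (i : Fin n)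
    (k : Fin d) (r : ℝ) (ω : Ω) : ℝ := σ r (X r ω) i k

/-- Boundedness, measurability and Lipschitz continuity of a diffusion coefficient. -/
structure GoodCoeff (σ : ℝ → (Fin n → ℝ) → Matrix (Fin n) (Fin d) ℝ) (C L : ℝ) : Prop where
  bdd : ∀ s x i j, |σ s x i j| ≤ C
  meas : ∀ i j, Measurable fun p : ℝ × (Fin n → ℝ) => σ p.1 p.2 i j
  lip : ∀ s x y i j, |σ s x i j - σ s y i j| ≤ L * dist x y

/-- A weak solution with drift `σ β`, together with the convergence of the Riemann sums of its
diffusion coefficient. -/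
structure Sys (T : ℝ) (x₀ : Fin n → ℝ) (σ : ℝ → (Fin n → ℝ) → Matrix (Fin n) (Fin d) ℝ)
    (P : Measure Ω) (F : ℝ → MeasurableSpace Ω) (B : ℝ → Ω → Fin d → ℝ) (X : ℝ → Ω → Fin n → ℝ)
    (β : Fin d → ℝ → Ω → ℝ) : Prop where
  bm : BMSetup P F B
  X_cont : ∀ ω, Continuous fun s => X s ω
  X_prog : ProgMeas F X
  β_prog : ∃ C, BddProg F β C
  ito : ∀ s ∈ Icc (0 : ℝ) T, ∀ i, IsIto P F B 0 s (cut 0 s (rowProc σ X i))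
    (fun ω => X s ω i - x₀ i - dotI 0 s (rowProc σ X i) β ω)
  riem : ∀ s ∈ Icc (0 : ℝ) T, ∀ i k, Tendsto (fun N => sqn (volume.prod P) (fun x : ℝ × Ω =>
    stepProc (grid 0 s N) (N + 1) (fun j ω k => rowProc σ X i k (grid 0 s N j) ω) k x.1 x.2
      - cut 0 s (rowProc σ X i) k x.1 x.2)) atTop (nhds 0)

lemma ProgMeas.comp_pair {E E' : Type*} [MeasurableSpace E] [MeasurableSpace E']
    {F : ℝ → MeasurableSpace Ω} {X : ℝ → Ω → E} (hX : ProgMeas F X) {f : ℝ × E → E'}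
    (hf : Measurable f) : ProgMeas F (fun r ω => f (r, X r ω)) := fun s hs => by
  let _ := F s
  exact hf.comp ((measurable_subtype_coe.comp measurable_fst).prodMk (hX s hs))

lemma ProgMeas.measurable {E : Type*} [MeasurableSpace E]
    {F : ℝ → MeasurableSpace Ω} {X : ℝ → Ω → E} (hX : ProgMeas F X) {s : ℝ} (hs : 0 ≤ s) :
    Measurable[F s] (X s) := by
  let _ := F s
  exact (hX s hs).comp ((measurable_const (a := (⟨s, hs, le_rfl⟩ : Icc (0:ℝ) s))).prodMk
    measurable_id)

lemma GoodCoeff.bddProg {σ : ℝ → (Fin n → ℝ) → Matrix (Fin n) (Fin d) ℝ} {C L : ℝ}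
    (G : GoodCoeff σ C L) {F : ℝ → MeasurableSpace Ω} {X : ℝ → Ω → Fin n → ℝ} (hX : ProgMeas F X)
    (i : Fin n) : BddProg F (rowProc σ X i) C :=
  ⟨fun k => hX.comp_pair (G.meas i k), fun _ _ _ => G.bdd _ _ _ _⟩

lemma GoodCoeff.stepAdapted {σ : ℝ → (Fin n → ℝ) → Matrix (Fin n) (Fin d) ℝ} {C L : ℝ}
    (G : GoodCoeff σ C L) {F : ℝ → MeasurableSpace Ω} {X : ℝ → Ω → Fin n → ℝ} (hX : ProgMeas F X)
    (i : Fin n) {s : ℝ} (hs : 0 ≤ s) (N : ℕ) : StepAdapted F (grid 0 s N) (N + 1)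
      (fun j ω k => rowProc σ X i k (grid 0 s N j) ω) C where
  mono := grid_mono hs
  nonneg := by rw [grid_zero]
  meas j _ := by
    have h0 : 0 ≤ grid 0 s N j := (grid_zero (a := 0) (b := s) (N := N)).symm.le.trans (grid_mono hs (Nat.zero_le j))
    refine @measurable_pi_lambda _ _ _ (F _) _ _ fun k => ?_
    exact ((G.bddProg hX i).prog k).measurable h0
  bdd _ _ _ _ := G.bdd _ _ _ _

lemma tendsto_sqn_of_absolutelyContinuous {α : Type*} [MeasurableSpace α] {μ ν : Measure α}
    (hν : ν ≪ μ) {u : ℕ → α → ℝ} {C : ℝ} {s : Set α} (hs : MeasurableSet s) (hs' : ν s ≠ ⊤)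
    (hu : ∀ N, AEMeasurable (u N) μ) (hC : ∀ N x, |u N x| ≤ C) (h0 : ∀ N, ∀ x ∉ s, u N x = 0)
    (h : Tendsto (fun N => sqn μ (u N)) atTop (nhds 0)) :
    Tendsto (fun N => sqn ν (u N)) atTop (nhds 0) := by
  refine tendsto_of_subseq_tendsto fun ns hns => ?_
  have h1 : TendstoInMeasure μ (fun N => u (ns N)) atTop (fun _ => 0) :=
    tendstoInMeasure_of_sqn (fun N => hu _) aemeasurable_const (by simpa [Function.comp_def] using h.comp hns)
  obtain ⟨ms, -, h2⟩ := h1.exists_seq_tendsto_ae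
  refine ⟨ms, ?_⟩
  have h3 := hν.ae_le h2
  have : Tendsto (fun N => ∫⁻ x, ENNReal.ofReal (u (ns (ms N)) x ^ 2) ∂ν) atTop
      (nhds (∫⁻ _, 0 ∂ν)) := by
    refine tendsto_lintegral_of_dominated_convergence' (s.indicator fun _ => ENNReal.ofReal (C ^ 2))
      (fun N => (((hu _).mono_ac hν).pow_const 2).ennreal_ofReal)
      (fun N => Eventually.of_forall fun x => ?_) ?_ ?_
    · by_cases hx : x ∈ s
      · simp only [hx, indicator_of_mem]
        refine ENNReal.ofReal_le_ofReal ?_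
        rw [← sq_abs]
        exact pow_le_pow_left₀ (abs_nonneg _) (hC _ _) 2
      · simp [hx, h0 _ x hx]
    · rw [lintegral_indicator hs]
      simp [ENNReal.mul_ne_top, hs']
    · filter_upwards [h3] with x hx
      have := (ENNReal.continuous_ofReal.tendsto _).comp (hx.pow 2)
      simpa [Function.comp_def] using this
  simpa [sqn] using this

lemma tendstoInMeasure_pi {ι : Type*} [Fintype ι] {μ : Measure Ω} {f : ℕ → Ω → ι → ℝ}
    {g : Ω → ι → ℝ} (h : ∀ i, TendstoInMeasure μ (fun N ω => f N ω i) atTop fun ω => g ω i) :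
    TendstoInMeasure μ f atTop g := by
  intro ε hε
  have h1 := tendsto_finsetSum Finset.univ fun i (_ : i ∈ Finset.univ) => h i ε hε
  rw [Finset.sum_const_zero] at h1
  refine tendsto_of_tendsto_of_tendsto_of_le_of_le tendsto_const_nhds h1 (fun _ => zero_le)
    fun N => ?_
  refine (measure_mono fun ω hω => ?_).trans (measure_biUnion_finset_le Finset.univ fun i =>
    {ω | ε ≤ edist (f N ω i) (g ω i)})
  simp only [mem_ofPred_eq, edist_pi_def] at hω
  by_contra hcon
  simp only [Finset.mem_univ, iUnion_true, mem_iUnion, mem_ofPred_eq, not_exists, not_le] at hcon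
  exact absurd ((Finset.sup_lt_iff hε).2 fun i _ => hcon i) (not_lt.2 hω)

namespace Sys

variable {T : ℝ} {x₀ : Fin n → ℝ} {σ : ℝ → (Fin n → ℝ) → Matrix (Fin n) (Fin d) ℝ}
    {P : Measure Ω} [IsProbabilityMeasure P] {F : ℝ → MeasurableSpace Ω} {B : ℝ → Ω → Fin d → ℝ}
    {X : ℝ → Ω → Fin n → ℝ} {β θ : Fin d → ℝ → Ω → ℝ} {C L D : ℝ} {J : Ω → ℝ}

lemma stepProc_sub_cut_eq_zero (G : GoodCoeff σ C L) (hX : ProgMeas F X) {s : ℝ} (hs : 0 ≤ s)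
    (i : Fin n) (k : Fin d) (N : ℕ) {r : ℝ} (hr : r ∉ Ioc 0 s) (ω : Ω) :
    stepProc (grid 0 s N) (N + 1) (fun j ω k => rowProc σ X i k (grid 0 s N j) ω) k r ω
      - cut 0 s (rowProc σ X i) k r ω = 0 := by
  rw [StepAdapted.stepProc_eq_zero (G.stepAdapted hX i hs N).mono (by rwa [grid_zero, grid_last])]
  simp [cut, hr]

theorem girsanov (Y : Sys T x₀ σ P F B X β) (G : GoodCoeff σ C L) (A : BddProg F θ D) (hT : 0 ≤ T)
    (H : IsIto P F B 0 T (cut 0 T θ) J) :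
    Sys T x₀ σ (girP P T θ J) F (girB B T θ) X (fun k r ω => β k r ω + θ k r ω) := by
  have := isProbabilityMeasure_girP Y.bm A hT H
  obtain ⟨Cβ, hβ⟩ := Y.β_prog
  refine ⟨_root_.girsanov Y.bm A hT H, Y.X_cont, Y.X_prog, ⟨_, hβ.add A⟩, fun s hs i => ?_,
    fun s hs i k => ?_⟩
  · have Ai := G.bddProg Y.X_prog i
    refine (IsIto.girsanov Y.bm A hT H Ai le_rfl hs.1 (Y.ito s hs i)).congr (fun k => ae_eq_refl _)
      (Eventually.of_forall fun ω => ?_)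
    have e1 : dotI 0 s (rowProc σ X i) (cut 0 T θ) ω = dotI 0 s (rowProc σ X i) θ ω :=
      dotI_congr (fun _ _ _ => rfl) fun k r hr => by simp [cut, hr.1, hr.2.trans hs.2]
    have e2 : dotI 0 s (rowProc σ X i) (fun k r ω => β k r ω + θ k r ω) ω
        = dotI 0 s (rowProc σ X i) β ω + dotI 0 s (rowProc σ X i) θ ω := by
      unfold dotI
      rw [← Finset.sum_add_distrib]
      refine Finset.sum_congr rfl fun k _ => ?_
      simp only [mul_add]
      exact integral_add ((Ai.mul hβ).integrableOn le_rfl k ω s)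
        ((Ai.mul A).integrableOn le_rfl k ω s)
    simp only [e1, e2]
    ring
  · have Ai := G.bddProg Y.X_prog i
    have hC : ∀ r ω, 0 ≤ C := fun r ω => (abs_nonneg _).trans (Ai.bdd k r ω)
    refine tendsto_sqn_of_absolutelyContinuous (C := C + C) (s := Ioc 0 s ×ˢ univ)
      (Measure.AbsolutelyContinuous.rfl.prod girP_absolutelyContinuous)
      (measurableSet_Ioc.prod MeasurableSet.univ) (by simp [Measure.prod_prod])
      (fun N => ((measurable_stepProc (fun j hj => ((G.stepAdapted Y.X_prog i hs.1 N).meas j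
        hj).mono (Y.bm.le _) le_rfl) k).sub
          (Ai.measurable_cut_top Y.bm.le le_rfl k)).aemeasurable)
      (fun N x => (abs_sub _ _).trans (add_le_add
        ((G.stepAdapted Y.X_prog i hs.1 N).abs_stepProc_le (hC x.1 x.2) _ _ _)
        (Ai.cut_abs_le _ _ _ _ _))) (fun N x hx => ?_) (Y.riem s hs i k)
    exact stepProc_sub_cut_eq_zero G Y.X_prog hs.1 i k N (by simpa using hx) _

theorem isItoIntegralOn (Y : Sys T x₀ σ P F B X β) (G : GoodCoeff σ C L) :
    IsItoIntegralOn P T (fun s ω => σ s (X s ω)) B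
      (fun s ω => X s ω - x₀ - ∫ r in Icc (0 : ℝ) s, (σ r (X r ω)).mulVec fun k => β k r ω) := by
  intro s hs
  refine tendstoInMeasure_pi fun i => ?_
  obtain ⟨Cβ, hβ⟩ := Y.β_prog
  have Ai := fun i => G.bddProg Y.X_prog i
  have hA := fun N => G.stepAdapted Y.X_prog i hs.1 N
  have lim : TendstoInMeasure P (fun N => stepInt B (grid 0 s N) (N + 1)
      (fun j ω k => rowProc σ X i k (grid 0 s N j) ω)) atTop
      (fun ω => X s ω i - x₀ i - dotI 0 s (rowProc σ X i) β ω) := by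
    refine tendstoInMeasure_of_sqn (fun N => (((hA N).measurable_stepInt Y.bm).mono (Y.bm.le _)
      le_rfl).aemeasurable) (Y.ito s hs i).aemJ ?_
    have h1 := tendsto_finsetSum Finset.univ fun k (_ : k ∈ Finset.univ) => Y.riem s hs i k
    rw [Finset.sum_const_zero] at h1
    have h2 := ENNReal.Tendsto.const_mul (a := 4) h1 (by simp)
    rw [mul_zero] at h2
    refine tendsto_of_tendsto_of_tendsto_of_le_of_le tendsto_const_nhds h2 (fun _ => zero_le)
      fun N => ?_
    have hm := (hA N).mem_elemSpan (B := B)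
    rw [grid_zero, grid_last] at hm
    exact (((IsIto.of_mem Y.bm le_rfl hm).sub Y.bm le_rfl (Y.ito s hs i)).bounds Y.bm le_rfl).1
  have lim' : TendstoInMeasure P (fun N ω => itoRiemannSum (fun s ω => σ s (X s ω)) B s N ω i) atTop
      (fun ω => X s ω i - x₀ i - dotI 0 s (rowProc σ X i) β ω) := by
    intro ε hε
    refine (tendsto_add_atTop_iff_nat 1).1 ((lim ε hε).congr fun N => ?_)
    have : ∀ ω, itoRiemannSum (fun s ω => σ s (X s ω)) B s (N + 1) ω i = stepInt B (grid 0 s N)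
        (N + 1) (fun j ω k => rowProc σ X i k (grid 0 s N j) ω) ω := fun ω => by
      have hg : ∀ j : ℕ, s * j / ((N + 1 : ℕ) : ℝ) = grid 0 s N j := fun j => by
        simp only [grid]; push_cast; ring
      have hg' : ∀ j : ℕ, s * (j + 1) / ((N + 1 : ℕ) : ℝ) = grid 0 s N (j + 1) := fun j => by
        rw [← hg]; push_cast; ring
      simp only [itoRiemannSum, stepInt, rowProc, hg, hg', Finset.sum_apply, Matrix.mulVec,
        dotProduct, Pi.sub_apply]
    simp only [this]
  refine lim'.congr_right (Eventually.of_forall fun ω => ?_)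
  simp only [Pi.sub_apply]
  congr 1
  rw [integral_Icc_eq_integral_Ioc, eval_integral]
  · exact (integral_finsetSum Finset.univ fun k _ =>
      ((Ai i).mul hβ).integrableOn le_rfl k ω s).symm
  · intro j
    exact integrable_finsetSum Finset.univ fun k _ => ((Ai j).mul hβ).integrableOn le_rfl k ω s

end Sys

end

/-! ### Continuity of translations in mean square -/

section

variable {Ω : Type*} [mΩ : MeasurableSpace Ω] {n d : ℕ}

lemma lintegral_comp_mul_left_real {f : ℝ → ENNReal} (hf : Measurable f) {c : ℝ} (hc : 0 < c) :
    ∫⁻ r, f r = ENNReal.ofReal c * ∫⁻ u, f (c * u) := by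
  conv_lhs => rw [← Real.smul_map_volume_mul_left hc.ne', lintegral_smul_measure,
    lintegral_map hf (measurable_const_mul c), abs_of_pos hc, smul_eq_mul]

/-- Continuity of dilations in mean. -/
lemma tendsto_lintegral_dilation {f : ℝ → ℝ} {C T : ℝ} (hf : Measurable f) (hC : ∀ r, |f r| ≤ C)
    (hi : Integrable f) {c : ℝ} (hc : 0 < c) {u : ℕ → ℝ} (hu : Tendsto u atTop (nhds c)) :
    Tendsto (fun N => ∫⁻ s in Ioc 0 T, ENNReal.ofReal ((f (u N * s) - f (c * s)) ^ 2)) atTop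
      (nhds 0) := by
  have key : Tendsto (fun N => ∫⁻ s in Ioc 0 T, ‖f (u N * s) - f (c * s)‖ₑ) atTop (nhds 0) := by
    rw [ENNReal.tendsto_nhds_zero]
    intro ε hε
    by_cases hεt : ε = ⊤
    · simp [hεt]
    have hK : ENNReal.ofReal (2 / c) ≠ ⊤ := ENNReal.ofReal_ne_top
    have hK0 : ENNReal.ofReal (2 / c) ≠ 0 := by
      simp only [ne_eq, ENNReal.ofReal_eq_zero, not_le]; positivity
    set δ := ε / 3 / ENNReal.ofReal (2 / c) with hδ
    have hδ0 : δ ≠ 0 := by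
      simp [hδ, ENNReal.div_eq_zero_iff, hε.ne']
    have hKδ : ENNReal.ofReal (2 / c) * δ = ε / 3 := ENNReal.mul_div_cancel hK0 hK
    obtain ⟨φ, hφc, hφ1, hφ2, hφ3⟩ := hi.exists_hasCompactSupport_lintegral_sub_le hδ0
    obtain ⟨D, hD⟩ := hφ2.bounded_above_of_compact_support hφc
    have hdil : ∀ v, c / 2 < v → ∫⁻ s in Ioc 0 T, ‖f (v * s) - φ (v * s)‖ₑ ≤ ε / 3 := by
      intro v hv
      have hv0 : 0 < v := (by positivity : 0 < c / 2).trans hv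
      have hm : Measurable fun r => ‖f r - φ r‖ₑ := (hf.sub hφ2.measurable).enorm
      have e := lintegral_comp_mul_left_real hm hv0
      calc _ ≤ ∫⁻ s, ‖f (v * s) - φ (v * s)‖ₑ := setLIntegral_le_lintegral _ _
        _ = ENNReal.ofReal v⁻¹ * ∫⁻ r, ‖f r - φ r‖ₑ := by
          rw [e, ← mul_assoc, ← ENNReal.ofReal_mul (by positivity), inv_mul_cancel₀ hv0.ne']
          simp
        _ ≤ ENNReal.ofReal (2 / c) * δ := by
          gcongr
          rw [← one_div, div_le_div_iff₀ hv0 hc]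
          linarith
        _ = ε / 3 := hKδ
    have hmid : Tendsto (fun N => ∫⁻ s in Ioc 0 T, ‖φ (u N * s) - φ (c * s)‖ₑ) atTop (nhds 0) := by
      have : Tendsto (fun N => ∫⁻ s in Ioc 0 T, ‖φ (u N * s) - φ (c * s)‖ₑ) atTop
          (nhds (∫⁻ _ in Ioc 0 T, 0)) := by
        refine tendsto_lintegral_of_dominated_convergence (fun _ => ENNReal.ofReal (D + D))
          (fun N => ((hφ2.measurable.comp (measurable_const_mul _)).sub
            (hφ2.measurable.comp (measurable_const_mul _))).enorm)
          (fun N => Eventually.of_forall fun s => ?_) ?_ (Eventually.of_forall fun s => ?_)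
        · simp only
          rw [← ofReal_norm]
          exact ENNReal.ofReal_le_ofReal ((norm_sub_le _ _).trans (add_le_add (hD _) (hD _)))
        · simp [ENNReal.mul_ne_top]
        · have h1 : Tendsto (fun N => φ (u N * s) - φ (c * s)) atTop (nhds 0) := by
            have := (hφ2.tendsto _).comp (hu.mul_const s)
            simpa [Function.comp_def] using this.sub_const (φ (c * s))
          simpa [Function.comp_def] using (continuous_enorm.tendsto _).comp h1
      simpa using this
    have h3 : 0 < ε / 3 := ENNReal.div_pos hε.ne' (by simp)
    filter_upwards [hu.eventually_const_lt (by linarith : c / 2 < c),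
      (ENNReal.tendsto_nhds_zero.1 hmid) _ h3] with N h1 h2
    calc ∫⁻ s in Ioc 0 T, ‖f (u N * s) - f (c * s)‖ₑ
        ≤ ∫⁻ s in Ioc 0 T, (‖f (u N * s) - φ (u N * s)‖ₑ + ‖φ (u N * s) - φ (c * s)‖ₑ
          + ‖f (c * s) - φ (c * s)‖ₑ) := by
          refine lintegral_mono fun s => ?_
          have : f (u N * s) - f (c * s) = (f (u N * s) - φ (u N * s)) + (φ (u N * s) - φ (c * s))
            - (f (c * s) - φ (c * s)) := by ring
          rw [this]
          exact enorm_sub_le.trans (add_le_add (enorm_add_le _ _) le_rfl)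
      _ = (∫⁻ s in Ioc 0 T, ‖f (u N * s) - φ (u N * s)‖ₑ)
          + (∫⁻ s in Ioc 0 T, ‖φ (u N * s) - φ (c * s)‖ₑ)
          + ∫⁻ s in Ioc 0 T, ‖f (c * s) - φ (c * s)‖ₑ := by
          have hφm := hφ2.measurable
          rw [lintegral_add_left (by fun_prop), lintegral_add_left (by fun_prop)]
      _ ≤ ε / 3 + ε / 3 + ε / 3 := by
          gcongr
          · exact hdil _ h1
          · exact hdil _ (by linarith)
      _ = ε := ENNReal.add_thirds ε
  have h2 := ENNReal.Tendsto.const_mul (a := ENNReal.ofReal (C + C)) key (by simp)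
  rw [mul_zero] at h2
  refine tendsto_of_tendsto_of_tendsto_of_le_of_le tendsto_const_nhds h2 (fun _ => zero_le)
    fun N => ?_
  simp only
  rw [← lintegral_const_mul _ (by fun_prop)]
  refine lintegral_mono fun s => ?_
  rw [← ofReal_norm, ← ENNReal.ofReal_mul' (norm_nonneg _)]
  refine ENNReal.ofReal_le_ofReal ?_
  rw [Real.norm_eq_abs, ← sq_abs, sq]
  exact mul_le_mul_of_nonneg_right ((abs_sub _ _).trans (add_le_add (hC _) (hC _))) (abs_nonneg _)

/-- Almost everywhere convergence upgrades to `L²` convergence under uniform exponential bounds. -/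
lemma tendsto_sqn_of_exp_bound {P : Measure Ω} [IsProbabilityMeasure P] {u : ℕ → Ω → ℝ} {f : Ω → ℝ}
    (hu : ∀ N, Measurable (u N)) {K : ENNReal} (hKt : K ≠ ⊤)
    (hK : ∀ N, ∀ c ∈ ({1, -1} : Set ℝ), ∫⁻ ω, ENNReal.ofReal (Real.exp (c * u N ω)) ∂P ≤ K)
    (h : ∀ᵐ ω ∂P, Tendsto (fun N => u N ω) atTop (nhds (f ω))) :
    Tendsto (fun N => sqn P fun ω => u N ω - f ω) atTop (nhds 0) := by
  have hf : AEMeasurable f P := aemeasurable_of_tendsto_metrizable_ae' (fun N => (hu N).aemeasurable) h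
  have hKf : ∀ c ∈ ({1, -1} : Set ℝ), ∫⁻ ω, ENNReal.ofReal (Real.exp (c * f ω)) ∂P ≤ K := by
    intro c hc
    calc ∫⁻ ω, ENNReal.ofReal (Real.exp (c * f ω)) ∂P
        = ∫⁻ ω, liminf (fun N => ENNReal.ofReal (Real.exp (c * u N ω))) atTop ∂P := by
          refine lintegral_congr_ae ?_
          filter_upwards [h] with ω hω
          have h1 := (ENNReal.continuous_ofReal.comp
            (Real.continuous_exp.comp (continuous_const_mul c))).tendsto (f ω)
          exact (h1.comp hω).liminf_eq.symm
      _ ≤ liminf (fun N => ∫⁻ ω, ENNReal.ofReal (Real.exp (c * u N ω)) ∂P) atTop :=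
          lintegral_liminf_le fun N => ((hu N).const_mul c).exp.ennreal_ofReal
      _ ≤ K := by
          refine (liminf_le_liminf (Eventually.of_forall fun N => hK N c hc)).trans ?_
          simp
  have hfour : ∀ x : ℝ, x ^ 4 ≤ 24 * (Real.exp (1 * x) + Real.exp (-1 * x)) := by
    intro x
    have : ∀ y : ℝ, 0 ≤ y → y ^ 4 ≤ 24 * Real.exp y := fun y hy => by
      have := Real.pow_div_factorial_le_exp y hy 4
      have e : ((Nat.factorial 4 : ℕ) : ℝ) = 24 := by norm_num [Nat.factorial]
      rw [e] at this
      linarith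
    rcases le_total 0 x with hx | hx
    · have h1 := this x hx
      have h2 := Real.exp_pos (-1 * x)
      rw [one_mul]; linarith
    · have h1 := this (-x) (by linarith)
      have h2 := Real.exp_pos (1 * x)
      rw [neg_one_mul]; nlinarith
  have hsplit : ∀ (R x y : ℝ), 0 < R → (x - y) ^ 2 ≤ min ((x - y) ^ 2) R
      + 192 / R * (Real.exp (1 * x) + Real.exp (-1 * x) + Real.exp (1 * y) + Real.exp (-1 * y)) := by
    intro R x y hR
    have e4 : (x - y) ^ 4 ≤ 8 * (x ^ 4 + y ^ 4) := by
      nlinarith [sq_nonneg (x + y), sq_nonneg (x - y), sq_nonneg (x ^ 2 - y ^ 2), sq_nonneg (x * y),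
        sq_nonneg ((x + y) ^ 2), sq_nonneg (x ^ 2 + y ^ 2 + 2 * x * y), sq_nonneg (x * (x + y)),
        sq_nonneg (y * (x + y))]
    have h1 := hfour x
    have h2 := hfour y
    have : (x - y) ^ 4 / R ≤ 192 / R * (Real.exp (1 * x) + Real.exp (-1 * x) + Real.exp (1 * y)
        + Real.exp (-1 * y)) := by
      rw [div_mul_eq_mul_div]
      gcongr
      linarith
    refine le_trans ?_ (add_le_add le_rfl this)
    rcases le_total ((x - y) ^ 2) R with hle | hle
    · rw [min_eq_left hle]
      have : 0 ≤ (x - y) ^ 4 / R := by positivity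
      linarith
    · rw [min_eq_right hle]
      have : (x - y) ^ 2 ≤ (x - y) ^ 4 / R := by
        rw [le_div_iff₀ hR]
        nlinarith [sq_nonneg (x - y)]
      linarith
  have hbound : ∀ R : ℝ, 0 < R → ∀ N, sqn P (fun ω => u N ω - f ω)
      ≤ ∫⁻ ω, ENNReal.ofReal (min ((u N ω - f ω) ^ 2) R) ∂P
        + ENNReal.ofReal (192 / R) * (4 * K) := by
    intro R hR N
    have hm : ∀ c : ℝ, AEMeasurable (fun ω => ENNReal.ofReal (Real.exp (c * f ω))) P := fun c =>
      (hf.const_mul c).exp.ennreal_ofReal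
    have hm' : ∀ c : ℝ, AEMeasurable (fun ω => ENNReal.ofReal (Real.exp (c * u N ω))) P := fun c =>
      ((hu N).const_mul c).exp.ennreal_ofReal.aemeasurable
    calc sqn P (fun ω => u N ω - f ω)
        ≤ ∫⁻ ω, (ENNReal.ofReal (min ((u N ω - f ω) ^ 2) R) + ENNReal.ofReal (192 / R)
          * (ENNReal.ofReal (Real.exp (1 * u N ω)) + ENNReal.ofReal (Real.exp (-1 * u N ω))
            + ENNReal.ofReal (Real.exp (1 * f ω)) + ENNReal.ofReal (Real.exp (-1 * f ω)))) ∂P := by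
          refine lintegral_mono fun ω => ?_
          rw [← ENNReal.ofReal_add (by positivity) (by positivity),
            ← ENNReal.ofReal_add (by positivity) (by positivity),
            ← ENNReal.ofReal_add (by positivity) (by positivity), ← ENNReal.ofReal_mul (by positivity),
            ← ENNReal.ofReal_add (by positivity) (by positivity)]
          exact ENNReal.ofReal_le_ofReal (hsplit R _ _ hR)
      _ = ∫⁻ ω, ENNReal.ofReal (min ((u N ω - f ω) ^ 2) R) ∂P + ENNReal.ofReal (192 / R)
          * (∫⁻ ω, ENNReal.ofReal (Real.exp (1 * u N ω)) ∂P
            + ∫⁻ ω, ENNReal.ofReal (Real.exp (-1 * u N ω)) ∂P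
            + ∫⁻ ω, ENNReal.ofReal (Real.exp (1 * f ω)) ∂P
            + ∫⁻ ω, ENNReal.ofReal (Real.exp (-1 * f ω)) ∂P) := by
          have hsum : AEMeasurable (fun ω => ENNReal.ofReal (Real.exp (1 * u N ω))
              + ENNReal.ofReal (Real.exp (-1 * u N ω)) + ENNReal.ofReal (Real.exp (1 * f ω))
              + ENNReal.ofReal (Real.exp (-1 * f ω))) P :=
            (((hm' 1).add (hm' (-1))).add (hm 1)).add (hm (-1))
          rw [lintegral_add_right' _ (hsum.const_mul _), lintegral_const_mul'' _ hsum,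
            lintegral_add_right' _ (hm (-1)), lintegral_add_right' _ (hm 1),
            lintegral_add_right' _ (hm' (-1))]
      _ ≤ ∫⁻ ω, ENNReal.ofReal (min ((u N ω - f ω) ^ 2) R) ∂P
        + ENNReal.ofReal (192 / R) * (K + K + K + K) := by
          gcongr
          · exact hK N 1 (by simp)
          · exact hK N (-1) (by simp)
          · exact hKf 1 (by simp)
          · exact hKf (-1) (by simp)
      _ = _ := by ring_nf
  rw [ENNReal.tendsto_nhds_zero]
  intro ε hε
  by_cases hεt : ε = ⊤
  · simp [hεt]
  have h2 : 0 < ε / 2 := ENNReal.half_pos hε.ne'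
  have hR : ∃ R : ℝ, 0 < R ∧ ENNReal.ofReal (192 / R) * (4 * K) ≤ ε / 2 := by
    have t1 : Tendsto (fun R : ℝ => ENNReal.ofReal (192 / R)) atTop (nhds 0) := by
      have := (ENNReal.continuous_ofReal.tendsto 0).comp
        (Tendsto.div_atTop (tendsto_const_nhds (x := (192 : ℝ))) tendsto_id)
      simpa [Function.comp_def] using this
    have t2 := ENNReal.Tendsto.mul_const (b := 4 * K) t1 (Or.inr (ENNReal.mul_ne_top (by simp) hKt))
    rw [zero_mul] at t2
    exact ((eventually_gt_atTop 0).and ((ENNReal.tendsto_nhds_zero.1 t2) _ h2)).exists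
  obtain ⟨R, hR0, hR1⟩ := hR
  have t : Tendsto (fun N => ∫⁻ ω, ENNReal.ofReal (min ((u N ω - f ω) ^ 2) R) ∂P) atTop
      (nhds (∫⁻ _, 0 ∂P)) := by
    refine tendsto_lintegral_of_dominated_convergence' (fun _ => ENNReal.ofReal R)
      (fun N => ((((hu N).aemeasurable.sub hf).pow_const 2).min aemeasurable_const).ennreal_ofReal)
      (fun N => Eventually.of_forall fun ω => ENNReal.ofReal_le_ofReal (min_le_right _ _))
      (by simp) ?_
    filter_upwards [h] with ω hω
    have h1 : Continuous fun x : ℝ => ENNReal.ofReal (min ((x - f ω) ^ 2) R) :=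
      ENNReal.continuous_ofReal.comp (by fun_prop)
    have := (h1.tendsto (f ω)).comp hω
    simpa [Function.comp_def, hR0.le] using this
  rw [lintegral_zero] at t
  filter_upwards [(ENNReal.tendsto_nhds_zero.1 t) _ h2] with N hN
  exact (hbound R hR0 N).trans ((add_le_add hN hR1).trans (ENNReal.add_halves ε).le)

end

/-! ### Riemann sums along random grids -/

section

variable {Ω : Type*} [mΩ : MeasurableSpace Ω] {n d : ℕ}

/-- Left endpoint samples of a process on the uniform grid of `[0, s]`. -/
def sample (θ : Fin d → ℝ → Ω → ℝ) (s : ℝ) (N j : ℕ) (ω : Ω) (k : Fin d) : ℝ :=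
  θ k (grid 0 s N j) ω

lemma grid_nonneg {s : ℝ} (hs : 0 ≤ s) (N j : ℕ) : 0 ≤ grid 0 s N j := by
  unfold grid
  have : (0 : ℝ) < N + 1 := by positivity
  simp only [sub_zero, zero_add]
  positivity

lemma grid_eq_mul (s : ℝ) (N j : ℕ) : grid 0 s N j = s * grid 0 1 N j := by
  unfold grid; ring

lemma BddProg.stepAdapted_sample {F : ℝ → MeasurableSpace Ω} {θ : Fin d → ℝ → Ω → ℝ} {C : ℝ}
    (A : BddProg F θ C) {s : ℝ} (hs : 0 ≤ s) (N : ℕ) :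
    StepAdapted F (grid 0 s N) (N + 1) (sample θ s N) C where
  mono := grid_mono hs
  nonneg := by rw [grid_zero]
  meas j _ := @measurable_pi_lambda _ _ _ (F _) _ _ fun k =>
    (A.prog k).measurable (grid_nonneg hs N j)
  bdd _ _ _ _ := A.bdd _ _ _

section

variable {P : Measure Ω} [IsProbabilityMeasure P] {F : ℝ → MeasurableSpace Ω}
  {B : ℝ → Ω → Fin d → ℝ} {θ : Fin d → ℝ → Ω → ℝ} {C T : ℝ}

lemma tendsto_sqn_sample_of_tendstoInMeasure (S : BMSetup P F B) (A : BddProg F θ C) {s : ℝ}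
    (hs : 0 ≤ s) {I : Ω → ℝ} (h : TendstoInMeasure P
      (fun N => stepInt B (grid 0 s N) (N + 1) (sample θ s N)) atTop I) :
    Tendsto (fun N => sqn P fun ω => stepInt B (grid 0 s N) (N + 1) (sample θ s N) ω - I ω) atTop
      (nhds 0) := by
  refine tendsto_of_subseq_tendsto fun ns hns => ?_
  have h1 : TendstoInMeasure P (fun N => stepInt B (grid 0 s (ns N)) (ns N + 1) (sample θ s (ns N)))
    atTop I := fun ε hε => (h ε hε).comp hns
  obtain ⟨ms, -, h2⟩ := h1.exists_seq_tendsto_ae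
  refine ⟨ms, tendsto_sqn_of_exp_bound (fun N => ((A.stepAdapted_sample hs _).measurable_stepInt
    S).mono (S.le _) le_rfl) (K := ENNReal.ofReal (Real.exp (1 / 2 * (s * (d * C ^ 2)))))
    ENNReal.ofReal_ne_top (fun N c hc => ?_) h2⟩
  refine ((A.stepAdapted_sample hs _).lintegral_exp_mul_le S c).trans (le_of_eq ?_)
  have : c ^ 2 = 1 := by rcases hc with rfl | rfl <;> norm_num
  rw [grid_last, grid_zero, this, sub_zero]

lemma BddProg.measurable_indicator_Icc (A : BddProg F θ C) (hF : ∀ s, F s ≤ mΩ) (hT : 0 ≤ T)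
    (k : Fin d) : Measurable fun x : ℝ × Ω => (Icc 0 T).indicator (fun r => θ k r x.2) x.1 := by
  have h1 := (A.measurable_cut_top (b := T) hF le_rfl k).add
    ((((A.prog k).measurable le_rfl).mono (hF 0) le_rfl |>.comp measurable_snd).indicator
      (measurable_fst (measurableSet_singleton (0 : ℝ))) :
        Measurable ((Prod.fst ⁻¹' {(0 : ℝ)}).indicator fun x : ℝ × Ω => θ k 0 x.2))
  refine (congrArg _ (funext fun x => ?_)).mp h1
  by_cases h0 : x.1 = 0
  · simp [h0, _root_.cut, hT, indicator]
  · by_cases h2 : x.1 ∈ Ioc 0 T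
    · have : x.1 ∈ Icc 0 T := ⟨h2.1.le, h2.2⟩
      simp only [_root_.cut, Pi.add_apply, indicator_of_mem h2, indicator_of_mem this]
      simp [indicator, h0]
    · have : x.1 ∉ Icc 0 T := fun h => h2 ⟨lt_of_le_of_ne h.1 (Ne.symm h0), h.2⟩
      simp only [_root_.cut, Pi.add_apply, indicator_of_notMem h2, indicator_of_notMem this]
      simp [indicator, h0]

lemma BddProg.tendsto_lintegral_sample (A : BddProg F θ C) (hF : ∀ s, F s ≤ mΩ) (hT : 0 ≤ T)
    (k : Fin d) :
    ∃ Ψ : ℕ → ℝ → ENNReal, (∀ N, Measurable (Ψ N)) ∧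
      Tendsto (fun N => ∫⁻ s in Ioc 0 T, Ψ N s) atTop (nhds 0) ∧
      ∀ N, ∀ s ∈ Ioc 0 T, sqn (volume.prod P) (fun x : ℝ × Ω =>
        stepProc (grid 0 s N) (N + 1) (sample θ s N) k x.1 x.2 - _root_.cut 0 s θ k x.1 x.2)
          = ENNReal.ofReal s * Ψ N s := by
  set η : ℝ → Ω → ℝ := fun r ω => (Icc 0 T).indicator (fun r => θ k r ω) r with hη
  have mη : Measurable fun x : ℝ × Ω => η x.1 x.2 := A.measurable_indicator_Icc hF hT k
  have hC : ∀ r ω, 0 ≤ C := fun r ω => (abs_nonneg _).trans (A.bdd k r ω)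
  have bη : ∀ r ω, |η r ω| ≤ C := fun r ω => by
    simp only [hη, indicator]
    split_ifs
    · exact A.bdd _ _ _
    · simpa using hC r ω
  set u : ℕ → ℝ → ℝ → Ω → ℝ := fun N s r ω => ∑ i ∈ Finset.range (N + 1),
    (Ioc (grid 0 1 N i) (grid 0 1 N (i + 1))).indicator
      (fun _ => η (s * grid 0 1 N i) ω - η (s * r) ω) r with hu
  have mu : ∀ N, Measurable fun x : ℝ × ℝ × Ω => u N x.1 x.2.1 x.2.2 := by
    intro N
    refine Finset.measurable_sum _ fun i _ => ?_
    have h1 : Measurable fun x : ℝ × ℝ × Ω =>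
        η (x.1 * grid 0 1 N i) x.2.2 - η (x.1 * x.2.1) x.2.2 :=
      (mη.comp (by fun_prop : Measurable fun x : ℝ × ℝ × Ω => (x.1 * grid 0 1 N i, x.2.2))).sub
        (mη.comp (by fun_prop : Measurable fun x : ℝ × ℝ × Ω => (x.1 * x.2.1, x.2.2)))
    have h2 := h1.indicator ((measurable_fst.comp measurable_snd :
      Measurable fun x : ℝ × ℝ × Ω => x.2.1)
        (measurableSet_Ioc (a := grid 0 1 N i) (b := grid 0 1 N (i + 1))))
    refine (congrArg _ (funext fun x => ?_)).mp h2
    simp only [indicator, mem_preimage, Function.comp_apply]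
  have ucell : ∀ {N i : ℕ} {r : ℝ}, i < N + 1 → r ∈ Ioc (grid 0 1 N i) (grid 0 1 N (i + 1)) →
      ∀ s ω, u N s r ω = η (s * grid 0 1 N i) ω - η (s * r) ω := by
    intro N i r hi hr s ω
    exact StepAdapted.stepProc_eq (d := 1) (grid_mono zero_le_one) hi hr 0 ω
      (ξ := fun i ω _ => η (s * grid 0 1 N i) ω - η (s * r) ω)
  have uout : ∀ {N : ℕ} {r : ℝ}, r ∉ Ioc (0 : ℝ) 1 → ∀ s ω, u N s r ω = 0 := by
    intro N r hr s ω
    exact StepAdapted.stepProc_eq_zero (d := 1) (grid_mono zero_le_one)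
      (by rwa [grid_zero, grid_last]) 0 ω
      (ξ := fun i ω _ => η (s * grid 0 1 N i) ω - η (s * r) ω)
  have cell : ∀ (N : ℕ) {r : ℝ}, r ∈ Ioc (0 : ℝ) 1 → ∃ i < N + 1,
      r ∈ Ioc (grid 0 1 N i) (grid 0 1 N (i + 1)) := fun N r hr =>
    StepAdapted.exists_cell (by rwa [grid_zero, grid_last])
  have bu : ∀ N s r ω, |u N s r ω| ≤ C + C := by
    intro N s r ω
    by_cases hr : r ∈ Ioc (0 : ℝ) 1
    · obtain ⟨i, hi, hir⟩ := cell N hr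
      rw [ucell hi hir]
      exact (abs_sub _ _).trans (add_le_add (bη _ _) (bη _ _))
    · rw [uout hr, abs_zero]
      have := hC 0 ω
      positivity
  have msq : ∀ N, Measurable fun x : ℝ × ℝ × Ω => ENNReal.ofReal (u N x.1 x.2.1 x.2.2 ^ 2) :=
    fun N => ((mu N).pow_const 2).ennreal_ofReal
  clear_value u
  refine ⟨fun N s => ∫⁻ x : ℝ × Ω, ENNReal.ofReal (u N s x.1 x.2 ^ 2) ∂(volume.prod P),
    fun N => (msq N).lintegral_prod_right', ?_, fun N s hs => ?_⟩
  · have swap : ∀ N, ∫⁻ s in Ioc 0 T, ∫⁻ x : ℝ × Ω, ENNReal.ofReal (u N s x.1 x.2 ^ 2) ∂(volume.prod P)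
        = ∫⁻ x : ℝ × Ω, (∫⁻ s in Ioc 0 T, ENNReal.ofReal (u N s x.1 x.2 ^ 2)) ∂(volume.prod P) :=
      fun N => lintegral_lintegral_swap (msq N).aemeasurable
    simp only [swap]
    have : Tendsto (fun N => ∫⁻ x : ℝ × Ω, (∫⁻ s in Ioc 0 T, ENNReal.ofReal (u N s x.1 x.2 ^ 2))
        ∂(volume.prod P)) atTop (nhds (∫⁻ x : ℝ × Ω, 0 ∂(volume.prod P))) := by
      refine tendsto_lintegral_of_dominated_convergence
        ((Ioc (0 : ℝ) 1 ×ˢ (univ : Set Ω)).indicator fun _ => ENNReal.ofReal ((C + C) ^ 2) *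
          volume (Ioc 0 T)) (fun N => (msq N).lintegral_prod_left')
        (fun N => Eventually.of_forall fun x => ?_) ?_ (Eventually.of_forall fun x => ?_)
      · by_cases hx : x.1 ∈ Ioc (0 : ℝ) 1
        · simp only [indicator, mem_prod, hx, mem_univ, and_self, if_true]
          rw [← setLIntegral_const]
          refine lintegral_mono fun s => ENNReal.ofReal_le_ofReal ?_
          rw [← sq_abs]
          exact pow_le_pow_left₀ (abs_nonneg _) (bu _ _ _ _) 2
        · simp [uout hx]
      · rw [lintegral_indicator (measurableSet_Ioc.prod MeasurableSet.univ), lintegral_const,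
          Measure.restrict_apply_univ, Measure.prod_prod]
        simp [ENNReal.mul_ne_top]
      · by_cases hx : x.1 ∈ Ioc (0 : ℝ) 1
        · choose i hi hir using fun N => cell N hx
          have hlim : Tendsto (fun N => grid 0 1 N (i N)) atTop (nhds x.1) := by
            have hm := tendsto_mesh 0 1
            refine tendsto_of_tendsto_of_tendsto_of_le_of_le
              (by simpa using (tendsto_const_nhds (x := x.1)).sub hm) tendsto_const_nhds
              (fun N => ?_) fun N => (hir N).1.le
            have h1 := (hir N).2
            have h2 := grid_succ_sub (a := 0) (b := 1) (N := N) (i := i N)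
            rw [sub_zero, one_div] at h2
            linarith
          have mp : Measurable fun r => η r x.2 :=
            mη.comp (measurable_id.prodMk measurable_const)
          refine (tendsto_lintegral_dilation (T := T) mp (fun r => bη r x.2) ?_ hx.1 hlim).congr
            fun N => ?_
          · have : IntegrableOn (fun r => η r x.2) (Icc 0 T) :=
              Measure.integrableOn_of_bounded (by simp) mp.aestronglyMeasurable (M := C)
                (Eventually.of_forall fun r => bη r x.2)
            refine ((integrable_indicator_iff measurableSet_Icc).2 this).congr
              (Eventually.of_forall fun r => ?_)
            simp only [hη, indicator]
            split_ifs <;> rfl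
          · refine lintegral_congr fun s => ?_
            rw [ucell (hi N) (hir N), mul_comm s, mul_comm s]
        · simp [uout hx]
    simpa using this
  · have mst : Measurable fun x : ℝ × Ω => stepProc (grid 0 s N) (N + 1) (sample θ s N) k x.1 x.2
        - _root_.cut 0 s θ k x.1 x.2 := (measurable_stepProc (t := grid 0 s N) (fun j hj => ((A.stepAdapted_sample hs.1.le N).meas j
        hj).mono (hF _) le_rfl) k).sub (A.measurable_cut_top (b := s) hF le_rfl k)
    have heq : ∀ r ω, stepProc (grid 0 s N) (N + 1) (sample θ s N) k (s * r) ω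
        - _root_.cut 0 s θ k (s * r) ω = u N s r ω := by
      intro r ω
      by_cases hr : r ∈ Ioc (0 : ℝ) 1
      · obtain ⟨i, hi, hir⟩ := cell N hr
        rw [ucell hi hir]
        have h1 : s * r ∈ Ioc (grid 0 s N i) (grid 0 s N (i + 1)) := by
          rw [grid_eq_mul, grid_eq_mul s N (i + 1)]
          exact ⟨mul_lt_mul_of_pos_left hir.1 hs.1, mul_le_mul_of_nonneg_left hir.2 hs.1.le⟩
        have h2 : s * r ∈ Ioc 0 s := ⟨mul_pos hs.1 hr.1, by nlinarith [hs.1, hr.2]⟩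
        rw [StepAdapted.stepProc_eq (grid_mono hs.1.le) hi h1, _root_.cut, indicator_of_mem h2,
          sample, grid_eq_mul]
        have h3 : s * r ∈ Icc 0 T := ⟨h2.1.le, h2.2.trans hs.2⟩
        have h4 : s * grid 0 1 N i ∈ Icc 0 T :=
          ⟨mul_nonneg hs.1.le (grid_nonneg zero_le_one _ _),
            (mul_le_mul_of_nonneg_left hir.1.le hs.1.le).trans h3.2⟩
        simp only [hη, indicator_of_mem h3, indicator_of_mem h4]
      · rw [uout hr]
        have h2 : s * r ∉ Ioc 0 s := by
          rintro ⟨h, h'⟩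
          exact hr ⟨pos_of_mul_pos_right h hs.1.le |>.trans_le le_rfl, by
            by_contra hc; push Not at hc; nlinarith [hs.1]⟩
        rw [StepAdapted.stepProc_eq_zero (grid_mono hs.1.le) (by rwa [grid_zero, grid_last]),
          _root_.cut, indicator_of_notMem h2, sub_zero]
    have ms : Measurable fun x : ℝ × Ω => ENNReal.ofReal (u N s x.1 x.2 ^ 2) :=
      (msq N).comp (measurable_prodMk_left (x := s))
    simp only [sqn]
    rw [lintegral_prod_symm' _ ((mst.pow_const 2).ennreal_ofReal),
      lintegral_prod_symm' _ ms, ← lintegral_const_mul _ ms.lintegral_prod_left']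
    refine lintegral_congr fun ω => ?_
    have hmr : Measurable fun r => ENNReal.ofReal ((stepProc (grid 0 s N) (N + 1) (sample θ s N) k r ω
        - _root_.cut 0 s θ k r ω) ^ 2) :=
      ((mst.comp (measurable_id.prodMk (measurable_const (a := ω)))).pow_const 2).ennreal_ofReal
    rw [lintegral_comp_mul_left_real hmr hs.1]
    simp only [heq]

end

end

/-! ### Riemann sums of solutions -/

section

variable {Ω : Type*} [mΩ : MeasurableSpace Ω] {n d : ℕ}

section

variable {P : Measure Ω} [IsProbabilityMeasure P] {F : ℝ → MeasurableSpace Ω}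
  {B : ℝ → Ω → Fin d → ℝ} {θ : Fin d → ℝ → Ω → ℝ} {C T : ℝ}

lemma eq_zero_of_le_add_liminf {c : ENNReal} {u v : ℕ → ENNReal} (h : ∀ N, c ≤ u N + v N)
    (hu : Tendsto u atTop (nhds 0)) (hv : liminf v atTop = 0) : c = 0 := by
  refine le_antisymm (ENNReal.le_of_forall_pos_le_add fun ε hε _ => ?_) zero_le
  have hε' : (0 : ENNReal) < (ε : ENNReal) / 2 := ENNReal.half_pos (by simpa using hε.ne')
  have h1 := (frequently_lt_of_liminf_lt (by isBoundedDefault) (hv.trans_lt hε')).and_eventually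
    ((ENNReal.tendsto_nhds_zero.1 hu) _ hε')
  obtain ⟨N, h2, h3⟩ := h1.exists
  rw [zero_add]
  exact (h N).trans ((add_le_add h3 h2.le).trans (ENNReal.add_halves _).le)

/-- If the Riemann sums converge in probability at all times to a process with continuous paths,
then this process is the stochastic integral for almost every time. -/
lemma ae_isIto_of_riemann (S : BMSetup P F B) (A : BddProg F θ C) (hT : 0 ≤ T) {I : ℝ → Ω → ℝ}
    (h : ∀ s ∈ Icc 0 T, TendstoInMeasure P
      (fun N => stepInt B (grid 0 s N) (N + 1) (sample θ s N)) atTop (I s)) :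
    ∀ᵐ s, s ∈ Ioc 0 T → IsIto P F B 0 s (cut 0 s θ) (I s) := by
  choose Ψ mΨ tΨ hΨ using fun k => A.tendsto_lintegral_sample (P := P) S.le hT k
  have hz : ∀ᵐ s ∂(volume.restrict (Ioc 0 T)), liminf (fun N => ∑ k, Ψ k N s) atTop = 0 := by
    have m1 : ∀ N, Measurable fun s => ∑ k, Ψ k N s := fun N =>
      Finset.measurable_sum _ fun k _ => mΨ k N
    have h1 := lintegral_liminf_le (μ := volume.restrict (Ioc 0 T)) (u := atTop) m1
    have h2 : Tendsto (fun N => ∫⁻ s in Ioc 0 T, ∑ k, Ψ k N s) atTop (nhds 0) := by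
      have := tendsto_finsetSum Finset.univ fun k (_ : k ∈ Finset.univ) => tΨ k
      rw [Finset.sum_const_zero] at this
      refine this.congr fun N => ?_
      rw [lintegral_finsetSum _ fun k _ => mΨ k N]
    rw [h2.liminf_eq, nonpos_iff_eq_zero, lintegral_eq_zero_iff (Measurable.liminf m1)] at h1
    exact h1
  rw [ae_restrict_iff' measurableSet_Ioc] at hz
  filter_upwards [hz] with s hs hsT
  specialize hs hsT
  obtain ⟨M, hM⟩ := A.exists_isIto' S le_rfl hsT.1.le
  have lim := tendsto_sqn_sample_of_tendstoInMeasure S A hsT.1.le (h s ⟨hsT.1.le, hsT.2⟩)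
  have mst := fun N => (((A.stepAdapted_sample hsT.1.le N).measurable_stepInt S).mono
    (S.le _) le_rfl).aemeasurable (μ := P)
  have hae : AEMeasurable (I s) P := by
    obtain ⟨ns, -, h2⟩ := (h s ⟨hsT.1.le, hsT.2⟩).exists_seq_tendsto_ae
    exact aemeasurable_of_tendsto_metrizable_ae' (fun N => mst (ns N)) h2
  have hb : ∀ N, sqn P (fun ω => I s ω - M ω) ≤ 2 * sqn P (fun ω =>
      stepInt B (grid 0 s N) (N + 1) (sample θ s N) ω - I s ω)
      + 8 * ENNReal.ofReal s * ∑ k, Ψ k N s := by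
    intro N
    refine (sqn_sub_le_add hae (mst N)).trans (add_le_add (le_of_eq ?_) ?_)
    · rw [sqn_sub_comm]
    · have hm := (A.stepAdapted_sample hsT.1.le N).mem_elemSpan (B := B)
      rw [grid_zero, grid_last] at hm
      refine (mul_le_mul' le_rfl (((IsIto.of_mem S le_rfl hm).sub S le_rfl hM).bounds S
        le_rfl).1).trans (le_of_eq ?_)
      simp only [hΨ _ N s hsT, ← Finset.mul_sum]
      ring
  have h0 : sqn P (fun ω => I s ω - M ω) = 0 := by
    refine eq_zero_of_le_add_liminf hb ?_ ?_
    · simpa using ENNReal.Tendsto.const_mul (a := 2) lim (by simp)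
    · rw [ENNReal.liminf_const_mul_of_ne_top, hs, mul_zero]
      exact ENNReal.mul_ne_top (by simp) ENNReal.ofReal_ne_top
  refine hM.congr (fun k => ae_eq_refl _) ?_
  filter_upwards [sqn_eq_zero (hae.sub hM.aemJ) h0] with ω hω
  rw [Pi.sub_apply] at hω
  linarith

lemma tendsto_sqn_cut (S : BMSetup P F B) (A : BddProg F θ C) {s : ℝ} {u : ℕ → ℝ}
    (hs : s ∈ Icc 0 T) (huT : ∀ N, u N ∈ Icc 0 T) (hu : Tendsto u atTop (nhds s)) (k : Fin d) :
    Tendsto (fun N => sqn (volume.prod P) (fun x : ℝ × Ω =>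
      cut 0 (u N) θ k x.1 x.2 - cut 0 s θ k x.1 x.2)) atTop (nhds 0) := by
  refine tendsto_sqn_of_forall_ae (a := 0) (b := T) (C := C)
    (fun N => A.measurable_cut_top S.le le_rfl k) (A.measurable_cut_top S.le le_rfl k)
    (fun N r ω => A.cut_abs_le _ _ _ _ _) (fun r ω => A.cut_abs_le _ _ _ _ _)
    (fun N r ω hr => ?_) (fun r ω hr => ?_) (Eventually.of_forall fun ω => ?_)
  · rw [cut, indicator_of_notMem fun h => hr ⟨h.1, h.2.trans (huT N).2⟩]
  · rw [cut, indicator_of_notMem fun h => hr ⟨h.1, h.2.trans hs.2⟩]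
  · have : ∀ᵐ r : ℝ, r ≠ s := by simp [ae_iff]
    filter_upwards [this] with r hr
    refine tendsto_const_nhds.congr' ?_
    rcases lt_or_gt_of_ne hr with h | h
    · filter_upwards [hu.eventually_const_lt h] with N hN
      by_cases h0 : 0 < r
      · rw [cut, cut, indicator_of_mem (show r ∈ Ioc 0 s from ⟨h0, h.le⟩),
          indicator_of_mem (show r ∈ Ioc 0 (u N) from ⟨h0, hN.le⟩)]
      · rw [cut, cut, indicator_of_notMem fun h => h0 h.1, indicator_of_notMem fun h => h0 h.1]
    · filter_upwards [hu.eventually_lt_const h] with N hN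
      rw [cut, cut, indicator_of_notMem fun h' => absurd h'.2 (not_le.2 h),
        indicator_of_notMem fun h' => absurd h'.2 (not_le.2 hN)]

/-- If the Riemann sums converge in probability at all times to a process with continuous paths,
then this process is the stochastic integral at all times. -/
theorem isIto_of_riemann (S : BMSetup P F B) (A : BddProg F θ C) (hT : 0 < T) {I : ℝ → Ω → ℝ}
    (hI : ∀ ω, ContinuousOn (fun s => I s ω) (Icc 0 T))
    (h : ∀ s ∈ Icc 0 T, TendstoInMeasure P
      (fun N => stepInt B (grid 0 s N) (N + 1) (sample θ s N)) atTop (I s)) :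
    ∀ s ∈ Icc 0 T, IsIto P F B 0 s (cut 0 s θ) (I s) := by
  intro s hs
  have hae := ae_isIto_of_riemann S A hT.le h
  have hdense : Dense {r | r ∈ Ioc 0 T → IsIto P F B 0 r (cut 0 r θ) (I r)} :=
    Measure.dense_of_ae hae
  have hcl : s ∈ closure (Ioo 0 T ∩ {r | r ∈ Ioc 0 T → IsIto P F B 0 r (cut 0 r θ) (I r)}) := by
    rw [← closure_closure (s := Ioo 0 T ∩ _)]
    have h1 := hdense.open_subset_closure_inter (isOpen_Ioo (a := (0 : ℝ)) (b := T))
    refine closure_mono h1 ?_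
    rwa [closure_Ioo hT.ne]
  obtain ⟨u, hu, hlim⟩ := mem_closure_iff_seq_limit.1 hcl
  have huT : ∀ N, u N ∈ Icc 0 T := fun N => ⟨(hu N).1.1.le, (hu N).1.2.le⟩
  have HN : ∀ N, IsIto P F B 0 T (cut 0 (u N) θ) (I (u N)) := fun N =>
    ((hu N).2 ⟨(hu N).1.1, (hu N).1.2.le⟩).mono le_rfl (huT N).2
  obtain ⟨J, hJ, hJlim⟩ := IsIto.exists_of_tendsto S le_rfl HN
    (fun k => (A.measurable_cut_top S.le le_rfl k).aemeasurable)
    (fun k => tendsto_sqn_cut S A hs huT hlim k)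
  have hJI : J =ᵐ[P] I s := by
    obtain ⟨ns, hns, h2⟩ := (tendstoInMeasure_of_sqn (fun N => (HN N).aemJ) hJ.aemJ
      hJlim).exists_seq_tendsto_ae
    filter_upwards [h2] with ω hω
    refine tendsto_nhds_unique hω ?_
    have : Tendsto (fun N => u (ns N)) atTop (nhdsWithin s (Icc 0 T)) :=
      tendsto_nhdsWithin_iff.2 ⟨hlim.comp hns.tendsto_atTop, Eventually.of_forall fun N => huT _⟩
    exact ((hI ω) s hs).tendsto.comp this
  obtain ⟨M, hM⟩ := A.exists_isIto' S le_rfl hs.1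
  have hMJ := (hM.mono le_rfl hs.2).ae_unique S le_rfl hJ fun k => ae_eq_refl _
  exact hM.congr (fun k => ae_eq_refl _) (hMJ.trans hJI)

theorem tendsto_sqn_sample (S : BMSetup P F B) (A : BddProg F θ C) {s : ℝ} (hs : 0 ≤ s) {I : Ω → ℝ}
    (h : TendstoInMeasure P (fun N => stepInt B (grid 0 s N) (N + 1) (sample θ s N)) atTop I)
    (H : IsIto P F B 0 s (cut 0 s θ) I) (k : Fin d) :
    Tendsto (fun N => sqn (volume.prod P) (fun x : ℝ × Ω =>
      stepProc (grid 0 s N) (N + 1) (sample θ s N) k x.1 x.2 - cut 0 s θ k x.1 x.2)) atTop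
      (nhds 0) := by
  have lim := ENNReal.Tendsto.const_mul (a := 4) (tendsto_sqn_sample_of_tendstoInMeasure S A hs h)
    (by simp)
  rw [mul_zero] at lim
  refine tendsto_of_tendsto_of_tendsto_of_le_of_le tendsto_const_nhds lim (fun _ => zero_le)
    fun N => ?_
  have hm := (A.stepAdapted_sample hs N).mem_elemSpan (B := B)
  rw [grid_zero, grid_last] at hm
  refine le_trans ?_ (((IsIto.of_mem S le_rfl hm).sub S le_rfl H).bounds S le_rfl).2
  exact Finset.single_le_sum (f := fun k => sqn (volume.prod P) (fun x : ℝ × Ω =>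
    stepProc (grid 0 s N) (N + 1) (sample θ s N) k x.1 x.2 - cut 0 s θ k x.1 x.2))
    (fun _ _ => zero_le) (Finset.mem_univ k)

end

end

/-! ### Weak solutions given by Riemann sums -/

section

variable {Ω : Type*} [mΩ : MeasurableSpace Ω] {n d : ℕ}

section

variable {T : ℝ} {x₀ : Fin n → ℝ} {σ : ℝ → (Fin n → ℝ) → Matrix (Fin n) (Fin d) ℝ}
    {P : Measure Ω} [IsProbabilityMeasure P] {F : ℝ → MeasurableSpace Ω} {B : ℝ → Ω → Fin d → ℝ}
    {X : ℝ → Ω → Fin n → ℝ} {β : Fin d → ℝ → Ω → ℝ} {C L D : ℝ}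

lemma BddProg.continuousOn_integral (A : BddProg F β C) (k : Fin d) (ω : Ω) :
    ContinuousOn (fun s => ∫ r in Ioc 0 s, β k r ω) (Icc 0 T) := by
  refine intervalIntegral.continuousOn_primitive ?_
  rw [integrableOn_Icc_iff_integrableOn_Ioc]
  exact A.integrableOn le_rfl k ω T

lemma itoRiemannSum_eq_stepInt (i : Fin n) (s : ℝ) (N : ℕ) (ω : Ω) :
    itoRiemannSum (fun s ω => σ s (X s ω)) B s (N + 1) ω i
      = stepInt B (grid 0 s N) (N + 1) (sample (rowProc σ X i) s N) ω := by
  have hg : ∀ j : ℕ, s * j / ((N + 1 : ℕ) : ℝ) = grid 0 s N j := fun j => by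
    simp only [grid]; push_cast; ring
  have hg' : ∀ j : ℕ, s * (j + 1) / ((N + 1 : ℕ) : ℝ) = grid 0 s N (j + 1) := fun j => by
    rw [← hg]; push_cast; ring
  simp only [itoRiemannSum, stepInt, sample, rowProc, hg, hg', Finset.sum_apply, Matrix.mulVec,
    dotProduct, Pi.sub_apply]

theorem Sys.of_isItoIntegralOn (S : BMSetup P F B) (G : GoodCoeff σ C L) (hT : 0 < T)
    (X_cont : ∀ ω, Continuous fun s => X s ω) (X_prog : ProgMeas F X) (A : BddProg F β D)
    (h : IsItoIntegralOn P T (fun s ω => σ s (X s ω)) B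
      (fun s ω => X s ω - x₀ - ∫ r in Icc (0 : ℝ) s, (σ r (X r ω)).mulVec fun k => β k r ω)) :
    Sys T x₀ σ P F B X β := by
  have Ai := fun i => G.bddProg X_prog i
  have h1 : ∀ i, ∀ s ∈ Icc 0 T, TendstoInMeasure P (fun N => stepInt B (grid 0 s N) (N + 1)
      (sample (rowProc σ X i) s N)) atTop
      (fun ω => X s ω i - x₀ i - dotI 0 s (rowProc σ X i) β ω) := by
    intro i s hs ε hε
    have h2 := (tendsto_add_atTop_iff_nat 1).2 (h s hs ε hε)
    refine tendsto_of_tendsto_of_tendsto_of_le_of_le tendsto_const_nhds h2 (fun _ => zero_le)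
      fun N => measure_mono fun ω hω => ?_
    simp only [mem_ofPred_eq] at hω ⊢
    refine hω.trans ?_
    rw [← itoRiemannSum_eq_stepInt]
    refine le_of_eq_of_le ?_ (edist_le_pi_edist _ _ i)
    congr 1
    simp only [Pi.sub_apply]
    congr 1
    rw [integral_Icc_eq_integral_Ioc, eval_integral]
    · exact (integral_finsetSum Finset.univ fun k _ =>
        ((Ai i).mul A).integrableOn le_rfl k ω s).symm
    · intro j
      exact integrable_finsetSum Finset.univ fun k _ => ((Ai j).mul A).integrableOn le_rfl k ω s
  have h2 : ∀ i, ∀ s ∈ Icc 0 T, IsIto P F B 0 s (cut 0 s (rowProc σ X i))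
      (fun ω => X s ω i - x₀ i - dotI 0 s (rowProc σ X i) β ω) := by
    intro i
    refine isIto_of_riemann (I := fun s ω => X s ω i - x₀ i - dotI 0 s (rowProc σ X i) β ω)
      S (Ai i) hT (fun ω => ?_) (h1 i)
    refine ContinuousOn.sub (((continuous_apply i).comp (X_cont ω)).continuousOn.sub
      continuousOn_const) ?_
    exact continuousOn_finsetSum _ fun k _ => ((Ai i).mul A).continuousOn_integral k ω
  exact ⟨S, X_cont, X_prog, ⟨_, A⟩, fun s hs i => h2 i s hs, fun s hs i k =>
    tendsto_sqn_sample S (Ai i) hs.1 (h1 i s hs) (h2 i s hs) k⟩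

/-- A change of measure removing the drift is undone by the opposite change of measure. -/
theorem lintegral_girP_neg (S : BMSetup P F B) (A : BddProg F β C) (hT : 0 ≤ T) {J : Ω → ℝ}
    (H : IsIto P F B 0 T (cut 0 T β) J) :
    IsIto P F B 0 T (cut 0 T fun k r ω => - β k r ω) (fun ω => - J ω) ∧
    IsIto (girP P T (fun k r ω => - β k r ω) (fun ω => - J ω)) F
      (girB B T (fun k r ω => - β k r ω)) 0 T (cut 0 T β) (fun ω => J ω + quad 0 T β ω) ∧
    ∀ f : Ω → ENNReal, AEMeasurable f P → ∫⁻ ω, f ω ∂P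
      = ∫⁻ ω, ENNReal.ofReal (expI 0 T β (fun ω => J ω + quad 0 T β ω) ω) * f ω
        ∂(girP P T (fun k r ω => - β k r ω) (fun ω => - J ω)) := by
  have H' : IsIto P F B 0 T (cut 0 T fun k r ω => - β k r ω) (fun ω => - J ω) := by
    refine (H.const_mul (-1)).congr (fun k => Eventually.of_forall fun x => ?_)
      (Eventually.of_forall fun ω => by simp)
    by_cases hr : x.1 ∈ Ioc 0 T <;> simp [cut, hr]
  have hq : ∀ ω, quad 0 T (fun k r ω => - β k r ω) ω = quad 0 T β ω := fun ω => by simp [quad]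
  have := isProbabilityMeasure_girP S A.neg hT H'
  refine ⟨H', ?_, fun f hf => ?_⟩
  · refine (IsIto.girsanov S A.neg hT H' A le_rfl hT H).congr (fun k => ae_eq_refl _)
      (Eventually.of_forall fun ω => ?_)
    have : dotI 0 T β (cut 0 T fun k r ω => - β k r ω) ω = - quad 0 T β ω := by
      rw [← dotI_self, dotI_congr (h' := β) (θ' := fun k r ω => - β k r ω) (fun _ _ _ => rfl)
        (fun k r hr => by simp [cut, hr])]
      simp [dotI, integral_neg]
    simp only [this, sub_neg_eq_add]
  · have m1 : AEMeasurable (fun ω => ENNReal.ofReal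
        (expI 0 T (fun k r ω => - β k r ω) (fun ω => - J ω) ω)) P :=
      (aemeasurable_expI S.le A.neg le_rfl H'.aemJ).ennreal_ofReal
    have m2 : AEMeasurable (expI 0 T β (fun ω => J ω + quad 0 T β ω)) P :=
      aemeasurable_expI S.le A le_rfl (H.aemJ.add ((A.measurable_quad le_rfl).mono (S.le _) le_rfl).aemeasurable)
    have m3 : AEMeasurable (fun ω => ENNReal.ofReal
        (expI 0 T β (fun ω => J ω + quad 0 T β ω) ω) * f ω) P := m2.ennreal_ofReal.mul hf
    rw [girP, lintegral_withDensity_eq_lintegral_mul₀ m1 m3]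
    refine lintegral_congr fun ω => ?_
    simp only [Pi.mul_apply]
    rw [← mul_assoc, ← ENNReal.ofReal_mul (expI_pos _ _ _ _ _).le]
    have : expI 0 T (fun k r ω => - β k r ω) (fun ω => - J ω) ω
        * expI 0 T β (fun ω => J ω + quad 0 T β ω) ω = 1 := by
      unfold expI
      rw [← Real.exp_add, hq]
      ring_nf
      exact Real.exp_zero
    rw [this]
    simp

end

end

/-! ### Feedback fields -/

section

variable {Ω : Type*} [mΩ : MeasurableSpace Ω] {n d : ℕ}

section

lemma StepAdapted.sq_stepProc {t : ℕ → ℝ} (ht : Monotone t) (N : ℕ) (ξ : ℕ → Ω → Fin d → ℝ)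
    (k : Fin d) (r : ℝ) (ω : Ω) :
    stepProc t N ξ k r ω ^ 2 = stepProc t N (fun j ω k => ξ j ω k ^ 2) k r ω := by
  by_cases hr : r ∈ Ioc (t 0) (t N)
  · obtain ⟨i, hi, hri⟩ := StepAdapted.exists_cell hr
    rw [stepProc_eq ht hi hri, stepProc_eq ht hi hri]
  · rw [stepProc_eq_zero ht hr, stepProc_eq_zero ht hr]; simp

lemma stepProc_sub {t : ℕ → ℝ} (N : ℕ) (ξ η : ℕ → Ω → Fin d → ℝ) (k : Fin d) (r : ℝ) (ω : Ω) :
    stepProc t N ξ k r ω - stepProc t N η k r ω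
      = stepProc t N (fun j ω k => ξ j ω k - η j ω k) k r ω := by
  simp only [stepProc, ← Finset.sum_sub_distrib]
  refine Finset.sum_congr rfl fun i _ => ?_
  by_cases hr : r ∈ Ioc (t i) (t (i + 1)) <;> simp [hr]

lemma sqn_stepProc {P : Measure Ω} [IsProbabilityMeasure P] {t : ℕ → ℝ} (ht : Monotone t) (N : ℕ)
    {ξ : ℕ → Ω → Fin d → ℝ} (k : Fin d) (hξ : ∀ j < N, AEMeasurable (fun ω => ξ j ω k) P) :
    sqn (volume.prod P) (fun x : ℝ × Ω => stepProc t N ξ k x.1 x.2)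
      = ∑ j ∈ Finset.range N, ENNReal.ofReal (t (j + 1) - t j) * sqn P (fun ω => ξ j ω k) := by
  have h : ∀ x : ℝ × Ω, ENNReal.ofReal (stepProc t N ξ k x.1 x.2 ^ 2) = ∑ j ∈ Finset.range N,
      (Ioc (t j) (t (j + 1))).indicator (fun _ => (1 : ENNReal)) x.1
        * ENNReal.ofReal (ξ j x.2 k ^ 2) := fun x => by
    rw [StepAdapted.sq_stepProc ht, stepProc, ENNReal.ofReal_sum_of_nonneg fun i _ =>
      indicator_nonneg (fun _ _ => sq_nonneg _) _]
    refine Finset.sum_congr rfl fun j _ => ?_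
    by_cases hr : x.1 ∈ Ioc (t j) (t (j + 1)) <;> simp [hr]
  have m1 : ∀ j, AEMeasurable ((Ioc (t j) (t (j + 1))).indicator fun _ => (1 : ENNReal)) volume :=
    fun j => (measurable_const.indicator measurableSet_Ioc).aemeasurable
  have m2 : ∀ j < N, AEMeasurable (fun ω => ENNReal.ofReal (ξ j ω k ^ 2)) P :=
    fun j hj => ((hξ j hj).pow_const 2).ennreal_ofReal
  have m3 : ∀ j ∈ Finset.range N, AEMeasurable (fun x : ℝ × Ω =>
      (Ioc (t j) (t (j + 1))).indicator (fun _ => (1 : ENNReal)) x.1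
        * ENNReal.ofReal (ξ j x.2 k ^ 2)) (volume.prod P) := fun j hj =>
    (m1 j).comp_fst.mul (m2 j (Finset.mem_range.1 hj)).comp_snd
  unfold sqn
  simp only [h]
  rw [lintegral_finsetSum' _ m3]
  refine Finset.sum_congr rfl fun j hj => ?_
  rw [lintegral_prod_mul (m1 j) (m2 j (Finset.mem_range.1 hj)),
    lintegral_indicator measurableSet_Ioc]
  simp

/-- A vector field with a discrete parameter, bounded, measurable and Lipschitz in space. -/
structure GoodField (f : Fin d → ℕ → ℝ → (Fin n → ℝ) → ℝ) (C L : ℝ) : Prop where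
  bdd : ∀ k q r x, |f k q r x| ≤ C
  meas : ∀ k, Measurable fun p : ℝ × ℕ × (Fin n → ℝ) => f k p.2.1 p.1 p.2.2
  lip : ∀ k q r x y, |f k q r x - f k q r y| ≤ L * dist x y

/-- A vector field along a process. -/
def fieldProc (f : Fin d → ℕ → ℝ → (Fin n → ℝ) → ℝ) (κ : Ω → ℕ) (X : ℝ → Ω → Fin n → ℝ)
    (k : Fin d) (r : ℝ) (ω : Ω) : ℝ := f k (κ ω) r (X r ω)

/-- The average of a vector field over a cell, at a given position. -/
def fieldCoef (a b : ℝ) (f : Fin d → ℕ → ℝ → (Fin n → ℝ) → ℝ) (N : ℕ) (κ : Ω → ℕ)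
    (Y : ℕ → Ω → Fin n → ℝ) (j : ℕ) (ω : Ω) (k : Fin d) : ℝ :=
  curAvg a b (f k (κ ω)) N j (Y j ω)

variable {f : Fin d → ℕ → ℝ → (Fin n → ℝ) → ℝ} {C L a b : ℝ} {κ : Ω → ℕ}
  {X : ℝ → Ω → Fin n → ℝ} {F : ℝ → MeasurableSpace Ω}

namespace GoodField

lemma mono (A : GoodField f C L) {C' L' : ℝ} (h : C ≤ C') (h' : L ≤ L') : GoodField f C' L' :=
  ⟨fun k q r x => (A.bdd k q r x).trans h, A.meas, fun k q r x y => (A.lip k q r x y).trans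
    (mul_le_mul_of_nonneg_right h' dist_nonneg)⟩

lemma measurable_uncurry (A : GoodField f C L) (k : Fin d) (q : ℕ) :
    Measurable (Function.uncurry (f k q)) :=
  (A.meas k).comp (measurable_fst.prodMk (measurable_const.prodMk measurable_snd))

lemma measurable_curAvg (A : GoodField f C L) (k : Fin d) (N j : ℕ) :
    Measurable fun p : ℕ × (Fin n → ℝ) => curAvg a b (f k p.1) N j p.2 :=
  (measurable_setIntegral_left (A.meas k) _).const_mul _

lemma bddProg_cut (A : GoodField f C L) (hF : ∀ s u, s ≤ u → F s ≤ F u) (hX : ProgMeas F X)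
    (hκ : Measurable[F a] κ) : BddProg F (cut a b (fieldProc f κ X)) C := by
  refine ⟨fun k s hs => ?_, fun k r ω => ?_⟩
  · by_cases h : a ≤ s
    · let _ := F s
      have h1 : Measurable fun p : Icc (0:ℝ) s × Ω => f k (κ p.2) p.1 (X p.1 p.2) :=
        (A.meas k).comp ((measurable_subtype_coe.comp measurable_fst).prodMk
          (((hκ.mono (hF _ _ h) le_rfl).comp measurable_snd).prodMk (hX s hs)))
      have h2 := h1.indicator (s := (fun p : Icc (0:ℝ) s × Ω => (p.1 : ℝ)) ⁻¹' (Ioc a b))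
        ((measurable_subtype_coe.comp measurable_fst) measurableSet_Ioc)
      refine (congrArg _ (funext fun x => ?_)).mp h2
      by_cases hx : (x.1 : ℝ) ∈ Ioc a b <;> simp [_root_.cut, hx, fieldProc]
    · have : (fun p : Icc (0:ℝ) s × Ω => _root_.cut a b (fieldProc f κ X) k p.1 p.2) = fun _ => 0 := by
        ext p
        have : (p.1 : ℝ) ∉ Ioc a b := fun h' => h (h'.1.le.trans p.1.2.2)
        simp [_root_.cut, this]
      rw [this]
      exact measurable_const
  · by_cases hr : r ∈ Ioc a b
    · simpa [cut, hr, fieldProc] using A.bdd _ _ _ _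
    · simpa [cut, hr] using (abs_nonneg _).trans (A.bdd k (κ ω) r (X r ω))

lemma stepAdapted (A : GoodField f C L) (hF : ∀ s u, s ≤ u → F s ≤ F u) (ha : 0 ≤ a) (hab : a ≤ b)
    (hκ : Measurable[F a] κ) {N : ℕ} {Y : ℕ → Ω → Fin n → ℝ}
    (hY : ∀ j, Measurable[F (grid a b N j)] (Y j)) :
    StepAdapted F (grid a b N) (N + 1) (fieldCoef a b f N κ Y) C where
  mono := grid_mono hab
  nonneg := by rwa [grid_zero]
  meas j _ := by
    refine @measurable_pi_lambda _ _ _ (F _) _ _ fun k => ?_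
    have h : a ≤ grid a b N j := grid_zero.symm.le.trans (grid_mono hab (Nat.zero_le j))
    let _ := F (grid a b N j)
    exact (A.measurable_curAvg k N j).comp ((hκ.mono (hF _ _ h) le_rfl).prodMk (hY j))
  bdd j _ ω k := abs_curAvg_le hab (A.bdd k _) _ _ _

lemma measurable_grid (hX : ProgMeas F X) (ha : 0 ≤ a) (hab : a ≤ b) (N j : ℕ) :
    Measurable[F (grid a b N j)] (X (grid a b N j)) :=
  hX.measurable (ha.trans (grid_zero.symm.le.trans (grid_mono hab (Nat.zero_le j))))

theorem tendsto_sqn {P : Measure Ω} [IsProbabilityMeasure P] (A : GoodField f C L)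
    (hF : ∀ s u, s ≤ u → F s ≤ F u) (hle : ∀ s, F s ≤ mΩ) (ha : 0 ≤ a) (hab : a < b)
    (hX : ProgMeas F X) (hXc : ∀ ω, Continuous fun s => X s ω) (hκ : Measurable[F a] κ)
    (k : Fin d) :
    Tendsto (fun N => sqn (volume.prod P) (fun x : ℝ × Ω =>
      stepProc (grid a b N) (N + 1) (fieldCoef a b f N κ fun j => X (grid a b N j)) k x.1 x.2
        - cut a b (fieldProc f κ X) k x.1 x.2)) atTop (nhds 0) := by
  have hC : 0 ≤ C := (abs_nonneg _).trans (A.bdd k 0 0 0)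
  have hA := fun N => A.stepAdapted hF ha hab.le hκ (N := N)
    (Y := fun j => X (grid a b N j)) (measurable_grid hX ha hab.le N)
  have hB := A.bddProg_cut (b := b) hF hX hκ
  refine tendsto_sqn_of_forall_ae (a := a) (b := b) (C := C)
    (u := fun N r ω => stepProc (grid a b N) (N + 1)
      (fieldCoef a b f N κ fun j => X (grid a b N j)) k r ω)
    (v := fun r ω => cut a b (fieldProc f κ X) k r ω)
    (fun N => measurable_stepProc (fun i hi => ((hA N).meas i hi).mono (hle _) le_rfl) k) ?_
    (fun N r ω => (hA N).abs_stepProc_le hC k r ω)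
    (fun r ω => hB.bdd k r ω) (fun N r ω hr => ?_) (fun r ω hr => by simp [cut, hr])
    (Eventually.of_forall fun ω => ?_)
  · have := hB.measurable_cut_top (a := a) (b := b) hle ha k
    rwa [cut_cut le_rfl le_rfl] at this
  · rw [StepAdapted.stepProc_eq_zero (grid_mono hab.le) (by rwa [grid_zero, grid_last])]
  · exact tendsto_stepProc_of_cell hab (f := fun r => f k (κ ω) r (X r ω))
      (ae_tendsto_curAvg hab (A.measurable_uncurry k (κ ω)) (A.bdd k (κ ω)) (A.lip k (κ ω)) (hXc ω))

lemma abs_curAvg_sub_le (A : GoodField f C L) (hab : a < b) (k : Fin d) (q N j : ℕ)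
    (x y : Fin n → ℝ) :
    |curAvg a b (f k q) N j x - curAvg a b (f k q) N j y| ≤ L * dist x y := by
  have hi : ∀ x, IntegrableOn (fun r => f k q r x) (Ioc (grid a b N j) (grid a b N (j + 1))) :=
    fun x => integrableOn_Ioc_of_bdd ((A.measurable_uncurry k q).comp
      (measurable_id.prodMk measurable_const)) (fun r => A.bdd k q r x) _ _
  have : curAvg a b (f k q) N j x - curAvg a b (f k q) N j y
      = curAvg a b (fun r (_ : Unit) => f k q r x - f k q r y) N j () := by
    simp only [curAvg]
    rw [integral_sub (hi x) (hi y), mul_sub]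
  rw [this]
  exact abs_curAvg_le hab.le (fun r _ => A.lip k q r x y) _ _ _

lemma sqn_fieldCoef_sub_le {P : Measure Ω} (A : GoodField f C L) (hab : a < b) (k : Fin d)
    (N j : ℕ) {Y Z : ℕ → Ω → Fin n → ℝ} (hY : AEMeasurable (Y j) P) (hZ : AEMeasurable (Z j) P) :
    sqn P (fun ω => fieldCoef a b f N κ Y j ω k - fieldCoef a b f N κ Z j ω k)
      ≤ ENNReal.ofReal (L ^ 2) * ∑ i, sqn P (fun ω => Y j ω i - Z j ω i) := by
  have hm : ∀ i, AEMeasurable (fun ω => ENNReal.ofReal ((Y j ω i - Z j ω i) ^ 2)) P := fun i =>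
    ((((measurable_pi_apply i).comp_aemeasurable hY).sub
      ((measurable_pi_apply i).comp_aemeasurable hZ)).pow_const 2).ennreal_ofReal
  unfold sqn
  rw [← lintegral_finsetSum' _ fun i _ => hm i, ← lintegral_const_mul' _ _ (by simp)]
  refine lintegral_mono fun ω => ?_
  simp only
  rw [← ENNReal.ofReal_sum_of_nonneg fun i _ => sq_nonneg _, ← ENNReal.ofReal_mul (sq_nonneg _)]
  refine ENNReal.ofReal_le_ofReal ?_
  have h1 := A.abs_curAvg_sub_le hab k (κ ω) N j (Y j ω) (Z j ω)
  have h2 : dist (Y j ω) (Z j ω) ^ 2 ≤ ∑ i, (Y j ω i - Z j ω i) ^ 2 := by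
    have h3 : dist (Y j ω) (Z j ω) ≤ √(∑ i, (Y j ω i - Z j ω i) ^ 2) := by
      refine (dist_pi_le_iff (Real.sqrt_nonneg _)).2 fun i => ?_
      refine Real.le_sqrt_of_sq_le ?_
      rw [Real.dist_eq, sq_abs]
      exact Finset.single_le_sum (f := fun i => (Y j ω i - Z j ω i) ^ 2)
        (fun i _ => sq_nonneg _) (Finset.mem_univ i)
    calc _ ≤ √(∑ i, (Y j ω i - Z j ω i) ^ 2) ^ 2 := pow_le_pow_left₀ dist_nonneg h3 2
      _ = _ := Real.sq_sqrt (Finset.sum_nonneg fun i _ => sq_nonneg _)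
  calc _ = |fieldCoef a b f N κ Y j ω k - fieldCoef a b f N κ Z j ω k| ^ 2 := (sq_abs _).symm
    _ ≤ (L * dist (Y j ω) (Z j ω)) ^ 2 := pow_le_pow_left₀ (abs_nonneg _) h1 2
    _ ≤ _ := by rw [mul_pow]; exact mul_le_mul_of_nonneg_left h2 (sq_nonneg _)

end GoodField

/-- A discrete Grönwall inequality. -/
lemma le_mul_pow_of_le_add_sum {e : ℕ → ENNReal} {A c : ENNReal} {M : ℕ}
    (h : ∀ k ≤ M, e k ≤ A + c * ∑ j ∈ Finset.range k, e j) : ∀ k ≤ M, e k ≤ A * (1 + c) ^ k := by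
  have h1 : ∀ k, A + c * ∑ j ∈ Finset.range k, A * (1 + c) ^ j = A * (1 + c) ^ k := by
    intro k
    induction k with
    | zero => simp
    | succ k ih => rw [Finset.sum_range_succ, mul_add, ← add_assoc, ih]; ring
  intro k
  induction k using Nat.strong_induction_on with
  | _ k ih =>
    intro hk
    refine (h k hk).trans ((add_le_add_right (mul_le_mul_right (Finset.sum_le_sum fun j hj => ?_) c)
      A).trans (h1 k).le)
    have := Finset.mem_range.1 hj
    exact ih j this (this.le.trans hk)

end

end

/-! ### Local solutions and the Euler scheme -/

section

variable {Ω : Type*} [mΩ : MeasurableSpace Ω] {n d : ℕ}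

section

/-- The Euler scheme started from `X a`, driven by `B`, with drift `∑ k, μ i k` and diffusion
coefficient `s i k`. -/
def euler (a b : ℝ) (s μ : Fin n → Fin d → ℕ → ℝ → (Fin n → ℝ) → ℝ) (B : ℝ → Ω → Fin d → ℝ)
    (κ : Ω → ℕ) (x : Ω → Fin n → ℝ) (N : ℕ) : ℕ → Ω → Fin n → ℝ
  | 0 => x
  | j + 1 => fun ω i => euler a b s μ B κ x N j ω i
      + ∑ k, curAvg a b (s i k (κ ω)) N j (euler a b s μ B κ x N j ω)
        * (B (grid a b N (j + 1)) ω k - B (grid a b N j) ω k)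
      + ∑ k, (grid a b N (j + 1) - grid a b N j)
        * curAvg a b (μ i k (κ ω)) N j (euler a b s μ B κ x N j ω)

/-- The process `X` solves on `[a, b]` the stochastic differential equation whose coefficients are
the fields `s` and `μ`. -/
structure LocalSol (P : Measure Ω) (F : ℝ → MeasurableSpace Ω) (B : ℝ → Ω → Fin d → ℝ)
    (X : ℝ → Ω → Fin n → ℝ) (s μ : Fin n → Fin d → ℕ → ℝ → (Fin n → ℝ) → ℝ) (κ : Ω → ℕ)
    (a b C L : ℝ) : Prop where
  bm : BMSetup P F B
  cont : ∀ ω, Continuous fun s => X s ω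
  prog : ProgMeas F X
  good_s : ∀ i, GoodField (s i) C L
  good_μ : ∀ i, GoodField (μ i) C L
  meas_κ : Measurable[F a] κ
  nonneg : 0 ≤ a
  lt : a < b
  ito : ∀ t ∈ Icc a b, ∀ i, IsIto P F B 0 b (cut a t (fieldProc (s i) κ X))
    (fun ω => X t ω i - X a ω i - ∑ k, ∫ r in Ioc a t, μ i k (κ ω) r (X r ω))

variable {a b C L : ℝ} {κ : Ω → ℕ} {P : Measure Ω} [IsProbabilityMeasure P]
  {X : ℝ → Ω → Fin n → ℝ} {F : ℝ → MeasurableSpace Ω} {B : ℝ → Ω → Fin d → ℝ}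
  {s μ : Fin n → Fin d → ℕ → ℝ → (Fin n → ℝ) → ℝ} {f : Fin d → ℕ → ℝ → (Fin n → ℝ) → ℝ}

namespace LocalSol

lemma measurable_euler (A : LocalSol P F B X s μ κ a b C L) (N j : ℕ) :
    Measurable[F (grid a b N j)] (euler a b s μ B κ (X a) N j) := by
  induction j with
  | zero =>
    rw [grid_zero]
    exact A.prog.measurable A.nonneg
  | succ j ih =>
    have h0 : a ≤ grid a b N j := grid_zero.symm.le.trans (grid_mono A.lt.le (Nat.zero_le j))
    have h1 : grid a b N j ≤ grid a b N (j + 1) := grid_mono A.lt.le (Nat.le_succ j)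
    have m1 := ih.mono (A.bm.mono _ _ h1) le_rfl
    have m2 := A.meas_κ.mono (A.bm.mono _ _ (h0.trans h1)) le_rfl
    have m3 := A.bm.measurable_B_of_le (A.nonneg.trans h0) h1
    have m4 := A.bm.measurable_B (A.nonneg.trans (h0.trans h1))
    have hs := A.good_s
    have hμ := A.good_μ
    let _ := F (grid a b N (j + 1))
    refine measurable_pi_lambda _ fun i => ?_
    refine Measurable.add (Measurable.add ((measurable_pi_apply i).comp m1) ?_) ?_
    · exact Finset.measurable_sum _ fun k _ => (((hs i).measurable_curAvg k N j).comp
        (m2.prodMk m1)).mul (((measurable_pi_apply k).comp m4).sub ((measurable_pi_apply k).comp m3))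
    · exact Finset.measurable_sum _ fun k _ => (((hμ i).measurable_curAvg k N j).comp
        (m2.prodMk m1)).const_mul _

lemma aemeasurable_euler (A : LocalSol P F B X s μ κ a b C L) (N j : ℕ) :
    AEMeasurable (euler a b s μ B κ (X a) N j) P :=
  ((A.measurable_euler N j).mono (A.bm.le _) le_rfl).aemeasurable

lemma aemeasurable_grid (A : LocalSol P F B X s μ κ a b C L) (N j : ℕ) :
    AEMeasurable (X (grid a b N j)) P :=
  ((GoodField.measurable_grid A.prog A.nonneg A.lt.le N j).mono (A.bm.le _) le_rfl).aemeasurable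

/-- The one-step errors of a field along the exact solution. -/
def gridErr (P : Measure Ω) (a b : ℝ) (f : Fin d → ℕ → ℝ → (Fin n → ℝ) → ℝ) (κ : Ω → ℕ)
    (X : ℝ → Ω → Fin n → ℝ) (N : ℕ) : ENNReal :=
  ∑ k, sqn (volume.prod P) (fun x : ℝ × Ω =>
    stepProc (grid a b N) (N + 1) (fieldCoef a b f N κ fun j => X (grid a b N j)) k x.1 x.2
      - cut a b (fieldProc f κ X) k x.1 x.2)

lemma tendsto_gridErr (A : LocalSol P F B X s μ κ a b C L) {C' L' : ℝ} (hf : GoodField f C' L') :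
    Tendsto (gridErr P a b f κ X) atTop (nhds 0) := by
  have := tendsto_finsetSum Finset.univ fun k (_ : k ∈ Finset.univ) =>
    hf.tendsto_sqn (P := P) A.bm.mono A.bm.le A.nonneg A.lt A.prog A.cont A.meas_κ k
  rwa [Finset.sum_const_zero] at this

/-- The mean square error of the Euler scheme at a grid point. -/
def eulerErr (P : Measure Ω) (a b : ℝ) (s μ : Fin n → Fin d → ℕ → ℝ → (Fin n → ℝ) → ℝ)
    (B : ℝ → Ω → Fin d → ℝ) (κ : Ω → ℕ) (X : ℝ → Ω → Fin n → ℝ) (N j : ℕ) : ENNReal :=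
  ∑ i, sqn P (fun ω => euler a b s μ B κ (X a) N j ω i - X (grid a b N j) ω i)

lemma measurable_stepProc_euler (A : LocalSol P F B X s μ κ a b C L) {C' L' : ℝ}
    (hf : GoodField f C' L') (N : ℕ) {M : ℕ} (hM : M ≤ N + 1) (k : Fin d) :
    Measurable fun x : ℝ × Ω => stepProc (grid a b N) M
      (fieldCoef a b f N κ (euler a b s μ B κ (X a) N)) k x.1 x.2 :=
  measurable_stepProc (fun j hj => (((hf.stepAdapted A.bm.mono A.nonneg A.lt.le A.meas_κ
    (A.measurable_euler N)).meas j (hj.trans_le hM)).mono (A.bm.le _) le_rfl)) k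

lemma measurable_cut_field (A : LocalSol P F B X s μ κ a b C L) {C' L' : ℝ}
    (hf : GoodField f C' L') {t : ℝ} (ht : t ≤ b) (k : Fin d) :
    Measurable fun x : ℝ × Ω => cut a t (fieldProc f κ X) k x.1 x.2 := by
  have := (hf.bddProg_cut (b := b) A.bm.mono A.prog A.meas_κ).measurable_cut_top (a := a) (b := t)
    A.bm.le A.nonneg k
  rwa [cut_cut le_rfl ht] at this

lemma sqn_stepProc_euler_sub_le (A : LocalSol P F B X s μ κ a b C L) {C' L' : ℝ}
    (hf : GoodField f C' L') (N : ℕ) {M : ℕ} (hM : M ≤ N + 1) :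
    ∑ k, sqn (volume.prod P) (fun x : ℝ × Ω =>
      stepProc (grid a b N) M (fieldCoef a b f N κ (euler a b s μ B κ (X a) N)) k x.1 x.2
        - cut a (grid a b N M) (fieldProc f κ X) k x.1 x.2)
      ≤ 2 * gridErr P a b f κ X N + 2 * d * ENNReal.ofReal (L' ^ 2) *
        ENNReal.ofReal ((b - a) / (N + 1)) * ∑ j ∈ Finset.range M, eulerErr P a b s μ B κ X N j := by
  have hm := grid_mono (N := N) A.lt.le
  have hb : grid a b N M ≤ b := (hm hM).trans grid_last.le
  set ξ := fieldCoef a b f N κ (euler a b s μ B κ (X a) N) with hξ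
  set η := fieldCoef a b f N κ (fun j => X (grid a b N j)) with hη
  have Aη : StepAdapted F (grid a b N) (N + 1) η C' := hf.stepAdapted A.bm.mono A.nonneg A.lt.le
    A.meas_κ (GoodField.measurable_grid A.prog A.nonneg A.lt.le N)
  have Aξ : StepAdapted F (grid a b N) (N + 1) ξ C' := hf.stepAdapted A.bm.mono A.nonneg A.lt.le
    A.meas_κ (A.measurable_euler N)
  have mη : ∀ k, Measurable fun x : ℝ × Ω => stepProc (grid a b N) M η k x.1 x.2 := fun k =>
    measurable_stepProc (fun j hj => ((Aη.meas j (hj.trans_le hM)).mono (A.bm.le _) le_rfl)) k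
  have mξ := A.measurable_stepProc_euler hf N hM
  rw [← hξ] at mξ
  have h1 : ∀ k, sqn (volume.prod P) (fun x : ℝ × Ω => stepProc (grid a b N) M η k x.1 x.2
        - cut a (grid a b N M) (fieldProc f κ X) k x.1 x.2)
      ≤ sqn (volume.prod P) (fun x : ℝ × Ω => stepProc (grid a b N) (N + 1) η k x.1 x.2
        - cut a b (fieldProc f κ X) k x.1 x.2) := fun k => by
    refine lintegral_mono fun x => ENNReal.ofReal_le_ofReal ?_
    simp only
    by_cases hr : x.1 ∈ Ioc a (grid a b N M)
    · obtain ⟨i, hi, hri⟩ := StepAdapted.exists_cell (t := grid a b N) (N := M) (by rwa [grid_zero])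
      rw [StepAdapted.stepProc_eq hm hi hri, StepAdapted.stepProc_eq hm (hi.trans_le hM) hri]
      have : x.1 ∈ Ioc a b := ⟨hr.1, hr.2.trans hb⟩
      simp [cut, hr, this]
    · rw [StepAdapted.stepProc_eq_zero hm (by rwa [grid_zero])]
      simp [cut, hr, sq_nonneg]
  have h2 : ∀ k, sqn (volume.prod P) (fun x : ℝ × Ω => stepProc (grid a b N) M ξ k x.1 x.2
        - stepProc (grid a b N) M η k x.1 x.2)
      ≤ ENNReal.ofReal (L' ^ 2) * ENNReal.ofReal ((b - a) / (N + 1)) *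
        ∑ j ∈ Finset.range M, eulerErr P a b s μ B κ X N j := fun k => by
    simp only [stepProc_sub]
    rw [sqn_stepProc hm M k fun j hj => ?_, Finset.mul_sum]
    · refine Finset.sum_le_sum fun j _ => ?_
      rw [grid_succ_sub, mul_comm (ENNReal.ofReal (L' ^ 2)), mul_assoc]
      exact mul_le_mul_right (hf.sqn_fieldCoef_sub_le A.lt k N j (A.aemeasurable_euler N j)
        (A.aemeasurable_grid N j)) _
    · exact (((measurable_pi_apply k).comp ((Aξ.meas j (hj.trans_le hM)).mono (A.bm.le _)
        le_rfl)).sub ((measurable_pi_apply k).comp ((Aη.meas j (hj.trans_le hM)).mono (A.bm.le _)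
        le_rfl))).aemeasurable
  calc _ ≤ ∑ k : Fin d, (2 * (ENNReal.ofReal (L' ^ 2) * ENNReal.ofReal ((b - a) / (N + 1)) *
        ∑ j ∈ Finset.range M, eulerErr P a b s μ B κ X N j)
        + 2 * sqn (volume.prod P) (fun x : ℝ × Ω => stepProc (grid a b N) (N + 1) η k x.1 x.2
        - cut a b (fieldProc f κ X) k x.1 x.2)) := Finset.sum_le_sum fun k _ =>
          (sqn_sub_le_add (mξ k).aemeasurable (mη k).aemeasurable).trans
            (add_le_add (mul_le_mul_right (h2 k) 2) (mul_le_mul_right (h1 k) 2))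
    _ = _ := by
      rw [Finset.sum_add_distrib, ← Finset.mul_sum, Finset.sum_const, add_comm]
      simp only [Finset.card_univ, Fintype.card_fin, nsmul_eq_mul]
      refine congrArg₂ _ (Finset.mul_sum _ _ _).symm ?_
      ring

end LocalSol

end

end

/-! ### Convergence of the Euler scheme -/

section

variable {Ω : Type*} [mΩ : MeasurableSpace Ω] {n d : ℕ}

section

variable {a b C L : ℝ} {κ : Ω → ℕ} {P : Measure Ω} [IsProbabilityMeasure P]
  {X : ℝ → Ω → Fin n → ℝ} {F : ℝ → MeasurableSpace Ω} {B : ℝ → Ω → Fin d → ℝ}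
  {s μ : Fin n → Fin d → ℕ → ℝ → (Fin n → ℝ) → ℝ} {f : Fin d → ℕ → ℝ → (Fin n → ℝ) → ℝ}

lemma setIntegral_stepProc {t : ℕ → ℝ} (ht : Monotone t) (N : ℕ) (ξ : ℕ → Ω → Fin d → ℝ)
    (k : Fin d) (ω : Ω) :
    ∫ r in Ioc (t 0) (t N), stepProc t N ξ k r ω
      = ∑ j ∈ Finset.range N, (t (j + 1) - t j) * ξ j ω k := by
  have := sum_setIntegral_eq_stepProc ht N ξ k ω (f := fun _ => (1 : ℝ)) (by simp) id
  simp only [id, mul_one] at this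
  rw [this]
  refine Finset.sum_congr rfl fun j _ => ?_
  simp [ht (Nat.le_succ j), mul_comm]

lemma euler_eq (hab : a ≤ b) (x : Ω → Fin n → ℝ) (N M : ℕ) (ω : Ω) (i : Fin n) :
    euler a b s μ B κ x N M ω i = x ω i
      + stepInt B (grid a b N) M (fieldCoef a b (s i) N κ (euler a b s μ B κ x N)) ω
      + ∑ k, ∫ r in Ioc a (grid a b N M),
        stepProc (grid a b N) M (fieldCoef a b (μ i) N κ (euler a b s μ B κ x N)) k r ω := by
  have h : ∀ k, ∫ r in Ioc a (grid a b N M),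
        stepProc (grid a b N) M (fieldCoef a b (μ i) N κ (euler a b s μ B κ x N)) k r ω
      = ∑ j ∈ Finset.range M, (grid a b N (j + 1) - grid a b N j) *
        fieldCoef a b (μ i) N κ (euler a b s μ B κ x N) j ω k := fun k => by
    have := setIntegral_stepProc (grid_mono (N := N) hab) M
      (fieldCoef a b (μ i) N κ (euler a b s μ B κ x N)) k ω
    rwa [grid_zero] at this
  simp only [h]
  rw [Finset.sum_comm]
  clear h
  induction M with
  | zero => simp [euler, stepInt]
  | succ M ih =>
    simp only [stepInt] at ih ⊢
    rw [Finset.sum_range_succ, Finset.sum_range_succ]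
    simp only [euler]
    rw [ih]
    simp only [fieldCoef]
    ring

lemma exists_one_add_pow_le (hab : a ≤ b) {R : ENNReal} (hR : R ≠ ⊤) : ∃ K : ENNReal, K ≠ ⊤ ∧
    ∀ N M : ℕ, M ≤ N + 1 → (1 + R * ENNReal.ofReal ((b - a) / (N + 1))) ^ M ≤ K := by
  refine ⟨ENNReal.ofReal (Real.exp (R.toReal * (b - a))), by simp, fun N M hM => ?_⟩
  have hδ : 0 ≤ (b - a) / ((N : ℝ) + 1) := div_nonneg (sub_nonneg.2 hab) (by positivity)
  have e : 1 + R * ENNReal.ofReal ((b - a) / (N + 1))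
      = ENNReal.ofReal (1 + R.toReal * ((b - a) / (N + 1))) := by
    rw [ENNReal.ofReal_add zero_le_one (by positivity), ENNReal.ofReal_mul (by positivity),
      ENNReal.ofReal_toReal hR, ENNReal.ofReal_one]
  calc _ ≤ (1 + R * ENNReal.ofReal ((b - a) / (N + 1))) ^ (N + 1) :=
        pow_le_pow_right₀ le_self_add hM
    _ = ENNReal.ofReal ((1 + R.toReal * ((b - a) / (N + 1))) ^ (N + 1)) := by
        rw [e, ENNReal.ofReal_pow (by positivity)]
    _ ≤ _ := ENNReal.ofReal_le_ofReal ?_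
  calc _ ≤ Real.exp (R.toReal * ((b - a) / (N + 1))) ^ (N + 1) :=
        pow_le_pow_left₀ (by positivity) ((add_comm _ _).trans_le (Real.add_one_le_exp _)) _
    _ = _ := by
        rw [← Real.exp_nat_mul]
        congr 1
        push_cast
        field_simp

namespace LocalSol

lemma sqn_euler_sub_le (A : LocalSol P F B X s μ κ a b C L) (N : ℕ) {M : ℕ} (hM : M ≤ N + 1)
    (i : Fin n) :
    sqn P (fun ω => euler a b s μ B κ (X a) N M ω i - X (grid a b N M) ω i)
      ≤ 8 * (∑ k, sqn (volume.prod P) (fun x : ℝ × Ω => stepProc (grid a b N) M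
        (fieldCoef a b (s i) N κ (euler a b s μ B κ (X a) N)) k x.1 x.2
          - cut a (grid a b N M) (fieldProc (s i) κ X) k x.1 x.2))
      + 2 * d * ENNReal.ofReal (b - a) * (∑ k, sqn (volume.prod P) (fun x : ℝ × Ω =>
        stepProc (grid a b N) M (fieldCoef a b (μ i) N κ (euler a b s μ B κ (X a) N)) k x.1 x.2
          - cut a (grid a b N M) (fieldProc (μ i) κ X) k x.1 x.2)) := by
  have hm := grid_mono (N := N) A.lt.le
  have hb : grid a b N M ≤ b := (hm hM).trans grid_last.le
  have ha : a ≤ grid a b N M := grid_zero.symm.le.trans (hm (Nat.zero_le M))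
  set t := grid a b N M with ht
  set ξ := fieldCoef a b (s i) N κ (euler a b s μ B κ (X a) N) with hξ
  set η := fieldCoef a b (μ i) N κ (euler a b s μ B κ (X a) N) with hη
  have Aξ : StepAdapted F (grid a b N) (N + 1) ξ C := (A.good_s i).stepAdapted A.bm.mono A.nonneg
    A.lt.le A.meas_κ (A.measurable_euler N)
  have H1 : IsIto P F B 0 b (stepProc (grid a b N) M ξ) (stepInt B (grid a b N) M ξ) := by
    have := (Aξ.of_le hM).mem_elemSpan (B := B)
    exact (IsIto.of_mem A.bm Aξ.nonneg this).mono Aξ.nonneg hb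
  have H2 := H1.sub A.bm le_rfl (A.ito t ⟨ha, hb⟩ i)
  have b1 := (H2.bounds A.bm le_rfl).1
  have mη : ∀ k, Measurable fun x : ℝ × Ω => stepProc (grid a b N) M η k x.1 x.2 :=
    A.measurable_stepProc_euler (A.good_μ i) N hM
  have mc : ∀ k, Measurable fun x : ℝ × Ω => cut a t (fieldProc (μ i) κ X) k x.1 x.2 :=
    A.measurable_cut_field (A.good_μ i) hb
  have mw : ∀ k, Measurable fun x : ℝ × Ω => stepProc (grid a b N) M η k x.1 x.2
    - cut a t (fieldProc (μ i) κ X) k x.1 x.2 := fun k => (mη k).sub (mc k)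
  have mi : ∀ k, AEMeasurable (fun ω => ∫ r in Ioc a t, (stepProc (grid a b N) M η k r ω
      - cut a t (fieldProc (μ i) κ X) k r ω)) P := fun k =>
    (measurable_setIntegral_left (f := fun x : ℝ × Ω => stepProc (grid a b N) M η k x.1 x.2
    - cut a t (fieldProc (μ i) κ X) k x.1 x.2) (mw k) (Ioc a t)).aemeasurable
  have b2 : sqn P (fun ω => ∑ k, ∫ r in Ioc a t, (stepProc (grid a b N) M η k r ω
      - cut a t (fieldProc (μ i) κ X) k r ω)) ≤ d * ∑ k, (ENNReal.ofReal (b - a) *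
      sqn (volume.prod P) (fun x : ℝ × Ω => stepProc (grid a b N) M η k x.1 x.2
          - cut a t (fieldProc (μ i) κ X) k x.1 x.2)) := by
    have h0 := sqn_sum_le mi
    rw [Fintype.card_fin] at h0
    refine h0.trans (mul_le_mul_right (Finset.sum_le_sum fun k _ => ?_) _)
    refine (sqn_setIntegral_le (mw k) a t).trans (mul_le_mul_left ?_ _)
    exact ENNReal.ofReal_le_ofReal (by linarith)
  have e : ∀ ω, euler a b s μ B κ (X a) N M ω i - X t ω i
      = (stepInt B (grid a b N) M ξ ω
        - (X t ω i - X a ω i - ∑ k, ∫ r in Ioc a t, μ i k (κ ω) r (X r ω)))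
      + ∑ k, ∫ r in Ioc a t, (stepProc (grid a b N) M η k r ω
        - cut a t (fieldProc (μ i) κ X) k r ω) := fun ω => by
    have h1 : ∀ k, ∫ r in Ioc a t, (stepProc (grid a b N) M η k r ω
        - cut a t (fieldProc (μ i) κ X) k r ω) = (∫ r in Ioc a t, stepProc (grid a b N) M η k r ω)
        - ∫ r in Ioc a t, μ i k (κ ω) r (X r ω) := fun k => by
      have i1 : IntegrableOn (fun r => stepProc (grid a b N) M η k r ω) (Ioc a t) :=
        integrableOn_Ioc_of_bdd (C := C) ((mη k).comp measurable_prodMk_right) (fun r =>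
          (((A.good_μ i).stepAdapted A.bm.mono A.nonneg
          A.lt.le A.meas_κ (A.measurable_euler N)).of_le hM).abs_stepProc_le
          ((abs_nonneg _).trans ((A.good_μ i).bdd k 0 0 0)) _ _ _) _ _
      have i2 : IntegrableOn (fun r => cut a t (fieldProc (μ i) κ X) k r ω) (Ioc a t) :=
        integrableOn_Ioc_of_bdd (C := C) ((mc k).comp measurable_prodMk_right) (fun r => by
          have := ((A.good_μ i).bddProg_cut (b := t) A.bm.mono A.prog A.meas_κ).bdd k r ω
          exact this) _ _
      rw [integral_sub i1 i2]
      congr 1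
      exact setIntegral_congr_fun measurableSet_Ioc fun r hr => by simp [cut, hr, fieldProc]
    simp only [h1]
    rw [euler_eq A.lt.le, Finset.sum_sub_distrib]
    ring
  simp only [e]
  calc _ ≤ _ := sqn_add_le H2.aemJ
    _ ≤ _ := add_le_add (mul_le_mul_right b1 2) (mul_le_mul_right b2 2)
    _ = _ := by
      rw [← Finset.mul_sum]
      ring

theorem exists_eulerErr_le (A : LocalSol P F B X s μ κ a b C L) : ∃ u : ℕ → ENNReal,
    Tendsto u atTop (nhds 0) ∧ ∀ N M, M ≤ N + 1 → eulerErr P a b s μ B κ X N M ≤ u N := by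
  set D : ENNReal := 2 * d * ENNReal.ofReal (b - a) with hD
  set R : ENNReal := n * ((8 + D) * (2 * d * ENNReal.ofReal (L ^ 2))) with hR
  set U : ℕ → ENNReal := fun N => ∑ i, (8 * (2 * gridErr P a b (s i) κ X N)
    + D * (2 * gridErr P a b (μ i) κ X N)) with hU
  have hDt : D ≠ ⊤ := by finiteness
  have hRt : R ≠ ⊤ := by finiteness
  obtain ⟨K, hK, hKle⟩ := exists_one_add_pow_le A.lt.le hRt
  refine ⟨fun N => U N * K, ?_, fun N M hM => ?_⟩
  · have h1 : Tendsto U atTop (nhds 0) := by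
      have := tendsto_finsetSum Finset.univ fun i (_ : i ∈ Finset.univ) =>
        (ENNReal.Tendsto.const_mul (a := 8) (ENNReal.Tendsto.const_mul (a := 2)
          (A.tendsto_gridErr (A.good_s i)) (by simp)) (by simp)).add
        (ENNReal.Tendsto.const_mul (a := D) (ENNReal.Tendsto.const_mul (a := 2)
          (A.tendsto_gridErr (A.good_μ i)) (by simp)) (by simp [hDt]))
      simpa using this
    simpa using ENNReal.Tendsto.mul_const h1 (Or.inr hK)
  · refine (le_mul_pow_of_le_add_sum (A := U N) (c := R * ENNReal.ofReal ((b - a) / (N + 1)))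
      (M := N + 1) (fun M hM => ?_) M hM).trans (mul_le_mul_right (hKle N M hM) _)
    calc _ ≤ ∑ i : Fin n, ((8 * (2 * gridErr P a b (s i) κ X N)
            + D * (2 * gridErr P a b (μ i) κ X N)) + (8 + D) * (2 * d * ENNReal.ofReal (L ^ 2)) *
            ENNReal.ofReal ((b - a) / (N + 1))
              * ∑ j ∈ Finset.range M, eulerErr P a b s μ B κ X N j) :=
          Finset.sum_le_sum fun i _ => ((A.sqn_euler_sub_le N hM i).trans
            (add_le_add (mul_le_mul_right (A.sqn_stepProc_euler_sub_le (A.good_s i) N hM) _)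
            (mul_le_mul_right (A.sqn_stepProc_euler_sub_le (A.good_μ i) N hM) _))).trans_eq
            (by rw [hD]; ring)
      _ = _ := by
        rw [Finset.sum_add_distrib, Finset.sum_const]
        simp only [Finset.card_univ, Fintype.card_fin, nsmul_eq_mul, hR, hU]
        ring

lemma tendsto_stepProc_euler (A : LocalSol P F B X s μ κ a b C L) {C' L' : ℝ}
    (hf : GoodField f C' L') (k : Fin d) : Tendsto (fun N => sqn (volume.prod P) (fun x : ℝ × Ω =>
      stepProc (grid a b N) (N + 1) (fieldCoef a b f N κ (euler a b s μ B κ (X a) N)) k x.1 x.2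
        - cut a b (fieldProc f κ X) k x.1 x.2)) atTop (nhds 0) := by
  obtain ⟨u, hu, hle⟩ := A.exists_eulerErr_le
  have h1 := (ENNReal.Tendsto.const_mul (a := 2) (A.tendsto_gridErr hf) (by simp)).add
    (ENNReal.Tendsto.const_mul (a := 2 * d * ENNReal.ofReal (L' ^ 2) * ENNReal.ofReal (b - a)) hu
      (Or.inr (by finiteness)))
  simp only [mul_zero, add_zero] at h1
  refine tendsto_of_tendsto_of_tendsto_of_le_of_le tendsto_const_nhds h1 (fun _ => zero_le)
    fun N => ?_
  have h2 := A.sqn_stepProc_euler_sub_le hf N le_rfl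
  rw [grid_last] at h2
  refine ((Finset.single_le_sum (f := fun k => sqn (volume.prod P) (fun x : ℝ × Ω =>
      stepProc (grid a b N) (N + 1) (fieldCoef a b f N κ (euler a b s μ B κ (X a) N)) k x.1 x.2
        - cut a b (fieldProc f κ X) k x.1 x.2)) (fun _ _ => zero_le)
        (Finset.mem_univ k)).trans h2).trans (add_le_add le_rfl ?_)
  have h3 : ∑ j ∈ Finset.range (N + 1), eulerErr P a b s μ B κ X N j ≤ (N + 1 : ℕ) * u N := by
    refine (Finset.sum_le_sum fun j hj => hle N j (Finset.mem_range.1 hj).le).trans ?_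
    simp
  have h4 : ENNReal.ofReal ((b - a) / (N + 1)) * (N + 1 : ℕ) = ENNReal.ofReal (b - a) := by
    have := A.lt
    rw [← ENNReal.ofReal_natCast, ← ENNReal.ofReal_mul (div_nonneg (by linarith) (by positivity))]
    congr 1
    push_cast
    field_simp
  calc _ ≤ 2 * d * ENNReal.ofReal (L' ^ 2) * ENNReal.ofReal ((b - a) / (N + 1))
        * ((N + 1 : ℕ) * u N) := mul_le_mul_right h3 _
    _ = 2 * d * ENNReal.ofReal (L' ^ 2) * (ENNReal.ofReal ((b - a) / (N + 1))
        * (N + 1 : ℕ)) * u N := by ring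
    _ = _ := by rw [h4]

end LocalSol

end

end

/-! ### Functionals of the Euler scheme -/

section

variable {Ω : Type*} {m : MeasurableSpace Ω} [mΩ : MeasurableSpace Ω] {n d : ℕ}

section

variable {a b C L : ℝ} {κ : Ω → ℕ} {P : Measure Ω} [IsProbabilityMeasure P]
  {X : ℝ → Ω → Fin n → ℝ} {F : ℝ → MeasurableSpace Ω} {B : ℝ → Ω → Fin d → ℝ}
  {s μ : Fin n → Fin d → ℕ → ℝ → (Fin n → ℝ) → ℝ} {f : Fin d → ℕ → ℝ → (Fin n → ℝ) → ℝ}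

/-- Up to null sets, `m` contains the increments of `B` between dyadic points of `[a, b]`. -/
def DyadicIncr {Ω : Type*} {d : ℕ} (m : MeasurableSpace Ω) [MeasurableSpace Ω] (P : Measure Ω)
    (B : ℝ → Ω → Fin d → ℝ) (a b : ℝ) : Prop :=
  ∀ p j, j < 2 ^ p → ∀ k, AEM m P (fun ω =>
    B (grid a b (2 ^ p - 1) (j + 1)) ω k - B (grid a b (2 ^ p - 1) j) ω k)

lemma tendsto_two_pow_sub_one : Tendsto (fun p : ℕ => 2 ^ p - 1) atTop atTop :=
  tendsto_atTop_mono (fun p => Nat.le_sub_one_of_lt p.lt_two_pow_self) tendsto_id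

namespace LocalSol

lemma aem_curAvg (hf : GoodField f C L) (hκ : AEM m P κ) {Y : Ω → Fin n → ℝ} (hY : AEM m P Y)
    (N j : ℕ) (k : Fin d) : AEM m P (fun ω => curAvg a b (f k (κ ω)) N j (Y ω)) :=
  (hκ.prodMk hY).comp (hf.measurable_curAvg k N j)

lemma aem_euler (A : LocalSol P F B X s μ κ a b C L) (hX : AEM m P (X a)) (hκ : AEM m P κ)
    (N : ℕ) (hW : ∀ j < N + 1, ∀ k, AEM m P (fun ω =>
      B (grid a b N (j + 1)) ω k - B (grid a b N j) ω k)) :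
    ∀ j ≤ N + 1, AEM m P (euler a b s μ B κ (X a) N j) := by
  intro j
  induction j with
  | zero => exact fun _ => hX
  | succ j ih =>
    intro hj
    have h1 := ih (Nat.le_of_succ_le hj)
    refine AEM.pi fun i => ?_
    refine AEM.add (AEM.add (h1.comp (measurable_pi_apply i)) ?_) ?_
    · exact AEM.sum _ fun k _ => (aem_curAvg (A.good_s i) hκ h1 N j k).mul (hW j hj k)
    · exact AEM.sum _ fun k _ => (aem_curAvg (A.good_μ i) hκ h1 N j k).comp
        (measurable_const.mul measurable_id)

lemma aem_euler_dyadic (A : LocalSol P F B X s μ κ a b C L) (hX : AEM m P (X a)) (hκ : AEM m P κ)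
    (hW : DyadicIncr m P B a b) (p : ℕ) {j : ℕ} (hj : j ≤ 2 ^ p) :
    AEM m P (euler a b s μ B κ (X a) (2 ^ p - 1) j) := by
  have h0 : 2 ^ p - 1 + 1 = 2 ^ p := Nat.succ_pred_eq_of_pos (Nat.two_pow_pos _)
  exact A.aem_euler hX hκ _ (fun j hj => hW p j (by rwa [h0] at hj)) j (by rwa [h0])

/-- The terminal value is a functional of the initial value and of the increments of `B`. -/
theorem aem_terminal (A : LocalSol P F B X s μ κ a b C L) (hX : AEM m P (X a)) (hκ : AEM m P κ)
    (hW : DyadicIncr m P B a b) : AEM m P (X b) := by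
  have h0 : ∀ p, 2 ^ p - 1 + 1 = 2 ^ p := fun p => Nat.succ_pred_eq_of_pos (Nat.two_pow_pos _)
  obtain ⟨u, hu, hle⟩ := A.exists_eulerErr_le
  refine AEM.pi fun i => AEM.of_sqn
    (u := fun p ω => euler a b s μ B κ (X a) (2 ^ p - 1) (2 ^ p - 1 + 1) ω i)
    (fun p => (A.aem_euler_dyadic hX hκ hW p (h0 p).le).comp (measurable_pi_apply i))
    (fun p => aemeasurable_pi_iff.1 (A.aemeasurable_euler _ _) i) ?_ ?_
  · have := aemeasurable_pi_iff.1 (A.aemeasurable_grid 0 1) i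
    have h1 : grid a b 0 1 = b := grid_last
    rwa [h1] at this
  · refine tendsto_of_tendsto_of_tendsto_of_le_of_le tendsto_const_nhds
      (hu.comp tendsto_two_pow_sub_one) (fun _ => zero_le) fun p => ?_
    refine le_trans ?_ (hle (2 ^ p - 1) _ le_rfl)
    have := Finset.single_le_sum (f := fun i => sqn P (fun ω =>
      euler a b s μ B κ (X a) (2 ^ p - 1) (2 ^ p - 1 + 1) ω i
        - X (grid a b (2 ^ p - 1) (2 ^ p - 1 + 1)) ω i)) (fun _ _ => zero_le) (Finset.mem_univ i)
    rw [grid_last] at this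
    refine this.trans (le_of_eq ?_)
    simp only [eulerErr, grid_last]

lemma aem_fieldCoef (A : LocalSol P F B X s μ κ a b C L) {C' L' : ℝ} (hf : GoodField f C' L')
    (hX : AEM m P (X a)) (hκ : AEM m P κ) (hW : DyadicIncr m P B a b) (p : ℕ) {j : ℕ}
    (hj : j < 2 ^ p) (k : Fin d) : AEM m P (fun ω =>
      fieldCoef a b f (2 ^ p - 1) κ (euler a b s μ B κ (X a) (2 ^ p - 1)) j ω k) :=
  aem_curAvg hf hκ (A.aem_euler_dyadic hX hκ hW p hj.le) _ _ k

/-- Stochastic integrals of fields along the solution are functionals of the initial value and of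
the increments of `B`. -/
theorem aem_ito (A : LocalSol P F B X s μ κ a b C L) {C' L' : ℝ} (hf : GoodField f C' L')
    (hX : AEM m P (X a)) (hκ : AEM m P κ) (hW : DyadicIncr m P B a b) {J : Ω → ℝ}
    (H : IsIto P F B a b (cut a b (fieldProc f κ X)) J) : AEM m P J := by
  have h0 : ∀ p, 2 ^ p - 1 + 1 = 2 ^ p := fun p => Nat.succ_pred_eq_of_pos (Nat.two_pow_pos _)
  have hξ := fun N => hf.stepAdapted A.bm.mono A.nonneg A.lt.le A.meas_κ (A.measurable_euler N)
  have hI : ∀ N, IsIto P F B a b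
      (stepProc (grid a b N) (N + 1) (fieldCoef a b f N κ (euler a b s μ B κ (X a) N)))
      (stepInt B (grid a b N) (N + 1) (fieldCoef a b f N κ (euler a b s μ B κ (X a) N))) := by
    intro N
    have h := (hξ N).mem_elemSpan (B := B)
    rw [grid_zero, grid_last] at h
    exact IsIto.of_mem A.bm A.nonneg h
  refine AEM.of_sqn (u := fun p => stepInt B (grid a b (2 ^ p - 1)) (2 ^ p - 1 + 1)
    (fieldCoef a b f (2 ^ p - 1) κ (euler a b s μ B κ (X a) (2 ^ p - 1)))) (fun p => ?_)
    (fun p => (hI _).aemJ) H.aemJ ?_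
  · refine AEM.sum _ fun j hj => AEM.sum _ fun k _ => ?_
    have hj' : j < 2 ^ p := by simpa [h0 p] using hj
    exact (A.aem_fieldCoef hf hX hκ hW p hj' k).mul (hW p j hj' k)
  · have h1 := tendsto_finsetSum Finset.univ fun k (_ : k ∈ Finset.univ) =>
      A.tendsto_stepProc_euler hf k
    have h2 := ENNReal.Tendsto.const_mul (a := 4) (h1.comp tendsto_two_pow_sub_one) (by simp)
    simp only [Finset.sum_const_zero, mul_zero, Function.comp_def] at h2
    exact tendsto_of_tendsto_of_tendsto_of_le_of_le tendsto_const_nhds h2 (fun _ => zero_le)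
      fun p => (((hI _).sub A.bm A.nonneg H).bounds A.bm A.nonneg).1

theorem aem_quad (A : LocalSol P F B X s μ κ a b C L) {C' L' : ℝ} (hf : GoodField f C' L')
    (hX : AEM m P (X a)) (hκ : AEM m P κ) (hW : DyadicIncr m P B a b) :
    AEM m P (quad a b (fieldProc f κ X)) := by
  have h0 : ∀ p, 2 ^ p - 1 + 1 = 2 ^ p := fun p => Nat.succ_pred_eq_of_pos (Nat.two_pow_pos _)
  have hξ := fun N => hf.stepAdapted A.bm.mono A.nonneg A.lt.le A.meas_κ (A.measurable_euler N)
  have hv := fun k => A.measurable_cut_field hf le_rfl k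
  have hb := hf.bddProg_cut (b := b) A.bm.mono A.prog A.meas_κ
  have hu := fun N k => A.measurable_stepProc_euler hf N le_rfl k
  rw [← quad_cut]
  refine AEM.of_sqn (u := fun p => quad a b (stepProc (grid a b (2 ^ p - 1)) (2 ^ p - 1 + 1)
    (fieldCoef a b f (2 ^ p - 1) κ (euler a b s μ B κ (X a) (2 ^ p - 1))))) (fun p => ?_)
    (fun p => (measurable_quad_top (hu _) a b).aemeasurable)
    (measurable_quad_top hv a b).aemeasurable ?_
  · have := (funext fun ω => quad_stepProc (grid_mono (N := 2 ^ p - 1) A.lt.le) (2 ^ p - 1 + 1)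
      (fieldCoef a b f (2 ^ p - 1) κ (euler a b s μ B κ (X a) (2 ^ p - 1))) ω)
    simp only [grid_zero, grid_last] at this
    refine (congrArg (AEM m P) this).mpr ?_
    refine AEM.sum _ fun j hj => AEM.comp (AEM.sum _ fun k _ => AEM.comp (φ := fun x => x ^ 2)
      (A.aem_fieldCoef hf hX hκ hW p (by simpa [h0 p] using hj) k) (by fun_prop))
      (measurable_const.mul measurable_id)
  · have h1 := tendsto_finsetSum Finset.univ fun k (_ : k ∈ Finset.univ) =>
      A.tendsto_stepProc_euler hf k
    have h2 := ENNReal.Tendsto.const_mul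
      (a := d * (ENNReal.ofReal (b - a) * ENNReal.ofReal ((C' + C') ^ 2)))
      (h1.comp tendsto_two_pow_sub_one) (Or.inr (by finiteness))
    simp only [Finset.sum_const_zero, mul_zero, Function.comp_def] at h2
    exact tendsto_of_tendsto_of_tendsto_of_le_of_le tendsto_const_nhds h2 (fun _ => zero_le)
      fun p => sqn_quad_sub_le (hu _) hv
        (fun k r ω => (hξ _).abs_stepProc_le ((abs_nonneg _).trans (hb.bdd k r ω)) k r ω) hb.bdd

theorem aem_expI (A : LocalSol P F B X s μ κ a b C L) {C' L' : ℝ} (hf : GoodField f C' L')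
    (hX : AEM m P (X a)) (hκ : AEM m P κ) (hW : DyadicIncr m P B a b) {J : Ω → ℝ}
    (H : IsIto P F B a b (cut a b (fieldProc f κ X)) J) :
    AEM m P (expI a b (fieldProc f κ X) J) :=
  ((A.aem_ito hf hX hκ hW H).prodMk (A.aem_quad hf hX hκ hW)).comp
    (φ := fun x : ℝ × ℝ => Real.exp (x.1 - 1 / 2 * x.2)) (by fun_prop)

end LocalSol

end

end

/-! ### Local solutions attached to a weak solution -/

section

variable {Ω : Type*} [mΩ : MeasurableSpace Ω] {n d : ℕ}

section

variable {T : ℝ} {x₀ : Fin n → ℝ} {σ : ℝ → (Fin n → ℝ) → Matrix (Fin n) (Fin d) ℝ}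
  {P : Measure Ω} [IsProbabilityMeasure P] {F : ℝ → MeasurableSpace Ω} {B : ℝ → Ω → Fin d → ℝ}
  {X : ℝ → Ω → Fin n → ℝ} {β : Fin d → ℝ → Ω → ℝ} {C L C' L' : ℝ}
  {c : Fin d → ℕ → ℝ → (Fin n → ℝ) → ℝ} {κ : Ω → ℕ} {a b : ℝ}

lemma GoodCoeff.goodField (G : GoodCoeff σ C L) (i : Fin n) :
    GoodField (fun (k : Fin d) (_ : ℕ) r x => σ r x i k) C L :=
  ⟨fun k _ r x => G.bdd r x i k,
    fun k => (G.meas i k).comp (measurable_fst.prodMk (measurable_snd.comp measurable_snd)),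
    fun k _ r x y => G.lip r x y i k⟩

lemma GoodField.mul {f g : Fin d → ℕ → ℝ → (Fin n → ℝ) → ℝ} (A : GoodField f C L)
    (A' : GoodField g C' L') :
    GoodField (fun k q r x => f k q r x * g k q r x) (C * C') (C * L' + C' * L) := by
  refine ⟨fun k q r x => ?_, fun k => (A.meas k).mul (A'.meas k), fun k q r x y => ?_⟩
  · rw [abs_mul]
    exact mul_le_mul (A.bdd k q r x) (A'.bdd k q r x) (abs_nonneg _)
      ((abs_nonneg _).trans (A.bdd k q r x))
  · have h : f k q r x * g k q r x - f k q r y * g k q r y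
        = f k q r x * (g k q r x - g k q r y) + g k q r y * (f k q r x - f k q r y) := by ring
    rw [h]
    refine (abs_add_le _ _).trans ?_
    rw [abs_mul, abs_mul]
    have h1 := mul_le_mul (A.bdd k q r x) (A'.lip k q r x y) (abs_nonneg _)
      ((abs_nonneg _).trans (A.bdd k q r x))
    have h2 := mul_le_mul (A'.bdd k q r y) (A.lip k q r x y) (abs_nonneg _)
      ((abs_nonneg _).trans (A'.bdd k q r y))
    calc _ ≤ _ := add_le_add h1 h2
      _ = _ := by ring

/-- A system whose drift is a field on `(a, b]` solves the corresponding equation there. -/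
lemma Sys.exists_localSol (Y : Sys T x₀ σ P F B X β) (G : GoodCoeff σ C L) (hc : GoodField c C' L')
    (hκ : Measurable[F a] κ) (ha : 0 ≤ a) (hab : a < b) (hb : b ≤ T)
    (hβ : ∀ k r ω, r ∈ Ioc a b → β k r ω = c k (κ ω) r (X r ω)) : ∃ C L, LocalSol P F B X
      (fun i k _ r x => σ r x i k) (fun i k q r x => σ r x i k * c k q r x) κ a b C L := by
  obtain ⟨Cβ, hβb⟩ := Y.β_prog
  refine ⟨max C (C * C'), max L (C * L' + C' * L), Y.bm, Y.X_cont, Y.X_prog,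
    fun i => (G.goodField i).mono (le_max_left _ _) (le_max_left _ _),
    fun i => ((G.goodField i).mul hc).mono (le_max_right _ _) (le_max_right _ _),
    hκ, ha, hab, fun t ht i => ?_⟩
  have Ai := G.bddProg Y.X_prog i
  have h1 := ((Y.ito t ⟨ha.trans ht.1, ht.2.trans hb⟩ i).mono le_rfl ht.2).sub Y.bm le_rfl
    ((Y.ito a ⟨ha, hab.le.trans hb⟩ i).mono le_rfl hab.le)
  refine h1.congr (fun k => Eventually.of_forall fun x => ?_) (Eventually.of_forall fun ω => ?_)
  · have := cut_add_cut (θ := rowProc σ X i) ha ht.1 k x.1 x.2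
    simp only [← this]
    rw [add_sub_cancel_left]
    rfl
  · have h2 : dotI 0 t (rowProc σ X i) β ω = dotI 0 a (rowProc σ X i) β ω
        + dotI a t (rowProc σ X i) β ω := by
      unfold dotI
      rw [← Finset.sum_add_distrib]
      exact Finset.sum_congr rfl fun k _ => setIntegral_Ioc_split ha ht.1
        ((Ai.mul hβb).integrableOn le_rfl k ω a) ((Ai.mul hβb).integrableOn ha k ω t)
    have h3 : dotI a t (rowProc σ X i) β ω
        = ∑ k, ∫ r in Ioc a t, σ r (X r ω) i k * c k (κ ω) r (X r ω) :=
      Finset.sum_congr rfl fun k _ => setIntegral_congr_fun measurableSet_Ioc fun r hr => by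
        simp only [hβ k r ω ⟨hr.1, hr.2.trans ht.2⟩, rowProc]
    simp only [h2, ← h3]
    ring

end

end

/-! ### Independence of dyadic increments -/

section

variable {Ω : Type*} [mΩ : MeasurableSpace Ω] {n d : ℕ}

section

lemma indep_sup_left_of_indep_sup_right {P : Measure Ω} [IsProbabilityMeasure P]
    {m₁ m₂ m₃ : MeasurableSpace Ω} (h₁ : m₁ ≤ mΩ) (h₂ : m₂ ≤ mΩ) (h₃ : m₃ ≤ mΩ)
    (h : Indep m₁ m₂ P) (h' : Indep m₃ (m₁ ⊔ m₂) P) : Indep (m₁ ⊔ m₃) m₂ P := by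
  rw [Indep_iff] at h h'
  set p : Set (Set Ω) := {s | ∃ A D, MeasurableSet[m₁] A ∧ MeasurableSet[m₃] D ∧ s = A ∩ D} with hp
  refine IndepSets.indep (p1 := p) (p2 := {s | MeasurableSet[m₂] s}) (sup_le h₁ h₃) h₂ ?_
    (@MeasurableSpace.isPiSystem_measurableSet _ m₂) ?_
    (@MeasurableSpace.generateFrom_measurableSet _ m₂).symm ?_
  · rintro _ ⟨A, D, hA, hD, rfl⟩ _ ⟨A', D', hA', hD', rfl⟩ -
    exact ⟨A ∩ A', D ∩ D', hA.inter hA', hD.inter hD', by ac_rfl⟩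
  · refine le_antisymm (sup_le (fun A hA => ?_) fun D hD => ?_) ?_
    · exact MeasurableSpace.measurableSet_generateFrom ⟨A, univ, hA, MeasurableSet.univ, by simp⟩
    · exact MeasurableSpace.measurableSet_generateFrom ⟨univ, D, MeasurableSet.univ, hD, by simp⟩
    · refine MeasurableSpace.generateFrom_le ?_
      rintro _ ⟨A, D, hA, hD, rfl⟩
      exact MeasurableSet.inter ((le_sup_left : m₁ ≤ m₁ ⊔ m₃) _ hA)
        ((le_sup_right : m₃ ≤ m₁ ⊔ m₃) _ hD)
  · rw [IndepSets_iff]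
    rintro _ E ⟨A, D, hA, hD, rfl⟩ hE
    have hE' : MeasurableSet[m₂] E := hE
    have hA' := (le_sup_left : m₁ ≤ m₁ ⊔ m₂) _ hA
    have e1 := h' D (A ∩ E) hD (hA'.inter ((le_sup_right : m₂ ≤ m₁ ⊔ m₂) _ hE'))
    have e2 := h' D A hD hA'
    rw [inter_comm A D, inter_assoc, e1, h A E hA hE', e2, mul_assoc]

/-- The σ-algebra generated by the first increments of `B` along `t`. -/
def incrSigma (B : ℝ → Ω → Fin d → ℝ) (t : ℕ → ℝ) : ℕ → MeasurableSpace Ω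
  | 0 => ⊥
  | k + 1 => incrSigma B t k ⊔
      MeasurableSpace.comap (fun ω => B (t (k + 1)) ω - B (t k) ω) inferInstance

variable {P : Measure Ω} [IsProbabilityMeasure P] {F : ℝ → MeasurableSpace Ω}
  {B : ℝ → Ω → Fin d → ℝ} {t : ℕ → ℝ} {a b : ℝ}

lemma comap_le_incrSigma {j k : ℕ} (h : j < k) :
    MeasurableSpace.comap (fun ω => B (t (j + 1)) ω - B (t j) ω) inferInstance
      ≤ incrSigma B t k := by
  induction k with
  | zero => omega
  | succ k ih =>
    rcases Nat.lt_succ_iff_lt_or_eq.1 h with h | rfl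
    · exact (ih h).trans le_sup_left
    · exact le_sup_right

lemma BMSetup.incrSigma_le (S : BMSetup P F B) (ht : Monotone t) (h0 : 0 ≤ t 0) (k : ℕ) :
    incrSigma B t k ≤ F (t k) := by
  induction k with
  | zero => exact bot_le
  | succ k ih =>
    exact sup_le (ih.trans (S.mono _ _ (ht (Nat.le_succ k))))
      (S.measurable_incr (h0.trans (ht (Nat.zero_le k))) (ht (Nat.le_succ k)) le_rfl).comap_le

lemma BMSetup.indep_incrSigma (S : BMSetup P F B) (ht : Monotone t) (h0 : 0 ≤ t 0) (k : ℕ) :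
    Indep (incrSigma B t k) (F (t 0)) P := by
  induction k with
  | zero => exact indep_bot_left _
  | succ k ih =>
    have hk := ht (Nat.le_succ k)
    have h0k := h0.trans (ht (Nat.zero_le k))
    refine indep_sup_left_of_indep_sup_right ((S.incrSigma_le ht h0 k).trans (S.le _)) (S.le _)
      ((S.measurable_incr h0k hk le_rfl).comap_le.trans (S.le _)) ih ?_
    have h1 : Indep (MeasurableSpace.comap (fun ω => B (t (k + 1)) ω - B (t k) ω) inferInstance)
        (F (t k)) P := by
      rcases hk.eq_or_lt with h | h
      · simp only [Nat.succ_eq_add_one] at h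
        simp only [← h, sub_self, MeasurableSpace.comap_const]
        exact indep_bot_left _
      · exact (S.bm.2.2.2 _ _ h0k h).2
    exact indep_of_indep_of_le_right h1
      (sup_le (S.incrSigma_le ht h0 k) (S.mono _ _ (ht (Nat.zero_le k))))

/-- The increments of `B` between the dyadic points of `[a, b]`. -/
def dyadicPath (B : ℝ → Ω → Fin d → ℝ) (a b : ℝ) (ω : Ω) (p j : ℕ) : Fin d → ℝ :=
  if j < 2 ^ p then B (grid a b (2 ^ p - 1) (j + 1)) ω - B (grid a b (2 ^ p - 1) j) ω else 0

lemma grid_dyadic (a b : ℝ) (p j : ℕ) : grid a b (2 ^ p - 1) j = a + j * ((b - a) / 2 ^ p) := by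
  have : ((2 ^ p - 1 : ℕ) : ℝ) + 1 = 2 ^ p := by
    rw [Nat.cast_sub Nat.one_le_two_pow]
    simp
  rw [grid, this]

lemma grid_dyadic_two_mul (a b : ℝ) (p j : ℕ) :
    grid a b (2 ^ (p + 1) - 1) (2 * j) = grid a b (2 ^ p - 1) j := by
  rw [grid_dyadic, grid_dyadic]
  push_cast
  rw [pow_succ]
  field_simp

lemma incrSigma_dyadic_le (p k : ℕ) :
    incrSigma B (grid a b (2 ^ p - 1)) k ≤ incrSigma B (grid a b (2 ^ (p + 1) - 1)) (2 * k) := by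
  induction k with
  | zero => exact bot_le
  | succ k ih =>
    have h1 := comap_le_incrSigma (B := B) (t := grid a b (2 ^ (p + 1) - 1))
      (show 2 * k < 2 * (k + 1) by omega)
    have h2 := comap_le_incrSigma (B := B) (t := grid a b (2 ^ (p + 1) - 1))
      (show 2 * k + 1 < 2 * (k + 1) by omega)
    refine sup_le (ih.trans (le_sup_left.trans le_sup_left)) (Measurable.comap_le ?_)
    have h3 := Measurable.add (m := incrSigma B (grid a b (2 ^ (p + 1) - 1)) (2 * (k + 1)))
      ((comap_measurable _).mono h2 le_rfl) ((comap_measurable _).mono h1 le_rfl)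
    refine (congrArg _ (funext fun ω => ?_)).mp h3
    rw [← grid_dyadic_two_mul a b p k, ← grid_dyadic_two_mul a b p (k + 1)]
    simp only [Pi.add_apply, show 2 * (k + 1) = 2 * k + 1 + 1 by ring]
    abel

lemma measurable_dyadicPath : Measurable[⨆ p, incrSigma B (grid a b (2 ^ p - 1)) (2 ^ p)]
    (dyadicPath B a b) := by
  refine @measurable_pi_lambda _ _ _ (_) _ _ fun p => @measurable_pi_lambda _ _ _ (_) _ _ fun j => ?_
  by_cases h : j < 2 ^ p
  · have := (comap_measurable _).mono ((comap_le_incrSigma (B := B)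
      (t := grid a b (2 ^ p - 1)) h).trans (le_iSup (fun p =>
        incrSigma B (grid a b (2 ^ p - 1)) (2 ^ p)) p)) le_rfl
    simpa [dyadicPath, h] using this
  · simp [dyadicPath, h]

lemma BMSetup.measurable_dyadicPath (S : BMSetup P F B) (ha : 0 ≤ a) (hab : a ≤ b) :
    Measurable[F b] (dyadicPath B a b) := by
  refine _root_.measurable_dyadicPath.mono (iSup_le fun p => ?_) le_rfl
  have := S.incrSigma_le (grid_mono hab) (by rwa [grid_zero]) (t := grid a b (2 ^ p - 1)) (2 ^ p)
  have h0 : 2 ^ p - 1 + 1 = 2 ^ p := Nat.succ_pred_eq_of_pos (Nat.two_pow_pos p)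
  have h1 := grid_last (a := a) (b := b) (N := 2 ^ p - 1)
  rw [h0] at h1
  rwa [h1] at this

lemma BMSetup.indep_dyadicPath (S : BMSetup P F B) (ha : 0 ≤ a) (hab : a ≤ b) :
    Indep (MeasurableSpace.comap (dyadicPath B a b) inferInstance) (F a) P := by
  refine indep_of_indep_of_le_left ?_ _root_.measurable_dyadicPath.comap_le
  have h0 : ∀ p, 0 ≤ grid a b (2 ^ p - 1) 0 := fun p => by rwa [grid_zero]
  refine indep_iSup_of_monotone (fun p => ?_)
    (fun p => (S.incrSigma_le (grid_mono hab) (h0 p) _).trans (S.le _)) (S.le _)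
    (monotone_nat_of_le_succ fun p => (incrSigma_dyadic_le p _).trans (by rw [pow_succ']))
  have := S.indep_incrSigma (grid_mono hab) (h0 p) (2 ^ p)
  rwa [grid_zero] at this

lemma dyadicIncr_of_le {Ω : Type*} {m : MeasurableSpace Ω} [MeasurableSpace Ω] {P : Measure Ω}
    {B : ℝ → Ω → Fin d → ℝ} (h : MeasurableSpace.comap (dyadicPath B a b) inferInstance ≤ m) :
    DyadicIncr m P B a b := by
  intro p j hj k
  have h1 : Measurable[m] (dyadicPath B a b) := (comap_measurable _).mono h le_rfl
  have h2 : Measurable[m] _ := (measurable_pi_apply k).comp ((measurable_pi_apply j).comp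
    ((measurable_pi_apply p).comp h1))
  refine AEM.of_measurable ((congrArg _ (funext fun ω => ?_)).mp h2)
  simp [dyadicPath, hj]

end

end

/-! ### Markov policies -/

section

variable {Ω : Type*} [mΩ : MeasurableSpace Ω] {n d : ℕ}

section

lemma exists_measurable_argmax {E : Type*} [MeasurableSpace E] {M : ℕ} (hM : 0 < M)
    (u : ℕ → E → ENNReal) (hu : ∀ q, Measurable (u q)) :
    ∃ φ : E → ℕ, Measurable φ ∧ (∀ x, φ x < M) ∧ ∀ x, ∀ q < M, u q x ≤ u (φ x) x := by
  have h : ∀ x, ∃ q, q < M ∧ ∀ q' < M, u q' x ≤ u q x := fun x => by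
    obtain ⟨q, hq, h⟩ := Finset.exists_max_image (Finset.range M) (fun q => u q x)
      ⟨0, Finset.mem_range.2 hM⟩
    exact ⟨q, Finset.mem_range.1 hq, fun q' hq' => h q' (Finset.mem_range.2 hq')⟩
  refine ⟨fun x => Nat.find (h x), measurable_find h fun k => ?_,
    fun x => (Nat.find_spec (h x)).1, fun x => (Nat.find_spec (h x)).2⟩
  have h1 : {x | k < M ∧ ∀ q' < M, u q' x ≤ u k x}
      = {_x | k < M} ∩ ⋂ q', ⋂ (_ : q' < M), {x | u q' x ≤ u k x} := by
    ext x; simp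
  rw [h1]
  exact (MeasurableSet.const _).inter (MeasurableSet.iInter fun q =>
    MeasurableSet.iInter fun _ => measurableSet_le (hu q) (hu k))

lemma lintegral_comp_of_lt {P : Measure Ω} {M : ℕ} {ξ : Ω → ℕ} (hξ : Measurable ξ)
    (hM : ∀ ω, ξ ω < M) (f : ℕ → Ω → ENNReal) :
    ∫⁻ ω, f (ξ ω) ω ∂P
      = ∑ q ∈ Finset.range M, ∫⁻ ω in {ω | ξ ω = q}, f q ω ∂P := by
  have h : (⋃ q ∈ Finset.range M, {ω | ξ ω = q}) = univ :=
    eq_univ_of_forall fun ω => by simpa using hM ω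
  have hm : ∀ q, MeasurableSet {ω | ξ ω = q} := fun q => hξ (measurableSet_singleton q)
  rw [← setLIntegral_univ, ← h, lintegral_biUnion_finset]
  · exact Finset.sum_congr rfl fun q _ => setLIntegral_congr_fun (hm q) fun ω hω => by
      simp only [show ξ ω = q from hω]
  · intro p _ q _ hpq
    exact disjoint_left.2 fun ω h1 h2 => hpq (h1.symm.trans h2)
  · exact fun q _ => hm q

/-- Dynamic programming: adapted policies do not do better than Markov policies. -/
theorem exists_markov_policy {P : Measure Ω} {E : Type*} [MeasurableSpace E]
    (𝓕 : ℕ → MeasurableSpace Ω) (mono : Monotone 𝓕) (le : ∀ i, 𝓕 i ≤ mΩ) (Z : ℕ → Ω → E)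
    (hZ : ∀ i, Measurable[𝓕 i] (Z i)) (ℓ : ℕ → ℕ → Ω → ENNReal) {K M : ℕ} (hM : 0 < M)
    (hℓ : ∀ i < K, ∀ q, AEM (𝓕 (i + 1)) P (ℓ i q))
    (markov : ∀ i < K, ∀ q, ∀ v : E → ENNReal, Measurable v → ∃ u : E → ENNReal, Measurable u ∧
      ∀ Y : Ω → ENNReal, AEM (𝓕 i) P Y →
        ∫⁻ ω, Y ω * (ℓ i q ω * v (Z (i + 1) ω)) ∂P = ∫⁻ ω, Y ω * u (Z i ω) ∂P)
    {g : E → ENNReal} (hg : Measurable g) :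
    ∃ φ : ℕ → E → ℕ, (∀ i, Measurable (φ i)) ∧ (∀ i x, φ i x < M) ∧
      ∀ ξ : ℕ → Ω → ℕ, (∀ i, Measurable[𝓕 i] (ξ i)) → (∀ i ω, ξ i ω < M) →
        ∫⁻ ω, (∏ i ∈ Finset.range K, ℓ i (ξ i ω) ω) * g (Z K ω) ∂P
          ≤ ∫⁻ ω, (∏ i ∈ Finset.range K, ℓ i (φ i (Z i ω)) ω) * g (Z K ω) ∂P := by
  have key : ∀ r i, i + r = K → ∃ (φ : ℕ → E → ℕ) (v : E → ENNReal), Measurable v ∧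
      (∀ i, Measurable (φ i)) ∧ (∀ i x, φ i x < M) ∧ ∀ Y : Ω → ENNReal, AEM (𝓕 i) P Y →
      (∀ ξ : ℕ → Ω → ℕ, (∀ i, Measurable[𝓕 i] (ξ i)) → (∀ i ω, ξ i ω < M) →
        ∫⁻ ω, Y ω * ((∏ j ∈ Finset.Ico i K, ℓ j (ξ j ω) ω) * g (Z K ω)) ∂P
          ≤ ∫⁻ ω, Y ω * v (Z i ω) ∂P) ∧
      ∫⁻ ω, Y ω * ((∏ j ∈ Finset.Ico i K, ℓ j (φ j (Z j ω)) ω) * g (Z K ω)) ∂P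
          = ∫⁻ ω, Y ω * v (Z i ω) ∂P := by
    intro r
    induction r with
    | zero =>
      intro i hi
      obtain rfl : i = K := hi
      exact ⟨fun _ _ => 0, g, hg, fun _ => measurable_const, fun _ _ => hM, fun Y _ =>
        ⟨fun ξ _ _ => by simp, by simp⟩⟩
    | succ r ih =>
      intro i hi
      have hiK : i < K := by omega
      obtain ⟨φ, v, hv, hφ, hφM, h⟩ := ih (i + 1) (by omega)
      choose u hu hu' using fun q => markov i hiK q v hv
      obtain ⟨φ₀, hφ₀, hφ₀M, hmax⟩ := exists_measurable_argmax hM u hu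
      have hone : ∀ (Y : Ω → ENNReal), AEM (𝓕 i) P Y → ∀ ξ : Ω → ℕ, Measurable[𝓕 i] ξ →
          (∀ ω, ξ ω < M) → (∫⁻ ω, (Y ω * ℓ i (ξ ω) ω) * v (Z (i + 1) ω) ∂P
            = ∫⁻ ω, Y ω * u (ξ ω) (Z i ω) ∂P) := by
        intro Y hY ξ hξ hξM
        have hξ' := hξ.mono (le i) le_rfl
        rw [lintegral_comp_of_lt hξ' hξM fun q ω => (Y ω * ℓ i q ω) * v (Z (i + 1) ω),
          lintegral_comp_of_lt hξ' hξM fun q ω => Y ω * u q (Z i ω)]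
        refine Finset.sum_congr rfl fun q _ => ?_
        have hs : MeasurableSet[𝓕 i] {ω | ξ ω = q} := hξ (measurableSet_singleton q)
        have hY' : AEM (𝓕 i) P ({ω | ξ ω = q}.indicator Y) := by
          obtain ⟨Y', hY', h⟩ := hY
          exact ⟨_, hY'.indicator hs, h.mono fun ω hω => by
            by_cases h1 : ω ∈ {ω | ξ ω = q} <;> simp [h1, hω]⟩
        have := hu' q _ hY'
        rw [← lintegral_indicator (le i _ hs), ← lintegral_indicator (le i _ hs)]
        refine (lintegral_congr fun ω => ?_).trans (this.trans (lintegral_congr fun ω => ?_))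
        · by_cases hω : ω ∈ {ω | ξ ω = q} <;> simp [hω, mul_assoc]
        · by_cases hω : ω ∈ {ω | ξ ω = q} <;> simp [hω]
      have hYℓ : ∀ (Y : Ω → ENNReal), AEM (𝓕 i) P Y → ∀ ξ : Ω → ℕ, Measurable[𝓕 i] ξ →
          AEM (𝓕 (i + 1)) P (fun ω => Y ω * ℓ i (ξ ω) ω) := by
        intro Y hY ξ hξ
        choose ℓ' hℓ' hℓe using fun q => hℓ i hiK q
        have h1 : AEM (𝓕 (i + 1)) P (fun ω => ℓ i (ξ ω) ω) := by
          refine ⟨fun ω => ℓ' (ξ ω) ω, ?_, (ae_all_iff.2 hℓe).mono fun ω hω => hω _⟩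
          have h2 := hξ.mono (mono (Nat.le_succ i)) le_rfl
          let _ := 𝓕 (i + 1)
          exact (measurable_from_prod_countable_right (f := fun p : ℕ × Ω => ℓ' p.1 p.2)
            hℓ').comp (h2.prodMk measurable_id)
        exact ((hY.mono (mono (Nat.le_succ i))).prodMk h1).comp
          (φ := fun x : ENNReal × ENNReal => x.1 * x.2) (measurable_fst.mul measurable_snd)
      refine ⟨fun j => if j = i then φ₀ else φ j, fun x => u (φ₀ x) x,
        (measurable_from_prod_countable_right (f := fun p : ℕ × E => u p.1 p.2) hu).comp
          (hφ₀.prodMk measurable_id), fun j => ?_, fun j x => ?_, fun Y hY => ⟨fun ξ hξ hξM => ?_, ?_⟩⟩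
      · by_cases hj : j = i <;> simp [hj, hφ₀, hφ]
      · by_cases hj : j = i <;> simp [hj, hφ₀M, hφM]
      · calc _ = ∫⁻ ω, (Y ω * ℓ i (ξ i ω) ω) * ((∏ j ∈ Finset.Ico (i + 1) K, ℓ j (ξ j ω) ω)
                * g (Z K ω)) ∂P := lintegral_congr fun ω => by
              rw [Finset.prod_eq_prod_Ico_succ_bot hiK]; ring
          _ ≤ _ := (h _ (hYℓ Y hY _ (hξ i))).1 ξ hξ hξM
          _ = _ := hone Y hY _ (hξ i) (hξM i)
          _ ≤ _ := lintegral_mono fun ω => mul_le_mul_right (hmax _ _ (hξM i ω)) _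
      · have hφZ : Measurable[𝓕 i] (fun ω => φ₀ (Z i ω)) := hφ₀.comp (hZ i)
        calc _ = ∫⁻ ω, (Y ω * ℓ i (φ₀ (Z i ω)) ω) * ((∏ j ∈ Finset.Ico (i + 1) K,
                ℓ j (φ j (Z j ω)) ω) * g (Z K ω)) ∂P := lintegral_congr fun ω => by
              rw [Finset.prod_eq_prod_Ico_succ_bot hiK]
              have : ∏ j ∈ Finset.Ico (i + 1) K,
                  ℓ j ((if j = i then φ₀ else φ j) (Z j ω)) ω
                  = ∏ j ∈ Finset.Ico (i + 1) K, ℓ j (φ j (Z j ω)) ω :=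
                Finset.prod_congr rfl fun j hj => by
                  have : j ≠ i := by have := (Finset.mem_Ico.1 hj).1; omega
                  simp [this]
              rw [this]
              simp only [if_true]
              ring
          _ = _ := (h _ (hYℓ Y hY _ hφZ)).2
          _ = _ := hone Y hY _ hφZ fun ω => hφ₀M _
  obtain ⟨φ, v, -, hφ, hφM, h⟩ := key K 0 (zero_add K)
  have h1 := h (fun _ => 1) (AEM.of_measurable measurable_const)
  simp only [one_mul, Nat.Ico_zero_eq_range] at h1
  exact ⟨φ, hφ, hφM, fun ξ hξ hξM => (h1.1 ξ hξ hξM).trans h1.2.ge⟩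

end

end

/-! ### Optimisation over one step -/

section

variable {Ω : Type*} [mΩ : MeasurableSpace Ω] {n d : ℕ}

section

/-- A functional of an `m`-measurable variable `Z` and of an independent variable `W` may be
integrated over `W` first. -/
lemma exists_markov_of_indep {Ω E W : Type*} {m : MeasurableSpace Ω} [mΩ : MeasurableSpace Ω]
    [MeasurableSpace E] [MeasurableSpace W] {P : Measure Ω} [IsProbabilityMeasure P]
    (hm : m ≤ mΩ) {Z : Ω → E} (hZ : Measurable[m] Z) {w : Ω → W} (hw : Measurable w)
    (hi : Indep (MeasurableSpace.comap w inferInstance) m P) {Ψ : Ω → ENNReal}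
    (hΨ : AEM (MeasurableSpace.comap Z inferInstance ⊔ MeasurableSpace.comap w inferInstance) P Ψ) :
    ∃ u : E → ENNReal, Measurable u ∧ ∀ Y : Ω → ENNReal, AEM m P Y →
      ∫⁻ ω, Y ω * Ψ ω ∂P = ∫⁻ ω, Y ω * u (Z ω) ∂P := by
  obtain ⟨Ψ', hΨ', he⟩ := hΨ
  rw [← MeasurableSpace.comap_prodMk] at hΨ'
  obtain ⟨G, hG, rfl⟩ := hΨ'.exists_eq_measurable_comp
  have := Measure.isProbabilityMeasure_map (μ := P) hw.aemeasurable
  refine ⟨fun x => ∫⁻ y, G (x, y) ∂(Measure.map w P), hG.lintegral_prod_right', fun Y hY => ?_⟩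
  obtain ⟨Y', hY', hYe⟩ := hY
  have hZ' := hZ.mono hm le_rfl
  have hYZ : Measurable[m] (fun ω => (Y' ω, Z ω)) := hY'.prodMk hZ
  have hYZ' := hYZ.mono hm le_rfl
  have hind : IndepFun (fun ω => (Y' ω, Z ω)) w P :=
    (indep_of_indep_of_le_right hi hYZ.comap_le).symm
  have hmap := (indepFun_iff_map_prod_eq_prod_map_map hYZ'.aemeasurable hw.aemeasurable).1 hind
  have hf : Measurable fun p : (ENNReal × E) × W => p.1.1 * G (p.1.2, p.2) := by fun_prop
  calc _ = ∫⁻ ω, Y' ω * G (Z ω, w ω) ∂P := lintegral_congr_ae <| by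
        filter_upwards [he, hYe] with ω h1 h2
        rw [h1, h2]; rfl
    _ = ∫⁻ p, p.1.1 * G (p.1.2, p.2) ∂(Measure.map (fun ω => ((Y' ω, Z ω), w ω)) P) :=
        (lintegral_map hf (hYZ'.prodMk hw)).symm
    _ = ∫⁻ ω, Y' ω * ∫⁻ y, G (Z ω, y) ∂(Measure.map w P) ∂P := by
        rw [hmap, lintegral_prod _ hf.aemeasurable, lintegral_map hf.lintegral_prod_right' hYZ']
        exact lintegral_congr fun ω => lintegral_const_mul _ (by fun_prop)
    _ = _ := lintegral_congr_ae (hYe.mono fun ω h => by simp only [h])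

variable {T : ℝ} {x₀ : Fin n → ℝ} {σ : ℝ → (Fin n → ℝ) → Matrix (Fin n) (Fin d) ℝ}
  {P : Measure Ω} [IsProbabilityMeasure P] {F : ℝ → MeasurableSpace Ω} {B : ℝ → Ω → Fin d → ℝ}
  {X : ℝ → Ω → Fin n → ℝ} {C L C' L' : ℝ}
  {c : Fin d → ℕ → ℝ → (Fin n → ℝ) → ℝ} {a b : ℝ} {J : Ω → ℝ}

lemma GoodField.bddProg (hc : GoodField c C' L') (hX : ProgMeas F X) (q : ℕ) :
    BddProg F (fieldProc c (fun _ => q) X) C' :=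
  ⟨fun k => hX.comp_pair (hc.measurable_uncurry k q), fun _ _ _ => hc.bdd _ _ _ _⟩

/-- The Markov property of a driftless solution, with an exponential weight. -/
theorem Sys.exists_markov (Y : Sys T x₀ σ P F B X (fun _ _ _ => 0)) (G : GoodCoeff σ C L)
    (hc : GoodField c C' L') (ha : 0 ≤ a) (hab : a < b) (hb : b ≤ T) (q : ℕ)
    (H : IsIto P F B a b (cut a b (fieldProc c (fun _ => q) X)) J)
    {v : (Fin n → ℝ) → ENNReal} (hv : Measurable v) :
    ∃ u : (Fin n → ℝ) → ENNReal, Measurable u ∧ ∀ Z : Ω → ENNReal, AEM (F a) P Z →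
      ∫⁻ ω, Z ω * (ENNReal.ofReal (expI a b (fieldProc c (fun _ => q) X) J ω) * v (X b ω)) ∂P
        = ∫⁻ ω, Z ω * u (X a ω) ∂P := by
  obtain ⟨C₁, L₁, A⟩ := Y.exists_localSol (c := fun _ _ _ _ => 0) G
    (C' := 0) (L' := 0) ⟨by simp, by simp, by simp⟩ (κ := fun _ => q) measurable_const ha hab hb
    (fun _ _ _ _ => rfl)
  have hXa : Measurable[F a] (X a) := Y.X_prog.measurable ha
  have hw := Y.bm.measurable_dyadicPath ha hab.le
  refine exists_markov_of_indep (Y.bm.le a) hXa (hw.mono (Y.bm.le b) le_rfl)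
    (Y.bm.indep_dyadicPath ha hab.le) ?_
  have hX : AEM (MeasurableSpace.comap (X a) inferInstance
      ⊔ MeasurableSpace.comap (dyadicPath B a b) inferInstance) P (X a) :=
    AEM.of_measurable ((comap_measurable (X a)).mono le_sup_left le_rfl)
  have hκ : AEM (MeasurableSpace.comap (X a) inferInstance
      ⊔ MeasurableSpace.comap (dyadicPath B a b) inferInstance) P (fun _ : Ω => q) :=
    AEM.of_measurable measurable_const
  have hW := dyadicIncr_of_le (P := P) (B := B) (a := a) (b := b)
    (m := MeasurableSpace.comap (X a) inferInstance
      ⊔ MeasurableSpace.comap (dyadicPath B a b) inferInstance) le_sup_right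
  exact ((A.aem_expI hc hX hκ hW H).prodMk (A.aem_terminal hX hκ hW)).comp
    (φ := fun x : ℝ × (Fin n → ℝ) => ENNReal.ofReal x.1 * v x.2)
    ((ENNReal.measurable_ofReal.comp measurable_fst).mul (hv.comp measurable_snd))

end

end

/-! ### Step selections -/

section

variable {Ω : Type*} [mΩ : MeasurableSpace Ω] {n d : ℕ}

section

/-- The selection equal to `ξ i` on the `i`-th cell, and to `0` outside of the cells. -/
def stepSel (t : ℕ → ℝ) (K : ℕ) (ξ : ℕ → Ω → ℕ) (r : ℝ) (ω : Ω) : ℕ :=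
  ∑ i ∈ Finset.range K, (Ioc (t i) (t (i + 1))).indicator (fun _ => ξ i ω) r

lemma stepSel_eq {t : ℕ → ℝ} (ht : Monotone t) {K i : ℕ} (hi : i < K) (ξ : ℕ → Ω → ℕ) {r : ℝ}
    (hr : r ∈ Ioc (t i) (t (i + 1))) (ω : Ω) : stepSel t K ξ r ω = ξ i ω := by
  unfold stepSel
  rw [Finset.sum_eq_single_of_mem i (Finset.mem_range.2 hi), indicator_of_mem hr]
  intro j _ hj
  refine indicator_of_notMem (fun h => ?_) _
  rcases lt_or_gt_of_ne hj with h1 | h1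
  · exact absurd (hr.1.trans_le h.2) (not_lt.2 (ht h1))
  · exact absurd (h.1.trans_le hr.2) (not_lt.2 (ht h1))

lemma progMeas_stepSel {Ω : Type*} {H : ℝ → MeasurableSpace Ω} (hH : Monotone H)
    (t : ℕ → ℝ) (K : ℕ) {ξ : ℕ → Ω → ℕ}
    (hξ : ∀ i < K, Measurable[H (t i)] (ξ i)) :
    ProgMeas H (stepSel t K ξ) := fun s hs => by
  unfold stepSel
  let _ := H s
  refine Finset.measurable_sum _ fun i hi => ?_
  by_cases h : t i ≤ s
  · have h1 : Measurable (ξ i) := (hξ i (Finset.mem_range.1 hi)).mono (hH h) le_rfl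
    have : (fun p : Icc (0 : ℝ) s × Ω => (Ioc (t i) (t (i + 1))).indicator (fun _ => ξ i p.2) (p.1 : ℝ))
        = ((fun p : Icc (0 : ℝ) s × Ω => (p.1 : ℝ)) ⁻¹' (Ioc (t i) (t (i + 1)))).indicator
          (fun p => ξ i p.2) := by
      ext p; simp only [indicator, mem_preimage]
    rw [this]
    exact (h1.comp measurable_snd).indicator
      ((measurable_subtype_coe.comp measurable_fst) measurableSet_Ioc)
  · have : (fun p : Icc (0 : ℝ) s × Ω => (Ioc (t i) (t (i + 1))).indicator (fun _ => ξ i p.2) (p.1 : ℝ))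
        = fun _ => 0 := by
      ext p
      exact indicator_of_notMem (fun h1 => h (h1.1.le.trans p.1.2.2)) _
    rw [this]
    exact measurable_const

variable {P : Measure Ω} [IsProbabilityMeasure P] {F : ℝ → MeasurableSpace Ω}
  {B : ℝ → Ω → Fin d → ℝ} {X : ℝ → Ω → Fin n → ℝ} {C' L' : ℝ}
  {c : Fin d → ℕ → ℝ → (Fin n → ℝ) → ℝ} {t : ℕ → ℝ} {K M : ℕ} {ξ : ℕ → Ω → ℕ}

/-- The feedback field along `X` with selection `sel`. -/
def selProc (c : Fin d → ℕ → ℝ → (Fin n → ℝ) → ℝ) (sel : ℝ → Ω → ℕ) (X : ℝ → Ω → Fin n → ℝ)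
    (k : Fin d) (r : ℝ) (ω : Ω) : ℝ := c k (sel r ω) r (X r ω)

lemma ProgMeas.prodMk {Ω E E' : Type*} [MeasurableSpace E] [MeasurableSpace E']
    {F : ℝ → MeasurableSpace Ω} {u : ℝ → Ω → E} {v : ℝ → Ω → E'} (hu : ProgMeas F u)
    (hv : ProgMeas F v) : ProgMeas F (fun r ω => (u r ω, v r ω)) := fun s hs => by
  let _ := F s
  exact (hu s hs).prodMk (hv s hs)

lemma GoodField.bddProg_selProc (hc : GoodField c C' L') (hX : ProgMeas F X) {sel : ℝ → Ω → ℕ}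
    (hs : ProgMeas F sel) : BddProg F (selProc c sel X) C' :=
  ⟨fun k => (hs.prodMk hX).comp_pair (hc.meas k), fun _ _ _ => hc.bdd _ _ _ _⟩

/-- Freezing the selection on one cell. -/
lemma IsIto.select (S : BMSetup P F B) {a b : ℝ} (ha : 0 ≤ a) {ζ : Ω → ℕ} (hζ : Measurable[F a] ζ)
    (hM : ∀ ω, ζ ω < M) {J : ℕ → Ω → ℝ}
    (H : ∀ q, IsIto P F B a b (cut a b (fieldProc c (fun _ => q) X)) (J q)) :
    IsIto P F B a b (cut a b (fieldProc c ζ X)) (fun ω => J (ζ ω) ω) := by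
  have h := IsIto.sum S ha (Finset.range M) (fun q _ => (H q).bdd_mul S
    (ζ := {ω | ζ ω = q}.indicator fun _ => 1) (C := 1)
    (measurable_const.indicator (hζ (measurableSet_singleton q)))
    (fun ω => by by_cases h : ω ∈ {ω | ζ ω = q} <;> simp [h]))
  have key : ∀ (u : ℕ → ℝ) ω, ∑ q ∈ Finset.range M, {ω | ζ ω = q}.indicator (fun _ => (1 : ℝ)) ω * u q
      = u (ζ ω) := by
    intro u ω
    rw [Finset.sum_eq_single_of_mem (ζ ω) (Finset.mem_range.2 (hM ω))]
    · rw [indicator_of_mem (show ω ∈ {ω' | ζ ω' = ζ ω} from rfl), one_mul]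
    · intro q _ hq
      rw [indicator_of_notMem (show ω ∉ {ω' | ζ ω' = q} from fun h => hq h.symm), zero_mul]
  refine h.congr (fun k => Eventually.of_forall fun x => ?_) (Eventually.of_forall fun ω => ?_)
  · exact key (fun q => cut a b (fieldProc c (fun _ => q) X) k x.1 x.2) x.2
  · exact key (fun q => J q ω) ω

theorem IsIto.stepSel (S : BMSetup P F B) (ht : Monotone t) (h0 : 0 ≤ t 0)
    (hξ : ∀ i, Measurable[F (t i)] (ξ i)) (hM : ∀ i ω, ξ i ω < M) {J : ℕ → ℕ → Ω → ℝ}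
    (H : ∀ i < K, ∀ q, IsIto P F B (t i) (t (i + 1))
      (cut (t i) (t (i + 1)) (fieldProc c (fun _ => q) X)) (J i q)) :
    ∀ i ≤ K, IsIto P F B (t 0) (t i) (cut (t 0) (t i) (selProc c (stepSel t K ξ) X))
      (fun ω => ∑ j ∈ Finset.range i, J j (ξ j ω) ω) := by
  intro i
  induction i with
  | zero => exact fun _ => by simpa using isIto_of_le le_rfl
  | succ i ih =>
    intro hi
    have h1 := IsIto.select S (h0.trans (ht (Nat.zero_le i))) (hξ i) (hM i) (H i hi)
    have h2 : cut (t i) (t (i + 1)) (fieldProc c (ξ i) X)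
        = cut (t i) (t (i + 1)) (selProc c (_root_.stepSel t K ξ) X) := by
      ext k r ω
      by_cases hr : r ∈ Ioc (t i) (t (i + 1))
      · simp only [cut, indicator_of_mem hr, fieldProc, selProc, stepSel_eq ht hi ξ hr]
      · simp only [cut, indicator_of_notMem hr]
    rw [h2] at h1
    simpa only [Finset.sum_range_succ] using
      IsIto.append S h0 (ht (Nat.zero_le i)) (ht (Nat.le_succ i)) (ih (by omega)) h1

lemma GoodField.expI_stepSel (hc : GoodField c C' L') (hX : ProgMeas F X) (hF : Monotone F)
    (ht : Monotone t) (h0 : 0 ≤ t 0)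
    (hξ : ∀ i, Measurable[F (t i)] (ξ i)) (J : ℕ → ℕ → Ω → ℝ) (ω : Ω) :
    ∀ i ≤ K, expI (t 0) (t i) (selProc c (stepSel t K ξ) X)
      (fun ω => ∑ j ∈ Finset.range i, J j (ξ j ω) ω) ω
      = ∏ j ∈ Finset.range i, expI (t j) (t (j + 1)) (fieldProc c (fun _ => ξ j ω) X)
        (J j (ξ j ω)) ω := by
  have A := hc.bddProg_selProc hX (progMeas_stepSel hF t K fun i _ => hξ i)
  intro i
  induction i with
  | zero => exact fun _ => by simp [expI, quad]
  | succ i ih =>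
    intro hi
    rw [Finset.prod_range_succ, ← ih (by omega)]
    have h1 : quad (t i) (t (i + 1)) (selProc c (stepSel t K ξ) X) ω
        = quad (t i) (t (i + 1)) (fieldProc c (fun _ => ξ i ω) X) ω :=
      quad_congr fun k r hr => by simp only [selProc, fieldProc, stepSel_eq ht hi ξ hr]
    rw [expI, expI, expI, ← Real.exp_add, Finset.sum_range_succ,
      A.quad_split h0 (ht (Nat.zero_le i)) (ht (Nat.le_succ i)), h1]
    congr 1
    ring

end

end

/-! ### Markov feedback controls -/

section

variable {Ω : Type*} [mΩ : MeasurableSpace Ω] {n d : ℕ}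

section

variable {T : ℝ} {x₀ : Fin n → ℝ} {σ : ℝ → (Fin n → ℝ) → Matrix (Fin n) (Fin d) ℝ}
  {P : Measure Ω} [IsProbabilityMeasure P] {F : ℝ → MeasurableSpace Ω} {B : ℝ → Ω → Fin d → ℝ}
  {X : ℝ → Ω → Fin n → ℝ} {C L C' L' : ℝ}
  {c : Fin d → ℕ → ℝ → (Fin n → ℝ) → ℝ} {M : ℕ}

/-- Step controls are dominated by Markov step controls. -/
theorem Sys.exists_feedback (Y : Sys T x₀ σ P F B X (fun _ _ _ => 0)) (G : GoodCoeff σ C L)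
    (hc : GoodField c C' L') (hT : 0 < T) (N : ℕ) (hM : 0 < M)
    {v : (Fin n → ℝ) → ENNReal} (hv : Measurable v) :
    ∃ φ : ℕ → (Fin n → ℝ) → ℕ, (∀ i, Measurable (φ i)) ∧ (∀ i x, φ i x < M) ∧
      ∀ ξ : ℕ → Ω → ℕ, (∀ i, Measurable[F (grid 0 T N i)] (ξ i)) → (∀ i ω, ξ i ω < M) →
      ∀ J J', IsIto P F B 0 T (cut 0 T (selProc c (stepSel (grid 0 T N) (N + 1) ξ) X)) J →
      IsIto P F B 0 T (cut 0 T (selProc c (stepSel (grid 0 T N) (N + 1)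
        fun i ω => φ i (X (grid 0 T N i) ω)) X)) J' →
      ∫⁻ ω, ENNReal.ofReal (expI 0 T (selProc c (stepSel (grid 0 T N) (N + 1) ξ) X) J ω)
          * v (X T ω) ∂P
        ≤ ∫⁻ ω, ENNReal.ofReal (expI 0 T (selProc c (stepSel (grid 0 T N) (N + 1)
          fun i ω => φ i (X (grid 0 T N i) ω)) X) J' ω) * v (X T ω) ∂P := by
  set t := grid 0 T N with ht_def
  have ht : Monotone t := grid_mono hT.le
  have h0 : t 0 = 0 := grid_zero
  have hN : t (N + 1) = T := grid_last
  have ht0 : ∀ i, 0 ≤ t i := fun i => h0.ge.trans (ht (Nat.zero_le i))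
  have hlt : ∀ i, t i < t (i + 1) := grid_lt hT
  have hF : Monotone F := fun _ _ h => Y.bm.mono _ _ h
  choose J₀ hJ₀ using fun i q => (hc.bddProg Y.X_prog q).exists_isIto' Y.bm (ht0 i) (ht (Nat.le_succ i))
  obtain ⟨φ, hφ, hφM, h⟩ := exists_markov_policy (P := P) (fun i => F (t i)) (hF.comp ht)
    (fun i => Y.bm.le _) (fun i => X (t i)) (fun i => Y.X_prog.measurable (ht0 i))
    (fun i q ω => ENNReal.ofReal (expI (t i) (t (i + 1)) (fieldProc c (fun _ => q) X) (J₀ i q) ω))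
    (K := N + 1) hM
    (fun i _ q => ((hJ₀ i q).aem_expI Y.bm (hc.bddProg Y.X_prog q) (ht0 i)
      (ht (Nat.le_succ i))).comp ENNReal.measurable_ofReal)
    (fun i hi q w hw => Y.exists_markov G hc (ht0 i) (hlt i) ((ht hi).trans hN.le) q (hJ₀ i q) hw) hv
  refine ⟨φ, hφ, hφM, fun ξ hξ hξM J J' hJ hJ' => ?_⟩
  have key : ∀ ζ : ℕ → Ω → ℕ, (∀ i, Measurable[F (t i)] (ζ i)) → (∀ i ω, ζ i ω < M) →
      ∀ J, IsIto P F B 0 T (cut 0 T (selProc c (stepSel t (N + 1) ζ) X)) J →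
      ∫⁻ ω, ENNReal.ofReal (expI 0 T (selProc c (stepSel t (N + 1) ζ) X) J ω) * v (X T ω) ∂P
      = ∫⁻ ω, (∏ i ∈ Finset.range (N + 1), ENNReal.ofReal (expI (t i) (t (i + 1))
        (fieldProc c (fun _ => ζ i ω) X) (J₀ i (ζ i ω)) ω)) * v (X (t (N + 1)) ω) ∂P := by
    intro ζ hζ hζM J hJ
    have h1 := IsIto.stepSel Y.bm ht h0.ge hζ hζM (fun i _ q => hJ₀ i q) (N + 1) le_rfl
    rw [h0, hN] at h1
    have h2 := IsIto.ae_unique Y.bm le_rfl hJ h1 fun k => EventuallyEq.rfl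
    refine lintegral_congr_ae (h2.mono fun ω hω => ?_)
    have h3 := hc.expI_stepSel Y.X_prog hF ht h0.ge hζ J₀ ω (N + 1) le_rfl
    rw [h0, hN] at h3
    simp only
    rw [hN, ← ENNReal.ofReal_prod_of_nonneg fun i _ => (expI_pos _ _ _ _ _).le, ← h3]
    simp only [expI, hω]
  rw [key ξ hξ hξM J hJ, key (fun i ω => φ i (X (t i) ω)) (fun i => (hφ i).comp (Y.X_prog.measurable (ht0 i)))
    (fun i ω => hφM _ _) J' hJ']
  exact h ξ hξ hξM

end

end

/-! ### Approximation by step controls -/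

section

variable {Ω : Type*} [mΩ : MeasurableSpace Ω] {n d : ℕ}

section

variable {T : ℝ} {P : Measure Ω} [IsProbabilityMeasure P] {F : ℝ → MeasurableSpace Ω}
  {X : ℝ → Ω → Fin n → ℝ} {C' L' : ℝ} {β : Fin d → ℝ → Ω → ℝ}
  {c : Fin d → ℕ → ℝ → (Fin n → ℝ) → ℝ}

/-- Distance between the candidate `q` and the target `β`. -/
def gapProc (c : Fin d → ℕ → ℝ → (Fin n → ℝ) → ℝ) (X : ℝ → Ω → Fin n → ℝ) (β : Fin d → ℝ → Ω → ℝ)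
    (q : ℕ) (_ : Fin 1) (r : ℝ) (ω : Ω) : ℝ := ∑ k, |c k q r (X r ω) - β k r ω|

lemma GoodField.bddProg_gapProc (hc : GoodField c C' L') (hX : ProgMeas F X)
    (A : BddProg F β C') (q : ℕ) : BddProg F (gapProc c X β q) (d * (C' + C')) := by
  have h := (hc.bddProg hX q).sub A
  refine ⟨fun _ s hs => ?_, fun _ r ω => ?_⟩
  · unfold gapProc
    let _ := F s
    exact Finset.measurable_sum _ fun k _ => (h.prog k s hs).abs
  · rw [gapProc, abs_of_nonneg (Finset.sum_nonneg fun _ _ => abs_nonneg _)]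
    refine (Finset.sum_le_sum fun k _ => h.bdd k r ω).trans (le_of_eq ?_)
    simp [mul_add]

lemma exists_nearSel (p : ℕ → ℝ) (ε : ℝ) (N : ℕ) : ∃ q, N < q ∨ p q < ε :=
  ⟨N + 1, Or.inl (Nat.lt_succ_self N)⟩

/-- The first candidate whose average gap on the previous cell is less than `ε`. -/
def nearSel (p : ℕ → ℝ) (ε : ℝ) (N : ℕ) : ℕ := Nat.find (exists_nearSel p ε N)

lemma nearSel_lt (p : ℕ → ℝ) (ε : ℝ) (N : ℕ) : nearSel p ε N < N + 2 :=
  Nat.lt_succ_of_le (Nat.find_min' _ (Or.inl (Nat.lt_succ_self N)))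

lemma measurable_nearSel {Ω : Type*} {m : MeasurableSpace Ω} {p : ℕ → Ω → ℝ}
    (hp : ∀ q, Measurable[m] (p q)) (ε : ℝ) (N : ℕ) :
    Measurable[m] (fun ω => nearSel (fun q => p q ω) ε N) :=
  measurable_find _ fun q => (MeasurableSet.const _).union (measurableSet_lt (hp q) measurable_const)

lemma eventually_nearSel {p : ℕ → ℕ → ℝ} {D : ℕ → ℝ} (h : ∀ q, Tendsto (p q) atTop (nhds (D q)))
    {ε : ℝ} (hε : 0 < ε) {q₀ : ℕ} (hq : D q₀ < ε) :
    ∀ᶠ N in atTop, D (nearSel (fun q => p q N) ε N) < 2 * ε := by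
  have h1 : ∀ᶠ N in atTop, ∀ q ∈ Finset.range (q₀ + 1), D q < p q N + ε :=
    (Finset.eventually_all _).2 fun q _ => by
      filter_upwards [(h q).eventually_const_lt (sub_lt_self (D q) hε)] with N hN
      linarith
  filter_upwards [h1, eventually_ge_atTop q₀, (h q₀).eventually_lt_const hq] with N hN hN' hN''
  have hle : nearSel (fun q => p q N) ε N ≤ q₀ := Nat.find_min' _ (Or.inr hN'')
  have h2 := hN _ (Finset.mem_range.2 (Nat.lt_succ_of_le hle))
  rcases Nat.find_spec (exists_nearSel (fun q => p q N) ε N) with h3 | h3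
  · exact absurd (hle.trans hN') (not_le.2 h3)
  · have h4 : p (nearSel (fun q => p q N) ε N) N < ε := h3
    linarith

/-- Step selection following `β` up to `ε`. -/
def nearSelProc (T : ℝ) (c : Fin d → ℕ → ℝ → (Fin n → ℝ) → ℝ) (X : ℝ → Ω → Fin n → ℝ)
    (β : Fin d → ℝ → Ω → ℝ) (ε : ℝ) (N i : ℕ) (ω : Ω) : ℕ :=
  nearSel (fun q => progStep 0 T (gapProc c X β q) N i ω 0) ε N

lemma measurable_nearSelProc (hc : GoodField c C' L') (hX : ProgMeas F X) (A : BddProg F β C')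
    (hT : 0 ≤ T) (ε : ℝ) (N i : ℕ) :
    Measurable[F (grid 0 T N i)] (nearSelProc T c X β ε N i) := by
  refine measurable_nearSel (fun q => ?_) ε N
  have h := (hc.bddProg_gapProc hX A q)
  unfold progStep prevAvg
  split_ifs with hi
  · exact measurable_const
  · refine Measurable.const_mul ?_ _
    refine (h.cut 0 T).measurable_integral ?_ 0
    have := grid_mono (N := N) hT (Nat.zero_le (i - 1))
    rwa [grid_zero] at this

lemma eventually_gap_lt (hc : GoodField c C' L') (hX : ProgMeas F X) (A : BddProg F β C')
    (hT : 0 < T) (hd : ∀ r ω, ∀ ε > 0, ∃ q, ∀ k, |c k q r (X r ω) - β k r ω| < ε)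
    {ε : ℝ} (hε : 0 < ε) (k : Fin d) (ω : Ω) : ∀ᵐ r, r ∈ Ioc 0 T → ∀ᶠ N in atTop,
      |selProc c (stepSel (grid 0 T N) (N + 1) (nearSelProc T c X β ε N)) X k r ω - β k r ω|
        < 2 * ε := by
  have h : ∀ q, ∀ᵐ r, r ∈ Ioc 0 T → ∀ i : ℕ → ℕ,
      (∀ N, r ∈ Ioc (grid 0 T N (i N)) (grid 0 T N (i N + 1))) →
      Tendsto (fun N => progStep 0 T (gapProc c X β q) N (i N) ω 0) atTop
        (nhds (cut 0 T (gapProc c X β q) 0 r ω)) := fun q => by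
    have h1 := hc.bddProg_gapProc hX A q
    exact ae_tendsto_prevAvg hT (locallyIntegrable_of_bdd (h1.measurable_cut_path le_rfl 0 ω)
      (fun r => h1.cut_abs_le 0 T 0 r ω))
  filter_upwards [ae_all_iff.2 h] with r hr hrT
  have hcell : ∀ N, ∃ i < N + 1, r ∈ Ioc (grid 0 T N i) (grid 0 T N (i + 1)) := fun N =>
    StepAdapted.exists_cell (by rwa [grid_zero, grid_last])
  choose i hi hir using hcell
  have h2 : ∀ q, Tendsto (fun N => progStep 0 T (gapProc c X β q) N (i N) ω 0) atTop
      (nhds (gapProc c X β q 0 r ω)) := fun q => by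
    have := hr q hrT i hir
    rwa [cut, indicator_of_mem hrT] at this
  obtain ⟨q₀, hq₀⟩ := hd r ω (ε / (d + 1)) (by positivity)
  have h3 : gapProc c X β q₀ 0 r ω < ε := by
    have h4 : gapProc c X β q₀ 0 r ω ≤ ∑ _k : Fin d, ε / (d + 1) :=
      Finset.sum_le_sum fun k _ => (hq₀ k).le
    refine h4.trans_lt ?_
    rw [Finset.sum_const, Finset.card_univ, Fintype.card_fin, nsmul_eq_mul, mul_div_assoc',
      div_lt_iff₀ (by positivity)]
    nlinarith
  filter_upwards [eventually_nearSel h2 hε h3] with N hN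
  refine lt_of_le_of_lt ?_ hN
  have h5 : stepSel (grid 0 T N) (N + 1) (nearSelProc T c X β ε N) r ω
      = nearSel (fun q => progStep 0 T (gapProc c X β q) N (i N) ω 0) ε N :=
    stepSel_eq (grid_mono hT.le) (hi N) _ (hir N) ω
  rw [selProc, h5]
  exact Finset.single_le_sum (f := fun k => |c k (nearSel (fun q =>
    progStep 0 T (gapProc c X β q) N (i N) ω 0) ε N) r (X r ω) - β k r ω|)
    (fun _ _ => abs_nonneg _) (Finset.mem_univ k)

lemma sqn_le_of_truncate {w : ℝ → Ω → ℝ} {ε : ℝ} (hw0 : ∀ r ω, r ∉ Ioc 0 T → w r ω = 0) :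
    sqn (volume.prod P) (fun x : ℝ × Ω => w x.1 x.2) ≤ ENNReal.ofReal (ε ^ 2 * T)
      + sqn (volume.prod P) (fun x : ℝ × Ω => if |w x.1 x.2| < ε then 0 else w x.1 x.2) := by
  have hs : MeasurableSet ((Ioc 0 T) ×ˢ (univ : Set Ω)) := measurableSet_Ioc.prod .univ
  have h1 : ENNReal.ofReal (ε ^ 2 * T) = ∫⁻ x, ((Ioc 0 T) ×ˢ (univ : Set Ω)).indicator
      (fun _ => ENNReal.ofReal (ε ^ 2)) x ∂(volume.prod P) := by
    rw [lintegral_indicator_const hs, Measure.prod_prod, measure_univ, mul_one, Real.volume_Ioc,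
      sub_zero, ENNReal.ofReal_mul (by positivity)]
  rw [h1, sqn, sqn, ← lintegral_add_left (measurable_const.indicator hs)]
  refine lintegral_mono fun x => ?_
  by_cases hx : x.1 ∈ Ioc 0 T
  · rw [indicator_of_mem (show x ∈ (Ioc 0 T) ×ˢ (univ : Set Ω) from ⟨hx, trivial⟩)]
    by_cases h : |w x.1 x.2| < ε
    · simp only [h, if_true]
      refine le_add_right (ENNReal.ofReal_le_ofReal ?_)
      rw [← sq_abs]
      exact pow_le_pow_left₀ (abs_nonneg _) h.le 2
    · simp only [h, if_false]
      exact le_add_left le_rfl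
  · simp [hw0 _ _ hx]

/-- Bounded progressive controls are approximated by step selections. -/
theorem exists_step_approx (hF : Monotone F) (hle : ∀ s, F s ≤ mΩ) (hc : GoodField c C' L')
    (hX : ProgMeas F X) (A : BddProg F β C') (hT : 0 < T)
    (hd : ∀ r ω, ∀ ε > 0, ∃ q, ∀ k, |c k q r (X r ω) - β k r ω| < ε) {δ : ℝ} (hδ : 0 < δ) :
    ∃ (N M : ℕ) (ξ : ℕ → Ω → ℕ), 0 < M ∧ (∀ i, Measurable[F (grid 0 T N i)] (ξ i)) ∧
      (∀ i ω, ξ i ω < M) ∧ ∀ k, sqn (volume.prod P) (fun x : ℝ × Ω =>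
        cut 0 T (selProc c (stepSel (grid 0 T N) (N + 1) ξ) X) k x.1 x.2
          - cut 0 T β k x.1 x.2) ≤ ENNReal.ofReal δ := by
  obtain ⟨ε, hε, hεδ⟩ : ∃ ε > 0, (2 * ε) ^ 2 * T ≤ δ / 2 := by
    refine ⟨min 1 (δ / (8 * T)), by positivity, ?_⟩
    have h1 : min 1 (δ / (8 * T)) ≤ 1 := min_le_left _ _
    have h2 : min 1 (δ / (8 * T)) ≤ δ / (8 * T) := min_le_right _ _
    have h3 : 0 < min 1 (δ / (8 * T)) := by positivity
    rw [le_div_iff₀ (by positivity)] at h2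
    nlinarith
  set ξ := fun N => nearSelProc T c X β ε N with hξ
  have hξm : ∀ N i, Measurable[F (grid 0 T N i)] (ξ N i) := fun N i =>
    measurable_nearSelProc hc hX A hT.le ε N i
  set w : Fin d → ℕ → ℝ → Ω → ℝ := fun k N r ω =>
    cut 0 T (selProc c (stepSel (grid 0 T N) (N + 1) (ξ N)) X) k r ω - cut 0 T β k r ω with hw
  have hb := fun N => hc.bddProg_selProc hX (progMeas_stepSel hF (grid 0 T N) (N + 1) fun i _ => hξm N i)
  have hwm : ∀ k N, Measurable fun x : ℝ × Ω => w k N x.1 x.2 := fun k N =>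
    ((hb N).measurable_cut_top hle le_rfl k).sub (A.measurable_cut_top hle le_rfl k)
  have hw0 : ∀ k N r ω, r ∉ Ioc 0 T → w k N r ω = 0 := fun k N r ω hr => by
    simp [hw, cut, indicator_of_notMem hr]
  have hwC : ∀ k N r ω, |w k N r ω| ≤ C' + C' := fun k N r ω =>
    (abs_sub _ _).trans (add_le_add ((hb N).cut_abs_le _ _ _ _ _) (A.cut_abs_le _ _ _ _ _))
  have key : ∀ k, Tendsto (fun N => sqn (volume.prod P) (fun x : ℝ × Ω =>
      if |w k N x.1 x.2| < 2 * ε then 0 else w k N x.1 x.2)) atTop (nhds 0) := by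
    intro k
    rcases isEmpty_or_nonempty Ω with hΩ | hΩ
    · refine tendsto_const_nhds.congr fun N => ?_
      rw [sqn, lintegral_of_isEmpty]
    have hC0 : 0 ≤ C' + C' := (abs_nonneg _).trans (hwC k 0 0 (Classical.arbitrary Ω))
    have := tendsto_sqn_of_forall_ae (P := P) (a := 0) (b := T) (C := C' + C')
      (u := fun N r ω => if |w k N r ω| < 2 * ε then 0 else w k N r ω) (v := fun _ _ => 0)
      (fun N => Measurable.ite (measurableSet_lt (hwm k N).abs measurable_const) measurable_const
        (hwm k N)) measurable_const (fun N r ω => by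
          split_ifs
          · simpa using hC0
          · exact hwC k N r ω) (fun r ω => by simpa using hC0)
      (fun N r ω hr => by simp [hw0 k N r ω hr]) (fun _ _ _ => rfl)
      (Eventually.of_forall fun ω => by
        filter_upwards [eventually_gap_lt hc hX A hT hd hε k ω] with r hr
        refine tendsto_const_nhds.congr' ?_
        by_cases hrT : r ∈ Ioc 0 T
        · filter_upwards [hr hrT] with N hN
          have : |w k N r ω| < 2 * ε := by
            simpa only [hw, cut, indicator_of_mem hrT] using hN
          simp [this]
        · exact Eventually.of_forall fun N => by simp [hw0 k N r ω hrT])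
    simpa using this
  have hδ2 : (0 : ENNReal) < ENNReal.ofReal (δ / 2) := ENNReal.ofReal_pos.2 (by positivity)
  have ev : ∀ᶠ N in atTop, ∀ k, sqn (volume.prod P) (fun x : ℝ × Ω =>
      if |w k N x.1 x.2| < 2 * ε then 0 else w k N x.1 x.2) < ENNReal.ofReal (δ / 2) :=
    eventually_all.2 fun k => (key k).eventually_lt_const hδ2
  obtain ⟨N, hN⟩ := ev.exists
  refine ⟨N, N + 2, ξ N, by omega, hξm N, fun i ω => nearSel_lt _ _ _, fun k => ?_⟩
  refine (sqn_le_of_truncate (ε := 2 * ε) (hw0 k N)).trans ?_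
  calc _ ≤ ENNReal.ofReal (δ / 2) + ENNReal.ofReal (δ / 2) :=
        add_le_add (ENNReal.ofReal_le_ofReal hεδ) (hN k).le
    _ = ENNReal.ofReal δ := by rw [← ENNReal.ofReal_add (by positivity) (by positivity)]; ring_nf

end

end

/-! ### Almost optimal Markov controls -/

section

variable {Ω : Type*} [mΩ : MeasurableSpace Ω] {n d : ℕ}

section

variable {T : ℝ} {x₀ : Fin n → ℝ} {σ : ℝ → (Fin n → ℝ) → Matrix (Fin n) (Fin d) ℝ}
  {P : Measure Ω} [IsProbabilityMeasure P] {F : ℝ → MeasurableSpace Ω} {B : ℝ → Ω → Fin d → ℝ}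
  {X : ℝ → Ω → Fin n → ℝ} {C L C' L' : ℝ} {β : Fin d → ℝ → Ω → ℝ} {J : Ω → ℝ}
  {c : Fin d → ℕ → ℝ → (Fin n → ℝ) → ℝ}

lemma IsIto.tendsto_expI (S : BMSetup P F B) {θ : ℕ → Fin d → ℝ → Ω → ℝ} {I : ℕ → Ω → ℝ}
    (hT : 0 < T) (A' : ∀ p, BddProg F (θ p) C') (A : BddProg F β C')
    (H' : ∀ p, IsIto P F B 0 T (cut 0 T (θ p)) (I p)) (H : IsIto P F B 0 T (cut 0 T β) J)
    (h : ∀ k, Tendsto (fun p => sqn (volume.prod P) (fun x : ℝ × Ω =>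
      cut 0 T (θ p) k x.1 x.2 - cut 0 T β k x.1 x.2)) atTop (nhds 0)) :
    Tendsto (fun p => ∫⁻ ω, ‖expI 0 T (θ p) (I p) ω - expI 0 T β J ω‖ₑ ∂P) atTop (nhds 0) := by
  have h1 : Tendsto (fun p => sqn P (fun ω => I p ω - J ω)) atTop (nhds 0) := by
    have h3 := ENNReal.Tendsto.const_mul (a := 4)
      (tendsto_finsetSum (Finset.univ : Finset (Fin d)) fun k _ => h k) (by simp)
    refine tendsto_of_tendsto_of_tendsto_of_le_of_le tendsto_const_nhds (by simpa using h3)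
      (fun _ => zero_le) fun p => ?_
    exact (((H' p).sub S le_rfl H).bounds S le_rfl).1
  have := _root_.tendsto_expI (P := P) (a := 0) (b := T) (C := C')
    (fun p k => (A' p).measurable_cut_top S.le le_rfl k)
    (fun k => A.measurable_cut_top S.le le_rfl k) (fun p k r ω => (A' p).cut_abs_le _ _ k r ω)
    (fun k r ω => A.cut_abs_le _ _ k r ω) (fun p => (H' p).aemJ) H.aemJ h1 h
    ENNReal.ofReal_ne_top (fun p => (H' p).lintegral_exp_mul_le S (A' p) le_rfl hT 2)
  simpa only [expI, quad_cut] using this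

/-- Bounded progressive controls are almost dominated by Markov step controls. -/
theorem Sys.exists_almost_optimal (Y : Sys T x₀ σ P F B X (fun _ _ _ => 0)) (G : GoodCoeff σ C L)
    (hc : GoodField c C' L') (hT : 0 < T) (A : BddProg F β C')
    (hd : ∀ r ω, ∀ ε > 0, ∃ q, ∀ k, |c k q r (X r ω) - β k r ω| < ε)
    (H : IsIto P F B 0 T (cut 0 T β) J) {v : (Fin n → ℝ) → ENNReal} (hv : Measurable v)
    {D : ENNReal} (hD : D ≠ ⊤) (hvD : ∀ x, v x ≤ D) {ε : ENNReal} (hε : 0 < ε) :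
    ∃ (N : ℕ) (φ : ℕ → (Fin n → ℝ) → ℕ), (∀ i, Measurable (φ i)) ∧
      ∀ J', IsIto P F B 0 T (cut 0 T (selProc c (stepSel (grid 0 T N) (N + 1)
        fun i ω => φ i (X (grid 0 T N i) ω)) X)) J' →
      ∫⁻ ω, ENNReal.ofReal (expI 0 T β J ω) * v (X T ω) ∂P
        ≤ ∫⁻ ω, ENNReal.ofReal (expI 0 T (selProc c (stepSel (grid 0 T N) (N + 1)
          fun i ω => φ i (X (grid 0 T N i) ω)) X) J' ω) * v (X T ω) ∂P + ε := by
  have hF : Monotone F := fun _ _ h => Y.bm.mono _ _ h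
  choose N M ξ hM hξ hξM hle using fun p : ℕ =>
    exists_step_approx (P := P) hF Y.bm.le hc Y.X_prog A hT hd
      (Nat.one_div_pos_of_nat (α := ℝ) (n := p))
  have A' := fun p => hc.bddProg_selProc Y.X_prog
    (progMeas_stepSel hF (grid 0 T (N p)) (N p + 1) fun i _ => hξ p i)
  choose I hI using fun p => (A' p).exists_isIto' Y.bm le_rfl hT.le
  have hlim := IsIto.tendsto_expI Y.bm hT A' A hI H fun k => by
    have h0 : Tendsto (fun p : ℕ => ENNReal.ofReal (1 / ((p : ℝ) + 1))) atTop (nhds 0) := by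
      simpa using ENNReal.tendsto_ofReal (tendsto_one_div_add_atTop_nhds_zero_nat (𝕜 := ℝ))
    exact tendsto_of_tendsto_of_tendsto_of_le_of_le tendsto_const_nhds h0 (fun _ => zero_le)
      fun p => hle p k
  have hlim' := ENNReal.Tendsto.mul_const hlim (b := D) (Or.inr hD)
  rw [zero_mul] at hlim'
  obtain ⟨p, hp⟩ := (hlim'.eventually_lt_const hε).exists
  obtain ⟨φ, hφ, hφM, h⟩ := Y.exists_feedback G hc hT (N p) (hM p) hv
  refine ⟨N p, φ, hφ, fun J' hJ' => ?_⟩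
  have hXT : Measurable (X T) := (Y.X_prog.measurable hT.le).mono (Y.bm.le T) le_rfl
  have m1 : AEMeasurable (fun ω => expI 0 T (selProc c (stepSel (grid 0 T (N p)) (N p + 1) (ξ p)) X)
      (I p) ω) P := aemeasurable_expI Y.bm.le (A' p) le_rfl (hI p).aemJ
  calc _ ≤ ∫⁻ ω, (ENNReal.ofReal (expI 0 T (selProc c (stepSel (grid 0 T (N p)) (N p + 1) (ξ p)) X)
          (I p) ω) * v (X T ω) + ‖expI 0 T (selProc c (stepSel (grid 0 T (N p)) (N p + 1) (ξ p)) X)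
          (I p) ω - expI 0 T β J ω‖ₑ * D) ∂P := lintegral_mono fun ω => by
        refine le_trans ?_ (add_le_add_right (mul_le_mul_right (hvD (X T ω)) _) _)
        rw [← add_mul]
        refine mul_le_mul_left ?_ _
        rw [← ofReal_norm, ← ENNReal.ofReal_add (expI_pos _ _ _ _ _).le (norm_nonneg _)]
        refine ENNReal.ofReal_le_ofReal ?_
        rw [Real.norm_eq_abs]
        linarith [neg_abs_le (expI 0 T (selProc c (stepSel (grid 0 T (N p)) (N p + 1) (ξ p)) X)
          (I p) ω - expI 0 T β J ω)]
    _ = _ := lintegral_add_left' (m1.ennreal_ofReal.mul (hv.comp hXT).aemeasurable) _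
    _ ≤ _ := add_le_add (h (ξ p) (hξ p) (hξM p) (I p) J' (hI p) hJ') (by
        rw [lintegral_mul_const' _ _ hD]
        exact hp.le)

end

end

/-! ### Adaptedness of the state to the driving noise -/

section

variable {Ω : Type*} [mΩ : MeasurableSpace Ω] {n d : ℕ}

section

variable {T : ℝ} {x₀ : Fin n → ℝ} {σ : ℝ → (Fin n → ℝ) → Matrix (Fin n) (Fin d) ℝ}
  {P : Measure Ω} [IsProbabilityMeasure P] {F : ℝ → MeasurableSpace Ω} {B : ℝ → Ω → Fin d → ℝ}
  {X : ℝ → Ω → Fin n → ℝ} {β : Fin d → ℝ → Ω → ℝ} {C L C' L' : ℝ}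
  {c : Fin d → ℕ → ℝ → (Fin n → ℝ) → ℝ}

lemma natFilt_mono {Ω E : Type*} [MeasurableSpace E] (u : ℝ → Ω → E) : Monotone (natFilt u) :=
  fun _ _ h => biSup_mono fun _ hr => ⟨hr.1, hr.2.trans h⟩

lemma augFilt_mono {E : Type*} [MeasurableSpace E] (P : Measure Ω) (u : ℝ → Ω → E) :
    Monotone (augFilt P u) := fun _ _ h => sup_le_sup_right (natFilt_mono u h) _

lemma measurable_natFilt {Ω E : Type*} [MeasurableSpace E] (u : ℝ → Ω → E) {r s : ℝ} (hr : 0 ≤ r)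
    (hrs : r ≤ s) : Measurable[natFilt u s] (u r) :=
  (comap_measurable (u r)).mono (le_iSup₂_of_le r ⟨hr, hrs⟩ le_rfl) le_rfl

/-- Almost sure measurability is measurability for the augmented σ-algebra. -/
lemma AEM.measurable_sup_nullSets {Ω E : Type*} {m : MeasurableSpace Ω} [mΩ : MeasurableSpace Ω]
    [MeasurableSpace E] {P : Measure Ω}
    {f : Ω → E} (h : AEM m P f) : Measurable[m ⊔ nullSets P] f := by
  obtain ⟨g, hg, hfg⟩ := h
  have hnull : ∀ s : Set Ω, P s = 0 → MeasurableSet[m ⊔ nullSets P] s := fun s hs =>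
    (le_sup_right : nullSets P ≤ m ⊔ nullSets P) s (MeasurableSpace.measurableSet_generateFrom hs)
  have h0 : P {ω | f ω ≠ g ω} = 0 := hfg
  intro s hs
  have e : f ⁻¹' s = (g ⁻¹' s \ {ω | f ω ≠ g ω}) ∪ (f ⁻¹' s ∩ {ω | f ω ≠ g ω}) := by
    ext ω
    by_cases hω : f ω = g ω <;> simp [hω]
  rw [e]
  refine MeasurableSet.union (m := m ⊔ nullSets P) (MeasurableSet.diff (m := m ⊔ nullSets P)
    ((le_sup_left : m ≤ m ⊔ nullSets P) _ (hg hs)) (hnull _ h0)) (hnull _ ?_)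
  exact measure_mono_null inter_subset_right h0

lemma dyadicIncr_natFilt {a b : ℝ} (ha : 0 ≤ a) (hab : a ≤ b) :
    DyadicIncr (natFilt B b) P B a b := by
  intro p j hj k
  have hm := grid_mono (N := 2 ^ p - 1) hab
  have h0 : ∀ i, 0 ≤ grid a b (2 ^ p - 1) i := fun i =>
    (grid_zero (a := a) (b := b) (N := 2 ^ p - 1) ▸ ha).trans (hm (Nat.zero_le i))
  have h1 : ∀ i ≤ 2 ^ p, grid a b (2 ^ p - 1) i ≤ b := fun i hi => by
    have := hm (show i ≤ 2 ^ p - 1 + 1 by omega)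
    rwa [grid_last] at this
  have hB : ∀ i ≤ 2 ^ p, Measurable[natFilt B b] fun ω => B (grid a b (2 ^ p - 1) i) ω k :=
    fun i hi => (measurable_pi_apply k).comp (measurable_natFilt B (h0 i) (h1 i hi))
  exact AEM.of_measurable (Measurable.sub (m := natFilt B b) (hB _ hj) (hB _ hj.le))

lemma Sys.initial_ae_eq (Y : Sys T x₀ σ P F B X β) (hT : 0 ≤ T) : X 0 =ᵐ[P] fun _ => x₀ := by
  have h : ∀ i, ∀ᵐ ω ∂P, X 0 ω i = x₀ i := fun i => by
    filter_upwards [(Y.ito 0 ⟨le_rfl, hT⟩ i).ae_unique Y.bm le_rfl (isIto_of_le le_rfl)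
      fun k => ae_eq_refl _] with ω hω
    simp only [dotI, Ioc_self, Measure.restrict_empty, integral_zero_measure,
      Finset.sum_const_zero] at hω
    linarith
  filter_upwards [ae_all_iff.2 h] with ω hω
  exact funext hω

/-- Under a Markov step feedback, the state at the grid points is a functional of the driving
Brownian motion. -/
theorem Sys.aem_natFilt_grid {N : ℕ} {φ : ℕ → (Fin n → ℝ) → ℕ} (hφ : ∀ i, Measurable (φ i))
    (Y : Sys T x₀ σ P F B X (selProc c (stepSel (grid 0 T N) (N + 1)
      fun i ω => φ i (X (grid 0 T N i) ω)) X)) (G : GoodCoeff σ C L) (hc : GoodField c C' L')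
    (hT : 0 < T) {i : ℕ} (hi : i ≤ N + 1) :
    AEM (natFilt B (grid 0 T N i)) P (X (grid 0 T N i)) := by
  induction i with
  | zero =>
    rw [grid_zero]
    exact (AEM.of_measurable measurable_const).congr (Y.initial_ae_eq hT.le).symm
  | succ i ih =>
    have hm := grid_mono (N := N) hT.le
    have h0 : 0 ≤ grid 0 T N i := grid_nonneg hT.le N i
    have hX := (ih (by omega)).mono (natFilt_mono B (hm (Nat.le_succ i)))
    have hb : grid 0 T N (i + 1) ≤ T := by
      have := hm hi
      rwa [grid_last] at this
    obtain ⟨_, _, S⟩ := Y.exists_localSol G hc (κ := fun ω => φ i (X (grid 0 T N i) ω))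
      ((hφ i).comp (Y.X_prog.measurable h0)) h0 (grid_lt hT i) hb
      fun k r ω hr => by
        simp only [selProc]
        rw [stepSel_eq hm (by omega) _ hr]
    exact S.aem_terminal hX (hX.comp (hφ i)) (dyadicIncr_natFilt h0 (grid_lt hT i).le)

end

end

/-! ### Solutions that are open-loop and closed-loop -/

section

section

variable {Ω : Type*} [mΩ : MeasurableSpace Ω] {n d : ℕ}
  {T : ℝ} {x₀ : Fin n → ℝ} {σ : ℝ → (Fin n → ℝ) → Matrix (Fin n) (Fin d) ℝ}
  {P : Measure Ω} [IsProbabilityMeasure P] {F : ℝ → MeasurableSpace Ω} {B : ℝ → Ω → Fin d → ℝ}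
  {X : ℝ → Ω → Fin n → ℝ} {β : Fin d → ℝ → Ω → ℝ} {C L C' L' : ℝ}
  {c : Fin d → ℕ → ℝ → (Fin n → ℝ) → ℝ}

/-- Any drift is almost dominated by a Markov step feedback, after an equivalent change of
measure. -/
theorem Sys.exists_markov_feedback (Y : Sys T x₀ σ P F B X β) (G : GoodCoeff σ C L)
    (hc : GoodField c C' L') (hT : 0 < T) (A : BddProg F β C')
    (hd : ∀ r ω, ∀ ε > 0, ∃ q, ∀ k, |c k q r (X r ω) - β k r ω| < ε)
    {v : (Fin n → ℝ) → ENNReal} (hv : Measurable v) {D : ENNReal} (hD : D ≠ ⊤)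
    (hvD : ∀ x, v x ≤ D) {ε : ENNReal} (hε : 0 < ε) :
    ∃ (P' : Measure Ω) (B' : ℝ → Ω → Fin d → ℝ) (N : ℕ) (φ : ℕ → (Fin n → ℝ) → ℕ),
      IsProbabilityMeasure P' ∧ (∀ i, Measurable (φ i)) ∧
      Sys T x₀ σ P' F B' X (selProc c (stepSel (grid 0 T N) (N + 1)
        fun i ω => φ i (X (grid 0 T N i) ω)) X) ∧
      ∫⁻ ω, v (X T ω) ∂P ≤ ∫⁻ ω, v (X T ω) ∂P' + ε := by
  obtain ⟨J, H⟩ := A.exists_isIto' Y.bm le_rfl hT.le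
  obtain ⟨H₁, H₂, hP⟩ := lintegral_girP_neg Y.bm A hT.le H
  have Y₁ := Y.girsanov G A.neg hT.le H₁
  have hX : Measurable (X T) := (Y.X_prog.measurable hT.le).mono (Y.bm.le _) le_rfl
  have := isProbabilityMeasure_girP Y.bm A.neg hT.le H₁
  have hvX : Measurable fun ω => v (X T ω) := hv.comp hX
  rw [hP _ hvX.aemeasurable]
  simp only [add_neg_cancel] at Y₁
  obtain ⟨N, φ, hφ, h⟩ := Y₁.exists_almost_optimal G hc hT A hd H₂ hv hD hvD hε
  have A' := hc.bddProg_selProc Y.X_prog (progMeas_stepSel (fun _ _ h => Y.bm.mono _ _ h)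
    (grid 0 T N) (N + 1) (ξ := fun i ω => φ i (X (grid 0 T N i) ω)) fun i _ =>
      (hφ i).comp (Y.X_prog.measurable (grid_nonneg hT.le N i)))
  obtain ⟨J', H'⟩ := A'.exists_isIto' Y₁.bm le_rfl hT.le
  have Y₂ := Y₁.girsanov G A' hT.le H'
  simp only [zero_add] at Y₂
  refine ⟨_, _, N, φ, isProbabilityMeasure_girP Y₁.bm A' hT.le H', hφ, Y₂, (h J' H').trans_eq ?_⟩
  exact (congrArg (· + ε) (lintegral_withDensity_eq_lintegral_mul₀
    (aemeasurable_expI Y₁.bm.le A' le_rfl H'.aemJ).ennreal_ofReal hvX.aemeasurable)).symm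

end

lemma integral_eq_toReal_lintegral_sub {Ω : Type*} [MeasurableSpace Ω] {P : Measure Ω}
    [IsProbabilityMeasure P] {Z : Ω → ℝ} (hZ : Measurable Z) {K : ℝ} (hK : ∀ ω, |Z ω| ≤ K) :
    ∫ ω, Z ω ∂P = (∫⁻ ω, ENNReal.ofReal (Z ω + K) ∂P).toReal - K := by
  have hi : Integrable Z P := Integrable.of_bound hZ.aestronglyMeasurable K
    (Eventually.of_forall hK)
  rw [← integral_eq_lintegral_of_nonneg_ae (Eventually.of_forall fun ω => by
    show 0 ≤ Z ω + K
    linarith [neg_le_of_abs_le (hK ω)]) (hZ.add_const K).aestronglyMeasurable,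
    integral_add hi (integrable_const K)]
  simp

section

variable {n d m : ℕ} {T : ℝ} {x₀ : Fin n → ℝ} {A : Set (Fin m → ℝ)}
  {σ : ℝ → (Fin n → ℝ) → Matrix (Fin n) (Fin d) ℝ}
  {lam : ℝ → (Fin n → ℝ) → (Fin m → ℝ) → Fin d → ℝ} {g : (Fin n → ℝ) → ℝ} {C L C' L' K : ℝ}

/-- Every weak solution is almost dominated by one that is both open-loop and closed-loop. -/
theorem SDEWeakSol.exists_openLoop_closedLoop (hT : 0 < T) (G : GoodCoeff σ C L)
    (hlam_bdd : ∀ s x a j, |lam s x a j| ≤ C')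
    (hlam_meas : Measurable fun p : ℝ × (Fin n → ℝ) × (Fin m → ℝ) => lam p.1 p.2.1 p.2.2)
    (hlam_cont : ∀ s x, ContinuousOn (fun a => lam s x a) A)
    (hlam_lip : ∀ s x y a j, |lam s x a j - lam s y a j| ≤ L' * dist x y)
    (hg : Measurable g) (hK : ∀ x, |g x| ≤ K)
    (S : SDEWeakSol T x₀ A (fun s x a => (σ s (x s)).mulVec (lam s (x s) a))
      (fun s x _ => σ s (x s))) {ε : ℝ} (hε : 0 < ε) :
    ∃ S' : SDEWeakSol T x₀ A (fun s x a => (σ s (x s)).mulVec (lam s (x s) a))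
      (fun s x _ => σ s (x s)), S'.OpenLoop ∧ S'.ClosedLoop ∧
      ∫ ω, g (S.X T ω) ∂S.P ≤ ∫ ω, g (S'.X T ω) ∂S'.P + ε := by
  have := S.hP
  obtain ⟨ω₀⟩ := S.P.nonempty_of_neZero
  have : Nonempty A := ⟨⟨_, S.α_mem 0 ω₀⟩⟩
  set a : ℕ → Fin m → ℝ := fun q => (TopologicalSpace.denseSeq A q : Fin m → ℝ) with ha
  have haA : ∀ q, a q ∈ A := fun q => (TopologicalSpace.denseSeq A q).2
  have ha_meas : Measurable a := measurable_from_nat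
  set c : Fin d → ℕ → ℝ → (Fin n → ℝ) → ℝ := fun k q r x => lam r x (a q) k with hc_def
  have hc : GoodField c C' L' := by
    refine ⟨fun k q r x => hlam_bdd _ _ _ _, fun k => ?_, fun k q r x y => hlam_lip _ _ _ _ _⟩
    exact (measurable_pi_apply k).comp (hlam_meas.comp
      (measurable_fst.prodMk ((measurable_snd.comp measurable_snd).prodMk
        (ha_meas.comp (measurable_fst.comp measurable_snd)))))
  have hβ : BddProg S.F (fun k r ω => lam r (S.X r ω) (S.α r ω) k) C' :=
    ⟨fun k => (S.X_prog.prodMk S.α_prog).comp_pair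
      (f := fun p : ℝ × (Fin n → ℝ) × (Fin m → ℝ) => lam p.1 p.2.1 p.2.2 k)
      ((measurable_pi_apply k).comp hlam_meas), fun k r ω => hlam_bdd _ _ _ _⟩
  have Y : Sys T x₀ σ S.P S.F S.B S.X (fun k r ω => lam r (S.X r ω) (S.α r ω) k) :=
    Sys.of_isItoIntegralOn ⟨S.F_mono, S.F_le, S.hB⟩ G hT S.X_cont S.X_prog hβ S.sde
  have hd : ∀ r ω, ∀ ε > 0, ∃ q, ∀ k,
      |c k q r (S.X r ω) - lam r (S.X r ω) (S.α r ω) k| < ε := by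
    intro r ω ε hε
    have hcont : Continuous fun x : A => lam r (S.X r ω) x :=
      continuousOn_iff_continuous_domRestrict.1 (hlam_cont r (S.X r ω))
    obtain ⟨q, hq⟩ := (TopologicalSpace.denseRange_denseSeq A).exists_mem_open
      (Metric.isOpen_ball.preimage hcont)
      ⟨⟨S.α r ω, S.α_mem r ω⟩, Metric.mem_ball_self (x := lam r (S.X r ω) (S.α r ω)) hε⟩
    exact ⟨q, fun k => (dist_le_pi_dist (lam r (S.X r ω) (a q)) _ k).trans_lt hq⟩
  obtain ⟨P', B', N, φ, hP', hφ, Y', hle⟩ := Y.exists_markov_feedback G hc hT hβ hd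
    (v := fun x => ENNReal.ofReal (g x + K)) (hg.add_const K).ennreal_ofReal
    (D := ENNReal.ofReal (2 * K)) ENNReal.ofReal_ne_top
    (fun x => ENNReal.ofReal_le_ofReal (by linarith [le_of_abs_le (hK x)]))
    (ENNReal.ofReal_pos.2 hε)
  set sel := stepSel (grid 0 T N) (N + 1) fun i ω => φ i (S.X (grid 0 T N i) ω) with hsel
  have h0 := grid_nonneg hT.le N
  have hprog : ∀ {H : ℝ → MeasurableSpace S.Ω}, ProgMeas H sel →
      ProgMeas H (fun r ω => a (sel r ω)) := fun h => h.comp_pair (ha_meas.comp measurable_snd)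
  refine ⟨⟨S.Ω, S.mΩ, P', hP', S.F, S.F_mono, S.F_le, B', S.X, fun r ω => a (sel r ω), Y'.bm.bm,
    S.X_cont, S.X_prog, hprog (progMeas_stepSel (fun _ _ h => S.F_mono _ _ h) _ _ fun i _ =>
      (hφ i).comp (S.X_prog.measurable (h0 i))), fun _ _ => haA _, Y'.isItoIntegralOn G⟩, ?_, ?_, ?_⟩
  · exact hprog (progMeas_stepSel (augFilt_mono _ _) _ _ fun i hi =>
      ((Y'.aem_natFilt_grid hφ G hc hT hi.le).comp (hφ i)).measurable_sup_nullSets)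
  · exact hprog (progMeas_stepSel (augFilt_mono _ _) _ _ fun i _ =>
      ((hφ i).comp (measurable_natFilt S.X (h0 i) le_rfl)).mono le_sup_left le_rfl)
  · have hX : Measurable (S.X T) := (S.X_prog.measurable hT.le).mono (S.F_le _) le_rfl
    have e1 := integral_eq_toReal_lintegral_sub (P := S.P) (hg.comp hX) fun ω => hK _
    have e2 := integral_eq_toReal_lintegral_sub (P := P') (hg.comp hX) fun ω => hK _
    simp only [Function.comp_apply] at e1 e2
    show _ ≤ ∫ ω, g (S.X T ω) ∂P' + ε
    rw [e1, e2]
    have hfin : ∫⁻ ω, ENNReal.ofReal (g (S.X T ω) + K) ∂P' ≠ ⊤ := by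
      refine ne_top_of_le_ne_top (ENNReal.ofReal_ne_top (r := 2 * K))
        ((lintegral_mono fun ω => ENNReal.ofReal_le_ofReal
          (show g (S.X T ω) + K ≤ 2 * K by linarith [le_of_abs_le (hK (S.X T ω))])).trans_eq ?_)
      simp
    have := ENNReal.toReal_mono (ENNReal.add_ne_top.2 ⟨hfin, ENNReal.ofReal_ne_top⟩) hle
    rw [ENNReal.toReal_add hfin ENNReal.ofReal_ne_top, ENNReal.toReal_ofReal hε.le] at this
    linarith

end

end

/-- Corollary 3.4. For state-dependent coefficients with `σ = σ(t, x)`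
Lipschitz and control-free, `b = σλ` with `λ` bounded, continuous in `a`, Lipschitz in `x`
and with convex range `{λ(t,x,a) : a ∈ A}`, the open-loop and closed-loop values coincide:
`V^o_0 = V^c_0`. -/
theorem open_eq_closed_of_state_dependent
    (n d m : ℕ) (T : ℝ) (hT : 0 < T) (x₀ : Fin n → ℝ) (A : Set (Fin m → ℝ))
    (σ : ℝ → (Fin n → ℝ) → Matrix (Fin n) (Fin d) ℝ)
    (lam : ℝ → (Fin n → ℝ) → (Fin m → ℝ) → Fin d → ℝ)
    (g : (Fin n → ℝ) → ℝ)
    (hσ_bdd : ∃ C : ℝ, ∀ s x i j, |σ s x i j| ≤ C)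
    (hσ_meas : Measurable fun p : ℝ × (Fin n → ℝ) =>
      (fun i j => σ p.1 p.2 i j : Fin n → Fin d → ℝ))
    (hσ_lip : ∃ L : ℝ, ∀ s x y i j, |σ s x i j - σ s y i j| ≤ L * dist x y)
    (hlam_bdd : ∃ C : ℝ, ∀ s x a j, |lam s x a j| ≤ C)
    (hlam_meas : Measurable fun p : ℝ × (Fin n → ℝ) × (Fin m → ℝ) => lam p.1 p.2.1 p.2.2)
    (hlam_cont : ∀ s x, ContinuousOn (fun a => lam s x a) A)
    (hlam_lip : ∃ L : ℝ, ∀ s x y a j, |lam s x a j - lam s y a j| ≤ L * dist x y)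
    (hlam_conv : ∀ s x, Convex ℝ ((fun a => lam s x a) '' A))
    (hg_meas : Measurable g) (hg_bdd : ∃ C : ℝ, ∀ x, |g x| ≤ C) :
    Vopen T x₀ A (fun s x a => (σ s (x s)).mulVec (lam s (x s) a))
        (fun s x _ => σ s (x s)) (fun x => g (x T))
      = Vclosed T x₀ A (fun s x a => (σ s (x s)).mulVec (lam s (x s) a))
          (fun s x _ => σ s (x s)) (fun x => g (x T)) := by
  obtain ⟨C, hC⟩ := hσ_bdd
  obtain ⟨L, hL⟩ := hσ_lip
  obtain ⟨C', hC'⟩ := hlam_bdd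
  obtain ⟨L', hL'⟩ := hlam_lip
  obtain ⟨K, hK⟩ := hg_bdd
  have G : GoodCoeff σ C L := ⟨hC, fun i j => (measurable_pi_apply j).comp
    ((measurable_pi_apply i).comp hσ_meas), hL⟩
  have key := fun S ε hε => SDEWeakSol.exists_openLoop_closedLoop (x₀ := x₀) (A := A) hT G hC'
    hlam_meas hlam_cont hL' hg_meas hK S (ε := ε) hε
  have hbd : ∀ S : SDEWeakSol T x₀ A (fun s x a => (σ s (x s)).mulVec (lam s (x s) a))
      (fun s x _ => σ s (x s)), ∫ ω, g (S.X T ω) ∂S.P ≤ K := fun S => by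
    have := S.hP
    have h := norm_integral_le_of_norm_le_const (μ := S.P) (f := fun ω => g (S.X T ω)) (C := K)
      (Eventually.of_forall fun ω => hK _)
    rw [probReal_univ, mul_one] at h
    exact (le_abs_self _).trans h
  unfold Vopen Vclosed
  by_cases hne : Nonempty (SDEWeakSol T x₀ A (fun s x a => (σ s (x s)).mulVec (lam s (x s) a))
      (fun s x _ => σ s (x s)))
  · obtain ⟨S₀⟩ := hne
    obtain ⟨S₁, ho, hc, -⟩ := key S₀ 1 one_pos
    refine le_antisymm (csSup_le ⟨_, S₁, ho, rfl⟩ ?_) (csSup_le ⟨_, S₁, hc, rfl⟩ ?_) <;>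
    · rintro _ ⟨S, -, rfl⟩
      refine le_of_forall_pos_le_add fun ε hε => ?_
      obtain ⟨S', ho', hc', hle⟩ := key S ε hε
      refine hle.trans (add_le_add_left ?_ ε)
      refine le_csSup ⟨K, ?_⟩ ⟨S', by assumption, rfl⟩
      rintro _ ⟨S, -, rfl⟩
      exact hbd S
  · rw [not_nonempty_iff] at hne
    congr 1
    ext r
    simp

end
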